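/- There exists η > 0 with the following property: suppose c_i, d_i (1 ≤ i ≤ 3) are integers with (c₁d₂ − c₂d₁)(c₁d₃ − c₃d₁)(c₂d₃ − c₃d₂) ≠ 0, and write Λ_j = c_jα + d_jβ (j = 1, 2, 3). Then for every ε > 0 there is a constant C = C(ε, c, d) such that for all real P ≥ 2 and all R with 2 ≤ R ≤ P^η one has ∫₀¹∫₀¹ |h(Λ₁;P,R) h(Λ₂;P,R) h(Λ₃;P,R)|⁷ dα dβ ≤ C · P^{13 + Δ₁₀/2 + ε}. -/

import Mathlib

open scoped Real
open Filter MeasureTheory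

noncomputable section

/-- `e(z) = exp(2πiz)`. -/
def e (z : ℝ) : ℂ := Complex.exp (2 * Real.pi * Complex.I * z)

/-- The set `𝒜(P,R)` of `R`-smooth positive integers not exceeding `P`. -/
def smoothA (P R : ℝ) : Finset ℕ :=
  (Finset.Icc 1 ⌊P⌋₊).filter (fun n => ∀ p ∈ n.primeFactors, (p : ℝ) ≤ R)

/-- The smooth Weyl sum `h(α; P, R)`. -/
def h (P R α : ℝ) : ℂ := ∑ x ∈ smoothA P R, e (α * (x : ℝ) ^ 4)

/-- `Δ₇ = 0.849408`. -/
def Δ₇ : ℝ := 0.849408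

/-- `Δ₁₀ = 0.213431`. -/
def Δ₁₀ : ℝ := 0.213431

/-! ### The additive character and trigonometric sums -/

theorem e_add (x y : ℝ) : e (x + y) = e x * e y := by
  simp only [e, ← Complex.exp_add]; push_cast; ring_nf

theorem e_zero : e 0 = 1 := by simp [e]

theorem e_eq (x : ℝ) : e x = Complex.exp ((2 * π * x : ℝ) * Complex.I) := by
  simp only [e]; push_cast; ring_nf

theorem norm_e (x : ℝ) : ‖e x‖ = 1 := by
  rw [e_eq, Complex.norm_exp_ofReal_mul_I]

theorem e_neg (x : ℝ) : e (-x) = (starRingEnd ℂ) (e x) := by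
  rw [e_eq, e_eq, ← Complex.exp_conj]; congr 1
  rw [map_mul, Complex.conj_I, Complex.conj_ofReal]; push_cast; ring

theorem e_int (n : ℤ) : e n = 1 := by
  rw [e, Complex.exp_eq_one_iff]; exact ⟨n, by push_cast; ring⟩

theorem continuous_e : Continuous e := by
  unfold e; fun_prop

@[fun_prop]
theorem continuous_e_comp {X : Type*} [TopologicalSpace X] {f : X → ℝ} (hf : Continuous f) :
    Continuous fun x => e (f x) := continuous_e.comp hf

theorem e_int_mul_add_one (n : ℤ) (x : ℝ) : e (n * (x + 1)) = e (n * x) := by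
  rw [mul_add, mul_one, e_add, e_int, mul_one]

theorem integral_e (n : ℤ) : ∫ α in (0:ℝ)..1, e (n * α) = if n = 0 then 1 else 0 := by
  split_ifs with hn
  · subst hn; simp [e_zero]
  · have hc : (2 * π * Complex.I * n : ℂ) ≠ 0 := by
      simp [Real.pi_ne_zero, hn]
    have := integral_exp_mul_complex (a := 0) (b := 1) hc
    have h2 : (fun α : ℝ => e (n * α)) = fun α : ℝ => Complex.exp (2 * π * Complex.I * n * α) := by
      funext α; simp only [e]; push_cast; ring_nf
    rw [h2, this]
    have h3 := e_int n
    simp only [e] at h3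
    push_cast at h3
    simp [h3]

/-- The sum of `e(n_i α)` over a finite family of integer frequencies. -/
def trig {ι : Type*} (s : Finset ι) (n : ι → ℤ) (α : ℝ) : ℂ := ∑ i ∈ s, e (n i * α)

@[fun_prop]
theorem continuous_trig {ι : Type*} (s : Finset ι) (n : ι → ℤ) : Continuous (trig s n) := by
  unfold trig; fun_prop

theorem trig_add_one {ι : Type*} (s : Finset ι) (n : ι → ℤ) (α : ℝ) :
    trig s n (α + 1) = trig s n α := by
  simp only [trig, e_int_mul_add_one]

theorem trig_mul {ι κ : Type*} (s : Finset ι) (n : ι → ℤ) (t : Finset κ) (m : κ → ℤ) (α : ℝ) :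
    trig s n α * trig t m α = trig (s ×ˢ t) (fun p => n p.1 + m p.2) α := by
  simp only [trig, Finset.sum_mul_sum, Finset.sum_product]
  refine Finset.sum_congr rfl fun i _ => Finset.sum_congr rfl fun j _ => ?_
  rw [← e_add]; push_cast; ring_nf

theorem trig_conj {ι : Type*} (s : Finset ι) (n : ι → ℤ) (α : ℝ) :
    (starRingEnd ℂ) (trig s n α) = trig s (fun i => - n i) α := by
  simp only [trig, map_sum, ← e_neg]; push_cast; simp only [neg_mul]

theorem norm_trig_le {ι : Type*} (s : Finset ι) (n : ι → ℤ) (α : ℝ) :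
    ‖trig s n α‖ ≤ s.card := by
  unfold trig
  refine (norm_sum_le _ _).trans ?_
  simp [norm_e]

theorem integral_sum_e {ι : Type*} (s : Finset ι) (n : ι → ℤ) (a : ι → ℂ) :
    ∫ α in (0:ℝ)..1, ∑ i ∈ s, a i * e (n i * α) = ∑ i ∈ s with n i = 0, a i := by
  rw [intervalIntegral.integral_finsetSum]
  · simp only [intervalIntegral.integral_const_mul, integral_e, mul_ite, mul_one, mul_zero]
    rw [Finset.sum_filter]
  · intro i _
    exact Continuous.intervalIntegrable (by fun_prop) _ _

theorem integral_trig {ι : Type*} (s : Finset ι) (n : ι → ℤ) :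
    ∫ α in (0:ℝ)..1, trig s n α = (s.filter fun i => n i = 0).card := by
  have := integral_sum_e s n (fun _ => 1)
  simpa [trig] using this

/-! ### Coefficientwise domination -/

/-- `F` is a trigonometric polynomial whose coefficients are bounded in absolute value by those of
`G`, the latter being nonnegative. -/
def Dom (F G : ℝ → ℂ) : Prop :=
  ∃ (ι : Type) (s : Finset ι) (n : ι → ℤ) (a : ι → ℂ) (b : ι → ℝ), (∀ i ∈ s, ‖a i‖ ≤ b i) ∧
    (∀ α, F α = ∑ i ∈ s, a i * e (n i * α)) ∧ (∀ α, G α = ∑ i ∈ s, (b i : ℂ) * e (n i * α))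

namespace Dom

variable {F G F' G' : ℝ → ℂ}

theorem add (hd : Dom F G) (hd' : Dom F' G') :
    Dom (fun α => F α + F' α) (fun α => G α + G' α) := by
  obtain ⟨ι, s, n, a, b, hab, hF, hG⟩ := hd
  obtain ⟨ι', s', n', a', b', hab', hF', hG'⟩ := hd'
  refine ⟨ι ⊕ ι', s.disjSum s', Sum.elim n n', Sum.elim a a', Sum.elim b b', ?_, ?_, ?_⟩
  · intro i hi
    rcases i with i | i
    · exact hab i (by simpa using hi)
    · exact hab' i (by simpa using hi)
  · intro α; simp [hF, hF', Finset.sum_disjSum]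
  · intro α; simp [hG, hG', Finset.sum_disjSum]

theorem mul (hd : Dom F G) (hd' : Dom F' G') :
    Dom (fun α => F α * F' α) (fun α => G α * G' α) := by
  obtain ⟨ι, s, n, a, b, hab, hF, hG⟩ := hd
  obtain ⟨ι', s', n', a', b', hab', hF', hG'⟩ := hd'
  refine ⟨ι × ι', s ×ˢ s', fun p => n p.1 + n' p.2, fun p => a p.1 * a' p.2,
    fun p => b p.1 * b' p.2, ?_, ?_, ?_⟩
  · rintro ⟨i, j⟩ hi
    rw [Finset.mem_product] at hi
    rw [norm_mul]
    exact mul_le_mul (hab _ hi.1) (hab' _ hi.2) (norm_nonneg _)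
      ((norm_nonneg _).trans (hab _ hi.1))
  · intro α
    simp only [hF, hF', Finset.sum_mul_sum, Finset.sum_product]
    refine Finset.sum_congr rfl fun i _ => Finset.sum_congr rfl fun j _ => ?_
    push_cast
    rw [add_mul, e_add]; ring
  · intro α
    simp only [hG, hG', Finset.sum_mul_sum, Finset.sum_product]
    refine Finset.sum_congr rfl fun i _ => Finset.sum_congr rfl fun j _ => ?_
    push_cast
    rw [add_mul, e_add]; ring

theorem conj (hd : Dom F G) :
    Dom (fun α => (starRingEnd ℂ) (F α)) (fun α => (starRingEnd ℂ) (G α)) := by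
  obtain ⟨ι, s, n, a, b, hab, hF, hG⟩ := hd
  refine ⟨ι, s, fun i => - n i, fun i => (starRingEnd ℂ) (a i), b, ?_, ?_, ?_⟩
  · intro i hi; rw [RCLike.norm_conj]; exact hab i hi
  · intro α; simp only [hF, map_sum, map_mul, ← e_neg]; push_cast; simp only [neg_mul]
  · intro α
    simp only [hG, map_sum, map_mul, ← e_neg, Complex.conj_ofReal]; push_cast; simp only [neg_mul]

theorem const {a : ℂ} {b : ℝ} (hab : ‖a‖ ≤ b) : Dom (fun _ => a) (fun _ => (b : ℂ)) :=
  ⟨Unit, {()}, fun _ => 0, fun _ => a, fun _ => b, fun _ _ => hab, by simp [e_zero],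
    by simp [e_zero]⟩

theorem char (n : ℤ) {a : ℂ} (ha : ‖a‖ ≤ 1) :
    Dom (fun α => a * e (n * α)) (fun α => e (n * α)) :=
  ⟨Unit, {()}, fun _ => n, fun _ => a, fun _ => 1, fun _ _ => ha, by simp, by simp⟩

theorem sum {κ : Type*} (t : Finset κ) {F G : κ → ℝ → ℂ} (hd : ∀ k ∈ t, Dom (F k) (G k)) :
    Dom (fun α => ∑ k ∈ t, F k α) (fun α => ∑ k ∈ t, G k α) := by
  classical
  induction t using Finset.induction_on with
  | empty => simpa using Dom.const (a := 0) (b := 0) (by simp)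
  | insert k t hk ih =>
    simp only [Finset.sum_insert hk]
    exact (hd k (by simp)).add (ih fun j hj => hd j (by simp [hj]))

theorem pow (hd : Dom F G) (k : ℕ) : Dom (fun α => F α ^ k) (fun α => G α ^ k) := by
  induction k with
  | zero => simpa using Dom.const (a := 1) (b := 1) (by simp)
  | succ k ih => simp only [pow_succ]; exact ih.mul hd

theorem norm_sq (hd : Dom F G) :
    Dom (fun α => ((‖F α‖ ^ 2 : ℝ) : ℂ)) (fun α => ((‖G α‖ ^ 2 : ℝ) : ℂ)) := by
  have := hd.mul hd.conj
  simp only [Complex.mul_conj'] at this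
  push_cast; exact this

theorem norm_pow (hd : Dom F G) (k : ℕ) :
    Dom (fun α => ((‖F α‖ ^ (2 * k) : ℝ) : ℂ)) (fun α => ((‖G α‖ ^ (2 * k) : ℝ) : ℂ)) := by
  have := hd.norm_sq.pow k
  simp only [← Complex.ofReal_pow, ← pow_mul] at this
  exact this

theorem mul_real {f g f' g' : ℝ → ℝ} (hd : Dom (fun α => (f α : ℂ)) (fun α => (g α : ℂ)))
    (hd' : Dom (fun α => (f' α : ℂ)) (fun α => (g' α : ℂ))) :
    Dom (fun α => ((f α * f' α : ℝ) : ℂ)) (fun α => ((g α * g' α : ℝ) : ℂ)) := by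
  push_cast; exact hd.mul hd'

theorem norm_integral_le {g : ℝ → ℝ} (hd : Dom F (fun α => (g α : ℂ))) :
    ‖∫ α in (0:ℝ)..1, F α‖ ≤ ∫ α in (0:ℝ)..1, g α := by
  obtain ⟨ι, s, n, a, b, hab, hF, hG⟩ := hd
  have h1 : ((∫ α in (0:ℝ)..1, g α : ℝ) : ℂ) = ∑ i ∈ s with n i = 0, (b i : ℂ) := by
    rw [← intervalIntegral.integral_ofReal, ← integral_sum_e]
    simp only [hG]
  have h2 : (∫ α in (0:ℝ)..1, g α : ℝ) = ∑ i ∈ s with n i = 0, b i := by exact_mod_cast h1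
  rw [h2]
  simp only [hF]
  rw [integral_sum_e]
  exact (norm_sum_le _ _).trans (Finset.sum_le_sum fun i hi => hab i (Finset.mem_filter.1 hi).1)

theorem integral_le {f g : ℝ → ℝ} (hd : Dom (fun α => (f α : ℂ)) (fun α => (g α : ℂ))) :
    ∫ α in (0:ℝ)..1, f α ≤ ∫ α in (0:ℝ)..1, g α := by
  have := hd.norm_integral_le
  rw [intervalIntegral.integral_ofReal, Complex.norm_real] at this
  exact (le_abs_self _).trans this

theorem trig_of_injOn {ι : Type*} {κ : Type} (s : Finset ι) (n : ι → ℤ) (t : Finset κ) (m : κ → ℤ)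
    (φ : ι → κ) (hφ : ∀ i ∈ s, φ i ∈ t) (hinj : Set.InjOn φ s) (hn : ∀ i ∈ s, n i = m (φ i)) :
    Dom (trig s n) (trig t m) := by
  classical
  refine ⟨κ, t, m, fun k => if k ∈ s.image φ then 1 else 0, fun _ => 1, ?_, ?_, ?_⟩
  · intro i _; dsimp only; split_ifs <;> simp
  · intro α
    simp only [ite_mul, one_mul, zero_mul]
    rw [← Finset.sum_filter]
    have : t.filter (fun k => k ∈ s.image φ) = s.image φ := by
      ext k; simp only [Finset.mem_filter, Finset.mem_image]
      constructor
      · exact fun hh => hh.2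
      · rintro ⟨i, hi, rfl⟩; exact ⟨hφ i hi, i, hi, rfl⟩
    rw [this, Finset.sum_image (fun i hi j hj hij => hinj hi hj hij), trig]
    exact Finset.sum_congr rfl fun i hi => by rw [hn i hi]
  · intro α; simp [trig]

theorem trig_subset {ι : Type} {s t : Finset ι} (hst : s ⊆ t) (n : ι → ℤ) :
    Dom (trig s n) (trig t n) :=
  trig_of_injOn s n t n id (fun _ hi => hst hi) Function.injective_id.injOn fun _ _ => rfl

end Dom

/-! ### Divisor bounds and square roots to a modulus -/

theorem card_divisors_le_rpow {ε : ℝ} (hε : 0 < ε) :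
    ∃ C : ℝ, 1 ≤ C ∧ ∀ n : ℕ, n ≠ 0 → (n.divisors.card : ℝ) ≤ C * (n : ℝ) ^ ε := by
  set K : ℝ := max 1 (1 / (ε * Real.log 2)) with hK
  have hK1 : 1 ≤ K := le_max_left _ _
  have hl2 : 0 < Real.log 2 := Real.log_pos (by norm_num)
  have hε2 : 0 < ε * Real.log 2 := by positivity
  obtain ⟨N, hN⟩ := exists_nat_gt ((2:ℝ) ^ (1 / ε))
  refine ⟨K ^ N, one_le_pow₀ hK1, fun n hn => ?_⟩
  have key : ∀ p ∈ n.primeFactors, ((n.factorization p + 1 : ℕ) : ℝ) ≤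
      (if p < N then K else 1) * ((p : ℝ) ^ (n.factorization p)) ^ ε := by
    intro p hp
    have hp2 : (2:ℝ) ≤ p := by exact_mod_cast (Nat.prime_of_mem_primeFactors hp).two_le
    set a := n.factorization p
    have hpow : ((p:ℝ) ^ a) ^ ε = ((p:ℝ) ^ ε) ^ a := by
      rw [← Real.rpow_natCast, ← Real.rpow_mul (by positivity), mul_comm, Real.rpow_mul (by positivity),
        Real.rpow_natCast]
    split_ifs with hpN
    · have h1 : (2:ℝ) ^ (ε * a) ≤ ((p:ℝ) ^ a) ^ ε := by
        rw [← Real.rpow_natCast, ← Real.rpow_mul (by positivity), mul_comm ε]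
        exact Real.rpow_le_rpow (by norm_num) hp2 (by positivity)
      have h2 : 1 + ε * Real.log 2 * a ≤ (2:ℝ) ^ (ε * a) := by
        rw [Real.rpow_def_of_pos (by norm_num)]
        have := Real.add_one_le_exp (Real.log 2 * (ε * a))
        linarith
      have h3 : (1:ℝ) + a ≤ K * (1 + ε * Real.log 2 * a) := by
        have h4 : 1 ≤ K * (ε * Real.log 2) := by
          have : 1 / (ε * Real.log 2) ≤ K := le_max_right _ _
          rwa [div_le_iff₀ hε2] at this
        have ha : (0:ℝ) ≤ a := by positivity
        nlinarith
      push_cast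
      calc (a:ℝ) + 1 ≤ K * (1 + ε * Real.log 2 * a) := by linarith
        _ ≤ K * ((p:ℝ) ^ a) ^ ε := by gcongr; linarith
    · rw [one_mul, hpow]
      have h1 : (2:ℝ) ≤ (p:ℝ) ^ ε := by
        have : (2:ℝ) ^ (1 / ε) ≤ p := hN.le.trans (by exact_mod_cast not_lt.1 hpN)
        have := Real.rpow_le_rpow (by positivity) this hε.le
        rwa [← Real.rpow_mul (by norm_num), one_div_mul_cancel hε.ne', Real.rpow_one] at this
      calc ((a + 1 : ℕ) : ℝ) ≤ ((2 ^ a : ℕ) : ℝ) := by exact_mod_cast Nat.lt_two_pow_self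
        _ = (2:ℝ) ^ a := by push_cast; rfl
        _ ≤ ((p:ℝ) ^ ε) ^ a := by gcongr
  rw [Nat.card_divisors hn]
  push_cast at key ⊢
  refine (Finset.prod_le_prod (fun _ _ => by positivity) key).trans ?_
  rw [Finset.prod_mul_distrib]
  gcongr ?_ * ?_
  · rw [Finset.prod_ite]
    simp only [Finset.prod_const, one_pow, mul_one]
    refine pow_le_pow_right₀ hK1 ?_
    refine (Finset.card_le_card (t := Finset.range N) ?_).trans (by simp)
    intro p hp; simp at hp ⊢; exact hp.2
  · rw [Real.finsetProd_rpow _ _ (fun _ _ => by positivity)]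
    apply le_of_eq; congr 1
    conv_rhs => rw [← Nat.prod_factorization_pow_eq_self hn]
    rw [Finsupp.prod, Nat.support_factorization]; push_cast; rfl

theorem card_sqrt_zmod_le {n : ℕ} [NeZero n] (S : Finset (ZMod n)) (a : ZMod n)
    (hS : ∀ z ∈ S, z ^ 2 = a) (g : ℕ) (hg0 : 0 < g)
    (hg : ∀ d : ℕ, d ∣ n → ∀ t : ℤ, (t : ZMod n) ∈ S → (d : ℤ) ∣ 2 * t → d ∣ g) :
    S.card ≤ g * n.divisors.card ^ 2 := by
  classical
  have hn : n ≠ 0 := NeZero.ne n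
  rcases S.eq_empty_or_nonempty with rfl | ⟨w, hw⟩
  · simp
  set f : ZMod n → ℕ × ℕ := fun z =>
    (Int.gcd n ((z.val : ℤ) - w.val), Int.gcd n ((z.val : ℤ) + w.val)) with hf
  have hmaps : ∀ z ∈ S, f z ∈ n.divisors ×ˢ n.divisors := by
    intro z _
    simp only [hf, Finset.mem_product, Nat.mem_divisors]
    exact ⟨⟨by simpa using Int.gcd_dvd_natAbs_left (n:ℤ) _, hn⟩,
      ⟨by simpa using Int.gcd_dvd_natAbs_left (n:ℤ) _, hn⟩⟩
  have hfib : ∀ b ∈ n.divisors ×ˢ n.divisors, (S.filter fun z => f z = b).card ≤ g := by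
    rintro ⟨d₁, d₂⟩ hb
    rw [Finset.mem_product, Nat.mem_divisors, Nat.mem_divisors] at hb
    obtain ⟨⟨hd₁, -⟩, hd₂, -⟩ := hb
    dsimp only at hd₁ hd₂
    rcases (S.filter fun z => f z = (d₁, d₂)).eq_empty_or_nonempty with h0 | ⟨z₁, hz₁⟩
    · rw [h0]; simp
    have hprop : ∀ z ∈ S.filter (fun z => f z = (d₁, d₂)),
        (d₁ : ℤ) ∣ z.val - w.val ∧ (d₂ : ℤ) ∣ z.val + w.val := by
      intro z hz
      have := (Finset.mem_filter.1 hz).2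
      simp only [hf, Prod.mk.injEq] at this
      constructor
      · rw [← this.1]; exact Int.gcd_dvd_right _ _
      · rw [← this.2]; exact Int.gcd_dvd_right _ _
    set c := Nat.gcd d₁ d₂ with hc
    have hcn : c ∣ n := (Nat.gcd_dvd_left _ _).trans hd₁
    have hcg : c ∣ g := by
      refine hg c hcn w.val (by simpa using hw) ?_
      have h1 : (c : ℤ) ∣ z₁.val - w.val :=
        (Int.natCast_dvd_natCast.2 (Nat.gcd_dvd_left _ _)).trans (hprop _ hz₁).1
      have h2 : (c : ℤ) ∣ z₁.val + w.val :=
        (Int.natCast_dvd_natCast.2 (Nat.gcd_dvd_right _ _)).trans (hprop _ hz₁).2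
      have := dvd_sub h2 h1
      ring_nf at this; ring_nf; exact this
    have hnd : n ∣ d₁ * d₂ := by
      have hz := Finset.mem_filter.1 hz₁
      have h1 : (n : ℤ) ∣ (z₁.val - w.val) * (z₁.val + w.val) := by
        rw [← ZMod.intCast_zmod_eq_zero_iff_dvd]
        push_cast
        have e1 := hS _ hz.1
        have e2 := hS _ hw
        simp only [ZMod.natCast_val, ZMod.cast_id', id]
        linear_combination e1 - e2
      have h2 := hz.2
      simp only [hf, Prod.mk.injEq] at h2
      have h3 : (n : ℤ) ∣ (d₁ : ℤ) * d₂ := by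
        rw [← h2.1, ← h2.2]
        have : Int.gcd (n:ℤ) ((z₁.val - w.val) * (z₁.val + w.val)) = n := by
          exact_mod_cast (Int.gcd_eq_left_iff_dvd (by positivity)).2 h1
        have h5 := Int.gcd_mul_right_dvd_mul_gcd (n:ℤ) (z₁.val - w.val) (z₁.val + w.val)
        rw [this] at h5
        exact_mod_cast h5
      exact_mod_cast h3
    have hc0 : 0 < c := Nat.pos_of_ne_zero fun h0 => by
      rw [h0] at hcn; exact hn (Nat.eq_zero_of_zero_dvd hcn)
    obtain ⟨m, hm⟩ := hcn
    have hm0 : 0 < m := Nat.pos_of_ne_zero fun h0 => by simp [h0] at hm; exact hn hm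
    have hml : m ∣ Nat.lcm d₁ d₂ := by
      have : c * m ∣ c * Nat.lcm d₁ d₂ := by
        rw [← hm, hc, Nat.gcd_mul_lcm]; exact hnd
      exact (Nat.mul_dvd_mul_iff_left hc0).1 this
    refine (Finset.card_le_card_of_injOn (t := Finset.range c) (fun z => z.val / m) ?_ ?_).trans
      ((by simp : (Finset.range c).card = c).le.trans (Nat.le_of_dvd hg0 hcg))
    · intro z _
      simp only [Finset.coe_range, Set.mem_Iio]
      rw [Nat.div_lt_iff_lt_mul hm0, ← hm]; exact z.val_lt
    · intro z hz z' hz' hzz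
      have h1 := hprop z hz
      have h2 := hprop z' hz'
      have h3 : (m : ℤ) ∣ z.val - z'.val := by
        have a1 : (d₁ : ℤ) ∣ z.val - z'.val := by
          have := dvd_sub h1.1 h2.1; ring_nf at this; ring_nf; exact this
        have a2 : (d₂ : ℤ) ∣ z.val - z'.val := by
          have := dvd_sub h1.2 h2.2; ring_nf at this; ring_nf; exact this
        have a3 : ((Nat.lcm d₁ d₂ : ℕ) : ℤ) ∣ z.val - z'.val := by
          rw [Int.natCast_dvd] at a1 a2 ⊢
          exact Nat.lcm_dvd a1 a2
        exact (Int.natCast_dvd_natCast.2 hml).trans a3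
      have h4 : z.val % m = z'.val % m := by
        have := (Nat.modEq_iff_dvd.2 h3); exact this.symm
      apply ZMod.val_injective
      rw [← Nat.div_add_mod z.val m, ← Nat.div_add_mod z'.val m, h4]
      dsimp only at hzz
      rw [hzz]
  refine (Finset.card_le_mul_card_image_of_maps_to hmaps g hfib).trans ?_
  rw [Finset.card_product, sq]

theorem card_fourth_root_zmod_le {n : ℕ} [NeZero n] (S : Finset (ZMod n)) (a : ZMod n)
    (hS : ∀ z ∈ S, z ^ 4 = a) (hu : ∀ z ∈ S, IsUnit z) : S.card ≤ 4 * n.divisors.card ^ 4 := by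
  classical
  have hgcd : ∀ d : ℕ, d ∣ n → ∀ t : ℤ, IsUnit (t : ZMod n) → (d : ℤ) ∣ 2 * t → d ∣ 2 := by
    intro d hd t ht hdt
    have h1 : IsCoprime t (n : ℤ) := (ZMod.coe_int_isUnit_iff_isCoprime t n).1 ht |>.symm
    have h2 : IsCoprime (d : ℤ) t :=
      (IsCoprime.of_isCoprime_of_dvd_right h1 (Int.natCast_dvd_natCast.2 hd)).symm
    exact_mod_cast h2.dvd_of_dvd_mul_right hdt
  have h1 : (S.image (· ^ 2)).card ≤ 2 * n.divisors.card ^ 2 := by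
    refine card_sqrt_zmod_le _ a ?_ 2 (by norm_num) ?_
    · intro z hz
      obtain ⟨y, hy, rfl⟩ := Finset.mem_image.1 hz
      rw [← hS y hy]; ring
    · intro d hd t ht
      obtain ⟨y, hy, hyt⟩ := Finset.mem_image.1 ht
      exact hgcd d hd t (by rw [← hyt]; exact (hu y hy).pow 2)
  have h2 : S.card ≤ (2 * n.divisors.card ^ 2) * (S.image (· ^ 2)).card := by
    refine Finset.card_le_mul_card_image_of_maps_to (fun z hz => Finset.mem_image_of_mem _ hz) _ ?_
    intro b _
    refine card_sqrt_zmod_le _ b (fun z hz => (Finset.mem_filter.1 hz).2) 2 (by norm_num) ?_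
    intro d hd t ht
    exact hgcd d hd t (hu _ (Finset.mem_filter.1 ht).1)
  calc S.card ≤ (2 * n.divisors.card ^ 2) * (2 * n.divisors.card ^ 2) :=
        h2.trans (Nat.mul_le_mul_left _ h1)
    _ = _ := by ring

theorem card_rep_coprime_le (n : ℕ) (T : Finset (ℕ × ℕ))
    (hT : ∀ v ∈ T, 0 < v.1 ∧ 0 < v.2 ∧ 3 * v.1 ^ 2 + v.2 ^ 2 = n ∧ Nat.Coprime v.1 v.2) :
    T.card ≤ 12 * n.divisors.card ^ 2 := by
  classical
  rcases Nat.eq_zero_or_pos n with rfl | hn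
  · have : T = ∅ := Finset.eq_empty_of_forall_notMem fun v hv => by
      obtain ⟨a, b, c, -⟩ := hT v hv
      have : 0 < v.1 ^ 2 := by positivity
      omega
    simp [this]
  have : NeZero n := ⟨hn.ne'⟩
  have hcop : ∀ v ∈ T, Nat.Coprime v.1 n := by
    intro v hv
    obtain ⟨-, -, c, d⟩ := hT v hv
    rw [← c, show 3 * v.1 ^ 2 + v.2 ^ 2 = v.2 ^ 2 + v.1 * (3 * v.1) by ring,
      Nat.coprime_add_mul_left_right]
    exact d.pow_right 2
  set f : ℕ × ℕ → ZMod n := fun v => v.2 * (v.1 : ZMod n)⁻¹ with hf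
  have hinv : ∀ v ∈ T, (v.1 : ZMod n) * (v.1 : ZMod n)⁻¹ = 1 := fun v hv =>
    ZMod.coe_mul_inv_eq_one _ (hcop v hv)
  have hsq : ∀ v ∈ T, (3 : ZMod n) * v.1 ^ 2 + v.2 ^ 2 = 0 := by
    intro v hv
    have := (hT v hv).2.2.1
    have h2 : ((3 * v.1 ^ 2 + v.2 ^ 2 : ℕ) : ZMod n) = (n : ℕ) := by rw [this]
    simpa using h2
  have hinj : Set.InjOn f T := by
    intro v hv v' hv' hvv
    have h1 := hinv v hv
    have h2 := hinv v' hv'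
    simp only [hf] at hvv
    have h3 : ((v.2 * v'.1 : ℕ) : ZMod n) = ((v'.2 * v.1 : ℕ) : ZMod n) := by
      push_cast
      calc (v.2 : ZMod n) * v'.1 = (v.2 * (v.1 : ZMod n)⁻¹) * (v.1 * v'.1) := by
            linear_combination (-(v.2 : ZMod n) * v'.1) * h1
        _ = (v'.2 * (v'.1 : ZMod n)⁻¹) * (v.1 * v'.1) := by rw [hvv]
        _ = _ := by linear_combination ((v'.2 : ZMod n) * v.1) * h2
    have hlt : ∀ u ∈ T, ∀ u' ∈ T, u.2 * u'.1 < n := by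
      intro u hu u' hu'
      obtain ⟨a, b, c, -⟩ := hT u hu
      obtain ⟨a', b', c', -⟩ := hT u' hu'
      by_contra! hcon
      have : n ^ 2 ≤ (u.2 * u'.1) ^ 2 := Nat.pow_le_pow_left hcon 2
      have e1 : u.2 ^ 2 < n := by have : 0 < u.1 ^ 2 := by positivity
                                  omega
      have e2 : u'.1 ^ 2 < n := by have : 0 < u'.1 ^ 2 := by positivity
                                   omega
      have e3 : u.2 ^ 2 * u'.1 ^ 2 < n * n := Nat.mul_lt_mul'' e1 e2
      nlinarith
    have h4 : v.2 * v'.1 = v'.2 * v.1 := by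
      have := (ZMod.natCast_eq_natCast_iff' _ _ n).1 h3
      rwa [Nat.mod_eq_of_lt (hlt v hv v' hv'), Nat.mod_eq_of_lt (hlt v' hv' v hv)] at this
    obtain ⟨a, b, -, c⟩ := hT v hv
    obtain ⟨a', b', -, c'⟩ := hT v' hv'
    have d1 : v.1 ∣ v'.1 := c.dvd_of_dvd_mul_left ⟨v'.2, by rw [h4]; ring⟩
    have d2 : v'.1 ∣ v.1 := c'.dvd_of_dvd_mul_left ⟨v.2, by rw [← h4]; ring⟩
    have e1 : v.1 = v'.1 := Nat.dvd_antisymm d1 d2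
    rw [e1] at h4
    exact Prod.ext e1 (Nat.eq_of_mul_eq_mul_right a' h4)
  rw [← Finset.card_image_of_injOn hinj]
  have hroot : ∀ z ∈ T.image f, z ^ 2 = -3 := by
    intro z hz
    obtain ⟨v, hv, rfl⟩ := Finset.mem_image.1 hz
    have h1 := hinv v hv
    have h2 := hsq v hv
    simp only [hf]
    have h3 : ((v.1 : ZMod n) * (v.1 : ZMod n)⁻¹) ^ 2 = 1 := by rw [h1]; ring
    linear_combination ((v.1 : ZMod n)⁻¹) ^ 2 * h2 - 3 * h3
  refine card_sqrt_zmod_le _ (-3) hroot 12 (by norm_num) ?_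
  intro d hd t ht hdt
  have h1 := hroot _ ht
  have h2 : (n : ℤ) ∣ t ^ 2 + 3 := by
    rw [← ZMod.intCast_zmod_eq_zero_iff_dvd]; push_cast; rw [h1]; ring
  have h3 : (d : ℤ) ∣ 4 * (t ^ 2 + 3) := ((Int.natCast_dvd_natCast.2 hd).trans h2).mul_left 4
  have h4 : (d : ℤ) ∣ 2 * t * (2 * t) := hdt.mul_left _
  have h5 : (d : ℤ) ∣ 12 := by
    have := dvd_sub h3 h4; ring_nf at this; exact this
  exact_mod_cast h5

theorem card_rep_le (n : ℕ) (T : Finset (ℕ × ℕ))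
    (hT : ∀ v ∈ T, 0 < v.1 ∧ 0 < v.2 ∧ 3 * v.1 ^ 2 + v.2 ^ 2 = n) :
    T.card ≤ 12 * n.divisors.card ^ 3 := by
  classical
  rcases Nat.eq_zero_or_pos n with rfl | hn
  · have : T = ∅ := Finset.eq_empty_of_forall_notMem fun v hv => by
      obtain ⟨a, b, c⟩ := hT v hv
      have : 0 < v.1 ^ 2 := by positivity
      omega
    simp [this]
  have hgn : ∀ v ∈ T, (Nat.gcd v.1 v.2) ^ 2 ∣ n := by
    intro v hv
    rw [← (hT v hv).2.2]
    exact dvd_add ((pow_dvd_pow_of_dvd (Nat.gcd_dvd_left _ _) 2).mul_left 3)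
      (pow_dvd_pow_of_dvd (Nat.gcd_dvd_right _ _) 2)
  have hmaps : ∀ v ∈ T, Nat.gcd v.1 v.2 ∈ n.divisors := fun v hv =>
    Nat.mem_divisors.2 ⟨(dvd_pow_self _ two_ne_zero).trans (hgn v hv), hn.ne'⟩
  have := Finset.card_le_mul_card_image_of_maps_to hmaps (12 * n.divisors.card ^ 2) ?_
  · exact this.trans (le_of_eq (by ring))
  intro g hg
  set T' := T.filter fun v => Nat.gcd v.1 v.2 = g
  have hg0 : 0 < g := Nat.pos_of_mem_divisors hg
  have hg' : ∀ v ∈ T', v ∈ T ∧ Nat.gcd v.1 v.2 = g := fun v hv => Finset.mem_filter.1 hv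
  rcases T'.eq_empty_or_nonempty with h0 | ⟨v₀, hv₀⟩
  · rw [h0]; simp
  have hdiv : ∀ v ∈ T', v.1 = g * (v.1 / g) ∧ v.2 = g * (v.2 / g) := by
    intro v hv
    rw [← (hg' v hv).2]
    exact ⟨(Nat.mul_div_cancel' (Nat.gcd_dvd_left _ _)).symm,
      (Nat.mul_div_cancel' (Nat.gcd_dvd_right _ _)).symm⟩
  have hinj : Set.InjOn (fun v : ℕ × ℕ => (v.1 / g, v.2 / g)) T' := by
    intro v hv v' hv' hvv
    simp only [Prod.mk.injEq] at hvv
    have h1 := hdiv v hv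
    have h2 := hdiv v' hv'
    exact Prod.ext (by rw [h1.1, h2.1, hvv.1]) (by rw [h1.2, h2.2, hvv.2])
  rw [← Finset.card_image_of_injOn hinj]
  refine (card_rep_coprime_le (n / g ^ 2) _ ?_).trans ?_
  · intro u hu
    obtain ⟨v, hv, rfl⟩ := Finset.mem_image.1 hu
    obtain ⟨hvT, hvg⟩ := hg' v hv
    obtain ⟨a, b, c⟩ := hT v hvT
    have h1 := hdiv v hv
    refine ⟨?_, ?_, ?_, ?_⟩
    · exact Nat.pos_of_ne_zero fun h0 => by dsimp only at h0; rw [h0] at h1; omega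
    · exact Nat.pos_of_ne_zero fun h0 => by dsimp only at h0; rw [h0] at h1; omega
    · symm
      apply Nat.div_eq_of_eq_mul_right (by positivity)
      dsimp only
      rw [← c]
      calc 3 * v.1 ^ 2 + v.2 ^ 2 = 3 * (g * (v.1 / g)) ^ 2 + (g * (v.2 / g)) ^ 2 := by
            rw [← h1.1, ← h1.2]
        _ = _ := by ring
    · dsimp only; rw [← hvg]; exact Nat.coprime_div_gcd_div_gcd (by rw [hvg]; exact hg0)
  · gcongr 12 * ?_ ^ 2
    refine Finset.card_le_card (Nat.divisors_subset_of_dvd hn.ne' ?_)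
    apply Nat.div_dvd_of_dvd
    rw [← (hg' v₀ hv₀).2]; exact hgn v₀ (hg' v₀ hv₀).1

/-! ### Hölder's inequality and scaling for integrals over the circle -/

theorem integral_prod_rpow_le {X κ : Type*} [MeasurableSpace X] (μ : Measure X) (s : Finset κ)
    (f : κ → X → ℝ) (p : κ → ℝ) (hf : ∀ i ∈ s, Integrable (f i) μ) (hf0 : ∀ i ∈ s, ∀ x, 0 ≤ f i x)
    (hp0 : ∀ i ∈ s, 0 ≤ p i) (hp : ∑ i ∈ s, p i = 1) :
    ∫ x, ∏ i ∈ s, f i x ^ p i ∂μ ≤ ∏ i ∈ s, (∫ x, f i x ∂μ) ^ p i := by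
  have hm : AEStronglyMeasurable (fun x => ∏ i ∈ s, f i x ^ p i) μ := by
    apply AEMeasurable.aestronglyMeasurable
    exact Finset.aemeasurable_fun_prod s fun i hi => (hf i hi).aemeasurable.pow_const _
  rw [integral_eq_lintegral_of_nonneg_ae
    (Eventually.of_forall fun x => Finset.prod_nonneg fun i hi => Real.rpow_nonneg (hf0 i hi x) _) hm]
  have hfin : ∀ i ∈ s, ∫⁻ x, ENNReal.ofReal (f i x) ∂μ ≠ ⊤ := fun i hi =>
    ((hasFiniteIntegral_iff_ofReal (Eventually.of_forall (hf0 i hi))).1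
      (hf i hi).hasFiniteIntegral).ne
  have h1 : ∫⁻ x, ENNReal.ofReal (∏ i ∈ s, f i x ^ p i) ∂μ ≤
      ∏ i ∈ s, (∫⁻ x, ENNReal.ofReal (f i x) ∂μ) ^ p i := by
    refine le_trans (le_of_eq ?_) (ENNReal.lintegral_prod_norm_pow_le s
      (fun i hi => (hf i hi).aemeasurable.ennreal_ofReal) hp hp0)
    refine lintegral_congr fun x => ?_
    rw [ENNReal.ofReal_prod_of_nonneg fun i hi => Real.rpow_nonneg (hf0 i hi x) _]
    exact Finset.prod_congr rfl fun i hi => (ENNReal.ofReal_rpow_of_nonneg (hf0 i hi x) (hp0 i hi)).symm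
  have h2 : ∏ i ∈ s, (∫⁻ x, ENNReal.ofReal (f i x) ∂μ) ^ p i ≠ ⊤ :=
    ENNReal.prod_ne_top fun i hi => ENNReal.rpow_ne_top_of_nonneg (hp0 i hi) (hfin i hi)
  refine (ENNReal.toReal_mono h2 h1).trans (le_of_eq ?_)
  rw [ENNReal.toReal_prod]
  refine Finset.prod_congr rfl fun i hi => ?_
  rw [← ENNReal.toReal_rpow, integral_eq_lintegral_of_nonneg_ae
    (Eventually.of_forall (hf0 i hi)) (hf i hi).aestronglyMeasurable]

theorem integral_rpow_mul_rpow_le {X : Type*} [MeasurableSpace X] (μ : Measure X) {f g : X → ℝ}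
    (hf : Integrable f μ) (hg : Integrable g μ) (hf0 : ∀ x, 0 ≤ f x) (hg0 : ∀ x, 0 ≤ g x)
    {a b : ℝ} (ha : 0 ≤ a) (hb : 0 ≤ b) (hab : a + b = 1) :
    ∫ x, f x ^ a * g x ^ b ∂μ ≤ (∫ x, f x ∂μ) ^ a * (∫ x, g x ∂μ) ^ b := by
  have := integral_prod_rpow_le μ Finset.univ ![f, g] ![a, b]
    (by intro i _; fin_cases i <;> simpa) (by intro i _; fin_cases i <;> simpa)
    (by intro i _; fin_cases i <;> simpa) (by simpa [Fin.sum_univ_two])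
  simpa [Fin.prod_univ_two] using this

theorem integral_rpow_mul_rpow_mul_rpow_le {X : Type*} [MeasurableSpace X] (μ : Measure X)
    {f g k : X → ℝ}
    (hf : Integrable f μ) (hg : Integrable g μ) (hk : Integrable k μ)
    (hf0 : ∀ x, 0 ≤ f x) (hg0 : ∀ x, 0 ≤ g x) (hk0 : ∀ x, 0 ≤ k x)
    {a b c : ℝ} (ha : 0 ≤ a) (hb : 0 ≤ b) (hc : 0 ≤ c) (habc : a + b + c = 1) :
    ∫ x, f x ^ a * g x ^ b * k x ^ c ∂μ ≤
      (∫ x, f x ∂μ) ^ a * (∫ x, g x ∂μ) ^ b * (∫ x, k x ∂μ) ^ c := by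
  have := integral_prod_rpow_le μ Finset.univ ![f, g, k] ![a, b, c]
    (by intro i _; fin_cases i <;> simpa) (by intro i _; fin_cases i <;> simpa)
    (by intro i _; fin_cases i <;> simpa) (by simpa [Fin.sum_univ_three])
  simpa [Fin.prod_univ_three] using this

theorem integral_comp_int_mul {E : Type*} [NormedAddCommGroup E] [NormedSpace ℝ E] {G : ℝ → E}
    (hG : ∀ x, G (x + 1) = G x) (hc : Continuous G) {L : ℤ} (hL : L ≠ 0) :
    ∫ α in (0:ℝ)..1, G (L * α) = ∫ α in (0:ℝ)..1, G α := by
  have hL' : (L : ℝ) ≠ 0 := by exact_mod_cast hL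
  have hper : Function.Periodic G 1 := hG
  have h1 := intervalIntegral.integral_comp_mul_left (a := 0) (b := 1) G hL'
  rw [h1]
  have h2 := hper.intervalIntegral_add_zsmul_eq L 0 (fun a b => hc.intervalIntegrable a b)
  simp only [zero_add, zsmul_eq_mul, mul_one] at h2
  rw [mul_zero, mul_one, h2, ← Int.cast_smul_eq_zsmul ℝ L, smul_smul, inv_mul_cancel₀ hL', one_smul]

theorem integral_e_mul_comp_eq_zero {G : ℝ → ℂ} (hG : ∀ x, G (x + 1) = G x)
    {L n : ℤ} (hL : L ≠ 0) (hn : ¬ L ∣ n) :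
    ∫ α in (0:ℝ)..1, e (n * α) * G (L * α) = 0 := by
  have hL' : (L : ℝ) ≠ 0 := by exact_mod_cast hL
  set K : ℝ → ℂ := fun α => e (n * α) * G (L * α) with hK
  have hGz : ∀ (m : ℤ) x, G (x + m) = G x := fun m x => by
    simpa using (Function.Periodic.int_mul (f := G) (c := 1) hG m) x
  have hper : Function.Periodic K 1 := by
    intro x
    simp only [hK]
    rw [e_int_mul_add_one, mul_add, mul_one, hGz]
  have h1 : ∫ α in (0:ℝ)..1, K (α + 1 / L) = ∫ α in (0:ℝ)..1, K α := by
    rw [intervalIntegral.integral_comp_add_right]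
    have := hper.intervalIntegral_add_eq (1 / L) 0
    simp only [zero_add] at this
    rw [zero_add, add_comm 1 (1 / (L:ℝ)), this]
  have h2 : ∀ α, K (α + 1 / L) = e (n / L) * K α := by
    intro α
    simp only [hK]
    have := hGz 1 (L * α)
    rw [mul_add, mul_add, mul_one_div_cancel hL', e_add]
    push_cast at this
    rw [this]; ring_nf
  simp only [h2, intervalIntegral.integral_const_mul] at h1
  have h3 : e (n / L) ≠ 1 := by
    intro h4
    rw [e, Complex.exp_eq_one_iff] at h4
    obtain ⟨k, hk⟩ := h4
    have hpi : (2 * π * Complex.I : ℂ) ≠ 0 := by simp [Real.pi_ne_zero]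
    have h5 : (((n / L : ℝ)) : ℂ) = ((k : ℝ) : ℂ) := by
      apply mul_left_cancel₀ hpi; rw [hk]; push_cast; ring
    have h6 : (n / L : ℝ) = k := by exact_mod_cast h5
    rw [div_eq_iff hL'] at h6
    apply hn
    exact ⟨k, by have : n = k * L := by exact_mod_cast h6
                 rw [this]; ring⟩
  have h7 : (e (n / L) - 1) * ∫ α in (0:ℝ)..1, K α = 0 := by rw [sub_mul, h1]; ring
  exact (mul_eq_zero.1 h7).resolve_left (sub_ne_zero.2 h3)

theorem norm_sq_trig {ι : Type*} (s : Finset ι) (n : ι → ℤ) (α : ℝ) :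
    ((‖trig s n α‖ ^ 2 : ℝ) : ℂ) = ∑ q ∈ s ×ˢ s, e (((n q.1 - n q.2 : ℤ) : ℝ) * α) := by
  push_cast
  rw [← Complex.mul_conj', trig_conj, trig_mul, trig]
  simp [sub_eq_add_neg]

/-- Orthogonality to the modulus `L`: only pairs of frequencies congruent modulo `L` contribute. -/
theorem integral_norm_sq_trig_mul {ι : Type*} (s : Finset ι) (n : ι → ℤ) {G : ℝ → ℝ}
    (hG : ∀ x, G (x + 1) = G x) (hc : Continuous G) {L : ℕ} [NeZero L] :
    ∫ α in (0:ℝ)..1, ‖trig s n α‖ ^ 2 * G (L * α) =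
      ∫ α in (0:ℝ)..1, (∑ c : ZMod L, ‖trig (s.filter fun i => (n i : ZMod L) = c) n α‖ ^ 2)
        * G (L * α) := by
  have hL : (L : ℤ) ≠ 0 := by exact_mod_cast NeZero.ne L
  apply Complex.ofReal_injective
  rw [← intervalIntegral.integral_ofReal, ← intervalIntegral.integral_ofReal, ← sub_eq_zero,
    ← intervalIntegral.integral_sub]
  rotate_left
  · exact Continuous.intervalIntegrable (by fun_prop) _ _
  · exact Continuous.intervalIntegrable (by fun_prop) _ _
  have h1 : ∀ α : ℝ, (((‖trig s n α‖ ^ 2 * G (L * α) : ℝ) : ℂ) -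
      (((∑ c : ZMod L, ‖trig (s.filter fun i => (n i : ZMod L) = c) n α‖ ^ 2) * G (L * α) : ℝ) : ℂ))
      = ∑ q ∈ (s ×ˢ s).filter (fun q => (n q.1 : ZMod L) ≠ n q.2),
        e (((n q.1 - n q.2 : ℤ) : ℝ) * α) * (G ((L : ℤ) * α) : ℂ) := by
    intro α
    rw [Complex.ofReal_mul, Complex.ofReal_mul, Complex.ofReal_sum, norm_sq_trig, ← sub_mul,
      ← Finset.sum_mul]
    simp only [norm_sq_trig]
    push_cast
    congr 1
    rw [sub_eq_iff_eq_add, ← Finset.sum_filter_add_sum_filter_not (s ×ˢ s)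
      (fun q => (n q.1 : ZMod L) ≠ n q.2)]
    congr 1
    have : ∀ c : ZMod L, (s.filter fun i => (n i : ZMod L) = c) ×ˢ (s.filter fun i => (n i : ZMod L) = c)
        = (((s ×ˢ s).filter fun q => ¬ ((n q.1 : ZMod L) ≠ n q.2))).filter
          (fun q => (n q.1 : ZMod L) = c) := by
      intro c
      ext ⟨i, j⟩
      simp only [Finset.mem_product, Finset.mem_filter, not_not]
      constructor
      · rintro ⟨⟨hi, rfl⟩, hj, h2⟩; exact ⟨⟨⟨hi, hj⟩, h2.symm⟩, rfl⟩
      · rintro ⟨⟨⟨hi, hj⟩, h2⟩, rfl⟩; exact ⟨⟨hi, rfl⟩, hj, h2.symm⟩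
    simp only [this]
    rw [Finset.sum_fiberwise]
  simp only [h1]
  rw [intervalIntegral.integral_finsetSum]
  · refine Finset.sum_eq_zero fun q hq => ?_
    refine integral_e_mul_comp_eq_zero (G := fun x => (G x : ℂ)) (fun x => by rw [hG])
      hL ?_
    intro hd
    apply (Finset.mem_filter.1 hq).2
    have := (ZMod.intCast_zmod_eq_zero_iff_dvd (n q.1 - n q.2) L).2 hd
    push_cast at this
    exact sub_eq_zero.1 this
  · intro i _
    exact Continuous.intervalIntegrable (by fun_prop) _ _

theorem norm_trig_sq_le_of_image_card {ι κ : Type*} [DecidableEq κ] (s : Finset ι) (n : ι → ℤ)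
    (key : ι → κ) (α : ℝ) :
    ‖trig s n α‖ ^ 2 ≤ (s.image key).card *
      ∑ k ∈ s.image key, ‖trig (s.filter fun i => key i = k) n α‖ ^ 2 := by
  have h1 : trig s n α = ∑ k ∈ s.image key, trig (s.filter fun i => key i = k) n α := by
    simp only [trig]
    exact (Finset.sum_fiberwise_of_maps_to (fun i hi => Finset.mem_image_of_mem key hi) _).symm
  rw [h1]
  refine (pow_le_pow_left₀ (norm_nonneg _) (norm_sum_le _ _) 2).trans ?_
  exact sq_sum_le_card_mul_sum_sq

/-- If the frequencies are fourth powers modulo `L` then, up to the number `ν` of fourth roots, only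
pairs with congruent roots matter. -/
theorem integral_norm_sq_trig_mul_le {ι : Type*} (s : Finset ι) (n : ι → ℤ) {G : ℝ → ℝ}
    (hG : ∀ x, G (x + 1) = G x) (hc : Continuous G) (hG0 : ∀ x, 0 ≤ G x) {L : ℕ} [NeZero L]
    (key : ι → ZMod L) (hkey : ∀ i ∈ s, (n i : ZMod L) = key i ^ 4) (ν : ℝ)
    (hν : ∀ c : ZMod L, (((s.image key).filter fun k => k ^ 4 = c).card : ℝ) ≤ ν) :
    ∫ α in (0:ℝ)..1, ‖trig s n α‖ ^ 2 * G (L * α) ≤ ν *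
      ∫ α in (0:ℝ)..1, (∑ k ∈ s.image key, ‖trig (s.filter fun i => key i = k) n α‖ ^ 2)
        * G (L * α) := by
  have hν0 : 0 ≤ ν := (Nat.cast_nonneg _).trans (hν 0)
  rw [integral_norm_sq_trig_mul s n hG hc, ← intervalIntegral.integral_const_mul]
  apply intervalIntegral.integral_mono_on zero_le_one
  · exact Continuous.intervalIntegrable (by fun_prop) _ _
  · exact Continuous.intervalIntegrable (by fun_prop) _ _
  intro α _
  rw [← mul_assoc]
  refine mul_le_mul_of_nonneg_right ?_ (hG0 _)
  rw [← Finset.sum_fiberwise (s.image key) (fun k => k ^ 4), Finset.mul_sum]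
  refine Finset.sum_le_sum fun c _ => ?_
  refine (norm_trig_sq_le_of_image_card _ n key α).trans ?_
  have himg : (s.filter fun i => (n i : ZMod L) = c).image key ⊆
      (s.image key).filter fun k => k ^ 4 = c := by
    intro k hk
    obtain ⟨i, hi, rfl⟩ := Finset.mem_image.1 hk
    obtain ⟨hi1, hi2⟩ := Finset.mem_filter.1 hi
    exact Finset.mem_filter.2 ⟨Finset.mem_image_of_mem _ hi1, by rw [← hkey i hi1, hi2]⟩
  refine mul_le_mul ?_ ?_ (Finset.sum_nonneg fun _ _ => by positivity) hν0
  · exact (Nat.cast_le.2 (Finset.card_le_card himg)).trans (hν c)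
  · refine (Finset.sum_le_sum fun k hk => ?_).trans
      (Finset.sum_le_sum_of_subset_of_nonneg himg fun _ _ _ => by positivity)
    apply le_of_eq
    congr 3
    rw [Finset.filter_filter]
    refine Finset.filter_congr fun i hi => ?_
    constructor
    · exact fun hh => hh.2
    · intro hh
      refine ⟨?_, hh⟩
      rw [hkey i hi, hh]; exact (Finset.mem_filter.1 (himg hk)).2

/-! ### The differenced sum -/

/-- Pairs `(m, k)` with `m ∈ 𝓜` and `1 ≤ k`, `k m⁴ < Y`. -/
def diffBase (𝓜 : Finset ℕ) (Y : ℕ) : Finset (ℕ × ℕ) :=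
  (𝓜 ×ˢ Finset.Icc 1 Y).filter fun b => b.2 * b.1 ^ 4 < Y

/-- Index set of the differenced sum. -/
def diffIdx (𝓜 : Finset ℕ) (Y : ℕ) : Finset (Σ _ : ℕ × ℕ, ℕ) :=
  (diffBase 𝓜 Y).sigma fun b => Finset.Icc 1 (Y - b.2 * b.1 ^ 4)

/-- The polynomial `((y + k m⁴)⁴ - y⁴) / m⁴`. -/
def diffPoly (m k y : ℕ) : ℤ :=
  k * (4 * y ^ 3 + 6 * y ^ 2 * (k * m ^ 4) + 4 * y * (k * m ^ 4) ^ 2 + (k * m ^ 4) ^ 3)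

/-- The differenced sum. -/
def diffSum (𝓜 : Finset ℕ) (Y : ℕ) : ℝ → ℂ :=
  trig (diffIdx 𝓜 Y) fun t => diffPoly t.1.1 t.1.2 t.2

@[fun_prop]
theorem continuous_diffSum (𝓜 : Finset ℕ) (Y : ℕ) : Continuous (diffSum 𝓜 Y) := by
  unfold diffSum; fun_prop

theorem diffSum_add_one (𝓜 : Finset ℕ) (Y : ℕ) (α : ℝ) :
    diffSum 𝓜 Y (α + 1) = diffSum 𝓜 Y α := trig_add_one _ _ _

theorem mem_diffBase {𝓜 : Finset ℕ} {Y : ℕ} {b : ℕ × ℕ} :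
    b ∈ diffBase 𝓜 Y ↔ b.1 ∈ 𝓜 ∧ 1 ≤ b.2 ∧ b.2 ≤ Y ∧ b.2 * b.1 ^ 4 < Y := by
  simp [diffBase]; tauto

theorem mem_diffIdx {𝓜 : Finset ℕ} {Y : ℕ} {t : Σ _ : ℕ × ℕ, ℕ} :
    t ∈ diffIdx 𝓜 Y ↔ t.1 ∈ diffBase 𝓜 Y ∧ 1 ≤ t.2 ∧ t.2 + t.1.2 * t.1.1 ^ 4 ≤ Y := by
  simp only [diffIdx, Finset.mem_sigma, Finset.mem_Icc]
  constructor
  · rintro ⟨h1, h2, h3⟩; exact ⟨h1, h2, by have := (mem_diffBase.1 h1).2.2.2; omega⟩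
  · rintro ⟨h1, h2, h3⟩; exact ⟨h1, h2, by omega⟩

theorem card_diffIdx_le (𝓜 : Finset ℕ) (Y : ℕ) :
    (diffIdx 𝓜 Y).card ≤ (diffBase 𝓜 Y).card * Y := by
  rw [diffIdx, Finset.card_sigma, ← smul_eq_mul]
  refine Finset.sum_le_card_nsmul _ _ _ fun b _ => ?_
  simp

theorem card_diffBase_le {𝓜 : Finset ℕ} {Y : ℕ} {M : ℝ} (hM : 0 < M)
    (h𝓜 : ∀ m ∈ 𝓜, M ≤ m) : ((diffBase 𝓜 Y).card : ℝ) ≤ 𝓜.card * (Y / M ^ 4) := by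
  classical
  have hsub : diffBase 𝓜 Y ⊆ 𝓜 ×ˢ Finset.Icc 1 ⌊(Y / M ^ 4 : ℝ)⌋₊ := by
    intro b hb
    obtain ⟨h1, h2, h3, h4⟩ := mem_diffBase.1 hb
    rw [Finset.mem_product, Finset.mem_Icc]
    refine ⟨h1, h2, Nat.le_floor ?_⟩
    rw [le_div_iff₀ (by positivity)]
    calc (b.2 : ℝ) * M ^ 4 ≤ (b.2 : ℝ) * (b.1 : ℝ) ^ 4 := by gcongr; exact h𝓜 _ h1
      _ ≤ (Y : ℝ) := by exact_mod_cast h4.le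
  refine (Nat.cast_le.2 (Finset.card_le_card hsub)).trans ?_
  rw [Finset.card_product, Nat.card_Icc, Nat.cast_mul]
  gcongr
  simp only [Nat.add_sub_cancel]
  exact Nat.floor_le (by positivity)

theorem diffPoly_mul (m k y : ℕ) :
    (m : ℤ) ^ 4 * diffPoly m k y = ((y + k * m ^ 4 : ℕ) : ℤ) ^ 4 - (y : ℤ) ^ 4 := by
  unfold diffPoly; push_cast; ring

theorem two_mul_diffPoly (m k y : ℕ) :
    2 * diffPoly m k y =
      k * (2 * y + k * m ^ 4) * ((2 * y + k * m ^ 4) ^ 2 + (k * m ^ 4) ^ 2) := by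
  unfold diffPoly; ring

theorem diffPoly_pos {m k y : ℕ} (hk : 0 < k) (hy : 0 < y) : 0 < diffPoly m k y := by
  unfold diffPoly; positivity

theorem diffPoly_le {m k y Y : ℕ} (hm : 0 < m) (hY : y + k * m ^ 4 ≤ Y) :
    diffPoly m k y ≤ (Y : ℤ) ^ 4 := by
  have h1 := diffPoly_mul m k y
  have h2 : (1 : ℤ) ≤ (m : ℤ) ^ 4 := by
    have : 0 < m ^ 4 := by positivity
    exact_mod_cast this
  have h3 : ((y + k * m ^ 4 : ℕ) : ℤ) ^ 4 ≤ (Y : ℤ) ^ 4 := by gcongr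
  have h4 : 0 ≤ diffPoly m k y := by unfold diffPoly; positivity
  have h5 : (0:ℤ) ≤ (y : ℤ) ^ 4 := by positivity
  nlinarith

theorem diffSum_eq_sum (𝓜 : Finset ℕ) (Y : ℕ) (α : ℝ) :
    diffSum 𝓜 Y α = ∑ b ∈ diffBase 𝓜 Y,
      trig (Finset.Icc 1 (Y - b.2 * b.1 ^ 4)) (fun y => diffPoly b.1 b.2 y) α := by
  simp only [diffSum, trig, diffIdx, Finset.sum_sigma]

theorem sum_diffSum_singleton (𝓜 : Finset ℕ) (Y : ℕ) (α : ℝ) :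
    ∑ m ∈ 𝓜, diffSum {m} Y α = diffSum 𝓜 Y α := by
  simp only [diffSum_eq_sum, diffBase, Finset.sum_filter, Finset.sum_product, Finset.sum_singleton]

theorem trig_mul_left {ι : Type*} (s : Finset ι) (n : ι → ℤ) (L : ℤ) (α : ℝ) :
    trig s n (L * α) = trig s (fun i => L * n i) α := by
  simp only [trig]; push_cast
  refine Finset.sum_congr rfl fun i _ => ?_
  ring_nf

theorem ofReal_two_mul_re (z : ℂ) : ((2 * z.re : ℝ) : ℂ) = z + (starRingEnd ℂ) z := by
  rw [Complex.add_conj]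

/-- The sum over residue classes modulo `m⁴` is majorised by the diagonal and the differenced
sum. -/
theorem dom_sum_classes {s : Finset ℕ} {Y m : ℕ} (hs : s ⊆ Finset.Icc 1 Y) (hm : 0 < m) :
    Dom (fun α => ((∑ k ∈ s.image (fun x : ℕ => ((x : ℕ) : ZMod (m ^ 4))),
        ‖trig (s.filter fun x : ℕ => ((x : ℕ) : ZMod (m ^ 4)) = k) (fun x => (x : ℤ) ^ 4) α‖ ^ 2 : ℝ) : ℂ))
      (fun α => ((Y + 2 * (diffSum {m} Y (((m : ℤ) ^ 4 : ℤ) * α)).re : ℝ) : ℂ)) := by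
  classical
  set P : Finset (ℕ × ℕ) := (s ×ˢ s).filter fun q => (q.1 : ZMod (m ^ 4)) = q.2 with hP
  set q : ℕ × ℕ → ℤ := fun x => (x.1 : ℤ) ^ 4 - (x.2 : ℤ) ^ 4 with hq
  have hL : 0 < m ^ 4 := by positivity
  have hmod : ∀ x ∈ P, x.1 ≡ x.2 [MOD m ^ 4] := fun x hx =>
    (ZMod.natCast_eq_natCast_iff _ _ _).1 (Finset.mem_filter.1 hx).2
  have hmem : ∀ x ∈ P, x.1 ∈ s ∧ x.2 ∈ s := fun x hx =>
    Finset.mem_product.1 (Finset.mem_filter.1 hx).1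
  have hF : ∀ α : ℝ, ((∑ k ∈ s.image (fun x : ℕ => ((x : ℕ) : ZMod (m ^ 4))),
        ‖trig (s.filter fun x : ℕ => ((x : ℕ) : ZMod (m ^ 4)) = k) (fun x => (x : ℤ) ^ 4) α‖ ^ 2 : ℝ) : ℂ)
      = (trig (P.filter fun x => x.1 = x.2) q α + trig (P.filter fun x => x.2 < x.1) q α) +
        (starRingEnd ℂ) (trig (P.filter fun x => x.2 < x.1) q α) := by
    intro α
    rw [Complex.ofReal_sum]
    simp only [norm_sq_trig]
    have h1 : ∀ k : ZMod (m ^ 4), (s.filter fun x : ℕ => ((x : ℕ) : ZMod (m ^ 4)) = k) ×ˢ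
        (s.filter fun x : ℕ => ((x : ℕ) : ZMod (m ^ 4)) = k) =
        P.filter fun x => (x.1 : ZMod (m ^ 4)) = k := by
      intro k; ext ⟨i, j⟩
      simp only [hP, Finset.mem_product, Finset.mem_filter]
      constructor
      · rintro ⟨⟨hi, rfl⟩, hj, h2⟩; exact ⟨⟨⟨hi, hj⟩, h2.symm⟩, rfl⟩
      · rintro ⟨⟨⟨hi, hj⟩, h2⟩, rfl⟩; exact ⟨⟨hi, rfl⟩, hj, h2.symm⟩
    simp only [h1]
    rw [Finset.sum_fiberwise_of_maps_to (g := fun x : ℕ × ℕ => (x.1 : ZMod (m ^ 4)))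
      (fun x hx => Finset.mem_image_of_mem _ (hmem x hx).1)]
    rw [trig_conj]
    have hswap : trig (P.filter fun x => x.2 < x.1) (fun i => - q i) α =
        trig (P.filter fun x => x.1 < x.2) q α := by
      simp only [trig]
      refine Finset.sum_nbij' Prod.swap Prod.swap ?_ ?_ ?_ ?_ ?_
      · rintro ⟨i, j⟩ hx; simp [hP] at hx ⊢; tauto
      · rintro ⟨i, j⟩ hx; simp [hP] at hx ⊢; tauto
      · intros; rfl
      · intros; rfl
      · rintro ⟨i, j⟩ _; simp [hq]
    rw [hswap]
    simp only [trig]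
    rw [← Finset.sum_union, ← Finset.sum_union]
    · refine Finset.sum_congr ?_ fun _ _ => rfl
      ext x; simp only [Finset.mem_union, Finset.mem_filter]
      have := lt_trichotomy x.1 x.2
      tauto
    · rw [Finset.disjoint_left]; intro x hx
      simp only [Finset.mem_union, Finset.mem_filter] at hx ⊢; omega
    · rw [Finset.disjoint_left]; intro x hx
      simp only [Finset.mem_filter] at hx ⊢; omega
  have hG : ∀ α : ℝ, ((Y + 2 * (diffSum {m} Y (((m : ℤ) ^ 4 : ℤ) * α)).re : ℝ) : ℂ) =
      (((Y:ℝ):ℂ) + trig (diffIdx {m} Y)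
        (fun t => (m : ℤ) ^ 4 * diffPoly t.1.1 t.1.2 t.2) α) + (starRingEnd ℂ)
        (trig (diffIdx {m} Y) (fun t => (m : ℤ) ^ 4 * diffPoly t.1.1 t.1.2 t.2) α) := by
    intro α
    rw [Complex.ofReal_add, ofReal_two_mul_re, diffSum, trig_mul_left]; push_cast; ring
  rw [funext hF, funext hG]
  have hd : Dom (trig (P.filter fun x => x.2 < x.1) q)
      (trig (diffIdx {m} Y) (fun t => (m : ℤ) ^ 4 * diffPoly t.1.1 t.1.2 t.2)) := by
    have hx' : ∀ x ∈ P.filter (fun x => x.2 < x.1), x.1 = x.2 + (x.1 - x.2) / m ^ 4 * m ^ 4 ∧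
        1 ≤ (x.1 - x.2) / m ^ 4 ∧ 1 ≤ x.2 ∧ x.1 ≤ Y := by
      intro x hx
      obtain ⟨hx1, hx2⟩ := Finset.mem_filter.1 hx
      have h1 : m ^ 4 ∣ x.1 - x.2 := (Nat.modEq_iff_dvd' hx2.le).1 (hmod x hx1).symm
      have h2 := Finset.mem_Icc.1 (hs (hmem x hx1).1)
      have h3 := Finset.mem_Icc.1 (hs (hmem x hx1).2)
      refine ⟨?_, ?_, h3.1, h2.2⟩
      · rw [Nat.div_mul_cancel h1]; omega
      · exact Nat.div_pos (Nat.le_of_dvd (by omega) h1) hL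
    refine Dom.trig_of_injOn _ _ _ _ (fun x => ⟨(m, (x.1 - x.2) / m ^ 4), x.2⟩) ?_ ?_ ?_
    · intro x hx
      obtain ⟨h1, h2, h3, h4⟩ := hx' x hx
      rw [mem_diffIdx, mem_diffBase]
      have h5 : (x.1 - x.2) / m ^ 4 ≤ (x.1 - x.2) / m ^ 4 * m ^ 4 := Nat.le_mul_of_pos_right _ hL
      refine ⟨⟨by simp, h2, ?_, ?_⟩, h3, ?_⟩ <;> dsimp only <;> omega
    · intro x hx x' hx' hxx
      rename_i hall
      have h1 := (hall x hx).1
      have h2 := (hall x' hx').1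
      simp only [Sigma.mk.injEq, Prod.mk.injEq, true_and, heq_eq_eq] at hxx
      rw [hxx.1, hxx.2, ← h2] at h1
      exact Prod.ext h1 hxx.2
    · intro x hx
      obtain ⟨h1, -⟩ := hx' x hx
      rw [diffPoly_mul, ← h1]
  refine (Dom.add (Dom.add ?_ hd) hd.conj)
  have h0 : trig (P.filter fun x => x.1 = x.2) q = fun _ => ((P.filter fun x => x.1 = x.2).card : ℂ) := by
    funext α
    simp only [trig]
    rw [Finset.sum_congr rfl (g := fun _ => 1)]
    · simp
    · intro x hx
      have := (Finset.mem_filter.1 hx).2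
      simp [hq, this, e_zero]
  rw [h0]
  apply Dom.const
  rw [Complex.norm_natCast]
  norm_cast
  refine (Finset.card_le_card_of_injOn (t := Finset.Icc 1 Y) (fun x => x.1) ?_ ?_).trans (by simp)
  · intro x hx
    exact hs (hmem x (Finset.mem_filter.1 hx).1).1
  · intro x hx x' hx' hxx
    have h1 := (Finset.mem_filter.1 hx).2
    have h2 := (Finset.mem_filter.1 hx').2
    exact Prod.ext hxx (by rw [← h1, ← h2]; exact hxx)

/-! ### Second and fourth moments of the differenced sum -/

theorem integral_norm_sq_trig_le {ι : Type*} (s : Finset ι) (n : ι → ℤ) {B : ℝ}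
    (hB : ∀ i ∈ s, ((s.filter fun j => n j = n i).card : ℝ) ≤ B) :
    ∫ α in (0:ℝ)..1, ‖trig s n α‖ ^ 2 ≤ s.card * B := by
  classical
  have h1 : ((∫ α in (0:ℝ)..1, ‖trig s n α‖ ^ 2 : ℝ) : ℂ) =
      (((s ×ˢ s).filter fun q => n q.1 - n q.2 = 0).card : ℂ) := by
    rw [← intervalIntegral.integral_ofReal]
    simp only [norm_sq_trig]
    exact integral_trig (s ×ˢ s) (fun q => n q.1 - n q.2)
  have h2 : (∫ α in (0:ℝ)..1, ‖trig s n α‖ ^ 2 : ℝ) =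
      (((s ×ˢ s).filter fun q => n q.1 - n q.2 = 0).card : ℝ) := by exact_mod_cast h1
  rw [h2]
  have h3 : ((s ×ˢ s).filter fun q => n q.1 - n q.2 = 0).card =
      ∑ i ∈ s, (s.filter fun j => n j = n i).card := by
    rw [Finset.card_filter, Finset.sum_product]
    refine Finset.sum_congr rfl fun i _ => ?_
    rw [Finset.card_filter]
    refine Finset.sum_congr rfl fun j _ => ?_
    have : n i - n j = 0 ↔ n j = n i := by omega
    simp only [this]
  rw [h3, Nat.cast_sum, ← nsmul_eq_mul]
  exact Finset.sum_le_card_nsmul _ _ _ hB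

/-- Weyl differencing as an identity. -/
theorem norm_sq_sum_e (f : ℕ → ℝ) {J Y : ℕ} (hJ : J ≤ Y) :
    ‖∑ y ∈ Finset.Icc 1 J, e (f y)‖ ^ 2 = J + 2 * (∑ l ∈ Finset.Icc 1 Y,
      ∑ y ∈ Finset.Icc 1 (J - l), e (f (y + l) - f y)).re := by
  classical
  rw [← Complex.ofReal_inj, Complex.ofReal_add, ofReal_two_mul_re]
  have hS : (∑ l ∈ Finset.Icc 1 Y, ∑ y ∈ Finset.Icc 1 (J - l), e (f (y + l) - f y)) =
      ∑ q ∈ (Finset.Icc 1 J ×ˢ Finset.Icc 1 J).filter (fun q => q.2 < q.1),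
        e (f q.1 - f q.2) := by
    rw [Finset.sum_sigma']
    refine Finset.sum_nbij' (fun t => (t.2 + t.1, t.2)) (fun q => ⟨q.1 - q.2, q.2⟩) ?_ ?_ ?_ ?_ ?_
    · rintro ⟨l, y⟩ ht; simp at ht ⊢; omega
    · rintro ⟨i, j⟩ hq; simp at hq ⊢; omega
    · rintro ⟨l, y⟩ ht; simp
    · rintro ⟨i, j⟩ hq; simp at hq ⊢; omega
    · rintro ⟨l, y⟩ ht; simp
  have hS' : (starRingEnd ℂ) (∑ q ∈ (Finset.Icc 1 J ×ˢ Finset.Icc 1 J).filter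
        (fun q => q.2 < q.1), e (f q.1 - f q.2)) =
      ∑ q ∈ (Finset.Icc 1 J ×ˢ Finset.Icc 1 J).filter (fun q => q.1 < q.2),
        e (f q.1 - f q.2) := by
    rw [map_sum]
    refine Finset.sum_nbij' Prod.swap Prod.swap ?_ ?_ ?_ ?_ ?_
    · rintro ⟨i, j⟩ hx; simp at hx ⊢; omega
    · rintro ⟨i, j⟩ hx; simp at hx ⊢; omega
    · intros; rfl
    · intros; rfl
    · rintro ⟨i, j⟩ _; simp [← e_neg]
  have hJ' : ((J : ℝ) : ℂ) = ∑ q ∈ (Finset.Icc 1 J ×ˢ Finset.Icc 1 J).filter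
      (fun q => q.1 = q.2), e (f q.1 - f q.2) := by
    rw [Finset.sum_congr rfl (g := fun _ => 1)]
    · have : (Finset.Icc 1 J ×ˢ Finset.Icc 1 J).filter (fun q => q.1 = q.2) =
          (Finset.Icc 1 J).diag := by
        ext ⟨i, j⟩; simp; omega
      rw [this]; simp
    · intro q hq; rw [(Finset.mem_filter.1 hq).2]; simp [e_zero]
  rw [hS, hS', hJ', ← Finset.sum_union, ← Finset.sum_union]
  · rw [Complex.ofReal_pow, ← Complex.mul_conj', map_sum, Finset.sum_mul_sum, ← Finset.sum_product']
    have : (((Finset.Icc 1 J ×ˢ Finset.Icc 1 J).filter (fun q => q.1 = q.2)) ∪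
        (((Finset.Icc 1 J ×ˢ Finset.Icc 1 J).filter (fun q => q.2 < q.1)) ∪
        ((Finset.Icc 1 J ×ˢ Finset.Icc 1 J).filter (fun q => q.1 < q.2)))) =
        Finset.Icc 1 J ×ˢ Finset.Icc 1 J := by
      ext x; simp only [Finset.mem_union, Finset.mem_filter]
      have := lt_trichotomy x.1 x.2
      tauto
    rw [this]
    refine Finset.sum_congr rfl fun q _ => ?_
    rw [← e_neg, ← e_add, sub_eq_add_neg]
  · rw [Finset.disjoint_left]; intro x hx
    simp only [Finset.mem_union, Finset.mem_filter] at hx ⊢; omega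
  · rw [Finset.disjoint_left]; intro x hx
    simp only [Finset.mem_filter] at hx ⊢; omega

/-- Index set of the twice differenced sum. -/
def diffIdx₂ (𝓜 : Finset ℕ) (Y : ℕ) : Finset (Σ _ : (ℕ × ℕ) × ℕ, ℕ) :=
  (diffBase 𝓜 Y ×ˢ Finset.Icc 1 Y).sigma fun b => Finset.Icc 1 (Y - b.1.2 * b.1.1 ^ 4 - b.2)

def diffPoly₂ (m k l y : ℕ) : ℤ := diffPoly m k (y + l) - diffPoly m k y

def diffSum₂ (𝓜 : Finset ℕ) (Y : ℕ) : ℝ → ℂ :=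
  trig (diffIdx₂ 𝓜 Y) fun t => diffPoly₂ t.1.1.1 t.1.1.2 t.1.2 t.2

@[fun_prop]
theorem continuous_diffSum₂ (𝓜 : Finset ℕ) (Y : ℕ) : Continuous (diffSum₂ 𝓜 Y) := by
  unfold diffSum₂; fun_prop

theorem card_diffIdx₂_le (𝓜 : Finset ℕ) (Y : ℕ) :
    (diffIdx₂ 𝓜 Y).card ≤ (diffBase 𝓜 Y).card * Y ^ 2 := by
  rw [diffIdx₂, Finset.card_sigma]
  refine (Finset.sum_le_card_nsmul _ _ Y fun b _ => ?_).trans ?_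
  · simp; omega
  · simp [Finset.card_product]; nlinarith

theorem mem_diffIdx₂ {𝓜 : Finset ℕ} {Y : ℕ} {t : Σ _ : (ℕ × ℕ) × ℕ, ℕ} (ht : t ∈ diffIdx₂ 𝓜 Y) :
    t.1.1 ∈ diffBase 𝓜 Y ∧ 1 ≤ t.1.2 ∧ 1 ≤ t.2 ∧ t.2 + t.1.2 + t.1.1.2 * t.1.1.1 ^ 4 ≤ Y := by
  simp only [diffIdx₂, Finset.mem_sigma, Finset.mem_Icc, Finset.mem_product] at ht
  obtain ⟨⟨h1, h2, -⟩, h3, h4⟩ := ht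
  exact ⟨h1, h2, h3, by omega⟩

theorem diffPoly₂_eq (m k l y : ℕ) :
    diffPoly₂ m k l y =
      k * l * (3 * (2 * y + k * m ^ 4 + l) ^ 2 + (l ^ 2 + (k * m ^ 4) ^ 2)) := by
  unfold diffPoly₂ diffPoly; push_cast; ring

theorem norm_diffSum_sq_le (𝓜 : Finset ℕ) (Y : ℕ) (α : ℝ) :
    ‖diffSum 𝓜 Y α‖ ^ 2 ≤ (diffBase 𝓜 Y).card *
      ((diffBase 𝓜 Y).card * Y + 2 * (diffSum₂ 𝓜 Y α).re) := by
  rw [diffSum_eq_sum]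
  refine (pow_le_pow_left₀ (norm_nonneg _) (norm_sum_le _ _) 2).trans ?_
  refine (sq_sum_le_card_mul_sum_sq).trans ?_
  gcongr
  have h1 : ∀ b ∈ diffBase 𝓜 Y,
      ‖trig (Finset.Icc 1 (Y - b.2 * b.1 ^ 4)) (fun y => diffPoly b.1 b.2 y) α‖ ^ 2 ≤
      Y + 2 * (∑ l ∈ Finset.Icc 1 Y, ∑ y ∈ Finset.Icc 1 (Y - b.2 * b.1 ^ 4 - l),
        e (diffPoly₂ b.1 b.2 l y * α)).re := by
    intro b _
    have := norm_sq_sum_e (fun y => diffPoly b.1 b.2 y * α) (Nat.sub_le Y (b.2 * b.1 ^ 4))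
    simp only [trig]
    rw [this]
    have h2 : ((Y - b.2 * b.1 ^ 4 : ℕ) : ℝ) ≤ Y := by exact_mod_cast Nat.sub_le _ _
    refine add_le_add h2 (le_of_eq ?_)
    simp only [diffPoly₂]
    push_cast
    simp only [sub_mul]
  refine (Finset.sum_le_sum h1).trans (le_of_eq ?_)
  rw [Finset.sum_add_distrib, ← Finset.mul_sum, ← Complex.re_sum, diffSum₂, trig, diffIdx₂,
    Finset.sum_sigma, Finset.sum_product]
  simp

theorem card_diffPoly_eq_le {𝓜 : Finset ℕ} {Y : ℕ} (h𝓜 : ∀ m ∈ 𝓜, 0 < m) {D : ℕ}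
    (hD : ∀ n : ℕ, n ≠ 0 → n ≤ 2 * Y ^ 4 → n.divisors.card ≤ D) (t : Σ _ : ℕ × ℕ, ℕ)
    (ht : t ∈ diffIdx 𝓜 Y) :
    ((diffIdx 𝓜 Y).filter fun u =>
      diffPoly u.1.1 u.1.2 u.2 = diffPoly t.1.1 t.1.2 t.2).card ≤ D ^ 2 := by
  classical
  obtain ⟨ht1, ht2, ht3⟩ := mem_diffIdx.1 ht
  obtain ⟨hb1, hb2, -, -⟩ := mem_diffBase.1 ht1
  set p := diffPoly t.1.1 t.1.2 t.2 with hp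
  have hp0 : 0 < p := diffPoly_pos hb2 ht2
  have hp1 : p ≤ (Y : ℤ) ^ 4 := diffPoly_le (h𝓜 _ hb1) ht3
  obtain ⟨n, hn⟩ : ∃ n : ℕ, (n : ℤ) = 2 * p := ⟨(2 * p).toNat, by omega⟩
  have hn0 : n ≠ 0 := by omega
  have hn1 : n ≤ 2 * Y ^ 4 := by zify; omega
  have hfac : ∀ u ∈ (diffIdx 𝓜 Y).filter (fun u => diffPoly u.1.1 u.1.2 u.2 = p),
      n = u.1.2 * (2 * u.2 + u.1.2 * u.1.1 ^ 4) *
        ((2 * u.2 + u.1.2 * u.1.1 ^ 4) ^ 2 + (u.1.2 * u.1.1 ^ 4) ^ 2) := by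
    intro u hu
    have := two_mul_diffPoly u.1.1 u.1.2 u.2
    rw [(Finset.mem_filter.1 hu).2, ← hn] at this
    exact_mod_cast this
  refine (Finset.card_le_card_of_injOn (t := n.divisors ×ˢ n.divisors)
    (fun u => (u.1.2, 2 * u.2 + u.1.2 * u.1.1 ^ 4)) ?_ ?_).trans ?_
  · intro u hu
    have hu' := hfac u hu
    simp only [Finset.coe_product, Set.mem_prod, Finset.mem_coe, Nat.mem_divisors]
    refine ⟨⟨⟨_, by rw [hu', mul_assoc]⟩, hn0⟩, ⟨_, by rw [hu', mul_comm u.1.2, mul_assoc]⟩, hn0⟩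
  · intro u hu v hv huv
    have hu' := hfac u hu
    have hv' := hfac v hv
    have hk : u.1.2 = v.1.2 := congrArg Prod.fst huv
    have hz : 2 * u.2 + u.1.2 * u.1.1 ^ 4 = 2 * v.2 + v.1.2 * v.1.1 ^ 4 := congrArg Prod.snd huv
    obtain ⟨hu1, hu2, -⟩ := mem_diffIdx.1 (Finset.mem_filter.1 hu).1
    obtain ⟨-, hu3, -⟩ := mem_diffBase.1 hu1
    rw [hz, hk] at hu'
    have h1 := hu'.symm.trans hv'
    have h2 : 0 < v.1.2 * (2 * v.2 + v.1.2 * v.1.1 ^ 4) := by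
      rw [← hz, ← hk]; positivity
    have h3 : (v.1.2 * u.1.1 ^ 4) ^ 2 = (v.1.2 * v.1.1 ^ 4) ^ 2 := by
      have := Nat.eq_of_mul_eq_mul_left h2 h1; omega
    have h4 : v.1.2 * u.1.1 ^ 4 = v.1.2 * v.1.1 ^ 4 := by
      exact Nat.pow_left_injective (n := 2) (by norm_num) h3
    have h5 : u.1.1 ^ 4 = v.1.1 ^ 4 := Nat.eq_of_mul_eq_mul_left (by omega) h4
    have h6 : u.1.1 = v.1.1 := Nat.pow_left_injective (n := 4) (by norm_num) h5
    have h7 : u.2 = v.2 := by rw [hk, h4] at hz; omega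
    obtain ⟨⟨a, b⟩, c⟩ := u
    obtain ⟨⟨a', b'⟩, c'⟩ := v
    simp_all
  · rw [Finset.card_product, ← sq]
    exact Nat.pow_le_pow_left (hD n hn0 hn1) 2

theorem integral_norm_diffSum_sq_le {𝓜 : Finset ℕ} {Y : ℕ} (h𝓜 : ∀ m ∈ 𝓜, 0 < m) {D : ℕ}
    (hD : ∀ n : ℕ, n ≠ 0 → n ≤ 2 * Y ^ 4 → n.divisors.card ≤ D) :
    ∫ α in (0:ℝ)..1, ‖diffSum 𝓜 Y α‖ ^ 2 ≤ (diffBase 𝓜 Y).card * Y * D ^ 2 := by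
  refine (integral_norm_sq_trig_le _ _ (B := (D:ℝ) ^ 2) ?_).trans ?_
  · intro t ht
    exact_mod_cast card_diffPoly_eq_le h𝓜 hD t ht
  · gcongr
    exact_mod_cast card_diffIdx_le 𝓜 Y

theorem card_diffPoly₂_eq_le {𝓜 : Finset ℕ} {Y : ℕ} (h𝓜 : ∀ m ∈ 𝓜, 0 < m) {D : ℕ}
    (hD : ∀ n : ℕ, n ≠ 0 → n ≤ 2 * Y ^ 4 → n.divisors.card ≤ D) (t : Σ _ : (ℕ × ℕ) × ℕ, ℕ)
    (ht : t ∈ diffIdx₂ 𝓜 Y) :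
    ((diffIdx₂ 𝓜 Y).filter fun u =>
      diffPoly₂ u.1.1.1 u.1.1.2 u.1.2 u.2 = diffPoly₂ t.1.1.1 t.1.1.2 t.1.2 t.2).card ≤
      12 * D ^ 5 := by
  classical
  obtain ⟨ht1, ht2, ht3, ht4⟩ := mem_diffIdx₂ ht
  obtain ⟨hb1, hb2, -, -⟩ := mem_diffBase.1 ht1
  set p := diffPoly₂ t.1.1.1 t.1.1.2 t.1.2 t.2 with hp
  have hp0 : 0 < p := by rw [hp, diffPoly₂_eq]; positivity
  have hp1 : p ≤ (Y : ℤ) ^ 4 := by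
    have h1 := diffPoly_le (y := t.2 + t.1.2) (h𝓜 _ hb1) ht4
    have h2 := diffPoly_pos (m := t.1.1.1) hb2 ht3
    rw [hp, diffPoly₂]; omega
  obtain ⟨n, hn⟩ : ∃ n : ℕ, (n : ℤ) = p := ⟨p.toNat, by omega⟩
  have hn0 : n ≠ 0 := by omega
  have hn1 : n ≤ 2 * Y ^ 4 := by zify; omega
  set U := (diffIdx₂ 𝓜 Y).filter (fun u => diffPoly₂ u.1.1.1 u.1.1.2 u.1.2 u.2 = p) with hU
  have hfac : ∀ u ∈ U, n = u.1.1.2 * u.1.2 * (3 * (2 * u.2 + u.1.1.2 * u.1.1.1 ^ 4 + u.1.2) ^ 2 +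
        (u.1.2 ^ 2 + (u.1.1.2 * u.1.1.1 ^ 4) ^ 2)) := by
    intro u hu
    have := diffPoly₂_eq u.1.1.1 u.1.1.2 u.1.2 u.2
    rw [(Finset.mem_filter.1 hu).2, ← hn] at this
    exact_mod_cast this
  have hpos : ∀ u ∈ U, 0 < u.1.1.1 ∧ 0 < u.1.1.2 ∧ 0 < u.1.2 ∧ 0 < u.2 := by
    intro u hu
    obtain ⟨h1, h2, h3, h4⟩ := mem_diffIdx₂ (Finset.mem_filter.1 hu).1
    obtain ⟨h5, h6, -, -⟩ := mem_diffBase.1 h1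
    exact ⟨h𝓜 _ h5, h6, h2, h3⟩
  have hmap : ∀ u ∈ U, (u.1.1.2, u.1.2) ∈ n.divisors ×ˢ n.divisors := by
    intro u hu
    have hu' := hfac u hu
    rw [Finset.mem_product, Nat.mem_divisors, Nat.mem_divisors]
    exact ⟨⟨⟨_, by rw [hu', mul_assoc]⟩, hn0⟩, ⟨_, by rw [hu', mul_comm u.1.1.2, mul_assoc]⟩, hn0⟩
  have hfib : ∀ q ∈ n.divisors ×ˢ n.divisors,
      (U.filter fun u => (u.1.1.2, u.1.2) = q).card ≤ 12 * D ^ 3 := by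
    rintro ⟨k, l⟩ hkl
    rcases (U.filter fun u => (u.1.1.2, u.1.2) = (k, l)).eq_empty_or_nonempty with h0 | ⟨v, hv⟩
    · rw [h0]; simp
    obtain ⟨hvU, hv2⟩ := Finset.mem_filter.1 hv
    set N := 3 * (2 * v.2 + v.1.1.2 * v.1.1.1 ^ 4 + v.1.2) ^ 2 +
        (v.1.1.2 * v.1.1.1 ^ 4) ^ 2 with hN
    have hkpos : 0 < k * l := by
      obtain ⟨-, h1, h2, -⟩ := hpos v hvU
      simp only [Prod.mk.injEq] at hv2
      rw [← hv2.1, ← hv2.2]; positivity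
    have hNn : k * l * (N + l ^ 2) = n := by
      have := hfac v hvU
      simp only [Prod.mk.injEq] at hv2
      rw [this, hN, hv2.1, hv2.2]; ring
    have hN0 : N ≠ 0 := by
      obtain ⟨h1, h2, h3, h4⟩ := hpos v hvU
      positivity
    have hN1 : N ≤ 2 * Y ^ 4 := by
      refine le_trans ?_ hn1
      rw [← hNn]; nlinarith
    calc (U.filter fun u => (u.1.1.2, u.1.2) = (k, l)).card
        = ((U.filter fun u => (u.1.1.2, u.1.2) = (k, l)).image fun u =>
          (2 * u.2 + u.1.1.2 * u.1.1.1 ^ 4 + u.1.2, u.1.1.2 * u.1.1.1 ^ 4)).card := by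
          rw [Finset.card_image_of_injOn]
          intro u hu w hw huw
          obtain ⟨huU, hu2⟩ := Finset.mem_filter.1 hu
          obtain ⟨hwU, hw2⟩ := Finset.mem_filter.1 hw
          simp only [Prod.mk.injEq] at huw hu2 hw2
          have hk0 := (hpos u huU).2.1
          have h4 : k * u.1.1.1 ^ 4 = k * w.1.1.1 ^ 4 := by
            have := huw.2; rwa [hu2.1, hw2.1] at this
          have h5 : u.1.1.1 ^ 4 = w.1.1.1 ^ 4 := Nat.eq_of_mul_eq_mul_left (by omega) h4
          have h6 : u.1.1.1 = w.1.1.1 := Nat.pow_left_injective (n := 4) (by norm_num) h5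
          have h7 : u.2 = w.2 := by omega
          have h8 := hu2.1.trans hw2.1.symm
          have h9 := hu2.2.trans hw2.2.symm
          obtain ⟨⟨⟨a, b⟩, c⟩, d⟩ := u
          obtain ⟨⟨⟨a', b'⟩, c'⟩, d'⟩ := w
          simp only at h6 h7 h8 h9
          subst h6 h7 h8 h9; rfl
      _ ≤ 12 * N.divisors.card ^ 3 := by
          refine card_rep_le N _ fun x hx => ?_
          obtain ⟨u, hu, rfl⟩ := Finset.mem_image.1 hx
          obtain ⟨huU, hu2⟩ := Finset.mem_filter.1 hu
          simp only [Prod.mk.injEq] at hu2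
          obtain ⟨h1, h2, h3, h4⟩ := hpos u huU
          refine ⟨by positivity, by positivity, ?_⟩
          have := hfac u huU
          rw [hu2.1, hu2.2, ← hNn] at this
          have := Nat.eq_of_mul_eq_mul_left hkpos this
          rw [hu2.1, hu2.2]
          dsimp only
          omega
      _ ≤ 12 * D ^ 3 := by gcongr; exact hD N hN0 hN1
  rw [Finset.card_eq_sum_card_fiberwise (f := fun u : (Σ _ : (ℕ × ℕ) × ℕ, ℕ) => (u.1.1.2, u.1.2))
    (t := n.divisors ×ˢ n.divisors) fun u hu => hmap u hu]
  refine (Finset.sum_le_card_nsmul _ _ _ hfib).trans ?_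
  rw [Finset.card_product, smul_eq_mul]
  have := hD n hn0 hn1
  calc _ ≤ D * D * (12 * D ^ 3) := by gcongr
    _ = _ := by ring

theorem integral_norm_diffSum_pow_four_le {𝓜 : Finset ℕ} {Y : ℕ} (h𝓜 : ∀ m ∈ 𝓜, 0 < m) {D : ℕ}
    (hD0 : 1 ≤ D) (hD : ∀ n : ℕ, n ≠ 0 → n ≤ 2 * Y ^ 4 → n.divisors.card ≤ D) :
    ∫ α in (0:ℝ)..1, ‖diffSum 𝓜 Y α‖ ^ 4 ≤
      50 * ((diffBase 𝓜 Y).card ^ 3 * Y ^ 2 * D ^ 5) := by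
  set B : ℝ := ((diffBase 𝓜 Y).card : ℝ) with hB
  have hB0 : 0 ≤ B := by positivity
  have h2 : ∫ α in (0:ℝ)..1, ‖diffSum₂ 𝓜 Y α‖ ^ 2 ≤ B * Y ^ 2 * (12 * D ^ 5) := by
    refine (integral_norm_sq_trig_le _ _ (B := 12 * (D:ℝ) ^ 5) ?_).trans ?_
    · intro t ht
      exact_mod_cast card_diffPoly₂_eq_le h𝓜 hD t ht
    · gcongr
      rw [hB]; exact_mod_cast card_diffIdx₂_le 𝓜 Y
  have h1 := integral_norm_diffSum_sq_le h𝓜 hD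
  have hpt : ∀ α, ‖diffSum 𝓜 Y α‖ ^ 4 ≤ 2 * (B ^ 2 * Y) * ‖diffSum 𝓜 Y α‖ ^ 2 +
      4 * B ^ 2 * ‖diffSum₂ 𝓜 Y α‖ ^ 2 := by
    intro α
    have h3 := norm_diffSum_sq_le 𝓜 Y α
    have h4 : (diffSum₂ 𝓜 Y α).re ≤ ‖diffSum₂ 𝓜 Y α‖ := Complex.re_le_norm _
    have h5 := norm_nonneg (diffSum₂ 𝓜 Y α)
    set x := ‖diffSum 𝓜 Y α‖ ^ 2 with hx
    have hx0 : 0 ≤ x := by positivity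
    have h6 : x ≤ B ^ 2 * Y + 2 * B * ‖diffSum₂ 𝓜 Y α‖ := by
      refine h3.trans ?_
      nlinarith
    have h7 : ‖diffSum 𝓜 Y α‖ ^ 4 = x * x := by rw [hx]; ring
    rw [h7]
    nlinarith [sq_nonneg (x - 2 * B * ‖diffSum₂ 𝓜 Y α‖), mul_le_mul_of_nonneg_left h6 hx0]
  have hD1 : (1:ℝ) ≤ D := by exact_mod_cast hD0
  calc ∫ α in (0:ℝ)..1, ‖diffSum 𝓜 Y α‖ ^ 4
      ≤ ∫ α in (0:ℝ)..1, (2 * (B ^ 2 * Y) * ‖diffSum 𝓜 Y α‖ ^ 2 +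
      4 * B ^ 2 * ‖diffSum₂ 𝓜 Y α‖ ^ 2) :=
        intervalIntegral.integral_mono_on (by norm_num)
          (Continuous.intervalIntegrable (by fun_prop) _ _)
          (Continuous.intervalIntegrable (by fun_prop) _ _) fun α _ => hpt α
    _ = 2 * (B ^ 2 * Y) * (∫ α in (0:ℝ)..1, ‖diffSum 𝓜 Y α‖ ^ 2) +
        4 * B ^ 2 * ∫ α in (0:ℝ)..1, ‖diffSum₂ 𝓜 Y α‖ ^ 2 := by
        rw [intervalIntegral.integral_add
          (Continuous.intervalIntegrable (by fun_prop) _ _)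
          (Continuous.intervalIntegrable (by fun_prop) _ _),
          intervalIntegral.integral_const_mul, intervalIntegral.integral_const_mul]
    _ ≤ 2 * (B ^ 2 * Y) * (B * Y * D ^ 2) + 4 * B ^ 2 * (B * Y ^ 2 * (12 * D ^ 5)) := by gcongr
    _ = 2 * (B ^ 3 * Y ^ 2 * D ^ 2) + 48 * (B ^ 3 * Y ^ 2 * D ^ 5) := by ring
    _ ≤ 2 * (B ^ 3 * Y ^ 2 * D ^ 5) + 48 * (B ^ 3 * Y ^ 2 * D ^ 5) := by
        gcongr
        norm_num
    _ = _ := by ring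

/-! ### Smooth sums and their moments -/

/-- `R`-smooth positive integers up to `N`. -/
def smoothUpTo (N R : ℕ) : Finset ℕ :=
  (Finset.Icc 1 N).filter fun n => ∀ p ∈ n.primeFactors, p ≤ R

/-- The smooth Weyl sum with integral parameters. -/
def smoothSum (N R : ℕ) : ℝ → ℂ := trig (smoothUpTo N R) fun x => (x : ℤ) ^ 4

/-- Moments of the smooth Weyl sum. -/
def moment (k N R : ℕ) : ℝ := ∫ α in (0:ℝ)..1, ‖smoothSum N R α‖ ^ k

@[fun_prop]
theorem continuous_smoothSum (N R : ℕ) : Continuous (smoothSum N R) := by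
  unfold smoothSum; fun_prop

theorem smoothSum_add_one (N R : ℕ) (α : ℝ) : smoothSum N R (α + 1) = smoothSum N R α :=
  trig_add_one _ _ _

theorem smoothSum_add_int (N R : ℕ) (α : ℝ) (n : ℤ) : smoothSum N R (α + n) = smoothSum N R α := by
  have : Function.Periodic (smoothSum N R) 1 := smoothSum_add_one N R
  simpa using this.int_mul n α

theorem moment_nonneg (k N R : ℕ) : 0 ≤ moment k N R :=
  intervalIntegral.integral_nonneg (by norm_num) fun _ _ => by positivity

theorem mem_smoothUpTo {N R x : ℕ} :
    x ∈ smoothUpTo N R ↔ 1 ≤ x ∧ x ≤ N ∧ ∀ p ∈ x.primeFactors, p ≤ R := by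
  simp [smoothUpTo, and_assoc]

theorem norm_smoothSum_le (N R : ℕ) (α : ℝ) : ‖smoothSum N R α‖ ≤ N := by
  refine (norm_trig_le _ _ _).trans ?_
  exact_mod_cast (Finset.card_filter_le _ _).trans (by simp)

theorem div_mem_smoothUpTo {N R x d : ℕ} (hx : x ∈ smoothUpTo N R) (hd : d ∣ x) :
    x / d ∈ smoothUpTo (N / d) R := by
  rw [mem_smoothUpTo] at hx ⊢
  have hd0 : 0 < d := Nat.pos_of_dvd_of_pos hd (by omega)
  refine ⟨Nat.div_pos (Nat.le_of_dvd (by omega) hd) hd0, Nat.div_le_div_right hx.2.1, ?_⟩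
  intro p hp
  exact hx.2.2 p (Nat.primeFactors_mono (Nat.div_dvd_of_dvd hd) (by omega) hp)

theorem exists_dvd_of_smooth {y M R : ℕ} (hM : 1 ≤ M) (hy : M < y)
    (hs : ∀ p ∈ y.primeFactors, p ≤ R) : ∃ m, m ∣ y ∧ M < m ∧ m ≤ M * R := by
  classical
  have hex : ∃ m, m ∣ y ∧ M < m := ⟨y, dvd_rfl, hy⟩
  refine ⟨Nat.find hex, (Nat.find_spec hex).1, (Nat.find_spec hex).2, ?_⟩
  set m := Nat.find hex with hm
  obtain ⟨h1, h2⟩ := Nat.find_spec hex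
  rw [← hm] at h1 h2
  obtain ⟨p, hp, hpm⟩ := Nat.exists_prime_and_dvd (n := m) (by omega)
  have hpR : p ≤ R := hs p (Nat.mem_primeFactors.2 ⟨hp, hpm.trans h1, by omega⟩)
  have h3 : ¬ (m / p ∣ y ∧ M < m / p) :=
    Nat.find_min hex (Nat.div_lt_self (by omega) hp.one_lt)
  have h4 : m / p ≤ M := by
    by_contra h
    exact h3 ⟨(Nat.div_dvd_of_dvd hpm).trans h1, by omega⟩
  calc m = m / p * p := (Nat.div_mul_cancel hpm).symm
    _ ≤ M * R := by gcongr

theorem Dom.refl_trig {ι : Type} (s : Finset ι) (n : ι → ℤ) : Dom (trig s n) (trig s n) :=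
  Dom.trig_subset (Finset.Subset.refl s) n

theorem smoothSum_mul_left (N R : ℕ) (L : ℤ) (α : ℝ) :
    smoothSum N R (L * α) = trig (smoothUpTo N R) (fun x => L * (x : ℤ) ^ 4) α := trig_mul_left _ _ _ _

theorem smoothUpTo_mono {N N' R : ℕ} (hN : N ≤ N') : smoothUpTo N R ⊆ smoothUpTo N' R := by
  intro x hx
  rw [mem_smoothUpTo] at hx ⊢
  exact ⟨hx.1, hx.2.1.trans hN, hx.2.2⟩

theorem dom_of_dvd {N Q R d : ℕ} (hQ : N / d ≤ Q) {s : Finset ℕ} (hs : s ⊆ smoothUpTo N R)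
    (hd : ∀ x ∈ s, d ∣ x) :
    Dom (trig s fun x => (x : ℤ) ^ 4)
      (fun α => smoothSum Q R (((d : ℤ) ^ 4 : ℤ) * α)) := by
  have : (fun α : ℝ => smoothSum Q R (((d : ℤ) ^ 4 : ℤ) * α)) =
      trig (smoothUpTo Q R) (fun x => (d : ℤ) ^ 4 * (x : ℤ) ^ 4) := by
    funext α; rw [smoothSum_mul_left]
  rw [this]
  refine Dom.trig_of_injOn _ _ _ _ (fun x => x / d)
    (fun x hx => smoothUpTo_mono hQ (div_mem_smoothUpTo (hs hx) (hd x hx))) ?_ ?_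
  · intro x hx y hy hxy
    rw [← Nat.div_mul_cancel (hd x hx), ← Nat.div_mul_cancel (hd y hy)]
    exact congrArg (· * d) hxy
  · intro x hx
    have : (x : ℤ) = d * ((x / d : ℕ) : ℤ) := by
      exact_mod_cast (Nat.mul_div_cancel' (hd x hx)).symm
    rw [this, mul_pow]

theorem integral_norm_pow_dvd_le {N R d : ℕ} (hd0 : d ≠ 0) {s : Finset ℕ}
    (hs : s ⊆ smoothUpTo N R) (hd : ∀ x ∈ s, d ∣ x) (k : ℕ) :
    ∫ α in (0:ℝ)..1, ‖trig s (fun x => (x : ℤ) ^ 4) α‖ ^ (2 * k) ≤ moment (2 * k) (N / d) R := by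
  refine ((dom_of_dvd le_rfl hs hd).norm_pow k).integral_le.trans (le_of_eq ?_)
  exact integral_comp_int_mul (G := fun α => ‖smoothSum (N / d) R α‖ ^ (2 * k))
    (fun x => by simp only [smoothSum_add_one]) (by fun_prop) (by positivity)

theorem integral_norm_pow_subset_le {N R : ℕ} {s : Finset ℕ}
    (hs : s ⊆ smoothUpTo N R) (k : ℕ) :
    ∫ α in (0:ℝ)..1, ‖trig s (fun x => (x : ℤ) ^ 4) α‖ ^ (2 * k) ≤ moment (2 * k) N R :=
  ((Dom.trig_subset hs _).norm_pow k).integral_le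

theorem interval_holder₂ {f g : ℝ → ℝ} (hf : Continuous f) (hg : Continuous g)
    (hf0 : ∀ x, 0 ≤ f x) (hg0 : ∀ x, 0 ≤ g x)
    {a b : ℝ} (ha : 0 ≤ a) (hb : 0 ≤ b) (hab : a + b = 1) :
    ∫ x in (0:ℝ)..1, f x ^ a * g x ^ b ≤
      (∫ x in (0:ℝ)..1, f x) ^ a * (∫ x in (0:ℝ)..1, g x) ^ b := by
  simp only [intervalIntegral.integral_of_le (zero_le_one (α := ℝ))]
  exact integral_rpow_mul_rpow_le _ (hf.intervalIntegrable 0 1).1 (hg.intervalIntegrable 0 1).1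
    hf0 hg0 ha hb hab

theorem interval_holder₃ {f g k : ℝ → ℝ} (hf : Continuous f) (hg : Continuous g)
    (hk : Continuous k) (hf0 : ∀ x, 0 ≤ f x) (hg0 : ∀ x, 0 ≤ g x) (hk0 : ∀ x, 0 ≤ k x)
    {a b c : ℝ} (ha : 0 ≤ a) (hb : 0 ≤ b) (hc : 0 ≤ c) (habc : a + b + c = 1) :
    ∫ x in (0:ℝ)..1, f x ^ a * g x ^ b * k x ^ c ≤
      (∫ x in (0:ℝ)..1, f x) ^ a * (∫ x in (0:ℝ)..1, g x) ^ b * (∫ x in (0:ℝ)..1, k x) ^ c := by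
  simp only [intervalIntegral.integral_of_le (zero_le_one (α := ℝ))]
  exact integral_rpow_mul_rpow_mul_rpow_le _ (hf.intervalIntegrable 0 1).1
    (hg.intervalIntegrable 0 1).1 (hk.intervalIntegrable 0 1).1 hf0 hg0 hk0 ha hb hc habc

theorem rpow_natCast_mul {x : ℝ} (hx : 0 ≤ x) (n : ℕ) (a : ℝ) : (x ^ n) ^ a = x ^ (n * a) := by
  rw [← Real.rpow_natCast, ← Real.rpow_mul hx]

/-! ### The congruence count for one pair `(d, m)` -/

theorem diffSum_mono_dom {𝓜 : Finset ℕ} {Y Y' : ℕ} (hY : Y ≤ Y') :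
    Dom (diffSum 𝓜 Y) (diffSum 𝓜 Y') := by
  refine Dom.trig_subset (fun t ht => ?_) _
  rw [mem_diffIdx, mem_diffBase] at ht ⊢
  obtain ⟨⟨h1, h2, h3, h4⟩, h5, h6⟩ := ht
  exact ⟨⟨h1, h2, by omega, by omega⟩, h5, by omega⟩

theorem Dom.add_two_re {F G : ℝ → ℂ} (hd : Dom F G) {a b : ℝ} (hab : |a| ≤ b) :
    Dom (fun α => ((a + 2 * (F α).re : ℝ) : ℂ)) (fun α => ((b + 2 * (G α).re : ℝ) : ℂ)) := by
  have h1 := (Dom.const (a := (a:ℂ)) (b := b) (by simpa using hab)).add (hd.add hd.conj)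
  have h2 : ∀ (F : ℝ → ℂ) (a : ℝ), (fun α => ((a + 2 * (F α).re : ℝ) : ℂ)) =
      fun α => (a : ℂ) + (F α + (starRingEnd ℂ) (F α)) := by
    intro F a; funext α; rw [Complex.ofReal_add, ofReal_two_mul_re]
  rw [h2, h2]; exact h1

theorem Dom.comp_int_mul {F G : ℝ → ℂ} (hd : Dom F G) (L : ℤ) :
    Dom (fun α => F (L * α)) (fun α => G (L * α)) := by
  obtain ⟨ι, s, n, a, b, hab, hF, hG⟩ := hd
  refine ⟨ι, s, fun i => n i * L, a, b, hab, fun α => ?_, fun α => ?_⟩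
  · dsimp only; rw [hF]; push_cast; simp only [mul_assoc]
  · dsimp only; rw [hG]; push_cast; simp only [mul_assoc]

/-- Majorant for the contribution of a modulus `m`. -/
def classIntegral (k m N Q R : ℕ) : ℝ :=
  ∫ α in (0:ℝ)..1, (N + 2 * (diffSum {m} N α).re) * ‖smoothSum Q R α‖ ^ (2 * k)

theorem dom_smoothSum_pow (Q R k : ℕ) : Dom (fun α => ((‖smoothSum Q R α‖ ^ (2 * k) : ℝ) : ℂ))
    (fun α => ((‖smoothSum Q R α‖ ^ (2 * k) : ℝ) : ℂ)) := (Dom.refl_trig _ _).norm_pow k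

theorem Dom.zero_left {F G : ℝ → ℂ} (hd : Dom F G) : Dom (fun _ => 0) G := by
  have := (Dom.const (a := 0) (b := 1) (by simp)).mul hd
  simpa using this

theorem classIntegral_nonneg (k m N Q R : ℕ) : 0 ≤ classIntegral k m N Q R := by
  have h1 := ((diffSum_mono_dom (𝓜 := {m}) (le_refl N)).add_two_re
    (a := N) (b := N) (by simp)).mul_real (dom_smoothSum_pow Q R k)
  have := h1.zero_left.norm_integral_le
  simpa [classIntegral] using this

theorem integral_class_le {k m N Y Q R D : ℕ} (hm : 0 < m) (hY : Y ≤ N)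
    (hD : (m ^ 4).divisors.card ≤ D)
    {s : Finset ℕ} (hs : s ⊆ Finset.Icc 1 Y) (hcop : ∀ x ∈ s, Nat.Coprime x m) :
    ∫ α in (0:ℝ)..1, ‖trig s (fun x => (x : ℤ) ^ 4) α‖ ^ 2 *
      ‖smoothSum Q R (((m : ℤ) ^ 4 : ℤ) * α)‖ ^ (2 * k) ≤ 4 * D ^ 4 * classIntegral k m N Q R := by
  classical
  have hL : 0 < m ^ 4 := by positivity
  have : NeZero (m ^ 4) := ⟨hL.ne'⟩
  have hper : ∀ x, ‖smoothSum Q R (x + 1)‖ ^ (2 * k) = ‖smoothSum Q R x‖ ^ (2 * k) :=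
    fun x => by simp only [smoothSum_add_one]
  have h1 := integral_norm_sq_trig_mul_le s (fun x => (x : ℤ) ^ 4)
    (G := fun α => ‖smoothSum Q R α‖ ^ (2 * k)) hper (by fun_prop) (fun _ => by positivity)
    (L := m ^ 4) (fun x : ℕ => ((x : ℕ) : ZMod (m ^ 4))) (fun x _ => by push_cast; rfl)
    (4 * (D : ℝ) ^ 4) (by
      intro c
      have := card_fourth_root_zmod_le
        ((s.image fun x : ℕ => ((x : ℕ) : ZMod (m ^ 4))).filter fun k => k ^ 4 = c) c
        (fun z hz => (Finset.mem_filter.1 hz).2) (by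
          intro z hz
          obtain ⟨x, hx, rfl⟩ := Finset.mem_image.1 (Finset.mem_filter.1 hz).1
          exact (ZMod.isUnit_iff_coprime _ _).2 (Nat.Coprime.pow_right 4 (hcop x hx)))
      refine (Nat.cast_le.2 this).trans ?_
      push_cast
      gcongr)
  have hcast : ((m ^ 4 : ℕ) : ℝ) = (((m : ℤ) ^ 4 : ℤ) : ℝ) := by push_cast; rfl
  rw [hcast] at h1
  refine h1.trans ?_
  gcongr
  have h2 := (dom_sum_classes hs hm).mul_real
    ((dom_smoothSum_pow Q R k).comp_int_mul ((m : ℤ) ^ 4))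
  refine h2.integral_le.trans ?_
  have h3 := integral_comp_int_mul
    (G := fun α => (Y + 2 * (diffSum {m} Y α).re) * ‖smoothSum Q R α‖ ^ (2 * k))
    (fun x => by simp only [smoothSum_add_one, diffSum_add_one])
    (by fun_prop) (L := (m : ℤ) ^ 4) (by positivity)
  rw [h3]
  exact (((diffSum_mono_dom hY).add_two_re (a := Y) (b := N)
    (by rw [abs_of_nonneg (by positivity)]; exact_mod_cast hY)).mul_real
    (dom_smoothSum_pow Q R k)).integral_le

theorem integral_pair_le {k d m N M Q R D : ℕ} (hd : 0 < d) (hm : 0 < m) (hmM : M ≤ d * m)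
    (hM : 0 < M) (hQ : Q = N / M) (hD : (m ^ 4).divisors.card ≤ D) {s t : Finset ℕ}
    (hs : s ⊆ smoothUpTo N R) (ht : t ⊆ smoothUpTo N R) (hs' : ∀ x ∈ s, Nat.gcd x (d * m) = d)
    (ht' : ∀ y ∈ t, d * m ∣ y) :
    ∫ α in (0:ℝ)..1, ‖trig s (fun x => (x : ℤ) ^ 4) α‖ ^ 2 *
      ‖trig t (fun x => (x : ℤ) ^ 4) α‖ ^ (2 * k) ≤ 4 * D ^ 4 * classIntegral k m N Q R := by
  classical
  have hdx : ∀ x ∈ s, d ∣ x := fun x hx => (hs' x hx) ▸ Nat.gcd_dvd_left x (d * m)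
  have hQ' : N / (d * m) ≤ Q := by rw [hQ]; exact Nat.div_le_div_left hmM hM
  have h1 := (((Dom.refl_trig s fun x => (x : ℤ) ^ 4).norm_sq).mul_real
    ((dom_of_dvd hQ' ht ht').norm_pow k)).integral_le
  refine h1.trans ?_
  have h2 : ∀ α : ℝ, trig s (fun x => (x : ℤ) ^ 4) α =
      trig (s.image fun x => x / d) (fun x => (x : ℤ) ^ 4) (((d : ℤ) ^ 4 : ℤ) * α) := by
    intro α
    rw [trig_mul_left]
    simp only [trig]
    rw [Finset.sum_image]
    · refine Finset.sum_congr rfl fun x hx => ?_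
      have : (x : ℤ) = d * ((x / d : ℕ) : ℤ) := by
        exact_mod_cast (Nat.mul_div_cancel' (hdx x hx)).symm
      rw [← mul_pow, ← this]
    · intro x hx y hy hxy
      rw [← Nat.div_mul_cancel (hdx x hx), ← Nat.div_mul_cancel (hdx y hy)]
      exact congrArg (· * d) hxy
  have h3 : ∀ α : ℝ, ((((d * m : ℕ) : ℤ) ^ 4 : ℤ) : ℝ) * α =
      (((m : ℤ) ^ 4 : ℤ) : ℝ) * ((((d : ℤ) ^ 4 : ℤ) : ℝ) * α) := by
    intro α; push_cast; ring
  simp only [h2, h3]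
  rw [integral_comp_int_mul (G := fun α =>
    ‖trig (s.image fun x => x / d) (fun x => (x : ℤ) ^ 4) α‖ ^ 2 *
      ‖smoothSum Q R (((m : ℤ) ^ 4 : ℤ) * α)‖ ^ (2 * k)) _ (by fun_prop)
      (L := (d : ℤ) ^ 4) (by positivity)]
  · refine integral_class_le (Y := N / d) hm (Nat.div_le_self _ _) hD ?_ ?_
    · intro x' hx'
      obtain ⟨x, hx, rfl⟩ := Finset.mem_image.1 hx'
      have := mem_smoothUpTo.1 (div_mem_smoothUpTo (hs hx) (hdx x hx))
      exact Finset.mem_Icc.2 ⟨this.1, this.2.1⟩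
    · intro x' hx'
      obtain ⟨x, hx, rfl⟩ := Finset.mem_image.1 hx'
      have h4 := hs' x hx
      rw [← Nat.mul_div_cancel' (hdx x hx), Nat.gcd_mul_left] at h4
      exact Nat.eq_of_mul_eq_mul_left hd (by rw [h4, mul_one])
  · intro x
    have : (((m : ℤ) ^ 4 : ℤ) : ℝ) * (x + 1) = (((m : ℤ) ^ 4 : ℤ) : ℝ) * x + ((m ^ 4 : ℕ) : ℤ) := by
      push_cast; ring
    rw [trig_add_one, this, smoothSum_add_int]

/-! ### The extraction inequality -/

theorem moment_eq (k N R : ℕ) : moment k N R = ∫ α in (0:ℝ)..1, ‖smoothSum N R α‖ ^ k := rfl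

theorem norm_integral_common_divisor_le (k : ℕ) {N R d : ℕ} (hd : d ≠ 0) {S : Finset (ℕ × ℕ)}
    (hS : ∀ x ∈ S, x.1 ∈ smoothUpTo N R ∧ x.2 ∈ smoothUpTo N R ∧ d ∣ x.1 ∧ d ∣ x.2) :
    ‖∫ α in (0:ℝ)..1, ((‖smoothSum N R α‖ ^ (2 * k) : ℝ) : ℂ) *
      trig S (fun x => (x.1 : ℤ) ^ 4 - (x.2 : ℤ) ^ 4) α‖ ≤
    moment (2 * k + 2) N R ^ (1 - 1 / ((k : ℝ) + 1)) *
      moment (2 * k + 2) (N / d) R ^ (1 / ((k : ℝ) + 1)) := by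
  classical
  set A := (smoothUpTo N R).filter fun x => d ∣ x with hA
  have h1 : Dom (trig S fun x => (x.1 : ℤ) ^ 4 - (x.2 : ℤ) ^ 4)
      (fun α => ((‖trig A (fun x => (x : ℤ) ^ 4) α‖ ^ 2 : ℝ) : ℂ)) := by
    have : (fun α => ((‖trig A (fun x => (x : ℤ) ^ 4) α‖ ^ 2 : ℝ) : ℂ)) =
        trig (A ×ˢ A) (fun x => (x.1 : ℤ) ^ 4 - (x.2 : ℤ) ^ 4) := by
      funext α; rw [norm_sq_trig]; rfl
    rw [this]
    refine Dom.trig_subset (fun x hx => ?_) _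
    obtain ⟨h1, h2, h3, h4⟩ := hS x hx
    exact Finset.mem_product.2 ⟨Finset.mem_filter.2 ⟨h1, h3⟩, Finset.mem_filter.2 ⟨h2, h4⟩⟩
  have h2 := (dom_smoothSum_pow N R k).mul h1
  have h3 : Dom (fun α => ((‖smoothSum N R α‖ ^ (2 * k) : ℝ) : ℂ) *
      trig S (fun x => (x.1 : ℤ) ^ 4 - (x.2 : ℤ) ^ 4) α)
      (fun α => ((‖smoothSum N R α‖ ^ (2 * k) * ‖trig A (fun x => (x : ℤ) ^ 4) α‖ ^ 2 : ℝ) : ℂ)) := by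
    have : (fun α => ((‖smoothSum N R α‖ ^ (2 * k) *
        ‖trig A (fun x => (x : ℤ) ^ 4) α‖ ^ 2 : ℝ) : ℂ)) = fun α =>
        ((‖smoothSum N R α‖ ^ (2 * k) : ℝ) : ℂ) *
          ((‖trig A (fun x => (x : ℤ) ^ 4) α‖ ^ 2 : ℝ) : ℂ) := by
      funext α; push_cast; rfl
    rw [this]; exact h2
  refine h3.norm_integral_le.trans ?_
  have hk : (0:ℝ) < (k:ℝ) + 1 := by positivity
  have h4 := interval_holder₂ (f := fun α => ‖smoothSum N R α‖ ^ (2 * k + 2))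
    (g := fun α => ‖trig A (fun x => (x : ℤ) ^ 4) α‖ ^ (2 * k + 2)) (by fun_prop) (by fun_prop)
    (fun _ => by positivity) (fun _ => by positivity) (a := 1 - 1 / ((k : ℝ) + 1))
    (b := 1 / ((k : ℝ) + 1)) (by rw [sub_nonneg, div_le_one hk]; linarith [(k.cast_nonneg : (0:ℝ) ≤ k)])
    (by positivity) (by ring)
  have h5 : ∀ x : ℝ, 0 ≤ x → (x ^ (2 * k + 2)) ^ (1 - 1 / ((k : ℝ) + 1)) = x ^ (2 * k) := by
    intro x hx
    rw [rpow_natCast_mul hx, ← Real.rpow_natCast]; congr 1; push_cast; field_simp; ring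
  have h6 : ∀ x : ℝ, 0 ≤ x → (x ^ (2 * k + 2)) ^ (1 / ((k : ℝ) + 1)) = x ^ 2 := by
    intro x hx
    rw [rpow_natCast_mul hx, ← Real.rpow_natCast]; congr 1; push_cast; field_simp
  simp only [h5 _ (norm_nonneg _), h6 _ (norm_nonneg _)] at h4
  refine h4.trans ?_
  rw [← moment_eq]
  gcongr
  · exact Real.rpow_nonneg (moment_nonneg ..) _
  · exact intervalIntegral.integral_nonneg (by norm_num) fun _ _ => by positivity
  · exact integral_norm_pow_dvd_le hd (s := A) (Finset.filter_subset _ _)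
      (fun x hx => (Finset.mem_filter.1 hx).2) (k + 1)

theorem integral_triple_le {k : ℕ} (hk : 1 ≤ k) {N R : ℕ} {s t : Finset ℕ} (hs : s ⊆ smoothUpTo N R) :
    ∫ α in (0:ℝ)..1, ‖smoothSum N R α‖ ^ (2 * k) *
      (‖trig s (fun x => (x : ℤ) ^ 4) α‖ * ‖trig t (fun x => (x : ℤ) ^ 4) α‖) ≤
    moment (2 * k + 2) N R ^ (1 - 1 / (2 * k : ℝ)) *
      (∫ α in (0:ℝ)..1, ‖trig s (fun x => (x : ℤ) ^ 4) α‖ ^ 2 *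
        ‖trig t (fun x => (x : ℤ) ^ 4) α‖ ^ (2 * k)) ^ (1 / (2 * k : ℝ)) := by
  have hk1 : (1:ℝ) ≤ k := by exact_mod_cast hk
  have hk0 : (0:ℝ) < k := by linarith
  set a : ℝ := k / (k + 1) with ha
  set b : ℝ := (k - 1) / (2 * k * (k + 1)) with hb
  set c : ℝ := 1 / (2 * k) with hc
  have hab : a + b = 1 - c := by rw [ha, hb, hc]; field_simp; ring
  have ha0 : 0 ≤ a := by positivity
  have hb0 : 0 ≤ b := div_nonneg (by linarith) (by positivity)
  have hc0 : 0 ≤ c := by positivity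
  have h4 := interval_holder₃ (f := fun α => ‖smoothSum N R α‖ ^ (2 * k + 2))
    (g := fun α => ‖trig s (fun x => (x : ℤ) ^ 4) α‖ ^ (2 * k + 2))
    (k := fun α => ‖trig s (fun x => (x : ℤ) ^ 4) α‖ ^ 2 *
        ‖trig t (fun x => (x : ℤ) ^ 4) α‖ ^ (2 * k)) (by fun_prop) (by fun_prop) (by fun_prop)
    (fun _ => by positivity) (fun _ => by positivity) (fun _ => by positivity) ha0 hb0 hc0
    (by linarith)
  have h5 : ∀ x y z : ℝ, 0 ≤ x → 0 ≤ y → 0 ≤ z → (x ^ (2 * k + 2)) ^ a * (y ^ (2 * k + 2)) ^ b *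
      (y ^ 2 * z ^ (2 * k)) ^ c = x ^ (2 * k) * (y * z) := by
    intro x y z hx hy hz
    rw [Real.mul_rpow (by positivity) (by positivity), rpow_natCast_mul hx, rpow_natCast_mul hy,
      rpow_natCast_mul hy, rpow_natCast_mul hz]
    have e1 : ((2 * k + 2 : ℕ) : ℝ) * a = (2 * k : ℕ) := by rw [ha]; push_cast; field_simp
    have e2 : ((2 * k : ℕ) : ℝ) * c = 1 := by rw [hc]; push_cast; field_simp
    have e3 : ((2 * k + 2 : ℕ) : ℝ) * b + ((2 : ℕ) : ℝ) * c = 1 := by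
      rw [hb, hc]; push_cast; field_simp; ring
    rw [e1, e2, Real.rpow_natCast, Real.rpow_one]
    have e4 : y ^ (((2 * k + 2 : ℕ) : ℝ) * b) * y ^ (((2 : ℕ) : ℝ) * c) = y := by
      rw [← Real.rpow_add_of_nonneg hy (by positivity) (by positivity), e3, Real.rpow_one]
    rw [mul_assoc, ← mul_assoc (y ^ _), e4]
  simp only [h5 _ _ _ (norm_nonneg _) (norm_nonneg _) (norm_nonneg _)] at h4
  refine h4.trans ?_
  gcongr
  · exact Real.rpow_nonneg (intervalIntegral.integral_nonneg (by norm_num)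
      fun _ _ => by positivity) _
  · rw [← hab, ← moment_eq]
    have hT := moment_nonneg (2 * k + 2) N R
    rw [Real.rpow_add_of_nonneg hT ha0 hb0]
    gcongr
    · exact intervalIntegral.integral_nonneg (by norm_num) fun _ _ => by positivity
    exact integral_norm_pow_subset_le hs (k + 1)

theorem sum_rpow_inv_le {ι : Type*} (s : Finset ι) (W : ι → ℝ) (hW : ∀ i ∈ s, 0 ≤ W i) {p : ℕ}
    (hp : 1 ≤ p) :
    ∑ i ∈ s, W i ^ (1 / (p : ℝ)) ≤ (s.card : ℝ) ^ (1 - 1 / (p : ℝ)) *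
      (∑ i ∈ s, W i) ^ (1 / (p : ℝ)) := by
  have hp1 : (1:ℝ) ≤ p := by exact_mod_cast hp
  have h2 := Real.rpow_sum_le_const_mul_sum_rpow_of_nonneg (s := s) (f := fun i => W i ^ (1 / (p : ℝ)))
    hp1 (fun i hi => Real.rpow_nonneg (hW i hi) _)
  have h3 : ∑ i ∈ s, (W i ^ (1 / (p : ℝ))) ^ (p : ℝ) = ∑ i ∈ s, W i := by
    refine Finset.sum_congr rfl fun i hi => ?_
    rw [← Real.rpow_mul (hW i hi), one_div_mul_cancel (by positivity), Real.rpow_one]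
  rw [h3] at h2
  have h0 : 0 ≤ ∑ i ∈ s, W i ^ (1 / (p : ℝ)) :=
    Finset.sum_nonneg fun i hi => Real.rpow_nonneg (hW i hi) _
  have h4 := Real.rpow_le_rpow (by positivity) h2 (by positivity : 0 ≤ 1 / (p : ℝ))
  rw [← Real.rpow_mul h0, mul_one_div_cancel (by positivity), Real.rpow_one,
    Real.mul_rpow (by positivity) (Finset.sum_nonneg hW), ← Real.rpow_mul (by positivity)] at h4
  convert h4 using 3
  field_simp

theorem le_of_le_mul_rpow {T a p : ℝ} (hT : 0 ≤ T) (ha : 0 ≤ a) (hp : 1 ≤ p)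
    (h : T ≤ a * T ^ (1 - 1 / p)) : T ≤ a ^ p := by
  rcases hT.eq_or_lt with rfl | hT
  · positivity
  have hp0 : 0 < p := by linarith
  have h1 : T ^ (1 / p) ≤ a := by
    have h2 : T = T ^ (1 / p) * T ^ (1 - 1 / p) := by
      rw [← Real.rpow_add hT]; simp
    have h3 : 0 < T ^ (1 - 1 / p) := by positivity
    have : T ^ (1 / p) * T ^ (1 - 1 / p) ≤ a * T ^ (1 - 1 / p) := by rw [← h2]; exact h
    exact le_of_mul_le_mul_right this h3
  calc T = (T ^ (1 / p)) ^ p := by rw [← Real.rpow_mul hT.le, one_div_mul_cancel hp0.ne', Real.rpow_one]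
    _ ≤ a ^ p := Real.rpow_le_rpow (by positivity) h1 hp0.le

theorem le_of_le_add_mul_rpow {T a b c p q r : ℝ} (hT : 0 ≤ T) (ha : 0 ≤ a) (hb : 0 ≤ b)
    (hc : 0 ≤ c) (hp : 1 ≤ p) (hq : 1 ≤ q) (hr : 1 ≤ r)
    (h : T ≤ a * T ^ (1 - 1 / p) + b * T ^ (1 - 1 / q) + c * T ^ (1 - 1 / r)) :
    T ≤ (3 * a) ^ p ∨ T ≤ (3 * b) ^ q ∨ T ≤ (3 * c) ^ r := by
  by_contra! hcon
  obtain ⟨h1, h2, h3⟩ := hcon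
  have h1' := mt (le_of_le_mul_rpow hT (by positivity : 0 ≤ 3 * a) hp) (not_le.2 h1)
  have h2' := mt (le_of_le_mul_rpow hT (by positivity : 0 ≤ 3 * b) hq) (not_le.2 h2)
  have h3' := mt (le_of_le_mul_rpow hT (by positivity : 0 ≤ 3 * c) hr) (not_le.2 h3)
  push Not at h1' h2' h3'
  linarith

theorem sum_classIntegral (k N Q R : ℕ) (𝓜 : Finset ℕ) :
    ∑ m ∈ 𝓜, classIntegral k m N Q R =
      ∫ α in (0:ℝ)..1, (𝓜.card * N + 2 * (diffSum 𝓜 N α).re) * ‖smoothSum Q R α‖ ^ (2 * k) := by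
  unfold classIntegral
  rw [← intervalIntegral.integral_finsetSum
    (fun _ _ => Continuous.intervalIntegrable (by fun_prop) _ _)]
  congr 1; funext α
  rw [← Finset.sum_mul, Finset.sum_add_distrib, ← Finset.mul_sum, ← Complex.re_sum,
    sum_diffSum_singleton]
  simp

set_option maxHeartbeats 1000000 in
theorem moment_extraction {k : ℕ} (hk : 1 ≤ k) {N R M D τ : ℕ} (hM : 1 ≤ M)
    (hτ : ∀ m, 1 ≤ m → m ≤ M * R → (m ^ 4).divisors.card ≤ τ) :
    moment (2 * k + 2) N R ≤ M * moment (2 * k + 2) N R ^ (1 - 1 / (2 * k + 2 : ℝ)) +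
      (∑ d ∈ Finset.Ioc D N, moment (2 * k + 2) (N / d) R ^ (1 / ((k : ℝ) + 1))) *
        moment (2 * k + 2) N R ^ (1 - 1 / ((k : ℝ) + 1)) +
      ((D * (M * R) : ℝ) ^ (1 - 1 / (2 * k : ℝ)) *
        (D * (4 * τ ^ 4 * ∑ m ∈ (Finset.Icc 1 (M * R)).filter fun m => M ≤ D * m,
          classIntegral k m N (N / M) R)) ^ (1 / (2 * k : ℝ))) *
        moment (2 * k + 2) N R ^ (1 - 1 / (2 * k : ℝ)) := by
  classical
  set A := smoothUpTo N R with hA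
  set H := smoothSum N R with hH
  set T := moment (2 * k + 2) N R with hT
  have hT0 : 0 ≤ T := moment_nonneg _ _ _
  set n : ℕ × ℕ → ℤ := fun x => (x.1 : ℤ) ^ 4 - (x.2 : ℤ) ^ 4 with hn
  have hμ : ∀ y : ℕ, ∃ m, y ∈ A → M < y → m ∣ y ∧ M < m ∧ m ≤ M * R := by
    intro y
    by_cases hy : y ∈ A ∧ M < y
    · obtain ⟨m, h1, h2, h3⟩ := exists_dvd_of_smooth hM hy.2 (mem_smoothUpTo.1 hy.1).2.2
      exact ⟨m, fun _ _ => ⟨h1, h2, h3⟩⟩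
    · exact ⟨0, fun h1 h2 => (hy ⟨h1, h2⟩).elim⟩
  choose μ hμ using hμ
  set S₁ := A ×ˢ A.filter (fun y => y ≤ M) with hS₁
  set S₂ := (A ×ˢ A).filter (fun x => M < x.2 ∧ D < Nat.gcd x.1 (μ x.2)) with hS₂
  set S₃ := (A ×ˢ A).filter (fun x => M < x.2 ∧ Nat.gcd x.1 (μ x.2) ≤ D) with hS₃
  have hInt : ∀ S : Finset (ℕ × ℕ), IntervalIntegrable
      (fun α => ((‖H α‖ ^ (2 * k) : ℝ) : ℂ) * trig S n α) volume 0 1 :=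
    fun S => Continuous.intervalIntegrable (by fun_prop) _ _
  have hsplit : ∀ α, ((‖H α‖ ^ (2 * k + 2) : ℝ) : ℂ) = ((‖H α‖ ^ (2 * k) : ℝ) : ℂ) * trig S₁ n α +
      ((‖H α‖ ^ (2 * k) : ℝ) : ℂ) * trig S₂ n α + ((‖H α‖ ^ (2 * k) : ℝ) : ℂ) * trig S₃ n α := by
    intro α
    rw [← mul_add, ← mul_add, pow_add, Complex.ofReal_mul]
    congr 1
    rw [hH, smoothSum, norm_sq_trig]
    have e1 : (A ×ˢ A).filter (fun x => x.2 ≤ M) = S₁ := by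
      ext x; simp [hS₁, and_assoc]
    have e2 : ((A ×ˢ A).filter (fun x => ¬ x.2 ≤ M)).filter (fun x => D < Nat.gcd x.1 (μ x.2)) = S₂ := by
      rw [Finset.filter_filter]; simp [hS₂]
    have e3 : ((A ×ˢ A).filter (fun x => ¬ x.2 ≤ M)).filter (fun x => ¬ D < Nat.gcd x.1 (μ x.2)) = S₃ := by
      rw [Finset.filter_filter]; simp [hS₃]
    rw [← Finset.sum_filter_add_sum_filter_not (A ×ˢ A) (fun x => x.2 ≤ M), e1,
      ← Finset.sum_filter_add_sum_filter_not ((A ×ˢ A).filter (fun x => ¬ x.2 ≤ M))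
        (fun x => D < Nat.gcd x.1 (μ x.2)), e2, e3, ← add_assoc]
    rfl
  have hTle : T ≤ ‖∫ α in (0:ℝ)..1, ((‖H α‖ ^ (2 * k) : ℝ) : ℂ) * trig S₁ n α‖ +
      ‖∫ α in (0:ℝ)..1, ((‖H α‖ ^ (2 * k) : ℝ) : ℂ) * trig S₂ n α‖ +
      ‖∫ α in (0:ℝ)..1, ((‖H α‖ ^ (2 * k) : ℝ) : ℂ) * trig S₃ n α‖ := by
    have h1 : (T : ℂ) = (∫ α in (0:ℝ)..1, ((‖H α‖ ^ (2 * k) : ℝ) : ℂ) * trig S₁ n α) +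
      (∫ α in (0:ℝ)..1, ((‖H α‖ ^ (2 * k) : ℝ) : ℂ) * trig S₂ n α) +
      (∫ α in (0:ℝ)..1, ((‖H α‖ ^ (2 * k) : ℝ) : ℂ) * trig S₃ n α) := by
      rw [← intervalIntegral.integral_add (hInt _) (hInt _),
        ← intervalIntegral.integral_add ((hInt _).add (hInt _)) (hInt _), hT, moment,
        ← intervalIntegral.integral_ofReal]
      exact intervalIntegral.integral_congr fun α _ => hsplit α
    calc T = ‖(T : ℂ)‖ := by rw [Complex.norm_real, Real.norm_of_nonneg hT0]
      _ ≤ _ := by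
        rw [h1]; exact (norm_add_le _ _).trans (add_le_add_left (norm_add_le _ _) _)
  refine hTle.trans (add_le_add (add_le_add ?_ ?_) ?_)
  · have h1 : ∀ α, ‖((‖H α‖ ^ (2 * k) : ℝ) : ℂ) * trig S₁ n α‖ ≤ M * ‖H α‖ ^ (2 * k + 1) := by
      intro α
      have h2 : trig S₁ n α = H α * (starRingEnd ℂ) (trig (A.filter (fun y => y ≤ M))
          (fun x => (x : ℤ) ^ 4) α) := by
        rw [trig_conj, hH, smoothSum, trig_mul]; rfl
      have h3 : ‖trig (A.filter (fun y => y ≤ M)) (fun x => (x : ℤ) ^ 4) α‖ ≤ M := by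
        refine (norm_trig_le _ _ _).trans ?_
        have : A.filter (fun y => y ≤ M) ⊆ Finset.Icc 1 M := by
          intro y hy
          obtain ⟨h1, h2⟩ := Finset.mem_filter.1 hy
          exact Finset.mem_Icc.2 ⟨(mem_smoothUpTo.1 h1).1, h2⟩
        have := Finset.card_le_card this
        rw [Nat.card_Icc, Nat.add_sub_cancel] at this
        exact_mod_cast this
      rw [h2, norm_mul, norm_mul, RCLike.norm_conj, Complex.norm_real,
        Real.norm_of_nonneg (by positivity)]
      calc _ ≤ ‖H α‖ ^ (2 * k) * (‖H α‖ * M) := by gcongr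
        _ = _ := by ring
    refine (intervalIntegral.norm_integral_le_integral_norm (by norm_num)).trans ?_
    refine (intervalIntegral.integral_mono_on (by norm_num)
      (Continuous.intervalIntegrable (by fun_prop) _ _)
      (Continuous.intervalIntegrable (by fun_prop) _ _) fun α _ => h1 α).trans ?_
    rw [intervalIntegral.integral_const_mul]
    gcongr
    have hp : (0:ℝ) < 2 * k + 2 := by positivity
    have h4 := interval_holder₂ (f := fun α => ‖H α‖ ^ (2 * k + 2)) (g := fun _ => (1:ℝ))
      (by fun_prop) (by fun_prop)
      (fun _ => by positivity) (fun _ => by positivity) (a := 1 - 1 / (2 * (k : ℝ) + 2))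
      (b := 1 / (2 * (k : ℝ) + 2)) (by
        rw [sub_nonneg, div_le_one hp]; linarith [(k.cast_nonneg : (0:ℝ) ≤ k)])
      (by positivity) (by ring)
    have h5 : ∀ x : ℝ, 0 ≤ x → (x ^ (2 * k + 2)) ^ (1 - 1 / (2 * (k : ℝ) + 2)) = x ^ (2 * k + 1) := by
      intro x hx
      rw [rpow_natCast_mul hx, ← Real.rpow_natCast]; congr 1; push_cast; field_simp; ring
    simp only [h5 _ (norm_nonneg _), Real.one_rpow, mul_one, intervalIntegral.integral_const,
      sub_zero, smul_eq_mul] at h4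
    exact h4
  · rw [Finset.sum_mul]
    have hmaps : ∀ x ∈ S₂, Nat.gcd x.1 (μ x.2) ∈ Finset.Ioc D N := by
      intro x hx
      obtain ⟨h1, h2, h3⟩ := Finset.mem_filter.1 hx
      have := mem_smoothUpTo.1 (Finset.mem_product.1 h1).1
      exact Finset.mem_Ioc.2 ⟨h3, (Nat.le_of_dvd this.1 (Nat.gcd_dvd_left _ _)).trans this.2.1⟩
    have h1 : ∀ α, ((‖H α‖ ^ (2 * k) : ℝ) : ℂ) * trig S₂ n α = ∑ d ∈ Finset.Ioc D N,
        ((‖H α‖ ^ (2 * k) : ℝ) : ℂ) *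
          trig (S₂.filter fun x => Nat.gcd x.1 (μ x.2) = d) n α := by
      intro α
      rw [← Finset.mul_sum]; congr 1
      exact (Finset.sum_fiberwise_of_maps_to hmaps _).symm
    simp only [h1]
    rw [intervalIntegral.integral_finsetSum fun d _ => hInt _]
    refine (norm_sum_le _ _).trans (Finset.sum_le_sum fun d hd => ?_)
    have hd0 : d ≠ 0 := by have := (Finset.mem_Ioc.1 hd).1; omega
    rw [mul_comm (moment (2 * k + 2) (N / d) R ^ _)]
    refine norm_integral_common_divisor_le k hd0 fun x hx => ?_
    obtain ⟨h2, h3⟩ := Finset.mem_filter.1 hx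
    obtain ⟨h4, h5, h6⟩ := Finset.mem_filter.1 h2
    obtain ⟨h7, h8⟩ := Finset.mem_product.1 h4
    exact ⟨h7, h8, h3 ▸ Nat.gcd_dvd_left _ _, h3 ▸ (Nat.gcd_dvd_right _ _).trans (hμ _ h8 h5).1⟩
  · set 𝓓 := (Finset.Icc 1 D ×ˢ Finset.Icc 1 (M * R)).filter (fun p => M ≤ p.1 * p.2) with h𝓓
    set X : ℕ × ℕ → Finset ℕ := fun p => A.filter fun x => Nat.gcd x (p.1 * p.2) = p.1 with hX
    set Y : ℕ × ℕ → Finset ℕ := fun p => A.filter fun y => M < y ∧ μ y = p.1 * p.2 with hY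
    have hmaps : ∀ x ∈ S₃, (Nat.gcd x.1 (μ x.2), μ x.2 / Nat.gcd x.1 (μ x.2)) ∈ 𝓓 := by
      intro x hx
      obtain ⟨h1, h2, h3⟩ := Finset.mem_filter.1 hx
      obtain ⟨h7, h8⟩ := Finset.mem_product.1 h1
      have h4 := hμ _ h8 h2
      have h5 : 0 < Nat.gcd x.1 (μ x.2) := Nat.gcd_pos_of_pos_left _ (mem_smoothUpTo.1 h7).1
      have h6 := Nat.mul_div_cancel' (Nat.gcd_dvd_right x.1 (μ x.2))
      refine Finset.mem_filter.2 ⟨Finset.mem_product.2 ⟨Finset.mem_Icc.2 ⟨h5, h3⟩,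
        Finset.mem_Icc.2 ⟨?_, (Nat.div_le_self _ _).trans h4.2.2⟩⟩, ?_⟩
      · exact Nat.div_pos (Nat.le_of_dvd (by omega) (Nat.gcd_dvd_right _ _)) h5
      · dsimp only; rw [h6]; exact h4.2.1.le
    have hfib : ∀ p ∈ 𝓓, S₃.filter
        (fun x => (Nat.gcd x.1 (μ x.2), μ x.2 / Nat.gcd x.1 (μ x.2)) = p) = X p ×ˢ Y p := by
      rintro ⟨d, m⟩ hp
      have hp' := Finset.mem_filter.1 hp
      simp only [Finset.mem_product, Finset.mem_Icc] at hp'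
      ext ⟨x, y⟩
      simp only [hS₃, hX, hY, Finset.mem_filter, Finset.mem_product, Prod.mk.injEq]
      constructor
      · rintro ⟨⟨⟨h1, h2⟩, h3, h4⟩, h5, h6⟩
        have h7 := Nat.mul_div_cancel' (Nat.gcd_dvd_right x (μ y))
        rw [h6, h5] at h7
        refine ⟨⟨h1, ?_⟩, h2, h3, h7.symm⟩
        rw [h7]; exact h5
      · rintro ⟨⟨h1, h2⟩, h3, h4, h5⟩
        rw [h5, h2]
        refine ⟨⟨⟨h1, h3⟩, h4, hp'.1.1.2⟩, rfl, ?_⟩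
        exact Nat.mul_div_cancel_left _ (by omega)
    have h1 : ∀ α, ((‖H α‖ ^ (2 * k) : ℝ) : ℂ) * trig S₃ n α = ∑ p ∈ 𝓓,
        ((‖H α‖ ^ (2 * k) : ℝ) : ℂ) * trig (X p ×ˢ Y p) n α := by
      intro α
      rw [← Finset.mul_sum]; congr 1
      rw [trig, ← Finset.sum_fiberwise_of_maps_to hmaps]
      exact Finset.sum_congr rfl fun p hp => by rw [hfib p hp]; rfl
    simp only [h1]
    rw [intervalIntegral.integral_finsetSum fun d _ => hInt _]
    have h2 : ∀ p ∈ 𝓓, ‖∫ α in (0:ℝ)..1, ((‖H α‖ ^ (2 * k) : ℝ) : ℂ) * trig (X p ×ˢ Y p) n α‖ ≤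
        T ^ (1 - 1 / (2 * k : ℝ)) *
          (4 * τ ^ 4 * classIntegral k p.2 N (N / M) R) ^ (1 / (2 * k : ℝ)) := by
      rintro ⟨d, m⟩ hp
      have hp' := Finset.mem_filter.1 hp
      simp only [Finset.mem_product, Finset.mem_Icc] at hp'
      refine (intervalIntegral.norm_integral_le_integral_norm (by norm_num)).trans ?_
      have h3 : ∀ α, ‖((‖H α‖ ^ (2 * k) : ℝ) : ℂ) * trig (X (d, m) ×ˢ Y (d, m)) n α‖ =
          ‖H α‖ ^ (2 * k) * (‖trig (X (d, m)) (fun x => (x : ℤ) ^ 4) α‖ *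
            ‖trig (Y (d, m)) (fun x => (x : ℤ) ^ 4) α‖) := by
        intro α
        have : trig (X (d, m) ×ˢ Y (d, m)) n α = trig (X (d, m)) (fun x => (x : ℤ) ^ 4) α *
            (starRingEnd ℂ) (trig (Y (d, m)) (fun x => (x : ℤ) ^ 4) α) := by
          rw [trig_conj, trig_mul]; rfl
        rw [this, norm_mul, norm_mul, RCLike.norm_conj, Complex.norm_real,
          Real.norm_of_nonneg (by positivity)]
      simp only [h3]
      refine (integral_triple_le hk (Finset.filter_subset _ _)).trans ?_
      gcongr
      · exact intervalIntegral.integral_nonneg (by norm_num) fun _ _ => by positivity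
      · refine integral_pair_le (d := d) (m := m) (M := M) (D := τ) (by omega) (by omega)
          hp'.2 (by omega) rfl (hτ m hp'.1.2.1 hp'.1.2.2)
          (Finset.filter_subset _ _) (Finset.filter_subset _ _)
          (fun x hx => (Finset.mem_filter.1 hx).2) (fun y hy => ?_)
        obtain ⟨h4, h5, h6⟩ := Finset.mem_filter.1 hy
        have := (hμ y h4 h5).1
        rwa [h6] at this
    refine (norm_sum_le _ _).trans ((Finset.sum_le_sum h2).trans ?_)
    rw [← Finset.mul_sum, mul_comm]
    gcongr
    have hcl := fun m => classIntegral_nonneg k m N (N / M) R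
    have h3 := sum_rpow_inv_le 𝓓 (fun p => 4 * (τ : ℝ) ^ 4 * classIntegral k p.2 N (N / M) R)
      (fun p _ => mul_nonneg (by positivity) (hcl _)) (p := 2 * k) (by omega)
    push_cast at h3
    refine h3.trans ?_
    have hcard : (𝓓.card : ℝ) ≤ D * (M * R) := by
      have := (Finset.card_filter_le (Finset.Icc 1 D ×ˢ Finset.Icc 1 (M * R))
        (fun p => M ≤ p.1 * p.2))
      rw [Finset.card_product, Nat.card_Icc, Nat.card_Icc, Nat.add_sub_cancel,
        Nat.add_sub_cancel] at this
      exact_mod_cast this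
    have hk1 : (1:ℝ) ≤ k := by exact_mod_cast hk
    have hsum0 : 0 ≤ ∑ p ∈ 𝓓, 4 * (τ : ℝ) ^ 4 * classIntegral k p.2 N (N / M) R :=
      Finset.sum_nonneg fun p _ => mul_nonneg (by positivity) (hcl _)
    gcongr
    · rw [sub_nonneg, div_le_one (by positivity)]; linarith
    · rw [Finset.mul_sum]
      have hsub : 𝓓 ⊆ Finset.Icc 1 D ×ˢ (Finset.Icc 1 (M * R)).filter fun m => M ≤ D * m := by
        intro p hp
        have hp' := Finset.mem_filter.1 hp
        have := Finset.mem_product.1 hp'.1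
        refine Finset.mem_product.2 ⟨this.1, Finset.mem_filter.2 ⟨this.2, hp'.2.trans ?_⟩⟩
        exact Nat.mul_le_mul_right _ (Finset.mem_Icc.1 this.1).2
      refine (Finset.sum_le_sum_of_subset_of_nonneg hsub fun p _ _ =>
        mul_nonneg (by positivity) (hcl _)).trans ?_
      rw [Finset.sum_product]
      simp

/-! ### Bounds polynomial in both parameters -/

/-- `f N R ≪ N ^ x` up to a fixed power of `R`. -/
def PolyBd (f : ℕ → ℕ → ℝ) (x : ℝ) : Prop :=
  ∃ C K : ℝ, 0 ≤ C ∧ 0 ≤ K ∧ ∀ N R : ℕ, 1 ≤ N → 1 ≤ R → f N R ≤ C * (N : ℝ) ^ x * (R : ℝ) ^ K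

namespace PolyBd
variable {f g : ℕ → ℕ → ℝ} {x y : ℝ}

theorem mono (hg : PolyBd g x) (hfg : ∀ N R, 1 ≤ N → 1 ≤ R → f N R ≤ g N R) : PolyBd f x := by
  obtain ⟨C, K, hC, hK, h⟩ := hg
  exact ⟨C, K, hC, hK, fun N R hN hR => (hfg N R hN hR).trans (h N R hN hR)⟩

theorem mono_exp (hf : PolyBd f x) (hxy : x ≤ y) : PolyBd f y := by
  obtain ⟨C, K, hC, hK, h⟩ := hf
  refine ⟨C, K, hC, hK, fun N R hN hR => (h N R hN hR).trans ?_⟩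
  have : (1:ℝ) ≤ N := by exact_mod_cast hN
  gcongr

theorem const (c : ℝ) : PolyBd (fun _ _ => c) 0 :=
  ⟨|c|, 0, abs_nonneg _, le_rfl, fun N R _ _ => by simpa using le_abs_self c⟩

theorem rpow_left (x : ℝ) : PolyBd (fun N _ => (N : ℝ) ^ x) x :=
  ⟨1, 0, zero_le_one, le_rfl, fun N R _ _ => by simp⟩

theorem self_left : PolyBd (fun N _ => (N : ℝ)) 1 := by
  simpa using rpow_left 1

theorem self_right : PolyBd (fun _ R => (R : ℝ)) 0 :=
  ⟨1, 1, zero_le_one, zero_le_one, fun N R _ _ => by simp⟩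

theorem mul (hf : PolyBd f x) (hg : PolyBd g y) (hg0 : ∀ N R, 0 ≤ g N R) :
    PolyBd (fun N R => f N R * g N R) (x + y) := by
  obtain ⟨C, K, hC, hK, h⟩ := hf
  obtain ⟨C', K', hC', hK', h'⟩ := hg
  refine ⟨C * C', K + K', by positivity, by positivity, fun N R hN hR => ?_⟩
  have hN' : (0:ℝ) < N := by exact_mod_cast hN
  have hR' : (0:ℝ) < R := by exact_mod_cast hR
  rw [Real.rpow_add hN', Real.rpow_add hR']
  calc f N R * g N R ≤ (C * (N : ℝ) ^ x * (R : ℝ) ^ K) * (C' * (N : ℝ) ^ y * (R : ℝ) ^ K') :=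
        mul_le_mul (h N R hN hR) (h' N R hN hR) (hg0 _ _) (by positivity)
    _ = _ := by ring

theorem const_mul (hf : PolyBd f x) (hf0 : ∀ N R, 0 ≤ f N R) {c : ℝ} (hc : 0 ≤ c) :
    PolyBd (fun N R => c * f N R) x := by
  have := (const c).mul hf hf0
  rwa [zero_add] at this

theorem rpow (hf : PolyBd f x) (hf0 : ∀ N R, 0 ≤ f N R) {a : ℝ} (ha : 0 ≤ a) :
    PolyBd (fun N R => f N R ^ a) (x * a) := by
  obtain ⟨C, K, hC, hK, h⟩ := hf
  refine ⟨C ^ a, K * a, by positivity, by positivity, fun N R hN hR => ?_⟩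
  have hN' : (0:ℝ) < N := by exact_mod_cast hN
  have hR' : (0:ℝ) < R := by exact_mod_cast hR
  rw [Real.rpow_mul hN'.le, Real.rpow_mul hR'.le, ← Real.mul_rpow (by positivity) (by positivity),
    ← Real.mul_rpow (by positivity) (by positivity)]
  exact Real.rpow_le_rpow (hf0 _ _) (h N R hN hR) ha

theorem pow (hf : PolyBd f x) (hf0 : ∀ N R, 0 ≤ f N R) (n : ℕ) :
    PolyBd (fun N R => f N R ^ n) (x * n) := by
  have := hf.rpow hf0 (n.cast_nonneg : (0:ℝ) ≤ n)
  simpa only [Real.rpow_natCast] using this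

theorem add (hf : PolyBd f x) (hg : PolyBd g x) : PolyBd (fun N R => f N R + g N R) x := by
  obtain ⟨C, K, hC, hK, h⟩ := hf
  obtain ⟨C', K', hC', hK', h'⟩ := hg
  refine ⟨C + C', K + K', by positivity, by positivity, fun N R hN hR => ?_⟩
  have hR' : (1:ℝ) ≤ R := by exact_mod_cast hR
  have h1 : (R : ℝ) ^ K ≤ (R : ℝ) ^ (K + K') := Real.rpow_le_rpow_of_exponent_le hR' (by linarith)
  have h2 : (R : ℝ) ^ K' ≤ (R : ℝ) ^ (K + K') := Real.rpow_le_rpow_of_exponent_le hR' (by linarith)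
  calc f N R + g N R ≤ C * (N : ℝ) ^ x * (R : ℝ) ^ K + C' * (N : ℝ) ^ x * (R : ℝ) ^ K' :=
        add_le_add (h N R hN hR) (h' N R hN hR)
    _ ≤ C * (N : ℝ) ^ x * (R : ℝ) ^ (K + K') + C' * (N : ℝ) ^ x * (R : ℝ) ^ (K + K') := by gcongr
    _ = _ := by ring

/-- Substituting `N / ⌊N ^ θ⌋` for `N`. -/
theorem comp_div (hf : PolyBd f x) (hx : 0 ≤ x) {θ : ℝ} (hθ0 : 0 ≤ θ) (hθ1 : θ ≤ 1) :
    PolyBd (fun N R => f (N / ⌊(N : ℝ) ^ θ⌋₊) R) ((1 - θ) * x) := by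
  obtain ⟨C, K, hC, hK, h⟩ := hf
  refine ⟨C * 2 ^ x, K, by positivity, hK, fun N R hN hR => ?_⟩
  have hN' : (1:ℝ) ≤ N := by exact_mod_cast hN
  have h1 : (1:ℝ) ≤ (N : ℝ) ^ θ := Real.one_le_rpow hN' hθ0
  have h2 : 1 ≤ ⌊(N : ℝ) ^ θ⌋₊ := Nat.le_floor (by simpa using h1)
  have h3 : ⌊(N : ℝ) ^ θ⌋₊ ≤ N := by
    refine Nat.floor_le_of_le ?_
    simpa using Real.rpow_le_rpow_of_exponent_le hN' hθ1
  have h4 : (N : ℝ) ^ θ / 2 ≤ ⌊(N : ℝ) ^ θ⌋₊ := by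
    have := Nat.lt_floor_add_one ((N : ℝ) ^ θ)
    have h5 : (1:ℝ) ≤ ⌊(N : ℝ) ^ θ⌋₊ := by exact_mod_cast h2
    linarith
  have h6 : ((N / ⌊(N : ℝ) ^ θ⌋₊ : ℕ) : ℝ) ≤ 2 * (N : ℝ) ^ (1 - θ) := by
    refine Nat.cast_div_le.trans ?_
    rw [Real.rpow_sub (by linarith), Real.rpow_one]
    calc (N : ℝ) / ⌊(N : ℝ) ^ θ⌋₊ ≤ N / ((N : ℝ) ^ θ / 2) := by gcongr
      _ = _ := by field_simp
  refine (h _ R (Nat.div_pos h3 h2) hR).trans ?_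
  rw [Real.rpow_mul (by linarith), mul_assoc C (2 ^ x), ← Real.mul_rpow (by norm_num) (by positivity)]
  gcongr

end PolyBd

/-- The maximum of the divisor function up to `n`. -/
def divMax (n : ℕ) : ℕ := (Finset.Icc 1 n).sup fun m => m.divisors.card

theorem card_divisors_le_divMax {m n : ℕ} (hm : m ≠ 0) (hmn : m ≤ n) :
    m.divisors.card ≤ divMax n :=
  Finset.le_sup (f := fun m : ℕ => m.divisors.card) (Finset.mem_Icc.2 ⟨by omega, hmn⟩)

theorem polyBd_divMax (c j : ℕ) {ε : ℝ} (hε : 0 < ε) :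
    PolyBd (fun N R => (divMax (c * (N * R) ^ j) : ℝ)) ε := by
  set δ := ε / (j + 1) with hδ
  have hδ0 : 0 < δ := by positivity
  obtain ⟨C, hC1, hC⟩ := card_divisors_le_rpow hδ0
  refine ⟨C * (c : ℝ) ^ δ, j * δ, by positivity, by positivity, fun N R hN hR => ?_⟩
  have hN' : (1:ℝ) ≤ N := by exact_mod_cast hN
  have hR' : (1:ℝ) ≤ R := by exact_mod_cast hR
  have h1 : (divMax (c * (N * R) ^ j) : ℝ) ≤ C * ((c * (N * R) ^ j : ℕ) : ℝ) ^ δ := by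
    rcases (Finset.Icc 1 (c * (N * R) ^ j)).eq_empty_or_nonempty with h | h
    · rw [divMax, h]; simp; positivity
    · obtain ⟨m, hm, hm'⟩ := Finset.exists_mem_eq_sup _ h fun m : ℕ => m.divisors.card
      obtain ⟨h2, h3⟩ := Finset.mem_Icc.1 hm
      rw [divMax, hm']
      refine (hC m (by omega)).trans ?_
      gcongr
  refine h1.trans ?_
  push_cast
  rw [Real.mul_rpow (by positivity) (by positivity), ← Real.rpow_natCast, ← Real.rpow_mul (by positivity),
    Real.mul_rpow (by positivity) (by positivity), ← mul_assoc, ← mul_assoc]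
  gcongr
  rw [hδ, mul_div_assoc']; rw [div_le_iff₀ (by positivity)]; nlinarith

/-! ### The recursive step for moments -/

theorem exists_tail_le {p : ℝ} (hp : 1 < p) :
    ∃ D : ℕ, 1 ≤ D ∧ ∀ N : ℕ, ∑ d ∈ Finset.Ioc D N, ((d : ℝ) ^ p)⁻¹ ≤ 1 / 3 := by
  have h1 : Summable fun n : ℕ => ((n : ℝ) ^ p)⁻¹ := Real.summable_nat_rpow_inv.2 hp
  obtain ⟨s, hs⟩ := summable_iff_vanishing_norm.1 h1 (1 / 3) (by norm_num)
  refine ⟨max 1 (s.sup id), le_max_left _ _, fun N => ?_⟩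
  have := hs (Finset.Ioc (max 1 (s.sup id)) N) (by
    rw [Finset.disjoint_left]
    intro d hd hd'
    have h2 := Finset.le_sup (f := id) hd'
    have h3 := (Finset.mem_Ioc.1 hd).1
    have h4 := le_max_right 1 (s.sup id)
    simp only [id] at h2 h4 h3
    omega)
  exact ((le_abs_self _).trans this.le)

/-- The moduli occurring in the extraction inequality. -/
def moduli (θ : ℝ) (D N R : ℕ) : Finset ℕ :=
  (Finset.Icc 1 (⌊(N : ℝ) ^ θ⌋₊ * R)).filter fun m => ⌊(N : ℝ) ^ θ⌋₊ ≤ D * m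

set_option maxHeartbeats 1000000 in
theorem polyBd_moment_of_classes {k : ℕ} (hk : 1 ≤ k) {μ θ : ℝ} (hθ0 : 0 ≤ θ) (hθ : θ ≤ 1 / 2)
    (hμ : k + 1 < μ)
    (h : ∀ D : ℕ, 1 ≤ D → PolyBd (fun N R => (D * (⌊(N : ℝ) ^ θ⌋₊ * R) : ℝ) ^ (2 * k - 1) *
      (D * (4 * (divMax (2 * (N * R) ^ 4) : ℝ) ^ 4 * ∑ m ∈ moduli θ D N R,
        classIntegral k m N (N / ⌊(N : ℝ) ^ θ⌋₊) R))) μ) :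
    PolyBd (moment (2 * k + 2)) μ := by
  have hk0 : (0:ℝ) < k + 1 := by positivity
  obtain ⟨D, hD, hDN⟩ := exists_tail_le (p := μ / (k + 1)) ((one_lt_div hk0).2 hμ)
  obtain ⟨C₁, K, hC₁, hK, h1⟩ := h D hD
  set C : ℝ := 3 ^ (2 * k + 2) + 3 ^ (2 * k) * C₁ with hC
  refine ⟨C, K, by positivity, hK, fun N R hN hR => ?_⟩
  have hR' : (1:ℝ) ≤ R := by exact_mod_cast hR
  induction N using Nat.strong_induction_on with
  | _ N ih =>
  have hN' : (1:ℝ) ≤ N := by exact_mod_cast hN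
  have hRK : (1:ℝ) ≤ (R : ℝ) ^ K := Real.one_le_rpow hR' hK
  set M := ⌊(N : ℝ) ^ θ⌋₊ with hM
  have hM1 : 1 ≤ M := Nat.le_floor (by simpa using Real.one_le_rpow hN' hθ0)
  have hMθ : (M : ℝ) ≤ (N : ℝ) ^ θ := Nat.floor_le (by positivity)
  have hMN : M ≤ N := by
    refine Nat.floor_le_of_le ?_
    simpa using Real.rpow_le_rpow_of_exponent_le hN' (by linarith : θ ≤ 1)
  have hext := moment_extraction (D := D) hk (N := N) (R := R) hM1
    (τ := divMax (2 * (N * R) ^ 4)) (fun m hm hm' => by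
      refine card_divisors_le_divMax (by positivity) ?_
      have : m ≤ N * R := hm'.trans (Nat.mul_le_mul_right _ hMN)
      calc m ^ 4 ≤ (N * R) ^ 4 := Nat.pow_le_pow_left this 4
        _ ≤ _ := by omega)
  have hT0 := moment_nonneg (2 * k + 2) N R
  have hk1 : (1:ℝ) ≤ k := by exact_mod_cast hk
  have hV0 : 0 ≤ ∑ m ∈ moduli θ D N R, classIntegral k m N (N / M) R :=
    Finset.sum_nonneg fun m _ => classIntegral_nonneg _ _ _ _ _
  change _ ≤ _ + _ + (_ * (_ * (_ * ∑ m ∈ moduli θ D N R, classIntegral k m N (N / M) R)) ^ _) * _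
    at hext
  rcases le_of_le_add_mul_rpow hT0 (by positivity)
    (Finset.sum_nonneg fun d _ => Real.rpow_nonneg (moment_nonneg _ _ _) _) (by positivity)
    (by linarith) (by linarith) (by linarith) hext with h2 | h2 | h2
  · refine h2.trans ?_
    have : (2 * (k : ℝ) + 2) = ((2 * k + 2 : ℕ) : ℝ) := by push_cast; ring
    rw [this, Real.rpow_natCast, mul_pow]
    have h3 : (M : ℝ) ^ (2 * k + 2) ≤ (N : ℝ) ^ μ := by
      calc (M : ℝ) ^ (2 * k + 2) ≤ ((N : ℝ) ^ θ) ^ (2 * k + 2) := by gcongr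
        _ = (N : ℝ) ^ (θ * (2 * k + 2)) := by
          rw [← Real.rpow_natCast, ← Real.rpow_mul (by linarith)]; push_cast; rfl
        _ ≤ (N : ℝ) ^ μ := Real.rpow_le_rpow_of_exponent_le hN' (by nlinarith)
    calc (3:ℝ) ^ (2 * k + 2) * (M : ℝ) ^ (2 * k + 2) ≤ C * (N : ℝ) ^ μ * 1 := by
          rw [mul_one]
          gcongr
          rw [hC]; linarith [show (0:ℝ) ≤ 3 ^ (2 * k) * C₁ by positivity]
      _ ≤ _ := by gcongr
  · refine h2.trans ?_
    set q : ℝ := 1 / ((k : ℝ) + 1) with hq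
    have hq0 : 0 ≤ q := by positivity
    have h3 : ∑ d ∈ Finset.Ioc D N, moment (2 * k + 2) (N / d) R ^ q ≤
        (C * (N : ℝ) ^ μ * (R : ℝ) ^ K) ^ q * (1 / 3) := by
      refine le_trans ?_ (mul_le_mul_of_nonneg_left (hDN N) (by positivity))
      rw [Finset.mul_sum]
      refine Finset.sum_le_sum fun d hd => ?_
      obtain ⟨hd1, hd2⟩ := Finset.mem_Ioc.1 hd
      have hd0 : (0:ℝ) < d := by exact_mod_cast (by omega : 0 < d)
      have h4 := ih (N / d) (Nat.div_lt_self (by omega) (by omega)) (Nat.div_pos hd2 (by omega))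
      have h5 : moment (2 * k + 2) (N / d) R ≤ (C * (N : ℝ) ^ μ * (R : ℝ) ^ K) * ((d : ℝ) ^ μ)⁻¹ := by
        refine h4.trans ?_
        calc C * ((N / d : ℕ) : ℝ) ^ μ * (R : ℝ) ^ K ≤ C * ((N : ℝ) / d) ^ μ * (R : ℝ) ^ K := by
              gcongr
              · linarith
              · exact Nat.cast_div_le
          _ = _ := by rw [Real.div_rpow (by linarith) hd0.le]; ring
      refine (Real.rpow_le_rpow (moment_nonneg _ _ _) h5 hq0).trans ?_
      rw [Real.mul_rpow (by positivity) (by positivity), Real.inv_rpow (by positivity),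
        ← Real.rpow_mul hd0.le]
      apply le_of_eq; congr 3; rw [hq]; ring
    calc (3 * ∑ d ∈ Finset.Ioc D N, moment (2 * k + 2) (N / d) R ^ q) ^ ((k : ℝ) + 1)
        ≤ ((C * (N : ℝ) ^ μ * (R : ℝ) ^ K) ^ q) ^ ((k : ℝ) + 1) := by
          refine Real.rpow_le_rpow (mul_nonneg (by norm_num)
              (Finset.sum_nonneg fun d _ => Real.rpow_nonneg (moment_nonneg _ _ _) _)) ?_ hk0.le
          linarith only [h3]
      _ = _ := by
        rw [← Real.rpow_mul (by positivity), hq, one_div_mul_cancel hk0.ne', Real.rpow_one]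
  · refine h2.trans ?_
    have e1 : (2 * (k : ℝ)) = ((2 * k : ℕ) : ℝ) := by push_cast; ring
    have h3 := h1 N R hN hR
    rw [Real.mul_rpow (by norm_num) (by positivity), Real.mul_rpow (by positivity) (by positivity),
      ← Real.rpow_mul (by positivity), ← Real.rpow_mul (by positivity),
      one_div_mul_cancel (by positivity), Real.rpow_one]
    have e2 : (1 - 1 / (2 * (k : ℝ))) * (2 * k) = ((2 * k - 1 : ℕ) : ℝ) := by
      rw [Nat.cast_sub (by omega)]; push_cast; field_simp
    rw [e2, Real.rpow_natCast, e1, Real.rpow_natCast]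
    calc _ ≤ (3:ℝ) ^ (2 * k) * (C₁ * (N : ℝ) ^ μ * (R : ℝ) ^ K) := by gcongr
      _ = (3 ^ (2 * k) * C₁) * (N : ℝ) ^ μ * (R : ℝ) ^ K := by ring
      _ ≤ _ := by
        gcongr
        rw [hC]; linarith [show (0:ℝ) ≤ 3 ^ (2 * k + 2) by positivity]

theorem interval_holder₄ {f g k l : ℝ → ℝ} (hf : Continuous f) (hg : Continuous g)
    (hk : Continuous k) (hl : Continuous l) (hf0 : ∀ x, 0 ≤ f x) (hg0 : ∀ x, 0 ≤ g x)
    (hk0 : ∀ x, 0 ≤ k x) (hl0 : ∀ x, 0 ≤ l x)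
    {a b c d : ℝ} (ha : 0 ≤ a) (hb : 0 ≤ b) (hc : 0 ≤ c) (hd : 0 ≤ d) (habc : a + b + c + d = 1) :
    ∫ x in (0:ℝ)..1, f x ^ a * g x ^ b * k x ^ c * l x ^ d ≤
      (∫ x in (0:ℝ)..1, f x) ^ a * (∫ x in (0:ℝ)..1, g x) ^ b * (∫ x in (0:ℝ)..1, k x) ^ c *
        (∫ x in (0:ℝ)..1, l x) ^ d := by
  simp only [intervalIntegral.integral_of_le (zero_le_one (α := ℝ))]
  have := integral_prod_rpow_le (volume.restrict (Set.Ioc (0:ℝ) 1)) Finset.univ ![f, g, k, l]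
    ![a, b, c, d]
    (by
      intro i _; fin_cases i
      exacts [(hf.intervalIntegrable 0 1).1, (hg.intervalIntegrable 0 1).1,
        (hk.intervalIntegrable 0 1).1, (hl.intervalIntegrable 0 1).1])
    (by intro i _; fin_cases i <;> simpa)
    (by intro i _; fin_cases i <;> simpa) (by simpa [Fin.sum_univ_four])
  simpa [Fin.prod_univ_four] using this

theorem one_le_floor_rpow {θ : ℝ} (hθ0 : 0 ≤ θ) {N : ℕ} (hN : 1 ≤ N) : 1 ≤ ⌊(N : ℝ) ^ θ⌋₊ :=
  Nat.le_floor (by simpa using Real.one_le_rpow (by exact_mod_cast hN : (1:ℝ) ≤ N) hθ0)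

theorem mem_moduli {θ : ℝ} {D N R m : ℕ} (hm : m ∈ moduli θ D N R) :
    1 ≤ m ∧ ⌊(N : ℝ) ^ θ⌋₊ ≤ D * m := by
  obtain ⟨h1, h2⟩ := Finset.mem_filter.1 hm
  exact ⟨(Finset.mem_Icc.1 h1).1, h2⟩

theorem card_moduli_le (θ : ℝ) (D N R : ℕ) :
    ((moduli θ D N R).card : ℝ) ≤ (N : ℝ) ^ θ * R := by
  have h1 := Finset.card_filter_le (Finset.Icc 1 (⌊(N : ℝ) ^ θ⌋₊ * R))
    (fun m => ⌊(N : ℝ) ^ θ⌋₊ ≤ D * m)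
  rw [Nat.card_Icc, Nat.add_sub_cancel] at h1
  have h2 : ((moduli θ D N R).card : ℝ) ≤ (⌊(N : ℝ) ^ θ⌋₊ : ℝ) * R := by exact_mod_cast h1
  refine h2.trans ?_
  gcongr
  exact Nat.floor_le (by positivity)

theorem polyBd_card_moduli (θ : ℝ) (D : ℕ) :
    PolyBd (fun N R => ((moduli θ D N R).card : ℝ)) θ := by
  have h1 := (PolyBd.rpow_left θ).mul PolyBd.self_right (fun _ _ => by positivity)
  rw [add_zero] at h1
  exact h1.mono fun N R _ _ => card_moduli_le θ D N R

theorem polyBd_floor (θ : ℝ) : PolyBd (fun N _ => (⌊(N : ℝ) ^ θ⌋₊ : ℝ)) θ :=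
  (PolyBd.rpow_left θ).mono fun N R _ _ => Nat.floor_le (by positivity)

theorem polyBd_card_diffBase {θ : ℝ} (hθ0 : 0 ≤ θ) {D : ℕ} (hD : 1 ≤ D) :
    PolyBd (fun N R => ((diffBase (moduli θ D N R) N).card : ℝ)) (1 - 3 * θ) := by
  have h1 := ((polyBd_card_moduli θ D).mul ((PolyBd.rpow_left (1 - 4 * θ)).const_mul
    (fun _ _ => by positivity) (by positivity : (0:ℝ) ≤ (2 * D) ^ 4)) (fun _ _ => by positivity))
  rw [show θ + (1 - 4 * θ) = 1 - 3 * θ by ring] at h1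
  refine h1.mono fun N R hN hR => ?_
  have hN' : (1:ℝ) ≤ N := by exact_mod_cast hN
  have hD' : (1:ℝ) ≤ D := by exact_mod_cast hD
  refine (card_diffBase_le (M := (N : ℝ) ^ θ / (2 * D)) (by positivity) fun m hm => ?_).trans ?_
  · have h2 := (mem_moduli hm).2
    have h3 : (⌊(N : ℝ) ^ θ⌋₊ : ℝ) ≤ D * m := by exact_mod_cast h2
    have h4 := Nat.lt_floor_add_one ((N : ℝ) ^ θ)
    have h5 : (1:ℝ) ≤ ⌊(N : ℝ) ^ θ⌋₊ := by exact_mod_cast one_le_floor_rpow hθ0 hN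
    rw [div_le_iff₀ (by positivity)]
    nlinarith
  · gcongr
    apply le_of_eq
    rw [Real.rpow_sub (by linarith), Real.rpow_one, div_pow, ← Real.rpow_natCast ((N : ℝ) ^ θ),
      ← Real.rpow_mul (by linarith)]
    push_cast
    rw [mul_comm θ 4]
    field_simp

theorem divMax_ge {N R : ℕ} (hR : 1 ≤ R) :
    ∀ n : ℕ, n ≠ 0 → n ≤ 2 * N ^ 4 → n.divisors.card ≤ divMax (2 * (N * R) ^ 4) := by
  intro n hn hn'
  refine card_divisors_le_divMax hn (hn'.trans ?_)
  gcongr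
  exact Nat.le_mul_of_pos_right _ hR

theorem one_le_divMax {n : ℕ} (hn : 1 ≤ n) : 1 ≤ divMax n := by
  simpa using card_divisors_le_divMax one_ne_zero hn

theorem polyBd_diffSum_sq {θ ε : ℝ} (hθ0 : 0 ≤ θ) {D : ℕ} (hD : 1 ≤ D) (hε : 0 < ε) :
    PolyBd (fun N R => ∫ α in (0:ℝ)..1, ‖diffSum (moduli θ D N R) N α‖ ^ 2) (2 - 3 * θ + ε) := by
  have h1 := ((polyBd_card_diffBase hθ0 hD).mul PolyBd.self_left (fun _ _ => by positivity)).mul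
    ((polyBd_divMax 2 4 (half_pos hε)).pow (fun _ _ => by positivity) 2) (fun _ _ => by positivity)
  rw [show 1 - 3 * θ + 1 + ε / 2 * (2:ℕ) = 2 - 3 * θ + ε by push_cast; ring] at h1
  exact h1.mono fun N R hN hR => integral_norm_diffSum_sq_le (fun m hm => (mem_moduli hm).1)
    (divMax_ge hR)

theorem polyBd_diffSum_pow_four {θ ε : ℝ} (hθ0 : 0 ≤ θ) {D : ℕ} (hD : 1 ≤ D) (hε : 0 < ε) :
    PolyBd (fun N R => ∫ α in (0:ℝ)..1, ‖diffSum (moduli θ D N R) N α‖ ^ 4)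
      (5 - 9 * θ + ε) := by
  have h1 := ((((polyBd_card_diffBase hθ0 hD).pow (fun _ _ => by positivity) 3).mul
    (PolyBd.self_left.pow (fun _ _ => by positivity) 2) (fun _ _ => by positivity)).mul
    ((polyBd_divMax 2 4 (by positivity : 0 < ε / 5)).pow (fun _ _ => by positivity) 5)
    (fun _ _ => by positivity)).const_mul (fun _ _ => by positivity) (by norm_num : (0:ℝ) ≤ 50)
  rw [show (1 - 3 * θ) * (3:ℕ) + 1 * (2:ℕ) + ε / 5 * (5:ℕ) = 5 - 9 * θ + ε by push_cast; ring] at h1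
  exact h1.mono fun N R hN hR => integral_norm_diffSum_pow_four_le (fun m hm => (mem_moduli hm).1)
    (one_le_divMax (by
      have := Nat.pow_pos (n := 4) (Nat.mul_pos hN hR); omega)) (divMax_ge hR)

theorem polyBd_moment_step {k : ℕ} (hk : 1 ≤ k) {μ ν θ x : ℝ} (hθ0 : 0 ≤ θ) (hθ : θ ≤ 1 / 2)
    (hν0 : 0 ≤ ν) (hν : PolyBd (moment (2 * k)) ν)
    (hx : ∀ D : ℕ, 1 ≤ D → PolyBd (fun N R => ∫ α in (0:ℝ)..1, ‖diffSum (moduli θ D N R) N α‖ *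
      ‖smoothSum (N / ⌊(N : ℝ) ^ θ⌋₊) R α‖ ^ (2 * k)) x)
    (hμ : k + 1 < μ) (hμ1 : 1 + 2 * k * θ + (1 - θ) * ν < μ) (hμ2 : (2 * k - 1) * θ + x < μ) :
    PolyBd (moment (2 * k + 2)) μ := by
  refine polyBd_moment_of_classes hk hθ0 hθ hμ fun D hD => ?_
  set y : ℝ := max (θ + 1 + (1 - θ) * ν) x with hy
  have hyμ : (2 * k - 1) * θ + y < μ := by
    rw [hy, ← lt_sub_iff_add_lt']
    refine max_lt ?_ ?_ <;> linarith
  set ε : ℝ := (μ - ((2 * k - 1) * θ + y)) / 4 with hε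
  have hε0 : 0 < ε := by rw [hε]; linarith
  have hV : PolyBd (fun N R => ∑ m ∈ moduli θ D N R,
        classIntegral k m N (N / ⌊(N : ℝ) ^ θ⌋₊) R) y := by
    have h1 := ((polyBd_card_moduli θ D).mul PolyBd.self_left (fun _ _ => by positivity)).mul
      (hν.comp_div hν0 hθ0 (by linarith)) (fun _ _ => moment_nonneg _ _ _)
    have h2 := (h1.mono_exp (le_max_left _ x)).add (((hx D hD).const_mul
      (fun _ _ => intervalIntegral.integral_nonneg (by norm_num) fun _ _ => by positivity)
        zero_le_two).mono_exp (le_max_right (θ + 1 + (1 - θ) * ν) x))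
    refine h2.mono fun N R hN hR => ?_
    rw [sum_classIntegral, moment, ← intervalIntegral.integral_const_mul,
      ← intervalIntegral.integral_const_mul, ← intervalIntegral.integral_add
        (Continuous.intervalIntegrable (by fun_prop) _ _)
        (Continuous.intervalIntegrable (by fun_prop) _ _)]
    refine intervalIntegral.integral_mono_on (by norm_num)
      (Continuous.intervalIntegrable (by fun_prop) _ _)
      (Continuous.intervalIntegrable (by fun_prop) _ _) fun α _ => ?_
    rw [add_mul, mul_assoc 2]
    gcongr
    exact Complex.re_le_norm _
  have hk1 : (1:ℝ) ≤ k := by exact_mod_cast hk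
  have h0 : ∀ N R, 0 ≤ ∑ m ∈ moduli θ D N R, classIntegral k m N (N / ⌊(N : ℝ) ^ θ⌋₊) R :=
    fun N R => Finset.sum_nonneg fun m _ => classIntegral_nonneg _ _ _ _ _
  have h3 := ((((polyBd_floor θ).mul PolyBd.self_right (fun _ _ => by positivity)).const_mul
    (fun _ _ => by positivity) (Nat.cast_nonneg D : (0:ℝ) ≤ D)).pow (fun _ _ => by positivity)
      (2 * k - 1)).mul (((((polyBd_divMax 2 4 hε0).pow (fun _ _ => by positivity) 4).const_mul
        (fun _ _ => by positivity) (by norm_num : (0:ℝ) ≤ 4)).mul hV h0).const_mul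
        (fun _ _ => mul_nonneg (by positivity) (h0 _ _)) (Nat.cast_nonneg D : (0:ℝ) ≤ D))
        (fun _ _ => mul_nonneg (by positivity) (mul_nonneg (by positivity) (h0 _ _)))
  refine h3.mono_exp (le_of_eq ?_)
  rw [Nat.cast_sub (by omega), hε]; push_cast; ring

theorem polyBd_moment_six {μ ν a b θ : ℝ} (hθ0 : 0 ≤ θ) (hθ : θ ≤ 1 / 2) (hν0 : 0 ≤ ν)
    (ha0 : 0 ≤ a) (hb0 : 0 ≤ b)
    (h4 : PolyBd (moment 4) ν) (h6 : PolyBd (moment 6) a) (h8 : PolyBd (moment 8) b) (hμ : 3 < μ)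
    (hμ1 : 1 + 4 * θ + (1 - θ) * ν < μ)
    (hμ2 : 3 * θ + (5 - 9 * θ) / 8 + (2 - 3 * θ) / 4 + (1 - θ) * (a / 2 + b / 8) < μ) :
    PolyBd (moment 6) μ := by
  set ε := (μ - (3 * θ + (5 - 9 * θ) / 8 + (2 - 3 * θ) / 4 + (1 - θ) * (a / 2 + b / 8))) / 2 with hε
  have hε0 : 0 < ε := by rw [hε]; linarith
  refine polyBd_moment_step (k := 2) (by norm_num) hθ0 hθ hν0 h4 (x := (5 - 9 * θ + ε) * (1 / 8) +
    (2 - 3 * θ + ε) * (1 / 4) + (1 - θ) * a * (1 / 2) + (1 - θ) * b * (1 / 8)) (fun D hD => ?_)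
    (by push_cast; linarith) (by push_cast; linarith) (by push_cast; linarith)
  have i0 : ∀ n N R, 0 ≤ ∫ α in (0:ℝ)..1, ‖diffSum (moduli θ D N R) N α‖ ^ n := fun _ _ _ =>
    intervalIntegral.integral_nonneg (by norm_num) fun _ _ => by positivity
  have h1 := ((((polyBd_diffSum_pow_four hθ0 hD hε0).rpow (fun _ _ => i0 _ _ _)
      (by norm_num : (0:ℝ) ≤ 1 / 8)).mul ((polyBd_diffSum_sq hθ0 hD hε0).rpow (fun _ _ => i0 _ _ _)
      (by norm_num : (0:ℝ) ≤ 1 / 4)) (fun _ _ => Real.rpow_nonneg (i0 _ _ _) _)).mul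
    ((h6.comp_div ha0 hθ0 (by linarith)).rpow (fun _ _ => moment_nonneg _ _ _)
      (by norm_num : (0:ℝ) ≤ 1 / 2)) (fun _ _ => Real.rpow_nonneg (moment_nonneg _ _ _) _)).mul
    ((h8.comp_div hb0 hθ0 (by linarith)).rpow (fun _ _ => moment_nonneg _ _ _)
      (by norm_num : (0:ℝ) ≤ 1 / 8)) (fun _ _ => Real.rpow_nonneg (moment_nonneg _ _ _) _)
  refine h1.mono fun N R hN hR => ?_
  refine le_trans (le_of_eq ?_) (interval_holder₄ (by fun_prop) (by fun_prop) (by fun_prop)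
    (by fun_prop) (fun _ => by positivity) (fun _ => by positivity) (fun _ => by positivity)
    (fun _ => by positivity) (by norm_num) (by norm_num) (by norm_num) (by norm_num) (by norm_num))
  congr 1; funext α
  have hF := norm_nonneg (diffSum (moduli θ D N R) N α)
  have hH := norm_nonneg (smoothSum (N / ⌊(N : ℝ) ^ θ⌋₊) R α)
  rw [rpow_natCast_mul hF, rpow_natCast_mul hF, rpow_natCast_mul hH, rpow_natCast_mul hH,
    ← Real.rpow_add_of_nonneg hF (by norm_num) (by norm_num), mul_assoc,
    ← Real.rpow_add_of_nonneg hH (by norm_num) (by norm_num), ← Real.rpow_natCast _ (2 * 2)]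
  norm_num

theorem polyBd_moment_eight {μ ν b θ : ℝ} (hθ0 : 0 ≤ θ) (hθ : θ ≤ 1 / 2) (hν0 : 0 ≤ ν)
    (hb0 : 0 ≤ b) (h6 : PolyBd (moment 6) ν) (h8 : PolyBd (moment 8) b) (hμ : 4 < μ)
    (hμ1 : 1 + 6 * θ + (1 - θ) * ν < μ)
    (hμ2 : 5 * θ + (5 - 9 * θ) / 4 + 3 / 4 * ((1 - θ) * b) < μ) :
    PolyBd (moment 8) μ := by
  set ε := (μ - (5 * θ + (5 - 9 * θ) / 4 + 3 / 4 * ((1 - θ) * b))) / 2 with hε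
  have hε0 : 0 < ε := by rw [hε]; linarith
  refine polyBd_moment_step (k := 3) (by norm_num) hθ0 hθ hν0 h6 (x := (5 - 9 * θ + ε) * (1 / 4) +
    (1 - θ) * b * (3 / 4)) (fun D hD => ?_)
    (by push_cast; linarith) (by push_cast; linarith) (by push_cast; linarith)
  have i0 : ∀ n N R, 0 ≤ ∫ α in (0:ℝ)..1, ‖diffSum (moduli θ D N R) N α‖ ^ n := fun _ _ _ =>
    intervalIntegral.integral_nonneg (by norm_num) fun _ _ => by positivity
  have h1 := ((polyBd_diffSum_pow_four hθ0 hD hε0).rpow (fun _ _ => i0 _ _ _)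
      (by norm_num : (0:ℝ) ≤ 1 / 4)).mul
    ((h8.comp_div hb0 hθ0 (by linarith)).rpow (fun _ _ => moment_nonneg _ _ _)
      (by norm_num : (0:ℝ) ≤ 3 / 4)) (fun _ _ => Real.rpow_nonneg (moment_nonneg _ _ _) _)
  refine h1.mono fun N R hN hR => ?_
  refine le_trans (le_of_eq ?_) (interval_holder₂ (by fun_prop) (by fun_prop)
    (fun _ => by positivity) (fun _ => by positivity) (by norm_num) (by norm_num) (by norm_num))
  congr 1; funext α
  have hF := norm_nonneg (diffSum (moduli θ D N R) N α)
  have hH := norm_nonneg (smoothSum (N / ⌊(N : ℝ) ^ θ⌋₊) R α)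
  rw [rpow_natCast_mul hF, rpow_natCast_mul hH, ← Real.rpow_natCast _ (2 * 3)]
  norm_num

/-- The complete biquadratic Weyl sum. -/
def fullSum (N : ℕ) : ℝ → ℂ := trig (Finset.Icc 1 N) fun x => (x : ℤ) ^ 4

@[fun_prop]
theorem continuous_fullSum (N : ℕ) : Continuous (fullSum N) := by
  unfold fullSum; fun_prop

theorem smoothUpTo_subset_Icc (N R : ℕ) : smoothUpTo N R ⊆ Finset.Icc 1 N := fun _ hx =>
  Finset.mem_Icc.2 ⟨(mem_smoothUpTo.1 hx).1, (mem_smoothUpTo.1 hx).2.1⟩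

theorem dom_smoothSum_fullSum (N R : ℕ) : Dom (smoothSum N R) (fullSum N) :=
  Dom.trig_subset (smoothUpTo_subset_Icc N R) _

theorem norm_sq_fullSum (N : ℕ) (α : ℝ) :
    ‖fullSum N α‖ ^ 2 = N + 2 * (diffSum {1} N α).re := by
  have h := norm_sq_sum_e (fun y => ((y : ℤ) ^ 4 : ℤ) * α) (le_refl N)
  refine h.trans ?_
  congr 3
  rw [diffSum_eq_sum]
  have h1 : diffBase {1} N = ({1} ×ˢ Finset.Icc 1 N).filter fun b => b.2 * b.1 ^ 4 < N := rfl
  rw [h1, Finset.sum_filter, Finset.sum_product]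
  simp only [Finset.sum_singleton, one_pow, mul_one]
  refine Finset.sum_congr rfl fun l _ => ?_
  split_ifs with hl
  · refine Finset.sum_congr rfl fun y _ => ?_
    congr 1
    rw [← sub_mul]
    congr 1
    unfold diffPoly
    push_cast; ring
  · rw [Nat.sub_eq_zero_of_le (not_lt.1 hl)]; simp

theorem card_diffBase_one_le (N : ℕ) : (diffBase {1} N).card ≤ N := by
  refine (Finset.card_filter_le _ _).trans ?_
  simp

theorem norm_fullSum_sq_le (N : ℕ) (α : ℝ) :
    ‖fullSum N α‖ ^ 2 ≤ N + 2 * ‖diffSum {1} N α‖ := by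
  rw [norm_sq_fullSum]; gcongr; exact Complex.re_le_norm _

theorem norm_fullSum_pow_four_le (N : ℕ) (α : ℝ) :
    ‖fullSum N α‖ ^ 4 ≤ 2 * N ^ 2 + 8 * ‖diffSum {1} N α‖ ^ 2 := by
  have h1 : (‖fullSum N α‖ ^ 2) ^ 2 ≤ (N + 2 * ‖diffSum {1} N α‖) ^ 2 := by
    gcongr; exact norm_fullSum_sq_le N α
  calc ‖fullSum N α‖ ^ 4 = (‖fullSum N α‖ ^ 2) ^ 2 := by ring
    _ ≤ _ := h1.trans (by nlinarith [sq_nonneg ((N : ℝ) - 2 * ‖diffSum {1} N α‖)])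

theorem polyBd_integral_fullSum_pow_four {ε : ℝ} (hε : 0 < ε) :
    PolyBd (fun N _ => ∫ α in (0:ℝ)..1, ‖fullSum N α‖ ^ 4) (2 + ε) := by
  have h1 := ((PolyBd.self_left.pow (fun _ _ => by positivity) 2).mul
    ((polyBd_divMax 2 4 (half_pos hε)).pow (fun _ _ => by positivity) 2)
    (fun _ _ => by positivity)).const_mul (fun _ _ => by positivity) (by norm_num : (0:ℝ) ≤ 10)
  rw [show (1:ℝ) * (2:ℕ) + ε / 2 * (2:ℕ) = 2 + ε by push_cast; ring] at h1
  refine h1.mono fun N R hN hR => ?_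
  have h2 := integral_norm_diffSum_sq_le (𝓜 := {1}) (Y := N) (by simp) (divMax_ge hR)
  have h3 : ((diffBase {1} N).card : ℝ) ≤ N := by exact_mod_cast card_diffBase_one_le N
  set τ := divMax (2 * (N * R) ^ 4) with hτ
  have h4 : (1:ℝ) ≤ τ := by
    have := Nat.pow_pos (n := 4) (Nat.mul_pos hN hR)
    exact_mod_cast one_le_divMax (by omega)
  calc ∫ α in (0:ℝ)..1, ‖fullSum N α‖ ^ 4
      ≤ ∫ α in (0:ℝ)..1, (2 * (N:ℝ) ^ 2 + 8 * ‖diffSum {1} N α‖ ^ 2) :=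
        intervalIntegral.integral_mono_on (by norm_num)
          (Continuous.intervalIntegrable (by fun_prop) _ _)
          (Continuous.intervalIntegrable (by fun_prop) _ _) fun α _ => norm_fullSum_pow_four_le N α
    _ = 2 * (N:ℝ) ^ 2 + 8 * ∫ α in (0:ℝ)..1, ‖diffSum {1} N α‖ ^ 2 := by
        rw [intervalIntegral.integral_add (Continuous.intervalIntegrable (by fun_prop) _ _)
          (Continuous.intervalIntegrable (by fun_prop) _ _), intervalIntegral.integral_const_mul]
        simp
    _ ≤ 2 * ((N:ℝ) ^ 2 * τ ^ 2) + 8 * ((N:ℝ) * N * τ ^ 2) := by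
        gcongr
        · exact le_mul_of_one_le_right (by positivity) (one_le_pow₀ h4)
        · refine h2.trans ?_; gcongr
    _ = _ := by ring

theorem polyBd_moment_four {ε : ℝ} (hε : 0 < ε) : PolyBd (moment 4) (2 + ε) :=
  (polyBd_integral_fullSum_pow_four hε).mono fun N R _ _ =>
    ((dom_smoothSum_fullSum N R).norm_pow 2).integral_le

theorem moment_add_le (k j N R : ℕ) : moment (k + j) N R ≤ N ^ j * moment k N R := by
  rw [moment, moment, ← intervalIntegral.integral_const_mul]
  refine intervalIntegral.integral_mono_on (by norm_num)
    (Continuous.intervalIntegrable (by fun_prop) _ _)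
    (Continuous.intervalIntegrable (by fun_prop) _ _) fun α _ => ?_
  rw [pow_add, mul_comm]
  gcongr
  exact norm_smoothSum_le N R α

theorem polyBd_moment_add {k : ℕ} {ν : ℝ} (h : PolyBd (moment k) ν) (j : ℕ) :
    PolyBd (moment (k + j)) (j + ν) := by
  have h1 := (PolyBd.self_left.pow (fun _ _ => by positivity) j).mul h
    (fun _ _ => moment_nonneg _ _ _)
  rw [one_mul] at h1
  exact h1.mono fun N R _ _ => moment_add_le k j N R

theorem polyBd_moment_six_eight : PolyBd (moment 6) 3.198 ∧ PolyBd (moment 8) 4.6 := by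
  have h4 : PolyBd (moment 4) (2 + 0.0005) := polyBd_moment_four (by norm_num)
  have key : ∀ n : ℕ, PolyBd (moment 6) (3.197 + 0.8 ^ n) ∧
      PolyBd (moment 8) (4.5998 + 2 * 0.8 ^ n) := by
    intro n
    induction n with
    | zero =>
      constructor
      · exact (polyBd_moment_add h4 2).mono_exp (by norm_num)
      · exact (polyBd_moment_add h4 4).mono_exp (by norm_num)
    | succ n ih =>
      obtain ⟨h6, h8⟩ := ih
      have hx : (0:ℝ) < 0.8 ^ n := by positivity
      have e : (0.8:ℝ) ^ (n + 1) = 0.8 * 0.8 ^ n := pow_succ' _ _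
      rw [e]
      generalize (0.8:ℝ) ^ n = x at hx h6 h8
      constructor
      · exact polyBd_moment_six (θ := 0.0975) (by norm_num) (by norm_num) (by norm_num)
          (by linarith) (by linarith) h4 h6 h8 (by linarith) (by linarith) (by linarith)
      · exact polyBd_moment_eight (θ := 0.1435) (by norm_num) (by norm_num) (by linarith)
          (by linarith) h6 h8 (by linarith) (by linarith) (by linarith)
  have h := key 42
  exact ⟨h.1.mono_exp (by norm_num), h.2.mono_exp (by norm_num)⟩

/-! ### Linear exponential sums -/

/-- `min (Y, 1 / |sin (π x)|)`, for `Y > 0`. -/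
def kap (Y : ℕ) (x : ℝ) : ℝ := (max (Y:ℝ)⁻¹ |Real.sin (π * x)|)⁻¹

theorem kap_nonneg (Y : ℕ) (x : ℝ) : 0 ≤ kap Y x := by unfold kap; positivity

theorem kap_le {Y : ℕ} (hY : 0 < Y) (x : ℝ) : kap Y x ≤ Y := by
  rw [kap, inv_le_comm₀ (by positivity) (by positivity)]
  exact le_max_left _ _

theorem kap_le_of_le {Y : ℕ} {x s : ℝ} (hs : 0 < s) (hx : s ≤ |Real.sin (π * x)|) :
    kap Y x ≤ s⁻¹ := by
  rw [kap]
  exact inv_anti₀ hs (hx.trans (le_max_right _ _))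

theorem le_kap {Y : ℕ} (hY : 0 < Y) {x A : ℝ} (h1 : A ≤ Y) (h2 : A * |Real.sin (π * x)| ≤ 1) :
    A ≤ kap Y x := by
  rcases le_or_gt A 0 with hA | hA
  · exact hA.trans (kap_nonneg _ _)
  rw [kap, le_inv_comm₀ hA (by positivity)]
  refine max_le (inv_anti₀ hA h1) ?_
  rw [inv_eq_one_div, le_div_iff₀ hA, mul_comm]; exact h2

theorem norm_e_sub_one (x : ℝ) : ‖e x - 1‖ = 2 * |Real.sin (π * x)| := by
  rw [e_eq]
  have := Complex.norm_exp_I_mul_ofReal_sub_one (2 * π * x)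
  rw [mul_comm Complex.I] at this
  rw [this, norm_mul, Real.norm_eq_abs, Real.norm_eq_abs]
  simp; congr 2; ring

theorem norm_sum_e_linear_le {J Y : ℕ} (hJ : J ≤ Y) (hY : 0 < Y) (β γ : ℝ) :
    ‖∑ y ∈ Finset.Icc 1 J, e (y * β + γ)‖ ≤ kap Y β := by
  refine le_kap hY ?_ ?_
  · refine (norm_sum_le _ _).trans ?_
    simp only [norm_e]; simpa using hJ
  · have h1 : (e β - 1) * ∑ y ∈ Finset.Icc 1 J, e (y * β + γ) =
        e ((J + 1 : ℕ) * β + γ) - e ((1:ℕ) * β + γ) := by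
      rw [Finset.mul_sum]
      have : ∀ y : ℕ, (e β - 1) * e (y * β + γ) = e ((y + 1 : ℕ) * β + γ) - e (y * β + γ) := by
        intro y
        rw [sub_mul, ← e_add]; push_cast; ring_nf
      rw [Finset.sum_congr rfl fun y _ => this y, ← Finset.Ico_add_one_right_eq_Icc,
        Finset.sum_Ico_sub (fun y : ℕ => e (y * β + γ)) (by omega)]
    have h2 : ‖(e β - 1) * ∑ y ∈ Finset.Icc 1 J, e (y * β + γ)‖ ≤ 2 := by
      rw [h1]
      refine (norm_sub_le _ _).trans ?_
      rw [norm_e, norm_e]; norm_num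
    rw [norm_mul, norm_e_sub_one] at h2
    linarith

theorem abs_sin_pi_fract (x : ℝ) : |Real.sin (π * x)| = Real.sin (π * Int.fract x) := by
  have h0 : 0 ≤ Real.sin (π * Int.fract x) := by
    apply Real.sin_nonneg_of_nonneg_of_le_pi
    · have := Int.fract_nonneg x; positivity
    · nlinarith [Int.fract_lt_one x, Real.pi_pos]
  rw [← abs_of_nonneg h0]
  have h1 : π * x = π * Int.fract x + ⌊x⌋ * π := by
    have := Int.fract_add_floor x
    nth_rw 1 [← this]; ring
  rw [h1, Real.sin_add_int_mul_pi]
  rcases Int.even_or_odd ⌊x⌋ with h2 | h2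
  · rw [h2.neg_one_zpow, one_mul]
  · rw [h2.neg_one_zpow]; simp

theorem two_mul_min_le_sin {x : ℝ} (h0 : 0 ≤ x) (h1 : x ≤ 1) :
    2 * min x (1 - x) ≤ Real.sin (π * x) := by
  rcases le_total x (1/2) with h | h
  · rw [min_eq_left (by linarith)]
    have := Real.mul_le_sin (x := π * x) (by positivity) (by nlinarith [Real.pi_pos])
    have h3 : 2 / π * (π * x) = 2 * x := by field_simp
    linarith
  · rw [min_eq_right (by linarith)]
    have := Real.mul_le_sin (x := π * (1 - x)) (by have := Real.pi_pos; nlinarith)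
      (by nlinarith [Real.pi_pos])
    have h3 : 2 / π * (π * (1 - x)) = 2 * (1 - x) := by field_simp
    have h4 : Real.sin (π * (1 - x)) = Real.sin (π * x) := by
      rw [← Real.sin_pi_sub]; congr 1; ring
    linarith

theorem abs_sin_pi_le (x : ℝ) (n : ℤ) : |Real.sin (π * x)| ≤ π * |x - n| := by
  have h1 : π * x = π * (x - n) + n * π := by ring
  rw [h1, Real.sin_add_int_mul_pi, abs_mul, abs_zpow, abs_neg, abs_one, one_zpow, one_mul]
  refine (Real.abs_sin_le_abs).trans ?_
  rw [abs_mul, abs_of_pos Real.pi_pos]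

theorem one_div_two_mul_le_abs_sub {α : ℝ} {r : ℕ} {a : ℤ} (hr : 0 < r) (har : IsCoprime a r)
    (hα : |α - a / r| ≤ 1 / (r:ℝ) ^ 2) {k : ℕ} (hk : 0 < k) (hkr : 2 * k ≤ r) (z : ℤ) :
    1 / (2 * r : ℝ) ≤ |k * α - z| := by
  have hr' : (0:ℝ) < r := by exact_mod_cast hr
  have hne : k * a - z * r ≠ 0 := by
    intro h
    have h1 : (r : ℤ) ∣ k * a := ⟨z, by linarith⟩
    have h2 : (r : ℤ) ∣ k := har.symm.dvd_of_dvd_mul_right h1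
    have := Int.le_of_dvd (by exact_mod_cast hk) h2
    omega
  have h1 : (1:ℝ) ≤ |(k * a - z * r : ℤ)| := by exact_mod_cast Int.one_le_abs hne
  have h2 : (1:ℝ) / r ≤ |k * (a / r : ℝ) - z| := by
    rw [div_le_iff₀ hr']
    refine h1.trans (le_of_eq ?_)
    rw [← abs_of_pos hr', ← abs_mul, abs_of_pos hr']; push_cast
    congr 1; field_simp
  have h3 : |k * (α - a / r)| ≤ 1 / (2 * r : ℝ) := by
    rw [abs_mul, Nat.abs_cast]
    calc (k:ℝ) * |α - a / r| ≤ k * (1 / (r:ℝ) ^ 2) := by gcongr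
      _ ≤ (r / 2 : ℝ) * (1 / (r:ℝ) ^ 2) := by
        gcongr
        rw [le_div_iff₀ (by norm_num), mul_comm]; exact_mod_cast hkr
      _ = _ := by field_simp
  have h4 : k * (a / r : ℝ) - z = (k * α - z) - k * (α - a / r) := by ring
  have h5 := abs_sub (k * α - z) (k * (α - a / r))
  rw [← h4] at h5
  have h6 : (1:ℝ) / r = 2 * (1 / (2 * r)) := by field_simp
  linarith

theorem sum_kap_short_le {α : ℝ} {r Y : ℕ} {a : ℤ} (hr : 0 < r) (hY : 0 < Y) (har : IsCoprime a r)
    (hα : |α - a / r| ≤ 1 / (r:ℝ) ^ 2) {T : Finset ℕ}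
    (hT : ∀ n ∈ T, ∀ n' ∈ T, n < n' → 2 * (n' - n) ≤ r) :
    ∑ n ∈ T, kap Y (n * α) ≤ 2 * Y + 2 * r * (1 + Real.log (2 * r)) := by
  classical
  have hr' : (0:ℝ) < r := by exact_mod_cast hr
  set j : ℕ → ℕ := fun n => ⌊2 * r * Int.fract (n * α)⌋₊ with hj
  set g : ℕ → ℝ := fun i => if i = 0 then (Y:ℝ) else r / i with hg
  have hg0 : ∀ i, 0 ≤ g i := by intro i; simp only [hg]; split_ifs <;> positivity
  have hx0 : ∀ n : ℕ, 0 ≤ 2 * r * Int.fract (n * α) := fun n =>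
    mul_nonneg (by positivity) (Int.fract_nonneg _)
  have hjlt : ∀ n, j n < 2 * r := by
    intro n
    rw [hj, Nat.floor_lt (hx0 n)]
    push_cast
    have := Int.fract_lt_one (n * α)
    nlinarith
  have hinj : Set.InjOn j T := by
    have key : ∀ n ∈ T, ∀ n' ∈ T, n < n' → j n ≠ j n' := by
      intro n hn n' hn' hlt hjj
      have h1 := one_div_two_mul_le_abs_sub hr har hα (k := n' - n) (by omega) (hT n hn n' hn' hlt)
        (⌊n' * α⌋ - ⌊n * α⌋)
      have h2 : ((n' - n : ℕ) : ℝ) * α - ((⌊n' * α⌋ - ⌊n * α⌋ : ℤ) : ℝ) =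
          Int.fract (n' * α) - Int.fract (n * α) := by
        rw [Nat.cast_sub hlt.le, Int.fract, Int.fract]; push_cast; ring
      rw [h2, div_le_iff₀ (by positivity)] at h1
      have h3 := Nat.floor_le (hx0 n)
      have h4 := Nat.lt_floor_add_one (2 * r * Int.fract (n * α))
      have h5 := Nat.floor_le (hx0 n')
      have h6 := Nat.lt_floor_add_one (2 * r * Int.fract (n' * α))
      have h7 : (⌊2 * r * Int.fract (n * α)⌋₊ : ℝ) = ⌊2 * r * Int.fract (n' * α)⌋₊ :=
        congrArg (Nat.cast : ℕ → ℝ) hjj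
      have h8 : |Int.fract (n' * α) - Int.fract (n * α)| * (2 * r) < 1 := by
        rw [← abs_of_pos (show (0:ℝ) < 2 * r by positivity), ← abs_mul, abs_lt]
        constructor <;> linarith
      linarith
    intro n hn n' hn' h
    by_contra hne
    rcases Nat.lt_or_gt_of_ne hne with h1 | h1
    · exact key n hn n' hn' h1 h
    · exact key n' hn' n hn h1 h.symm
  have hpt : ∀ n ∈ T, kap Y (n * α) ≤ g (j n) + g (2 * r - 1 - j n) := by
    intro n _
    have hjn := hjlt n
    by_cases h0 : j n = 0
    · have : g (j n) = Y := by simp [hg, h0]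
      rw [this]
      linarith [kap_le hY (n * α), hg0 (2 * r - 1 - j n)]
    by_cases h1 : 2 * r - 1 - j n = 0
    · have : g (2 * r - 1 - j n) = Y := by simp [hg, h1]
      rw [this]
      linarith [kap_le hY (n * α), hg0 (j n)]
    have hj0 : (0:ℝ) < j n := by exact_mod_cast Nat.pos_of_ne_zero h0
    have hj1 : (0:ℝ) < (2 * r - 1 - j n : ℕ) := by exact_mod_cast Nat.pos_of_ne_zero h1
    have hx := two_mul_min_le_sin (Int.fract_nonneg (n * α)) (Int.fract_lt_one (n * α)).le
    rw [← abs_sin_pi_fract] at hx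
    have h3 := Nat.floor_le (hx0 n)
    have h4 := Nat.lt_floor_add_one (2 * r * Int.fract (n * α))
    have h5 : ((2 * r - 1 - j n : ℕ) : ℝ) = 2 * r - 1 - j n := by
      rw [Nat.cast_sub (by omega), Nat.cast_sub (by omega)]; push_cast; ring
    have h6 : (j n : ℝ) / r ≤ 2 * Int.fract (n * α) := by
      rw [div_le_iff₀ hr']; simp only [hj]; linarith
    have h7 : ((2 * r - 1 - j n : ℕ) : ℝ) / r ≤ 2 * (1 - Int.fract (n * α)) := by
      rw [div_le_iff₀ hr', h5]; simp only [hj]; linarith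
    rcases le_total (Int.fract (n * α)) (1 - Int.fract (n * α)) with h | h
    · rw [min_eq_left h] at hx
      have := kap_le_of_le (Y := Y) (div_pos hj0 hr') (h6.trans hx)
      have h8 : g (j n) = (j n / r : ℝ)⁻¹ := by simp [hg, h0]
      linarith [hg0 (2 * r - 1 - j n)]
    · rw [min_eq_right h] at hx
      have := kap_le_of_le (Y := Y) (div_pos hj1 hr') (h7.trans hx)
      have h8 : g (2 * r - 1 - j n) = (((2 * r - 1 - j n : ℕ) : ℝ) / r)⁻¹ := by
        simp only [hg, h1, if_false, inv_div]
      linarith [hg0 (j n)]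
  have hsum : ∑ i ∈ Finset.range (2 * r), g i ≤ Y + r * (1 + Real.log (2 * r)) := by
    obtain ⟨s, hs⟩ : ∃ s, 2 * r = s + 1 := ⟨2 * r - 1, by omega⟩
    rw [hs, Finset.sum_range_succ']
    have h1 : ∑ i ∈ Finset.range s, g (i + 1) = r * (harmonic s : ℝ) := by
      rw [harmonic, Rat.cast_sum, Finset.mul_sum]
      refine Finset.sum_congr rfl fun i _ => ?_
      simp [hg, div_eq_mul_inv]
    have h2 := harmonic_le_one_add_log s
    have h3 : Real.log s ≤ Real.log (2 * r) := by
      rcases Nat.eq_zero_or_pos s with rfl | hs0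
      · omega
      apply Real.log_le_log (by exact_mod_cast hs0)
      have : (s:ℝ) + 1 = 2 * r := by exact_mod_cast hs.symm
      linarith
    have h4 : g 0 = Y := by simp [hg]
    rw [h1, h4]
    nlinarith
  calc ∑ n ∈ T, kap Y (n * α) ≤ ∑ n ∈ T, (g (j n) + g (2 * r - 1 - j n)) := Finset.sum_le_sum hpt
    _ = ∑ i ∈ T.image j, (g i + g (2 * r - 1 - i)) := by rw [Finset.sum_image hinj]
    _ ≤ ∑ i ∈ Finset.range (2 * r), (g i + g (2 * r - 1 - i)) := by
        refine Finset.sum_le_sum_of_subset_of_nonneg ?_ fun i _ _ => add_nonneg (hg0 _) (hg0 _)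
        intro i hi
        obtain ⟨n, -, rfl⟩ := Finset.mem_image.1 hi
        exact Finset.mem_range.2 (hjlt n)
    _ = 2 * ∑ i ∈ Finset.range (2 * r), g i := by
        rw [Finset.sum_add_distrib, Finset.sum_range_reflect]; ring
    _ ≤ _ := by linarith

theorem sum_kap_le {α : ℝ} {r Y W : ℕ} {a : ℤ} (hr : 0 < r) (hY : 0 < Y) (har : IsCoprime a r)
    (hα : |α - a / r| ≤ 1 / (r:ℝ) ^ 2) :
    ∑ n ∈ Finset.Icc 1 W, kap Y (n * α) ≤
      (2 * W / r + 1) * (2 * Y + 2 * r * (1 + Real.log (2 * r))) := by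
  classical
  have hr' : (0:ℝ) < r := by exact_mod_cast hr
  have hlog : 0 ≤ Real.log (2 * r) := Real.log_nonneg (by
    have : (1:ℝ) ≤ r := by exact_mod_cast hr
    linarith)
  set l := r / 2 + 1 with hl
  rw [← Finset.sum_fiberwise_of_maps_to (s := Finset.Icc 1 W) (t := Finset.range (W / l + 1))
    (g := fun n => n / l) (fun n hn => by
      rw [Finset.mem_range]
      have := Nat.div_le_div_right (c := l) (Finset.mem_Icc.1 hn).2
      omega)]
  have h1 : ∀ i ∈ Finset.range (W / l + 1),
      ∑ n ∈ (Finset.Icc 1 W).filter (fun n => n / l = i), kap Y (n * α) ≤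
        2 * Y + 2 * r * (1 + Real.log (2 * r)) := by
    intro i _
    refine sum_kap_short_le hr hY har hα fun n hn n' hn' hlt => ?_
    have h2 := (Finset.mem_filter.1 hn).2
    have h3 := (Finset.mem_filter.1 hn').2
    have h4 := Nat.div_add_mod n l
    have h5 := Nat.div_add_mod n' l
    rw [h2] at h4
    rw [h3] at h5
    have h6 := Nat.mod_lt n' (show 0 < l by omega)
    omega
  refine (Finset.sum_le_card_nsmul _ _ _ h1).trans ?_
  rw [Finset.card_range, nsmul_eq_mul]
  refine mul_le_mul_of_nonneg_right ?_ (by positivity)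
  have h2 : ((W / l : ℕ) : ℝ) ≤ W / l := Nat.cast_div_le
  have h3 : (r:ℝ) / 2 ≤ l := by
    rw [div_le_iff₀ (by norm_num)]; exact_mod_cast (by omega : r ≤ l * 2)
  have h4 : (W:ℝ) / l ≤ W / (r / 2 : ℝ) := by gcongr
  have h5 : (W:ℝ) / (r / 2 : ℝ) = 2 * W / r := by field_simp
  push_cast
  linarith

/-- A majorant of the major arc contribution. -/
def Psi (Y : ℕ) (N : ℝ) (α : ℝ) : ℝ :=
  ∑ q ∈ Finset.Icc 1 Y, (1 / q : ℝ) *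
    ∑ a ∈ Finset.range q, (1 + N * |Real.sin (π * (α - a / q))|)⁻¹

theorem Psi_nonneg (Y : ℕ) {N : ℝ} (hN : 0 ≤ N) (α : ℝ) : 0 ≤ Psi Y N α := by
  unfold Psi; positivity

theorem continuous_Psi (Y : ℕ) {N : ℝ} (hN : 0 ≤ N) : Continuous (Psi Y N) := by
  unfold Psi
  refine continuous_finsetSum _ fun q _ => continuous_const.mul
    (continuous_finsetSum _ fun a _ => Continuous.inv₀ (by fun_prop) fun α => ?_)
  positivity

theorem le_Psi {Y : ℕ} {N : ℝ} (hN : 0 ≤ N) {q : ℕ} (hq : 0 < q) (hqY : q ≤ Y) (a : ℤ) (α : ℝ) :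
    (1 / q : ℝ) * (1 + N * (π * (|q * α - a| / q)))⁻¹ ≤ Psi Y N α := by
  have hq' : (0:ℝ) < q := by exact_mod_cast hq
  have hqZ : (0:ℤ) < q := by exact_mod_cast hq
  obtain ⟨a', ha'⟩ : ∃ a' : ℕ, (a' : ℤ) = a % q :=
    ⟨(a % q).toNat, Int.toNat_of_nonneg (Int.emod_nonneg _ hqZ.ne')⟩
  have ha'q : a' ∈ Finset.range q := by
    rw [Finset.mem_range]
    have := Int.emod_lt_of_pos a hqZ
    omega
  have hdiv : (a : ℝ) = q * (a / (q:ℤ) : ℤ) + a' := by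
    have := Int.mul_ediv_add_emod a q
    rw [← ha'] at this
    exact_mod_cast this.symm
  have h1 : |Real.sin (π * (α - a' / q))| ≤ π * (|q * α - a| / q) := by
    refine (abs_sin_pi_le _ (a / (q:ℤ))).trans (le_of_eq ?_)
    rw [← abs_of_pos hq', ← abs_div, abs_of_pos hq']
    congr 2
    rw [hdiv]; field_simp; ring
  unfold Psi
  refine le_trans ?_ (Finset.single_le_sum (f := fun q : ℕ => (1 / q : ℝ) *
    ∑ a ∈ Finset.range q, (1 + N * |Real.sin (π * (α - a / q))|)⁻¹)
    (fun i _ => by positivity) (Finset.mem_Icc.2 ⟨hq, hqY⟩))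
  refine mul_le_mul_of_nonneg_left ?_ (by positivity)
  refine le_trans ?_ (Finset.single_le_sum (f := fun a : ℕ =>
    (1 + N * |Real.sin (π * (α - a / q))|)⁻¹) (fun i _ => by positivity) ha'q)
  apply inv_anti₀ (by positivity)
  have := mul_le_mul_of_nonneg_left h1 hN
  linarith

theorem exists_dirichlet (α : ℝ) {n : ℕ} (hn : 0 < n) :
    ∃ (a : ℤ) (q : ℕ), 0 < q ∧ q ≤ n ∧ IsCoprime a (q:ℤ) ∧ |q * α - a| ≤ 1 / ((n:ℝ) + 1) := by
  obtain ⟨x, hx, hxn⟩ := Real.exists_rat_abs_sub_le_and_den_le α hn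
  refine ⟨x.num, x.den, x.den_pos, hxn, ?_, ?_⟩
  · exact Int.isCoprime_iff_gcd_eq_one.2 (by simpa [Int.gcd] using x.reduced)
  · have hd : (0:ℝ) < x.den := by exact_mod_cast x.den_pos
    rw [le_div_iff₀ (by positivity)] at hx
    rw [le_div_iff₀ (by positivity)]
    have h1 : |(x.den:ℝ) * α - x.num| = |α - x| * x.den := by
      rw [← abs_of_pos hd, ← abs_mul, abs_of_pos hd]
      congr 1
      have : (x:ℝ) * x.den = x.num := by exact_mod_cast Rat.mul_den_eq_num x
      rw [sub_mul, this]; ring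
    rw [h1]; linarith

theorem sum_kap_dirichlet_le {α : ℝ} {r Y W n : ℕ} {a : ℤ} {L : ℝ} (hr : 0 < r) (hrn : r ≤ n)
    (hY : 0 < Y)
    (har : IsCoprime a r) (hα : |r * α - a| ≤ 1 / ((n:ℝ) + 1)) (hL : 1 + Real.log (2 * r) ≤ L) :
    ∑ n ∈ Finset.Icc 1 W, kap Y (n * α) ≤ (2 * W / r + 1) * (2 * Y + 2 * r * L) := by
  have hr' : (0:ℝ) < r := by exact_mod_cast hr
  refine (sum_kap_le (a := a) hr hY har ?_).trans (by gcongr)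
  have h1 : |α - a / r| = |r * α - a| / r := by
    rw [← abs_of_pos hr', ← abs_div, abs_of_pos hr']; congr 1; field_simp
  have h2 : 1 / ((n:ℝ) + 1) ≤ 1 / r := by
    apply one_div_le_one_div_of_le hr'
    have : (r:ℝ) ≤ n := by exact_mod_cast hrn
    linarith
  rw [h1, div_le_iff₀ hr']
  calc _ ≤ 1 / (r:ℝ) := hα.trans h2
    _ = _ := by field_simp

set_option maxHeartbeats 1000000 in
theorem sum_kap_le_Psi (α : ℝ) {Y V : ℕ} (hY : 0 < Y) (hYV : Y ≤ V) :
    ∑ n ∈ Finset.Icc 1 (24 * V), kap Y (n * α) ≤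
      1000 * (1 + Real.log (6 * (V * Y))) * (V + V * Y * Psi Y (V * Y) α) := by
  have hV : 0 < V := hY.trans_le hYV
  have hY1 : (1:ℝ) ≤ Y := by exact_mod_cast hY
  have hYV' : (Y:ℝ) ≤ V := by exact_mod_cast hYV
  have hV1 : (1:ℝ) ≤ V := hY1.trans hYV'
  set L := 1 + Real.log (6 * (V * Y)) with hLdef
  set N : ℝ := V * Y with hN
  have hN1 : 1 ≤ N := by rw [hN]; nlinarith
  have hVN : (V:ℝ) ≤ N := by rw [hN]; nlinarith
  have hL1 : 1 ≤ L := by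
    have := Real.log_nonneg (show (1:ℝ) ≤ 6 * N by linarith)
    rw [hLdef]; linarith
  have hLr : ∀ r : ℕ, 0 < r → (r:ℝ) ≤ 3 * N → 1 + Real.log (2 * r) ≤ L := by
    intro r hr hrN
    have : Real.log (2 * r) ≤ Real.log (6 * N) := Real.log_le_log (by positivity) (by linarith)
    rw [hLdef]; linarith
  have hPsi := Psi_nonneg Y (show 0 ≤ N by linarith) α
  obtain ⟨a, q, hq, hqV, hcop, hqα⟩ := exists_dirichlet α hV
  have hq' : (0:ℝ) < q := by exact_mod_cast hq
  have hq1 : (1:ℝ) ≤ q := by exact_mod_cast hq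
  have hqV' : (q:ℝ) ≤ V := by exact_mod_cast hqV
  have hdir := sum_kap_dirichlet_le (W := 24 * V) hq hqV hY hcop hqα
    (hLr q hq (by linarith))
  push_cast at hdir
  rcases lt_or_ge Y q with hYq | hqY
  · have hYq' : (Y:ℝ) ≤ q := by exact_mod_cast hYq.le
    have h1 : (2 * (24 * V) / q + 1 : ℝ) * (2 * Y + 2 * q * L) ≤ 200 * V * L := by
      have h2 : (2 * (24 * V) / q + 1 : ℝ) ≤ 49 * V / q := by
        rw [div_add_one hq'.ne']; gcongr; linarith
      have h3 : (2 * Y + 2 * q * L : ℝ) ≤ 4 * q * L := by nlinarith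
      calc _ ≤ (49 * V / q : ℝ) * (4 * q * L) := by gcongr
        _ = 196 * (V * L) := by field_simp; ring
        _ ≤ _ := by nlinarith [mul_pos (show (0:ℝ) < V by linarith) (show (0:ℝ) < L by linarith)]
    have h4 : 0 ≤ N * Psi Y N α := by positivity
    have h5 : 0 ≤ L * (N * Psi Y N α) := by positivity
    have h6 : 0 ≤ L * (V : ℝ) := by positivity
    nlinarith
  have hqY' : (q:ℝ) ≤ Y := by exact_mod_cast hqY
  set β := |q * α - a| with hβ
  have hlow := le_Psi (show 0 ≤ N by linarith) hq hqY a α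
  rw [← hβ] at hlow
  have hπ : π ≤ 4 := Real.pi_le_four
  rcases le_or_gt (β * N) q with hβ1 | hβ1
  · have h1 : (1 / q : ℝ) * (1 / 5) ≤ Psi Y N α := by
      refine le_trans ?_ hlow
      refine mul_le_mul_of_nonneg_left ?_ (by positivity)
      rw [one_div]
      apply inv_anti₀ (by positivity)
      have : N * (π * (β / q)) = π * (β * N / q) := by ring
      rw [this]
      have : β * N / q ≤ 1 := by rw [div_le_one hq']; exact hβ1
      have h0 : 0 ≤ β * N / q := by positivity
      nlinarith
    have h2 : (2 * (24 * V) / q + 1 : ℝ) ≤ 49 * V / q := by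
      rw [div_add_one hq'.ne']; gcongr; linarith
    have h3 : (2 * Y + 2 * q * L : ℝ) ≤ 4 * Y * L := by nlinarith
    calc _ ≤ _ := hdir
      _ ≤ (49 * V / q : ℝ) * (4 * Y * L) := by gcongr
      _ = 980 * (L * (N * ((1 / q : ℝ) * (1 / 5)))) := by rw [hN]; field_simp; norm_num
      _ ≤ 980 * (L * (N * Psi Y N α)) := by gcongr
      _ ≤ 1000 * (L * (V + N * Psi Y N α)) := by gcongr <;> linarith
      _ = _ := by ring
  · have hβ0 : 0 < β := by
      by_contra h
      have : β * N ≤ 0 := mul_nonpos_of_nonpos_of_nonneg (not_lt.1 h) (by linarith)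
      linarith
    have hβV : β * V ≤ 1 := by
      rw [le_div_iff₀ (by positivity)] at hqα; nlinarith
    have hβ1' : β ≤ 1 := by nlinarith
    have h1 : 1 / (5 * (N * β)) ≤ Psi Y N α := by
      refine le_trans ?_ hlow
      rw [← one_div, ← one_div_mul_one_div_rev, one_div_mul_one_div_rev, one_div_mul_one_div_rev]
      apply one_div_le_one_div_of_le (by positivity)
      have : (1 + N * (π * (β / q))) * q = q + N * π * β := by field_simp
      rw [this]
      have := mul_le_mul_of_nonneg_left hπ (show 0 ≤ N * β by positivity)
      nlinarith
    obtain ⟨b, r, hr, hrK, hcop', hrα⟩ := exists_dirichlet α (n := ⌈2 / β⌉₊)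
      (Nat.ceil_pos.2 (by positivity))
    set K := ⌈2 / β⌉₊ with hK
    have hr' : (0:ℝ) < r := by exact_mod_cast hr
    have hK1 : 2 / β ≤ K := Nat.le_ceil _
    have hK2 : (K:ℝ) < 2 / β + 1 := Nat.ceil_lt_add_one (by positivity)
    have hsmall : |r * α - b| < β / 2 := by
      refine hrα.trans_lt ?_
      rw [div_lt_iff₀ (by positivity)]
      rw [div_le_iff₀ hβ0] at hK1
      nlinarith
    have hr3 : (r:ℝ) * β ≤ 3 := by
      have h2 : (r:ℝ) ≤ K := by exact_mod_cast hrK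
      have h3 : (K:ℝ) * β < (2 / β + 1) * β := by gcongr
      have h4 : (2 / β + 1) * β = 2 + β := by field_simp
      nlinarith
    have hr2 : 1 / 2 ≤ (r:ℝ) * β := by
      have hne : q * b - r * a ≠ 0 := by
        intro h0
        have e1 : (q:ℤ) ∣ r := by
          have : (q:ℤ) ∣ r * a := ⟨b, by linarith⟩
          exact hcop.symm.dvd_of_dvd_mul_right this
        have e2 : (r:ℤ) ∣ q := by
          have : (r:ℤ) ∣ q * b := ⟨a, by linarith⟩
          exact hcop'.symm.dvd_of_dvd_mul_right this
        have e3 : q = r := Nat.dvd_antisymm (Int.natCast_dvd_natCast.1 e1)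
          (Int.natCast_dvd_natCast.1 e2)
        subst e3
        have e4 : b = a := by
          have : (q:ℤ) * b = q * a := by linarith
          exact mul_left_cancel₀ (by exact_mod_cast hq.ne') this
        subst e4
        rw [← hβ] at hsmall
        linarith
      have h2 : (1:ℝ) ≤ |(q * b - r * a : ℤ)| := by exact_mod_cast Int.one_le_abs hne
      have h3 : ((q * b - r * a : ℤ) : ℝ) = r * (q * α - a) - q * (r * α - b) := by
        push_cast; ring
      rw [Int.cast_abs, h3] at h2
      have h4 := abs_sub (r * (q * α - a) : ℝ) (q * (r * α - b))
      rw [abs_mul, abs_mul, Nat.abs_cast, Nat.abs_cast, ← hβ] at h4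
      have h5 : (q:ℝ) * |r * α - b| ≤ q * (β / 2) := by gcongr
      have h6 : (q:ℝ) * β ≤ 1 := by nlinarith
      linarith
    have hrN : (r:ℝ) ≤ 3 * N := by nlinarith
    have hdir2 := sum_kap_dirichlet_le (W := 24 * V) hr hrK hY hcop' hrα (hLr r hr hrN)
    push_cast at hdir2
    have h2 : (1:ℝ) / r ≤ 2 * β := by rw [div_le_iff₀ hr']; linarith
    have h3 : (r:ℝ) ≤ 15 * (N * Psi Y N α) := by
      have : N * (1 / (5 * (N * β))) ≤ N * Psi Y N α := by gcongr
      have h5 : N * (1 / (5 * (N * β))) = 1 / (5 * β) := by field_simp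
      rw [h5] at this
      have h6 : (r:ℝ) ≤ 3 / β := by rw [le_div_iff₀ hβ0]; exact hr3
      have h7 : 3 / β = 15 * (1 / (5 * β)) := by field_simp; norm_num
      linarith
    have h4 : (2 * (24 * V) / r + 1 : ℝ) * (2 * Y + 2 * r * L) =
        96 * V * Y * (1 / r) + 96 * V * L + 2 * Y + 2 * r * L := by field_simp; ring
    rw [h4] at hdir2
    have h5 : (V:ℝ) * Y * (1 / r) ≤ V * Y * (2 * β) := by gcongr
    have h6 : (V:ℝ) * Y * (2 * β) ≤ 2 * V := by nlinarith
    have h7 : (V:ℝ) ≤ V * L := by nlinarith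
    have h8 : (r:ℝ) * L ≤ 15 * (N * Psi Y N α) * L := by gcongr
    have h9 : 0 ≤ L * (N * Psi Y N α) := by positivity
    nlinarith

/-! ### Weyl's inequality for the differenced sum -/

theorem norm_sq_inner_le {m k l J Y : ℕ} (hJ : J ≤ Y) (hY : 0 < Y) (α : ℝ) :
    ‖∑ y ∈ Finset.Icc 1 J, e (diffPoly₂ m k l y * α)‖ ^ 2 ≤
      Y + 2 * ∑ l' ∈ Finset.Icc 1 Y, kap Y ((24 * k * l * l' : ℕ) * α) := by
  rw [norm_sq_sum_e (fun y => diffPoly₂ m k l y * α) hJ]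
  have hJ' : (J:ℝ) ≤ Y := by exact_mod_cast hJ
  refine add_le_add hJ' (mul_le_mul_of_nonneg_left ?_ (by norm_num))
  rw [Complex.re_sum]
  refine Finset.sum_le_sum fun l' _ => (Complex.re_le_norm _).trans ?_
  have h1 : ∀ y : ℕ, ((diffPoly₂ m k l (y + l') : ℤ) : ℝ) * α - (diffPoly₂ m k l y : ℤ) * α =
      y * ((24 * k * l * l' : ℕ) * α) +
        12 * k * l * l' * (l' + k * m ^ 4 + l) * α := by
    intro y
    rw [diffPoly₂_eq, diffPoly₂_eq]; push_cast; ring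
  simp only [h1]
  exact norm_sum_e_linear_le (by omega) hY _ _

theorem sum_kap_triple_le {H Y D : ℕ}
    (hD : ∀ n : ℕ, n ≠ 0 → n ≤ 24 * (H * Y ^ 2) → n.divisors.card ≤ D) (α : ℝ) :
    ∑ k ∈ Finset.Icc 1 H, ∑ l ∈ Finset.Icc 1 Y, ∑ l' ∈ Finset.Icc 1 Y,
        kap Y ((24 * k * l * l' : ℕ) * α) ≤
      D ^ 2 * ∑ n ∈ Finset.Icc 1 (24 * (H * Y ^ 2)), kap Y ((n : ℕ) * α) := by
  classical
  set T := Finset.Icc 1 H ×ˢ Finset.Icc 1 Y ×ˢ Finset.Icc 1 Y with hT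
  have h1 : ∑ k ∈ Finset.Icc 1 H, ∑ l ∈ Finset.Icc 1 Y, ∑ l' ∈ Finset.Icc 1 Y,
        kap Y ((24 * k * l * l' : ℕ) * α) =
      ∑ t ∈ T, kap Y ((24 * t.1 * t.2.1 * t.2.2 : ℕ) * α) := by
    rw [hT, Finset.sum_product]
    refine Finset.sum_congr rfl fun k _ => ?_
    rw [Finset.sum_product]
  have hmem : ∀ t ∈ T, (1 ≤ t.1 ∧ t.1 ≤ H) ∧ (1 ≤ t.2.1 ∧ t.2.1 ≤ Y) ∧ (1 ≤ t.2.2 ∧ t.2.2 ≤ Y) := by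
    intro t ht
    simpa [hT, Finset.mem_product] using ht
  rw [h1, ← Finset.sum_fiberwise_of_maps_to (t := Finset.Icc 1 (24 * (H * Y ^ 2)))
    (g := fun t : ℕ × ℕ × ℕ => 24 * t.1 * t.2.1 * t.2.2), Finset.mul_sum]
  · refine Finset.sum_le_sum fun n hn => ?_
    obtain ⟨hn1, hn2⟩ := Finset.mem_Icc.1 hn
    have h2 : ∀ t ∈ T.filter (fun t => 24 * t.1 * t.2.1 * t.2.2 = n),
        kap Y ((24 * t.1 * t.2.1 * t.2.2 : ℕ) * α) = kap Y (n * α) := by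
      intro t ht; rw [(Finset.mem_filter.1 ht).2]
    rw [Finset.sum_congr rfl h2, Finset.sum_const, nsmul_eq_mul]
    refine mul_le_mul_of_nonneg_right ?_ (kap_nonneg _ _)
    have h3 : (T.filter (fun t => 24 * t.1 * t.2.1 * t.2.2 = n)).card ≤
        (n.divisors ×ˢ n.divisors).card := by
      refine Finset.card_le_card_of_injOn (fun t => (t.1, t.2.1)) ?_ ?_
      · intro t ht
        have := (Finset.mem_filter.1 ht).2
        simp only [Finset.coe_product, Set.mem_prod, Finset.mem_coe, Nat.mem_divisors]
        exact ⟨⟨⟨24 * t.2.1 * t.2.2, by rw [← this]; ring⟩, by omega⟩,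
          ⟨24 * t.1 * t.2.2, by rw [← this]; ring⟩, by omega⟩
      · rintro ⟨k, l, l'⟩ ht ⟨k₂, l₂, l₂'⟩ hu htu
        obtain ⟨hT1, h4⟩ := Finset.mem_filter.1 ht
        obtain ⟨hU1, h5⟩ := Finset.mem_filter.1 hu
        obtain ⟨h6, h7, -⟩ := hmem _ hT1
        simp only [Prod.mk.injEq] at htu h4 h5 h6 h7 ⊢
        obtain ⟨rfl, rfl⟩ := htu
        refine ⟨rfl, rfl, ?_⟩
        have h8 : 0 < 24 * k * l := by
          have := h6.1; have := h7.1; positivity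
        exact Nat.eq_of_mul_eq_mul_left h8 (h4.trans h5.symm)
    rw [Finset.card_product] at h3
    have h4 := hD n (by omega) hn2
    have : (T.filter (fun t => 24 * t.1 * t.2.1 * t.2.2 = n)).card ≤ D ^ 2 :=
      h3.trans (by rw [sq]; gcongr)
    exact_mod_cast this
  · intro t ht
    obtain ⟨⟨h2, h3⟩, ⟨h4, h5⟩, h6, h7⟩ := hmem t ht
    rw [Finset.mem_Icc]
    constructor
    · have : 0 < 24 * t.1 * t.2.1 * t.2.2 := by positivity
      omega
    · calc 24 * t.1 * t.2.1 * t.2.2 ≤ 24 * H * Y * Y := by gcongr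
        _ = _ := by ring

theorem norm_diffSum₂_sq_le {𝓜 : Finset ℕ} {H Y D : ℕ} (hY : 0 < Y)
    (hH : ∀ b ∈ diffBase 𝓜 Y, b.2 ≤ H)
    (hD : ∀ n : ℕ, n ≠ 0 → n ≤ 24 * (H * Y ^ 2) → n.divisors.card ≤ D) (α : ℝ) :
    ‖diffSum₂ 𝓜 Y α‖ ^ 2 ≤ ((diffBase 𝓜 Y).card * Y) * ((diffBase 𝓜 Y).card * Y * Y +
      2 * (𝓜.card * (D ^ 2 * ∑ n ∈ Finset.Icc 1 (24 * (H * Y ^ 2)), kap Y ((n : ℕ) * α)))) := by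
  rw [diffSum₂, trig, diffIdx₂, Finset.sum_sigma]
  refine (pow_le_pow_left₀ (norm_nonneg _) (norm_sum_le _ _) 2).trans ?_
  refine (sq_sum_le_card_mul_sum_sq).trans ?_
  have hcard : ((diffBase 𝓜 Y ×ˢ Finset.Icc 1 Y).card : ℝ) = (diffBase 𝓜 Y).card * Y := by
    rw [Finset.card_product]; simp
  rw [hcard]
  refine mul_le_mul_of_nonneg_left ?_ (by positivity)
  have h1 : ∀ b ∈ diffBase 𝓜 Y ×ˢ Finset.Icc 1 Y,
      ‖∑ y ∈ Finset.Icc 1 (Y - b.1.2 * b.1.1 ^ 4 - b.2),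
        e (diffPoly₂ b.1.1 b.1.2 b.2 y * α)‖ ^ 2 ≤
      Y + 2 * ∑ l' ∈ Finset.Icc 1 Y, kap Y ((24 * b.1.2 * b.2 * l' : ℕ) * α) := by
    intro b _
    exact norm_sq_inner_le (by omega) hY α
  refine (Finset.sum_le_sum h1).trans ?_
  rw [Finset.sum_add_distrib, Finset.sum_const, nsmul_eq_mul, hcard, ← Finset.mul_sum]
  refine add_le_add le_rfl (mul_le_mul_of_nonneg_left ?_ (by norm_num))
  rw [Finset.sum_product]
  have hsub : diffBase 𝓜 Y ⊆ 𝓜 ×ˢ Finset.Icc 1 H := by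
    intro b hb
    obtain ⟨h2, h3, -⟩ := mem_diffBase.1 hb
    exact Finset.mem_product.2 ⟨h2, Finset.mem_Icc.2 ⟨h3, hH b hb⟩⟩
  refine (Finset.sum_le_sum_of_subset_of_nonneg hsub fun b _ _ =>
    Finset.sum_nonneg fun l _ => Finset.sum_nonneg fun l' _ => kap_nonneg _ _).trans ?_
  rw [Finset.sum_product]
  dsimp only
  rw [Finset.sum_const, nsmul_eq_mul]
  exact mul_le_mul_of_nonneg_left (sum_kap_triple_le hD α) (by positivity)

set_option maxHeartbeats 1000000 in
theorem norm_diffSum_pow_four_le {𝓜 : Finset ℕ} {H Y D : ℕ} (hY : 0 < Y) (hH0 : 0 < H)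
    (hH : ∀ b ∈ diffBase 𝓜 Y, b.2 ≤ H)
    (hD : ∀ n : ℕ, n ≠ 0 → n ≤ 24 * (H * Y ^ 2) → n.divisors.card ≤ D) (α : ℝ) :
    ‖diffSum 𝓜 Y α‖ ^ 4 ≤ 20000 * (D ^ 2 * (1 + Real.log (6 * (H * Y ^ 3)))) *
      ((𝓜.card * H) ^ 4 * Y ^ 3 * (1 + Y * Psi Y (H * Y ^ 3) α)) := by
  have hY1 : (1:ℝ) ≤ Y := by exact_mod_cast hY
  have hH1 : (1:ℝ) ≤ H := by exact_mod_cast hH0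
  have hD1 : (1:ℝ) ≤ D := by
    have := hD 1 one_ne_zero (by
      have : 0 < H * Y ^ 2 := by positivity
      omega)
    exact_mod_cast (by simpa using this : 1 ≤ D)
  set B : ℝ := ((diffBase 𝓜 Y).card : ℝ) with hB
  set M : ℝ := (𝓜.card : ℝ) with hM
  have hM0 : 0 ≤ M := by positivity
  have hB0 : 0 ≤ B := by positivity
  have hBA : B ≤ M * H := by
    have hsub : diffBase 𝓜 Y ⊆ 𝓜 ×ˢ Finset.Icc 1 H := by
      intro b hb
      obtain ⟨h2, h3, -⟩ := mem_diffBase.1 hb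
      exact Finset.mem_product.2 ⟨h2, Finset.mem_Icc.2 ⟨h3, hH b hb⟩⟩
    have := Finset.card_le_card hsub
    rw [Finset.card_product, Nat.card_Icc, Nat.add_sub_cancel] at this
    rw [hB, hM]; exact_mod_cast this
  have hS := sum_kap_le_Psi α (V := H * Y ^ 2) hY (by
    calc Y = 1 * Y ^ 1 := by ring
      _ ≤ H * Y ^ 2 := Nat.mul_le_mul hH0 (Nat.pow_le_pow_right hY (by norm_num)))
  push_cast at hS
  have hHY : (H:ℝ) * (Y:ℝ) ^ 2 * Y = H * Y ^ 3 := by ring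
  rw [hHY] at hS
  set Ψ := Psi Y (H * Y ^ 3) α with hΨ
  have hΨ0 : 0 ≤ Ψ := Psi_nonneg _ (by positivity) _
  set L := 1 + Real.log (6 * (H * (Y:ℝ) ^ 3)) with hL
  have hL1 : 1 ≤ L := by
    have := Real.log_nonneg (show (1:ℝ) ≤ 6 * (H * (Y:ℝ) ^ 3) by
      have : (1:ℝ) ≤ H * (Y:ℝ) ^ 3 := one_le_mul_of_one_le_of_one_le hH1 (one_le_pow₀ hY1)
      linarith)
    rw [hL]; linarith
  have h2 := norm_diffSum₂_sq_le hY hH hD α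
  have h3 := norm_diffSum_sq_le 𝓜 Y α
  rw [← hB] at h2 h3
  rw [← hM] at h2
  set A := M * H with hA
  have hA0 : 0 ≤ A := by positivity
  have hE1 : 1 ≤ D ^ 2 * L := one_le_mul_of_one_le_of_one_le (one_le_pow₀ hD1) hL1
  set E := D ^ 2 * L with hE
  set G := 1 + Y * Ψ with hG
  have hG1 : 1 ≤ G := by
    have : 0 ≤ Y * Ψ := by positivity
    rw [hG]; linarith
  have hEG : 1 ≤ E * G := one_le_mul_of_one_le_of_one_le hE1 hG1
  have hS0 : 0 ≤ ∑ n ∈ Finset.Icc 1 (24 * (H * Y ^ 2)), kap Y ((n : ℕ) * α) :=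
    Finset.sum_nonneg fun n _ => kap_nonneg _ _
  have h4 : ‖diffSum₂ 𝓜 Y α‖ ^ 2 ≤ 2001 * (A ^ 2 * Y ^ 3 * (E * G)) := by
    calc _ ≤ _ := h2
      _ ≤ (A * Y) * (A * Y * Y + 2 * (M * (D ^ 2 *
          (1000 * L * (H * Y ^ 2 + H * Y ^ 3 * Ψ))))) := by gcongr
      _ = A ^ 2 * Y ^ 3 * 1 + 2000 * (A ^ 2 * Y ^ 3 * (E * G)) := by
          rw [hA, hE, hG]; ring
      _ ≤ A ^ 2 * Y ^ 3 * (E * G) + 2000 * (A ^ 2 * Y ^ 3 * (E * G)) := by gcongr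
      _ = _ := by ring
  have h5 : ‖diffSum 𝓜 Y α‖ ^ 2 ≤ A * (A * Y + 2 * ‖diffSum₂ 𝓜 Y α‖) := by
    refine h3.trans ?_
    have := Complex.re_le_norm (diffSum₂ 𝓜 Y α)
    have h6 : B * Y + 2 * (diffSum₂ 𝓜 Y α).re ≤ A * Y + 2 * ‖diffSum₂ 𝓜 Y α‖ := by
      have : B * Y ≤ A * Y := by gcongr
      linarith
    calc _ ≤ B * (A * Y + 2 * ‖diffSum₂ 𝓜 Y α‖) := by gcongr
      _ ≤ _ := by gcongr
  have h7 : ‖diffSum 𝓜 Y α‖ ^ 4 ≤ (A * (A * Y + 2 * ‖diffSum₂ 𝓜 Y α‖)) ^ 2 := by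
    calc ‖diffSum 𝓜 Y α‖ ^ 4 = (‖diffSum 𝓜 Y α‖ ^ 2) ^ 2 := by ring
      _ ≤ _ := by gcongr
  refine h7.trans ?_
  have h8 : (A * (A * Y + 2 * ‖diffSum₂ 𝓜 Y α‖)) ^ 2 ≤
      A ^ 2 * (2 * (A * Y) ^ 2 + 8 * ‖diffSum₂ 𝓜 Y α‖ ^ 2) := by
    rw [mul_pow]
    gcongr
    nlinarith [sq_nonneg (A * Y - 2 * ‖diffSum₂ 𝓜 Y α‖)]
  refine h8.trans ?_
  calc A ^ 2 * (2 * (A * Y) ^ 2 + 8 * ‖diffSum₂ 𝓜 Y α‖ ^ 2)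
      ≤ A ^ 2 * (2 * (A * Y) ^ 2 + 8 * (2001 * (A ^ 2 * Y ^ 3 * (E * G)))) := by gcongr
    _ = 2 * (A ^ 4 * Y ^ 2 * 1) + 16008 * (A ^ 4 * Y ^ 3 * (E * G)) := by ring
    _ ≤ 2 * (A ^ 4 * Y ^ 3 * (E * G)) + 16008 * (A ^ 4 * Y ^ 3 * (E * G)) := by
        gcongr
        norm_num
    _ ≤ 20000 * (A ^ 4 * Y ^ 3 * (E * G)) := by
        have : 0 ≤ A ^ 4 * Y ^ 3 * (E * G) := by positivity
        linarith
    _ = _ := by rw [hE]; ring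

/-! ### Mean values against the major arc majorant -/

theorem e_eq_one_iff (x : ℝ) : e x = 1 ↔ ∃ n : ℤ, x = n := by
  rw [e, Complex.exp_eq_one_iff]
  constructor
  · rintro ⟨n, hn⟩
    refine ⟨n, ?_⟩
    have h1 : (2 * π * Complex.I : ℂ) ≠ 0 := Complex.two_pi_I_ne_zero
    have h2 : (x : ℂ) = n := by
      apply mul_left_cancel₀ h1
      rw [hn]; ring
    exact_mod_cast h2
  · rintro ⟨n, rfl⟩
    exact ⟨n, by push_cast; ring⟩

theorem e_nat_mul (k : ℕ) (x : ℝ) : e (k * x) = e x ^ k := by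
  induction k with
  | zero => simp [e_zero]
  | succ k ih => rw [pow_succ, ← ih, ← e_add]; push_cast; ring_nf

theorem sum_range_e_div {q : ℕ} (hq : 0 < q) (n : ℤ) :
    ∑ a ∈ Finset.range q, e (n * (a / q : ℝ)) = if (q : ℤ) ∣ n then (q : ℂ) else 0 := by
  have hq' : (q:ℝ) ≠ 0 := by exact_mod_cast hq.ne'
  have h1 : ∀ a : ℕ, e (n * (a / q : ℝ)) = e (n / q) ^ a := by
    intro a; rw [← e_nat_mul]; ring_nf
  simp only [h1]
  split_ifs with h
  · obtain ⟨k, rfl⟩ := h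
    have : e (((q * k : ℤ) : ℝ) / q) = 1 := by
      rw [e_eq_one_iff]; exact ⟨k, by push_cast; field_simp⟩
    rw [this]; simp
  · rw [geom_sum_eq]
    · have : e ((n:ℝ) / q) ^ q = 1 := by
        rw [← e_nat_mul, e_eq_one_iff]; exact ⟨n, by field_simp⟩
      rw [this]; simp
    · intro h2
      rw [e_eq_one_iff] at h2
      obtain ⟨k, hk⟩ := h2
      apply h
      refine ⟨k, ?_⟩
      rw [div_eq_iff hq'] at hk
      have : n = k * q := by exact_mod_cast hk
      rw [this]; ring

theorem integral_inv_one_add_sin_le {N : ℝ} (hN : 0 < N) :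
    ∫ α in (0:ℝ)..1, (1 + N * |Real.sin (π * α)|)⁻¹ ≤ Real.log (1 + N) / N := by
  have hc : Continuous fun α : ℝ => (1 + N * |Real.sin (π * α)|)⁻¹ :=
    Continuous.inv₀ (by fun_prop) fun α => by positivity
  have hhalf : ∫ α in (0:ℝ)..(1/2), (1 + N * |Real.sin (π * α)|)⁻¹ ≤
      Real.log (1 + N) / (2 * N) := by
    have hd : ∀ x ∈ Set.uIcc (0:ℝ) (1/2),
        HasDerivAt (fun x => Real.log (1 + 2 * N * x) / (2 * N)) ((1 + 2 * N * x)⁻¹) x := by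
      intro x hx
      rw [Set.uIcc_of_le (by norm_num)] at hx
      have hpos : 0 < 1 + 2 * N * x := by have := hx.1; positivity
      have h1 : HasDerivAt (fun x : ℝ => 1 + 2 * N * x) (2 * N) x := by
        simpa using ((hasDerivAt_id x).const_mul (2 * N)).const_add 1
      have h2 := (h1.log hpos.ne').div_const (2 * N)
      rwa [div_right_comm, div_self (by positivity), one_div] at h2
    have hcont : ContinuousOn (fun x : ℝ => (1 + 2 * N * x)⁻¹) (Set.uIcc 0 (1/2)) := by
      rw [Set.uIcc_of_le (by norm_num)]
      refine ContinuousOn.inv₀ (by fun_prop) fun x hx => ?_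
      have := hx.1; positivity
    have h3 := intervalIntegral.integral_eq_sub_of_hasDerivAt hd hcont.intervalIntegrable
    have h4 : ∫ α in (0:ℝ)..(1/2), (1 + N * |Real.sin (π * α)|)⁻¹ ≤
        ∫ α in (0:ℝ)..(1/2), (1 + 2 * N * α)⁻¹ := by
      refine intervalIntegral.integral_mono_on (by norm_num) (hc.intervalIntegrable _ _)
        hcont.intervalIntegrable fun x hx => ?_
      obtain ⟨hx0, hx1⟩ := hx
      apply inv_anti₀ (by positivity)
      have h5 := two_mul_min_le_sin hx0 (by linarith)
      rw [min_eq_left (by linarith)] at h5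
      have h6 := h5.trans (le_abs_self _)
      nlinarith
    rw [h3] at h4
    refine h4.trans (le_of_eq ?_)
    have : 1 + 2 * N * (1 / 2) = 1 + N := by ring
    rw [this]; simp
  have hsymm : ∫ α in (1/2:ℝ)..1, (1 + N * |Real.sin (π * α)|)⁻¹ =
      ∫ α in (0:ℝ)..(1/2), (1 + N * |Real.sin (π * α)|)⁻¹ := by
    have := intervalIntegral.integral_comp_sub_left (a := (0:ℝ)) (b := 1/2)
      (fun α : ℝ => (1 + N * |Real.sin (π * α)|)⁻¹) 1
    norm_num at this
    norm_num
    rw [← this]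
    refine intervalIntegral.integral_congr fun x _ => ?_
    have : π * (1 - x) = π - π * x := by ring
    rw [this, Real.sin_pi_sub]
  rw [← intervalIntegral.integral_add_adjacent_intervals (hc.intervalIntegrable 0 (1/2))
    (hc.intervalIntegrable _ _), hsymm]
  have : Real.log (1 + N) / N = 2 * (Real.log (1 + N) / (2 * N)) := by field_simp
  linarith

theorem sum_norm_sq_shift_le {ι : Type*} (s : Finset ι) (n : ι → ℤ) (a : ι → ℂ)
    (ha : ∀ i ∈ s, ‖a i‖ ≤ 1) {q : ℕ} (hq : 0 < q) (α : ℝ) :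
    (1 / q : ℝ) * ∑ c ∈ Finset.range q, ‖∑ i ∈ s, a i * e (n i * (α + c / q))‖ ^ 2 ≤
      ((s ×ˢ s).filter fun p => (q : ℤ) ∣ n p.1 - n p.2).card := by
  have hq' : (q:ℂ) ≠ 0 := by exact_mod_cast hq.ne'
  have h1 : (((1 / q : ℝ) * ∑ c ∈ Finset.range q, ‖∑ i ∈ s, a i * e (n i * (α + c / q))‖ ^ 2 : ℝ)
      : ℂ) = ∑ p ∈ (s ×ˢ s).filter (fun p => (q : ℤ) ∣ n p.1 - n p.2),
        a p.1 * (starRingEnd ℂ) (a p.2) * e ((n p.1 - n p.2 : ℤ) * α) := by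
    push_cast
    have h2 : ∀ c : ℕ, ((‖∑ i ∈ s, a i * e (n i * (α + c / q))‖ : ℂ)) ^ 2 =
        ∑ p ∈ s ×ˢ s, a p.1 * (starRingEnd ℂ) (a p.2) * e ((n p.1 - n p.2 : ℤ) * α) *
          e ((n p.1 - n p.2 : ℤ) * (c / q : ℝ)) := by
      intro c
      rw [← Complex.mul_conj', map_sum, Finset.sum_mul_sum, ← Finset.sum_product']
      refine Finset.sum_congr rfl fun p _ => ?_
      rw [map_mul, ← e_neg, mul_assoc (a p.1 * _), ← e_add, mul_mul_mul_comm, ← e_add]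
      congr 2; push_cast; ring
    simp only [h2]
    rw [Finset.sum_comm, Finset.mul_sum, Finset.sum_filter]
    refine Finset.sum_congr rfl fun p _ => ?_
    rw [← Finset.mul_sum, sum_range_e_div hq]
    split_ifs
    · rw [mul_comm _ (q:ℂ), ← mul_assoc, one_div, inv_mul_cancel₀ hq', one_mul]
      push_cast; rfl
    · simp
  have h3 : ‖(((1 / q : ℝ) * ∑ c ∈ Finset.range q, ‖∑ i ∈ s, a i * e (n i * (α + c / q))‖ ^ 2 : ℝ)
      : ℂ)‖ ≤ ((s ×ˢ s).filter fun p => (q : ℤ) ∣ n p.1 - n p.2).card := by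
    rw [h1]
    refine (norm_sum_le _ _).trans ((Finset.sum_le_card_nsmul _ _ 1 fun p hp => ?_).trans ?_)
    · obtain ⟨hp1, hp2⟩ := Finset.mem_product.1 (Finset.mem_filter.1 hp).1
      rw [norm_mul, norm_mul, norm_e, mul_one, RCLike.norm_conj]
      exact mul_le_one₀ (ha _ hp1) (norm_nonneg _) (ha _ hp2)
    · simp
  rw [Complex.norm_real] at h3
  exact (le_abs_self _).trans h3

theorem integral_Psi_mul_norm_sq_le {ι : Type*} (s : Finset ι) (n : ι → ℤ) (a : ι → ℂ)
    (ha : ∀ i ∈ s, ‖a i‖ ≤ 1) (Y : ℕ) {N : ℝ} (hN : 0 < N) {D : ℕ}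
    (hD : ∀ i ∈ s, ∀ j ∈ s, n i ≠ n j → (n i - n j).natAbs.divisors.card ≤ D) :
    ∫ α in (0:ℝ)..1, Psi Y N α * ‖∑ i ∈ s, a i * e (n i * α)‖ ^ 2 ≤
      (Real.log (1 + N) / N) *
        (Y * ((s ×ˢ s).filter fun p => n p.1 = n p.2).card + D * (s.card : ℝ) ^ 2) := by
  classical
  set G : ℝ → ℝ := fun α => ‖∑ i ∈ s, a i * e (n i * α)‖ ^ 2 with hG
  set w : ℝ → ℝ := fun α => (1 + N * |Real.sin (π * α)|)⁻¹ with hw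
  have hGc : Continuous G := by rw [hG]; fun_prop
  have hwc : Continuous w := Continuous.inv₀ (by fun_prop) fun α => by positivity
  have hw0 : ∀ α, 0 ≤ w α := fun α => by simp only [hw]; positivity
  have hG1 : ∀ α, G (α + 1) = G α := by
    intro α; simp only [hG, e_int_mul_add_one]
  have hw1 : ∀ α, w (α + 1) = w α := by
    intro α; simp only [hw]
    rw [show π * (α + 1) = π * α + π by ring, Real.sin_add_pi, abs_neg]
  have hshift : ∀ c : ℝ, ∫ α in (0:ℝ)..1, w (α - c) * G α = ∫ α in (0:ℝ)..1, w α * G (α + c) := by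
    intro c
    have hper : Function.Periodic (fun α => w (α - c) * G α) 1 := by
      intro α
      dsimp only
      rw [hG1, show α + 1 - c = (α - c) + 1 by ring, hw1]
    have h1 := hper.intervalIntegral_add_eq 0 c
    have h2 := intervalIntegral.integral_comp_add_right (a := (0:ℝ)) (b := 1)
      (fun α => w (α - c) * G α) c
    simp only [add_sub_cancel_right, zero_add] at h1 h2
    rw [h1, h2, add_comm 1 c]
  have hwG : ∀ c : ℝ, Continuous fun α => w (α - c) * G α := fun c =>
    (hwc.comp (continuous_id.sub continuous_const)).mul hGc
  have h1 : ∀ α, Psi Y N α * G α = ∑ q ∈ Finset.Icc 1 Y, (1 / q : ℝ) *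
      ∑ c ∈ Finset.range q, w (α - c / q) * G α := by
    intro α
    rw [Psi, Finset.sum_mul]
    refine Finset.sum_congr rfl fun q _ => ?_
    rw [mul_assoc, Finset.sum_mul]
  have h2 : ∫ α in (0:ℝ)..1, Psi Y N α * G α = ∑ q ∈ Finset.Icc 1 Y, (1 / q : ℝ) *
      ∑ c ∈ Finset.range q, ∫ α in (0:ℝ)..1, w α * G (α + c / q) := by
    simp only [h1]
    rw [intervalIntegral.integral_finsetSum fun q _ =>
      (show Continuous fun α => (1 / (q : ℕ) : ℝ) *
          ∑ c ∈ Finset.range q, w (α - c / (q : ℕ)) * G α from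
        continuous_const.mul (continuous_finsetSum _ fun c _ =>
          hwG (c / q))).intervalIntegrable _ _]
    refine Finset.sum_congr rfl fun q _ => ?_
    rw [intervalIntegral.integral_const_mul, intervalIntegral.integral_finsetSum fun c _ =>
      (hwG ((c : ℕ) / q)).intervalIntegrable _ _]
    simp only [hshift]
  have h3 : ∀ q ∈ Finset.Icc 1 Y, (1 / q : ℝ) *
      ∑ c ∈ Finset.range q, ∫ α in (0:ℝ)..1, w α * G (α + c / q) ≤
      (Real.log (1 + N) / N) * ((s ×ˢ s).filter fun p => (q : ℤ) ∣ n p.1 - n p.2).card := by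
    intro q hq
    have hq0 : 0 < q := (Finset.mem_Icc.1 hq).1
    have hcG : ∀ c : ℕ, Continuous fun α => w α * G (α + c / q) := fun c =>
      hwc.mul (hGc.comp (continuous_id.add continuous_const))
    rw [← intervalIntegral.integral_finsetSum fun c _ => (hcG c).intervalIntegrable _ _,
      ← intervalIntegral.integral_const_mul]
    calc _ ≤ ∫ α in (0:ℝ)..1, w α *
          (((s ×ˢ s).filter fun p => (q : ℤ) ∣ n p.1 - n p.2).card : ℝ) := by
          refine intervalIntegral.integral_mono_on (by norm_num)
            (Continuous.intervalIntegrable (continuous_const.mul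
              (continuous_finsetSum _ fun c _ => hcG c)) _ _)
            ((hwc.mul continuous_const).intervalIntegrable _ _) fun α _ => ?_
          rw [← Finset.mul_sum, mul_left_comm]
          exact mul_le_mul_of_nonneg_left (sum_norm_sq_shift_le s n a ha hq0 α) (hw0 α)
      _ ≤ _ := by
          rw [intervalIntegral.integral_mul_const]
          exact mul_le_mul_of_nonneg_right (integral_inv_one_add_sin_le hN) (by positivity)
  rw [h2]
  refine (Finset.sum_le_sum h3).trans ?_
  rw [← Finset.mul_sum]
  have hlog : 0 ≤ Real.log (1 + N) / N := div_nonneg (Real.log_nonneg (by linarith)) hN.le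
  refine mul_le_mul_of_nonneg_left ?_ hlog
  have h4 : ∑ q ∈ Finset.Icc 1 Y, ((s ×ˢ s).filter fun p => (q : ℤ) ∣ n p.1 - n p.2).card ≤
      Y * ((s ×ˢ s).filter fun p => n p.1 = n p.2).card + D * s.card ^ 2 := by
    simp only [Finset.card_filter]
    rw [Finset.sum_comm, Finset.mul_sum, sq, ← Finset.card_product, ← smul_eq_mul D,
      smul_eq_mul, mul_comm D, ← smul_eq_mul, ← Finset.sum_const, ← Finset.sum_add_distrib]
    refine Finset.sum_le_sum fun p hp => ?_
    obtain ⟨hp1, hp2⟩ := Finset.mem_product.1 hp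
    rw [← Finset.card_filter]
    split_ifs with h
    · refine (Finset.card_filter_le _ _).trans ?_
      simp
    · refine le_trans (Finset.card_le_card fun q hq => ?_) ((hD _ hp1 _ hp2 h).trans (by simp))
      rw [Nat.mem_divisors]
      obtain ⟨-, h5⟩ := Finset.mem_filter.1 hq
      exact ⟨Int.natCast_dvd.1 h5, by simpa [sub_eq_zero] using h⟩
  exact_mod_cast h4

theorem integral_norm_sq_trig_eq_card {ι : Type*} (s : Finset ι) (n : ι → ℤ) :
    ∫ α in (0:ℝ)..1, ‖trig s n α‖ ^ 2 =
      (((s ×ˢ s).filter fun q => n q.1 = n q.2).card : ℝ) := by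
  classical
  have h1 : ((∫ α in (0:ℝ)..1, ‖trig s n α‖ ^ 2 : ℝ) : ℂ) =
      (((s ×ˢ s).filter fun q => n q.1 - n q.2 = 0).card : ℂ) := by
    rw [← intervalIntegral.integral_ofReal]
    simp_rw [norm_sq_trig]
    exact integral_trig (s ×ˢ s) (fun q => n q.1 - n q.2)
  rw [show ((s ×ˢ s).filter fun q => n q.1 = n q.2) =
    ((s ×ˢ s).filter fun q => n q.1 - n q.2 = 0) by simp only [sub_eq_zero]]
  exact_mod_cast h1

theorem PolyBd.log {f : ℕ → ℕ → ℝ} {x : ℝ} (hf : PolyBd f x) (hf0 : ∀ N R, 0 ≤ f N R) {ε : ℝ}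
    (hε : 0 < ε) : PolyBd (fun N R => Real.log (f N R)) ε := by
  set δ := ε / (|x| + 1) with hδ
  have hx := abs_nonneg x
  have hδ0 : 0 < δ := by positivity
  have h1 := (hf.rpow hf0 hδ0.le).const_mul (fun _ _ => Real.rpow_nonneg (hf0 _ _) _)
    (by positivity : 0 ≤ 1 / δ)
  refine (h1.mono fun N R _ _ => ?_).mono_exp (?_ : x * δ ≤ ε)
  · rw [one_div_mul_eq_div]
    exact Real.log_le_rpow_div (hf0 _ _) hδ0
  · rw [hδ, mul_div_assoc', div_le_iff₀ (by positivity)]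
    nlinarith [le_abs_self x]

/-- An upper bound for the second entries of `diffBase (moduli θ D N R) N`. -/
def kMax (θ : ℝ) (D N : ℕ) : ℕ := N * D ^ 4 / ⌊(N : ℝ) ^ θ⌋₊ ^ 4 + 1

theorem snd_le_kMax {θ : ℝ} (hθ0 : 0 ≤ θ) {D N R : ℕ} (hN : 1 ≤ N) :
    ∀ b ∈ diffBase (moduli θ D N R) N, b.2 ≤ kMax θ D N := by
  intro b hb
  obtain ⟨hb1, hb2, hb3, hb4⟩ := mem_diffBase.1 hb
  have h1 := (mem_moduli hb1).2
  refine le_trans ?_ (Nat.le_succ _)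
  rw [Nat.le_div_iff_mul_le (Nat.pow_pos (one_le_floor_rpow hθ0 hN))]
  calc b.2 * ⌊(N : ℝ) ^ θ⌋₊ ^ 4 ≤ b.2 * (D * b.1) ^ 4 := by gcongr
    _ = (b.2 * b.1 ^ 4) * D ^ 4 := by ring
    _ ≤ _ := by gcongr

theorem kMax_le {θ : ℝ} {D N : ℕ} (hN : 1 ≤ N) : kMax θ D N ≤ N * (D ^ 4 + 1) := by
  have := Nat.div_le_self (N * D ^ 4) (⌊(N : ℝ) ^ θ⌋₊ ^ 4)
  rw [kMax]; nlinarith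

theorem rpow_le_kMax {θ : ℝ} (hθ0 : 0 ≤ θ) {D N : ℕ} (hD : 1 ≤ D) (hN : 1 ≤ N) :
    (N : ℝ) ^ (1 - 4 * θ) ≤ kMax θ D N := by
  have hN' : (1:ℝ) ≤ N := by exact_mod_cast hN
  have h1 : 1 ≤ ⌊(N : ℝ) ^ θ⌋₊ := one_le_floor_rpow hθ0 hN
  have h2 : (⌊(N : ℝ) ^ θ⌋₊ : ℝ) ≤ (N : ℝ) ^ θ := Nat.floor_le (by positivity)
  have h3 := Nat.lt_div_mul_add (a := N * D ^ 4) (Nat.pow_pos (n := 4) h1)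
  have h4 : N ≤ kMax θ D N * ⌊(N : ℝ) ^ θ⌋₊ ^ 4 := by
    rw [kMax, add_mul, one_mul]
    exact (Nat.le_mul_of_pos_right _ (Nat.pow_pos hD)).trans h3.le
  have h5 : (N : ℝ) ≤ kMax θ D N * (⌊(N : ℝ) ^ θ⌋₊ : ℝ) ^ 4 := by exact_mod_cast h4
  rw [Real.rpow_sub (by linarith), Real.rpow_one, mul_comm 4, Real.rpow_mul (by linarith),
    div_le_iff₀ (by positivity)]
  refine h5.trans ?_
  gcongr
  exact_mod_cast pow_le_pow_left₀ (Nat.cast_nonneg _) h2 4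

theorem polyBd_kMax {θ : ℝ} (hθ0 : 0 ≤ θ) (hθ : θ ≤ 1 / 4) (D : ℕ) :
    PolyBd (fun N _ => (kMax θ D N : ℝ)) (1 - 4 * θ) := by
  refine ((PolyBd.rpow_left (1 - 4 * θ)).const_mul (fun _ _ => by positivity)
    (by positivity : (0:ℝ) ≤ 16 * D ^ 4 + 1)).mono fun N R hN _ => ?_
  have hN' : (1:ℝ) ≤ N := by exact_mod_cast hN
  have h1 : (1:ℝ) ≤ ⌊(N : ℝ) ^ θ⌋₊ := by exact_mod_cast one_le_floor_rpow hθ0 hN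
  have h2 := Nat.lt_floor_add_one ((N : ℝ) ^ θ)
  have h3 : (1:ℝ) ≤ (N : ℝ) ^ (1 - 4 * θ) := Real.one_le_rpow hN' (by linarith)
  have h4 : ((N * D ^ 4 / ⌊(N : ℝ) ^ θ⌋₊ ^ 4 : ℕ) : ℝ) ≤ 16 * D ^ 4 * (N : ℝ) ^ (1 - 4 * θ) := by
    refine Nat.cast_div_le.trans ?_
    push_cast
    rw [div_le_iff₀ (by positivity)]
    have h5 : (N : ℝ) = (N : ℝ) ^ (1 - 4 * θ) * ((N : ℝ) ^ θ) ^ 4 := by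
      rw [← Real.rpow_natCast ((N : ℝ) ^ θ), ← Real.rpow_mul (by linarith),
        ← Real.rpow_add (by linarith)]
      norm_num
      rw [show 1 - 4 * θ + θ * 4 = 1 by ring, Real.rpow_one]
    have h6 : ((N : ℝ) ^ θ) ^ 4 ≤ 16 * (⌊(N : ℝ) ^ θ⌋₊ : ℝ) ^ 4 := by
      calc ((N : ℝ) ^ θ) ^ 4 ≤ (2 * (⌊(N : ℝ) ^ θ⌋₊ : ℝ)) ^ 4 := by gcongr; linarith
        _ = _ := by ring
    calc (N : ℝ) * D ^ 4 = D ^ 4 * (N : ℝ) ^ (1 - 4 * θ) * ((N : ℝ) ^ θ) ^ 4 := by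
          nth_rewrite 1 [h5]; ring
      _ ≤ D ^ 4 * (N : ℝ) ^ (1 - 4 * θ) * (16 * (⌊(N : ℝ) ^ θ⌋₊ : ℝ) ^ 4) := by gcongr
      _ = _ := by ring
  rw [kMax]; push_cast at h4 ⊢
  linarith

theorem polyBd_integral_Psi_mul_smoothSum {θ ε : ℝ} (hθ0 : 0 ≤ θ) (hθ : θ ≤ 1 / 4) {D : ℕ}
    (hD : 1 ≤ D) (hε : 0 < ε) :
    PolyBd (fun N R => ∫ α in (0:ℝ)..1, Psi N (kMax θ D N * N ^ 3) α *
      ‖smoothSum (N / ⌊(N : ℝ) ^ θ⌋₊) R α‖ ^ 4) ε := by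
  have hk := polyBd_kMax hθ0 hθ D
  have hm := (polyBd_moment_four (by positivity : 0 < ε / 4)).comp_div (by positivity) hθ0
    (by linarith)
  have hQ := ((PolyBd.self_left.comp_div zero_le_one hθ0 (by linarith)).pow
    (fun _ _ => by positivity) 4)
  have hl := (((hk.mul (PolyBd.self_left.pow (fun _ _ => by positivity) 3)
    (fun _ _ => by positivity)).mono_exp (y := 4) (by push_cast; linarith)).add
      ((PolyBd.const 1).mono_exp (by norm_num))).log (fun _ _ => by positivity)
      (by positivity : 0 < ε / 4)
  have h1 := (((PolyBd.self_left.mul hm (fun _ _ => moment_nonneg _ _ _)).mono_exp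
    (y := 4 - 4 * θ + ε / 4 ) (by nlinarith)).add
    (((polyBd_divMax 2 4 (by positivity : 0 < ε / 4)).mul hQ (fun _ _ => by positivity)).mono_exp
    (y := 4 - 4 * θ + ε / 4) (by push_cast; nlinarith)))
  have h2 := ((PolyBd.rpow_left (-(4 - 4 * θ))).mul hl fun _ _ => Real.log_nonneg (by
    have : (0:ℝ) ≤ 1 := zero_le_one
    simp; positivity)).mul h1 (fun _ _ => add_nonneg (mul_nonneg (by positivity)
      (moment_nonneg _ _ _)) (by positivity))
  refine (h2.mono fun N R hN hR => ?_).mono_exp (y := ε) (by linarith)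
  set Q := N / ⌊(N : ℝ) ^ θ⌋₊ with hQdef
  have hN' : (1:ℝ) ≤ N := by exact_mod_cast hN
  have hQN : Q ≤ N := Nat.div_le_self _ _
  set A := smoothUpTo Q R with hA
  have hAQ : A.card ≤ Q := by
    refine (Finset.card_filter_le _ _).trans (by simp)
  have hkp : (0:ℝ) < kMax θ D N := by rw [kMax]; positivity
  have h3 := integral_Psi_mul_norm_sq_le (A ×ˢ A) (fun p => (p.1 : ℤ) ^ 4 + (p.2 : ℤ) ^ 4)
    (fun _ => 1) (by simp) N (N := kMax θ D N * N ^ 3) (by positivity)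
    (D := divMax (2 * (N * R) ^ 4)) (by
      intro i hi j hj hij
      refine divMax_ge hR _ (by simpa [sub_eq_zero] using hij) ?_
      have hb : ∀ x ∈ A, x ^ 4 ≤ N ^ 4 := fun x hx =>
        Nat.pow_le_pow_left ((Finset.mem_Icc.1 (smoothUpTo_subset_Icc Q R hx)).2.trans hQN) 4
      rw [Finset.mem_product] at hi hj
      have a1 := hb _ hi.1; have a2 := hb _ hi.2; have a3 := hb _ hj.1; have a4 := hb _ hj.2
      zify at a1 a2 a3 a4
      have p1 : (0:ℤ) ≤ (i.1:ℤ) ^ 4 := by positivity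
      have p2 : (0:ℤ) ≤ (i.2:ℤ) ^ 4 := by positivity
      have p3 : (0:ℤ) ≤ (j.1:ℤ) ^ 4 := by positivity
      have p4 : (0:ℤ) ≤ (j.2:ℤ) ^ 4 := by positivity
      zify
      rw [abs_le]; constructor <;> linarith)
  have h4 : ∀ α, trig (A ×ˢ A) (fun p => (p.1 : ℤ) ^ 4 + (p.2 : ℤ) ^ 4) α = smoothSum Q R α ^ 2 :=
    fun α => by
      rw [← trig_mul A (fun x => (x : ℤ) ^ 4) A (fun x => (x : ℤ) ^ 4), ← sq]; rfl
  have hc := integral_norm_sq_trig_eq_card (A ×ˢ A) (fun p => (p.1 : ℤ) ^ 4 + (p.2 : ℤ) ^ 4)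
  beta_reduce at hc
  rw [← hc] at h3
  simp only [one_mul] at h3
  change ∫ α in (0:ℝ)..1, _ * ‖trig (A ×ˢ A) (fun p => (p.1 : ℤ) ^ 4 + (p.2 : ℤ) ^ 4) α‖ ^ 2 ≤ _
    at h3
  simp only [h4, norm_pow, ← pow_mul] at h3
  refine h3.trans ?_
  have h5 : ((A ×ˢ A).card : ℝ) ^ 2 ≤ (Q : ℝ) ^ 4 := by
    rw [Finset.card_product]; push_cast
    calc ((A.card : ℝ) * A.card) ^ 2 = (A.card : ℝ) ^ 4 := by ring
      _ ≤ _ := by gcongr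
  have hl0 : 0 ≤ Real.log (1 + kMax θ D N * N ^ 3) := Real.log_nonneg (by
    have : (0:ℝ) ≤ kMax θ D N * N ^ 3 := by positivity
    linarith)
  have h6 : Real.log (1 + kMax θ D N * N ^ 3) / (kMax θ D N * N ^ 3) ≤
      (N : ℝ) ^ (-(4 - 4 * θ)) * Real.log (kMax θ D N * N ^ 3 + 1) := by
    rw [Real.rpow_neg (by positivity), inv_mul_eq_div, add_comm (1:ℝ)] 
    refine div_le_div_of_nonneg_left (by rwa [add_comm] at hl0) (by positivity) ?_
    calc (N : ℝ) ^ (4 - 4 * θ) = (N : ℝ) ^ (1 - 4 * θ) * N ^ 3 := by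
          rw [← Real.rpow_natCast, ← Real.rpow_add (by linarith)]; norm_num; ring_nf
      _ ≤ _ := by gcongr; exact rpow_le_kMax hθ0 hD hN
  gcongr
  · exact add_nonneg (mul_nonneg (by positivity) (moment_nonneg _ _ _)) (by positivity)
  · exact mul_nonneg (by positivity) (by rwa [add_comm] at hl0)
  · exact le_of_eq rfl

theorem polyBd_diffSum_mul {k : ℕ} {ν θ y ε : ℝ} (hθ0 : 0 ≤ θ) (hθ : θ ≤ 1 / 4) (hν0 : 0 ≤ ν)
    (hν : PolyBd (moment (2 * k)) ν) {D : ℕ}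
    (hy : PolyBd (fun N R => ∫ α in (0:ℝ)..1, Psi N (kMax θ D N * N ^ 3) α ^ (1 / 4 : ℝ) *
      ‖smoothSum (N / ⌊(N : ℝ) ^ θ⌋₊) R α‖ ^ (2 * k)) y) (hε : 0 < ε) :
    PolyBd (fun N R => ∫ α in (0:ℝ)..1, ‖diffSum (moduli θ D N R) N α‖ *
      ‖smoothSum (N / ⌊(N : ℝ) ^ θ⌋₊) R α‖ ^ (2 * k))
        (max (7 / 4 - 3 * θ + (1 - θ) * ν) (2 - 3 * θ + y) + ε) := by
  have hk := polyBd_kMax hθ0 hθ D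
  have hl := ((hk.mul (PolyBd.self_left.pow (fun _ _ => by positivity) 3)
    (fun _ _ => by positivity)).const_mul (fun _ _ => by positivity)
      (by norm_num : (0:ℝ) ≤ 6)).log (fun _ _ => by positivity) (by positivity : 0 < ε)
  have hL : PolyBd (fun N R => 1 + Real.log (6 * (kMax θ D N * N ^ 3))) ε :=
    ((PolyBd.const 1).mono_exp hε.le).add hl
  have hL0 : ∀ N R : ℕ, 0 ≤ 1 + Real.log (6 * (kMax θ D N * N ^ 3)) := fun N R => by
    rcases Nat.eq_zero_or_pos N with rfl | hN
    · simp
    · have : 0 ≤ Real.log (6 * (kMax θ D N * N ^ 3)) := Real.log_nonneg (by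
        have h1 : (1:ℝ) ≤ N := by exact_mod_cast hN
        have h2 : (1:ℝ) ≤ kMax θ D N := by rw [kMax]; push_cast; simp
        have h3 : (1:ℝ) ≤ (N:ℝ) ^ 3 := one_le_pow₀ h1
        nlinarith)
      linarith
  have hE0 : ∀ N R : ℕ, 0 ≤ 20000 * ((divMax (24 * (D ^ 4 + 1) * (N * R) ^ 3) : ℝ) ^ 2 *
      (1 + Real.log (6 * (kMax θ D N * N ^ 3)))) := fun N R =>
    mul_nonneg (by positivity) (mul_nonneg (by positivity) (hL0 N R))
  have hE := ((((polyBd_divMax (24 * (D ^ 4 + 1)) 3 hε).pow (fun _ _ => by positivity) 2).mul hL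
    hL0).const_mul (fun N R => mul_nonneg (by positivity) (hL0 N R))
      (by norm_num : (0:ℝ) ≤ 20000)).rpow hE0 (by norm_num : (0:ℝ) ≤ 1 / 4)
  have hA := hE.mul (((polyBd_card_moduli θ D).mul hk (fun _ _ => by positivity)).mul
    (PolyBd.rpow_left (3 / 4)) (fun _ _ => by positivity)) (fun _ _ => by positivity)
  have hI0 : ∀ N R : ℕ, 0 ≤ ∫ α in (0:ℝ)..1, Psi N (kMax θ D N * N ^ 3) α ^ (1 / 4 : ℝ) *
      ‖smoothSum (N / ⌊(N : ℝ) ^ θ⌋₊) R α‖ ^ (2 * k) := fun N R =>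
    intervalIntegral.integral_nonneg (by norm_num) fun α _ =>
      mul_nonneg (Real.rpow_nonneg (Psi_nonneg _ (by positivity) _) _) (by positivity)
  have h1 := hA.mul (hν.comp_div hν0 hθ0 (by linarith)) (fun _ _ => moment_nonneg _ _ _)
  have h2 := hA.mul ((PolyBd.rpow_left (1 / 4)).mul hy hI0)
    (fun _ _ => mul_nonneg (by positivity) (hI0 _ _))
  refine ((h1.mono_exp ?_).add (h2.mono_exp ?_)).mono fun N R hN hR => ?_
  · have := le_max_left (7 / 4 - 3 * θ + (1 - θ) * ν) (2 - 3 * θ + y)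
    push_cast; linarith
  · have := le_max_right (7 / 4 - 3 * θ + (1 - θ) * ν) (2 - 3 * θ + y)
    push_cast; linarith
  set E : ℝ := 20000 * ((divMax (24 * (D ^ 4 + 1) * (N * R) ^ 3) : ℝ) ^ 2 *
      (1 + Real.log (6 * (kMax θ D N * N ^ 3)))) with hEdef
  set Q := N / ⌊(N : ℝ) ^ θ⌋₊ with hQdef
  set c : ℝ := ((moduli θ D N R).card : ℝ) with hc
  have hc0 : 0 ≤ c := Nat.cast_nonneg _
  have hkp : 0 < kMax θ D N := Nat.succ_pos _
  have hΨc : Continuous (Psi N (kMax θ D N * N ^ 3)) := continuous_Psi _ (by positivity)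
  have hE1 : 0 ≤ E := hE0 N R
  have hpt : ∀ α, ‖diffSum (moduli θ D N R) N α‖ ≤ E ^ (1 / 4 : ℝ) * (c * kMax θ D N *
      (N : ℝ) ^ (3 / 4 : ℝ)) * (1 + (N : ℝ) ^ (1 / 4 : ℝ) *
        Psi N (kMax θ D N * N ^ 3) α ^ (1 / 4 : ℝ)) := by
    intro α
    have hΨ := Psi_nonneg N (N := kMax θ D N * (N : ℝ) ^ 3) (by positivity) α
    have h3 := norm_diffSum_pow_four_le hN hkp (snd_le_kMax hθ0 (R := R) (D := D) hN)
      (D := divMax (24 * (D ^ 4 + 1) * (N * R) ^ 3)) (by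
        intro n hn hn'
        refine card_divisors_le_divMax hn (hn'.trans ?_)
        calc 24 * (kMax θ D N * N ^ 2) ≤ 24 * (N * (D ^ 4 + 1) * N ^ 2) := by
              gcongr; exact kMax_le hN
          _ = 24 * (D ^ 4 + 1) * (N * 1) ^ 3 := by ring
          _ ≤ _ := by gcongr) α
    rw [← hEdef] at h3
    clear_value E
    have h4 := Real.rpow_le_rpow (by positivity) h3 (by norm_num : (0:ℝ) ≤ 1 / 4)
    rw [← Real.rpow_natCast ‖_‖, ← Real.rpow_mul (norm_nonneg _),
      Real.mul_rpow hE1 (by positivity), Real.mul_rpow (by positivity) (by positivity),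
      Real.mul_rpow (by positivity) (by positivity), ← Real.rpow_natCast (c * kMax θ D N),
      ← Real.rpow_mul (by positivity), ← Real.rpow_natCast (N : ℝ) 3,
      ← Real.rpow_mul (by positivity)] at h4
    norm_num at h4
    refine h4.trans ?_
    have h5 := Real.rpow_add_le_add_rpow (zero_le_one (α := ℝ))
      (by positivity : 0 ≤ N * Psi N (kMax θ D N * N ^ 3) α) (by norm_num : (0:ℝ) ≤ 1 / 4)
      (by norm_num)
    rw [Real.one_rpow, Real.mul_rpow (by positivity) hΨ] at h5
    norm_num at h5
    have := Real.rpow_nonneg hE1 (1 / 4)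
    norm_num at this
    calc _ = E ^ (1 / 4 : ℝ) * (c * kMax θ D N * (N : ℝ) ^ (3 / 4 : ℝ)) *
          (1 + N * Psi N (kMax θ D N * N ^ 3) α) ^ (1 / 4 : ℝ) := by ring
      _ ≤ _ := by gcongr
  rw [moment, ← intervalIntegral.integral_const_mul, ← intervalIntegral.integral_const_mul,
    ← intervalIntegral.integral_const_mul, ← intervalIntegral.integral_add
      (Continuous.intervalIntegrable (by fun_prop) _ _)
      (Continuous.intervalIntegrable (by fun_prop (disch := norm_num)) _ _)]
  refine intervalIntegral.integral_mono_on (by norm_num)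
    (Continuous.intervalIntegrable (by fun_prop) _ _)
    (Continuous.intervalIntegrable (by fun_prop (disch := norm_num)) _ _) fun α _ => ?_
  calc _ ≤ _ := mul_le_mul_of_nonneg_right (hpt α) (by positivity)
    _ = _ := by ring

theorem polyBd_moment_ten_step {μ ν a : ℝ} (hν0 : 0 ≤ ν) (ha0 : 0 ≤ a)
    (h8 : PolyBd (moment 8) ν) (h10 : PolyBd (moment 10) a) (hμ : 5 < μ)
    (hμ1 : 5 / 2 + 13 / 16 * ν < μ) (hμ2 : 11 / 4 + 13 / 16 * (ν / 4 + a / 2) < μ) :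
    PolyBd (moment 10) μ := by
  set ε := (μ - max (5 / 2 + 13 / 16 * ν) (11 / 4 + 13 / 16 * (ν / 4 + a / 2))) / 4 with hε
  have hm := max_lt hμ1 hμ2
  have hm1 := le_max_left (5 / 2 + 13 / 16 * ν) (11 / 4 + 13 / 16 * (ν / 4 + a / 2))
  have hm2 := le_max_right (5 / 2 + 13 / 16 * ν) (11 / 4 + 13 / 16 * (ν / 4 + a / 2))
  have hε0 : 0 < ε := by rw [hε]; linarith
  refine polyBd_moment_step (k := 4) (θ := 3 / 16) (by norm_num) (by norm_num) (by norm_num) hν0 h8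
    (fun D hD => polyBd_diffSum_mul (y := ε * (1 / 4) + (1 - 3 / 16) * ν * (1 / 4) +
      (1 - 3 / 16) * a * (1 / 2)) (by norm_num) (by norm_num) hν0 h8 ?_ hε0)
    (by push_cast; linarith) (by push_cast; linarith) ?_
  · have i0 : ∀ N R : ℕ, 0 ≤ ∫ α in (0:ℝ)..1, Psi N (kMax (3 / 16) D N * N ^ 3) α *
        ‖smoothSum (N / ⌊(N : ℝ) ^ (3 / 16 : ℝ)⌋₊) R α‖ ^ 4 := fun N R =>
      intervalIntegral.integral_nonneg (by norm_num) fun α _ =>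
        mul_nonneg (Psi_nonneg _ (by positivity) _) (by positivity)
    have h1 := (((polyBd_integral_Psi_mul_smoothSum (θ := 3 / 16) (by norm_num) (by norm_num) hD
        hε0).rpow i0 (by norm_num : (0:ℝ) ≤ 1 / 4)).mul
      ((h8.comp_div (θ := 3 / 16) hν0 (by norm_num) (by norm_num)).rpow
        (fun _ _ => moment_nonneg _ _ _) (by norm_num : (0:ℝ) ≤ 1 / 4))
          (fun _ _ => Real.rpow_nonneg (moment_nonneg _ _ _) _)).mul
      ((h10.comp_div (θ := 3 / 16) ha0 (by norm_num) (by norm_num)).rpow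
        (fun _ _ => moment_nonneg _ _ _) (by norm_num : (0:ℝ) ≤ 1 / 2))
          (fun _ _ => Real.rpow_nonneg (moment_nonneg _ _ _) _)
    refine h1.mono fun N R hN hR => ?_
    have hΨc : Continuous (Psi N (kMax (3 / 16) D N * N ^ 3)) := continuous_Psi _ (by positivity)
    have hΨ := Psi_nonneg N (N := kMax (3 / 16) D N * (N : ℝ) ^ 3) (by positivity)
    refine le_trans (le_of_eq ?_) (interval_holder₃ (by fun_prop) (by fun_prop) (by fun_prop)
      (fun α => mul_nonneg (hΨ α) (by positivity)) (fun _ => by positivity)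
      (fun _ => by positivity) (by norm_num) (by norm_num) (by norm_num) (by norm_num))
    congr 1; funext α
    have hH := norm_nonneg (smoothSum (N / ⌊(N : ℝ) ^ (3 / 16 : ℝ)⌋₊) R α)
    rw [Real.mul_rpow (hΨ α) (by positivity), rpow_natCast_mul hH, rpow_natCast_mul hH,
      rpow_natCast_mul hH, mul_assoc, mul_assoc, ← Real.rpow_add_of_nonneg hH (by norm_num)
      (by norm_num), ← Real.rpow_add_of_nonneg hH (by norm_num) (by norm_num),
      ← Real.rpow_natCast _ (2 * 4)]
    norm_num
  · rw [← lt_sub_iff_add_lt', ← lt_sub_iff_add_lt]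
    refine max_lt ?_ ?_ <;> push_cast <;> linarith

theorem polyBd_moment_twelve_step {μ ν a : ℝ} (hν0 : 0 ≤ ν) (ha0 : 0 ≤ a)
    (h10 : PolyBd (moment 10) ν) (h12 : PolyBd (moment 12) a) (hμ : 6 < μ)
    (hμ1 : 23 / 8 + 13 / 16 * ν < μ) (hμ2 : 25 / 8 + 39 / 64 * a < μ) :
    PolyBd (moment 12) μ := by
  set ε := (μ - max (23 / 8 + 13 / 16 * ν) (25 / 8 + 39 / 64 * a)) / 4 with hε
  have hm := max_lt hμ1 hμ2
  have hm1 := le_max_left (23 / 8 + 13 / 16 * ν) (25 / 8 + 39 / 64 * a)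
  have hm2 := le_max_right (23 / 8 + 13 / 16 * ν) (25 / 8 + 39 / 64 * a)
  have hε0 : 0 < ε := by rw [hε]; linarith
  refine polyBd_moment_step (k := 5) (θ := 3 / 16) (by norm_num) (by norm_num) (by norm_num) hν0 h10
    (fun D hD => polyBd_diffSum_mul (y := ε * (1 / 4) + (1 - 3 / 16) * a * (3 / 4))
      (by norm_num) (by norm_num) hν0 h10 ?_ hε0)
    (by push_cast; linarith) (by push_cast; linarith) ?_
  · have i0 : ∀ N R : ℕ, 0 ≤ ∫ α in (0:ℝ)..1, Psi N (kMax (3 / 16) D N * N ^ 3) α *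
        ‖smoothSum (N / ⌊(N : ℝ) ^ (3 / 16 : ℝ)⌋₊) R α‖ ^ 4 := fun N R =>
      intervalIntegral.integral_nonneg (by norm_num) fun α _ =>
        mul_nonneg (Psi_nonneg _ (by positivity) _) (by positivity)
    have h1 := ((polyBd_integral_Psi_mul_smoothSum (θ := 3 / 16) (by norm_num) (by norm_num) hD
        hε0).rpow i0 (by norm_num : (0:ℝ) ≤ 1 / 4)).mul
      ((h12.comp_div (θ := 3 / 16) ha0 (by norm_num) (by norm_num)).rpow
        (fun _ _ => moment_nonneg _ _ _) (by norm_num : (0:ℝ) ≤ 3 / 4))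
          (fun _ _ => Real.rpow_nonneg (moment_nonneg _ _ _) _)
    refine h1.mono fun N R hN hR => ?_
    have hΨc : Continuous (Psi N (kMax (3 / 16) D N * N ^ 3)) := continuous_Psi _ (by positivity)
    have hΨ := Psi_nonneg N (N := kMax (3 / 16) D N * (N : ℝ) ^ 3) (by positivity)
    refine le_trans (le_of_eq ?_) (interval_holder₂ (by fun_prop) (by fun_prop)
      (fun α => mul_nonneg (hΨ α) (by positivity)) (fun _ => by positivity)
      (by norm_num) (by norm_num) (by norm_num))
    congr 1; funext α
    have hH := norm_nonneg (smoothSum (N / ⌊(N : ℝ) ^ (3 / 16 : ℝ)⌋₊) R α)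
    rw [Real.mul_rpow (hΨ α) (by positivity), rpow_natCast_mul hH, rpow_natCast_mul hH,
      mul_assoc, ← Real.rpow_add_of_nonneg hH (by norm_num) (by norm_num),
      ← Real.rpow_natCast _ (2 * 5)]
    norm_num
  · rw [← lt_sub_iff_add_lt', ← lt_sub_iff_add_lt]
    refine max_lt ?_ ?_ <;> push_cast <;> linarith

theorem polyBd_moment_ten : PolyBd (moment 10) 6.23755 := by
  obtain ⟨-, h8⟩ := polyBd_moment_six_eight
  have h1 : PolyBd (moment 10) 6.6 := (polyBd_moment_add h8 2).mono_exp (by norm_num)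
  have step : ∀ a μ : ℝ, PolyBd (moment 10) a → 0 ≤ a → 6.23755 ≤ μ →
      11 / 4 + 13 / 16 * (4.6 / 4 + a / 2) < μ → PolyBd (moment 10) μ := fun a μ h ha h1 h2 =>
    polyBd_moment_ten_step (by norm_num) ha h8 h (by linarith) (by linarith) h2
  have h2 := step _ 6.366 h1 (by norm_num) (by norm_num) (by norm_num)
  have h3 := step _ 6.271 h2 (by norm_num) (by norm_num) (by norm_num)
  exact step _ _ h3 (by norm_num) (by norm_num) (by norm_num)

theorem polyBd_moment_twelve {ε : ℝ} (hε : 0 < ε) : PolyBd (moment 12) (8 + ε) := by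
  have key : ∀ n : ℕ, PolyBd (moment 12) (8 + ε / 2 + 0.7 ^ n) := by
    intro n
    induction n with
    | zero => exact (polyBd_moment_add polyBd_moment_ten 2).mono_exp (by norm_num; linarith)
    | succ n ih =>
      have hx : (0:ℝ) < 0.7 ^ n := by positivity
      have e : (0.7:ℝ) ^ (n + 1) = 0.7 * 0.7 ^ n := pow_succ' _ _
      rw [e]
      exact polyBd_moment_twelve_step (by norm_num) (by positivity) polyBd_moment_ten ih
        (by linarith) (by linarith) (by linarith)
  obtain ⟨n, hn⟩ := exists_pow_lt_of_lt_one (half_pos hε) (by norm_num : (0.7:ℝ) < 1)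
  exact (key n).mono_exp (by linarith)

theorem card_sq_le_card_mul_card_filter {α β : Type*} [DecidableEq α] [DecidableEq β]
    (W : Finset α) (B : Finset β) (g : α → β) (hg : ∀ w ∈ W, g w ∈ B) :
    W.card ^ 2 ≤ B.card * ((W ×ˢ W).filter fun p => g p.1 = g p.2).card := by
  rw [Finset.card_eq_sum_card_fiberwise (f := g) (t := B) hg]
  refine sq_sum_le_card_mul_sum_sq.trans (le_of_eq ?_)
  congr 1
  rw [Finset.card_eq_sum_card_fiberwise (f := fun p : α × α => g p.1) (t := B)
    (fun p hp => hg _ (Finset.mem_product.1 (Finset.mem_filter.1 hp).1).1)]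
  refine Finset.sum_congr rfl fun b _ => ?_
  rw [sq, ← Finset.card_product]
  congr 1
  ext ⟨x, y⟩
  simp only [Finset.mem_product, Finset.mem_filter]
  grind

theorem card_key_sq_le {ι κ σ : Type*} (I : Finset ι) (T : Finset κ) (Z : Finset σ)
    (key : ι → κ) (q : ι → ℤ) (n : σ → ℤ) (hkey : ∀ u ∈ I, key u ∈ T)
    (hq : ∀ u ∈ I, ∀ v ∈ I, key u = key v → q u = q v → u = v) (hn : Set.InjOn n Z) {D : ℕ}
    (hD : ∀ a : ℤ, a ≠ 0 → ∀ [DecidableEq κ],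
      ((I ×ˢ I).filter fun p => key p.1 = key p.2 ∧ q p.1 - q p.2 = a).card ≤ D) :
    ((I ×ˢ Z ×ˢ Z).filter fun w => q w.1 = n w.2.1 - n w.2.2).card ^ 2 ≤
      T.card * Z.card *
        (((I ×ˢ Z ×ˢ Z).filter fun w => q w.1 = n w.2.1 - n w.2.2).card + D * Z.card ^ 2) := by
  classical
  set W := (I ×ˢ Z ×ˢ Z).filter fun w => q w.1 = n w.2.1 - n w.2.2 with hW
  have mW : ∀ w, w ∈ W ↔ (w.1 ∈ I ∧ w.2.1 ∈ Z ∧ w.2.2 ∈ Z) ∧ q w.1 = n w.2.1 - n w.2.2 := by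
    intro w; simp [hW, Finset.mem_product]
  have h1 := card_sq_le_card_mul_card_filter W (T ×ˢ Z) (fun w => (key w.1, w.2.1)) (by
    intro w hw; rw [mW] at hw; simp [hkey _ hw.1.1, hw.1.2.1])
  rw [Finset.card_product] at h1
  refine h1.trans (Nat.mul_le_mul_left _ ?_)
  rw [← Finset.card_filter_add_card_filter_not (fun p : (ι × σ × σ) × (ι × σ × σ) =>
    p.1.2.2 = p.2.2.2)]
  refine add_le_add ?_ ?_
  · refine Finset.card_le_card_of_injOn (fun p => p.1) (fun p hp => ?_) fun p hp p' hp' h => ?_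
    · simp only [Finset.coe_filter, Finset.mem_filter, Finset.mem_product, Set.mem_ofPred_eq] at hp
      exact hp.1.1.1
    · simp only [Finset.coe_filter, Finset.mem_filter, Finset.mem_product, Set.mem_ofPred_eq,
        mW, Prod.mk.injEq] at hp hp'
      have key2 : ∀ p : (ι × σ × σ) × (ι × σ × σ), ((((p.1.1 ∈ I ∧ p.1.2.1 ∈ Z ∧ p.1.2.2 ∈ Z) ∧
          q p.1.1 = n p.1.2.1 - n p.1.2.2) ∧ (p.2.1 ∈ I ∧ p.2.2.1 ∈ Z ∧ p.2.2.2 ∈ Z) ∧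
          q p.2.1 = n p.2.2.1 - n p.2.2.2) ∧ key p.1.1 = key p.2.1 ∧ p.1.2.1 = p.2.2.1) ∧
          p.1.2.2 = p.2.2.2 → p.2 = p.1 := by
        rintro ⟨⟨u, i, j⟩, ⟨u', i', j'⟩⟩ ⟨⟨⟨⟨⟨a1, a2, a3⟩, a4⟩, ⟨b1, b2, b3⟩, b4⟩, c1, c2⟩, c3⟩
        simp only at *
        subst c2 c3
        have := hq u a1 u' b1 c1 (a4.trans b4.symm)
        rw [this]
      exact Prod.ext h ((key2 p hp).trans (Eq.trans h (key2 p' hp').symm))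
  · rw [sq, ← Finset.card_product]
    refine Finset.card_le_mul_card_image_of_maps_to
      (f := fun p : (ι × σ × σ) × (ι × σ × σ) => (p.1.2.2, p.2.2.2)) (fun p hp => ?_) D
      fun b hb => ?_
    · simp only [Finset.mem_filter, Finset.mem_product, mW] at hp ⊢
      exact ⟨hp.1.1.1.1.2.2, hp.1.1.2.1.2.2⟩
    · by_cases hbb : n b.2 - n b.1 = 0
      · refine le_trans (le_of_eq ?_) (Nat.zero_le D)
        rw [Finset.card_eq_zero, Finset.filter_eq_empty_iff]
        intro p hp hpb
        simp only [Finset.mem_filter, Finset.mem_product, mW] at hp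
        subst hpb
        exact hp.2 (hn hp.1.1.1.1.2.2 hp.1.1.2.1.2.2 (by simp only at hbb; linarith))
      · refine (Finset.card_le_card_of_injOn (fun p => (p.1.1, p.2.1)) (fun p hp => ?_)
          fun p hp p' hp' h => ?_).trans (hD (n b.2 - n b.1) hbb)
        · simp only [Finset.coe_filter, Finset.mem_filter, Finset.mem_product, mW,
            Set.mem_ofPred_eq, Prod.mk.injEq] at hp ⊢
          obtain ⟨⟨⟨⟨⟨a1, a4⟩, b1, b4⟩, c1, c2⟩, c3⟩, d⟩ := hp
          refine ⟨⟨a1.1, b1.1⟩, c1, ?_⟩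
          subst d
          rw [a4, b4, c2]; ring
        · simp only [Finset.coe_filter, Finset.mem_filter, Finset.mem_product, mW,
            Set.mem_ofPred_eq, Prod.mk.injEq] at hp hp' h
          obtain ⟨⟨u, i, j⟩, ⟨u', i', j'⟩⟩ := p
          obtain ⟨⟨v, k, l⟩, ⟨v', k', l'⟩⟩ := p'
          obtain ⟨⟨⟨⟨⟨a1, a4⟩, b1, b4⟩, c1, c2⟩, c3⟩, d⟩ := hp
          obtain ⟨⟨⟨⟨⟨a1', a4'⟩, b1', b4'⟩, c1', c2'⟩, c3'⟩, d'⟩ := hp'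
          simp only at *
          obtain ⟨rfl, rfl⟩ := h
          subst d
          simp only [Prod.mk.injEq] at d'
          obtain ⟨rfl, rfl⟩ := d'
          subst c2 c2'
          have : i = k := hn a1.2.1 a1'.2.1 (by linarith)
          rw [this]

theorem le_add_sqrt_of_sq_le {S A B : ℝ} (hA : 0 ≤ A) (hB : 0 ≤ B) (h : S ^ 2 ≤ A * (S + B)) :
    S ≤ A + √(A * B) := by
  by_contra! hc
  have h0 := Real.sqrt_nonneg (A * B)
  have h1 := Real.sq_sqrt (mul_nonneg hA hB)
  nlinarith [mul_nonneg hA h0]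

theorem norm_integral_trig_mul_le {ι κ σ : Type*} (I : Finset ι) (T : Finset κ) (Z : Finset σ)
    (key : ι → κ) (q : ι → ℤ) (n : σ → ℤ) (hkey : ∀ u ∈ I, key u ∈ T)
    (hq : ∀ u ∈ I, ∀ v ∈ I, key u = key v → q u = q v → u = v) (hn : Set.InjOn n Z) {D : ℕ}
    (hD : ∀ a : ℤ, a ≠ 0 → ∀ [DecidableEq κ],
      ((I ×ˢ I).filter fun p => key p.1 = key p.2 ∧ q p.1 - q p.2 = a).card ≤ D) :
    ∫ α in (0:ℝ)..1, (trig I q α).re * ‖trig Z n α‖ ^ 2 ≤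
      T.card * Z.card + √(T.card * Z.card * (D * Z.card ^ 2)) := by
  have h1 := card_key_sq_le I T Z key q n hkey hq hn hD
  set S := ((I ×ˢ Z ×ˢ Z).filter fun w => q w.1 = n w.2.1 - n w.2.2).card with hS
  have h2 : ∫ α in (0:ℝ)..1, (trig I q α).re * ‖trig Z n α‖ ^ 2 = S := by
    have h3 : ∀ α, trig (I ×ˢ Z ×ˢ Z) (fun w => q w.1 + (n w.2.2 - n w.2.1)) α =
        trig I q α * ((‖trig Z n α‖ ^ 2 : ℝ) : ℂ) := by
      intro α
      rw [← trig_mul I q (Z ×ˢ Z) (fun w => n w.2 - n w.1), norm_sq_trig]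
      congr 1
      simp only [trig]
      rw [Finset.sum_product, Finset.sum_product_right]
    have h4 := integral_trig (I ×ˢ Z ×ˢ Z) (fun w => q w.1 + (n w.2.2 - n w.2.1))
    simp only [h3] at h4
    have h5 := congrArg Complex.re h4
    rw [← RCLike.re_eq_complex_re, ← intervalIntegral.intervalIntegral_re
      (Continuous.intervalIntegrable (by fun_prop) _ _)] at h5
    simp only [RCLike.re_eq_complex_re, Complex.re_mul_ofReal] at h5
    rw [h5, hS, Complex.natCast_re]
    congr 2
    refine Finset.filter_congr fun w _ => ?_
    constructor <;> intro h <;> linarith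
  rw [h2]
  exact le_add_sqrt_of_sq_le (by positivity) (by positivity) (by exact_mod_cast h1)

theorem card_diffPoly_sub_eq_le {Y D : ℕ}
    (hD : ∀ n : ℕ, n ≠ 0 → n ≤ 2 * Y ^ 4 → n.divisors.card ≤ D) {a : ℤ} (ha : a ≠ 0)
    [DecidableEq (ℕ × ℕ)] :
    ((diffIdx {1} Y ×ˢ diffIdx {1} Y).filter fun p => p.1.1 = p.2.1 ∧
      diffPoly p.1.1.1 p.1.1.2 p.1.2 - diffPoly p.2.1.1 p.2.1.2 p.2.2 = a).card ≤ 12 * D ^ 5 := by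
  have mono : ∀ m k y z : ℕ, y ≤ z → diffPoly m k y ≤ diffPoly m k z := fun m k y z h => by
    unfold diffPoly; gcongr
  have pos : ∀ a : ℤ, 0 < a → ((diffIdx {1} Y ×ˢ diffIdx {1} Y).filter fun p => p.1.1 = p.2.1 ∧
      diffPoly p.1.1.1 p.1.1.2 p.1.2 - diffPoly p.2.1.1 p.2.1.2 p.2.2 = a).card ≤ 12 * D ^ 5 := by
    intro a ha
    have h1 : ((diffIdx {1} Y ×ˢ diffIdx {1} Y).filter fun p => p.1.1 = p.2.1 ∧
        diffPoly p.1.1.1 p.1.1.2 p.1.2 - diffPoly p.2.1.1 p.2.1.2 p.2.2 = a).card ≤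
        ((diffIdx₂ {1} Y).filter fun u => diffPoly₂ u.1.1.1 u.1.1.2 u.1.2 u.2 = a).card := by
      refine Finset.card_le_card_of_injOn
        (fun p => (⟨(p.1.1, p.1.2 - p.2.2), p.2.2⟩ : Σ _ : (ℕ × ℕ) × ℕ, ℕ)) (fun p hp => ?_)
        fun p hp p' hp' h => ?_
      · obtain ⟨⟨b, y⟩, ⟨b', y'⟩⟩ := p
        simp only [Finset.coe_filter, Finset.mem_product, Set.mem_ofPred_eq] at hp ⊢
        obtain ⟨⟨h1, h2⟩, rfl, h4⟩ := hp
        have hlt : y' < y := by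
          by_contra! hc
          have := mono b.1 b.2 y y' hc
          omega
        obtain ⟨a1, a2, a3⟩ := mem_diffIdx.1 h1
        obtain ⟨b1, b2, b3⟩ := mem_diffIdx.1 h2
        simp only at a1 a2 a3 b1 b2 b3
        constructor
        · simp only [diffIdx₂, Finset.mem_sigma, Finset.mem_Icc, Finset.mem_product]
          exact ⟨⟨a1, by omega, by omega⟩, by omega, by omega⟩
        · unfold diffPoly₂
          rw [Nat.add_sub_cancel' hlt.le]; exact h4
      · obtain ⟨⟨b, y⟩, ⟨b', y'⟩⟩ := p
        obtain ⟨⟨c, z⟩, ⟨c', z'⟩⟩ := p'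
        simp only [Finset.coe_filter, Finset.mem_product, Set.mem_ofPred_eq] at hp hp'
        obtain ⟨-, rfl, h4⟩ := hp
        obtain ⟨-, rfl, h4'⟩ := hp'
        simp only [Sigma.mk.injEq, Prod.mk.injEq, heq_eq_eq] at h
        obtain ⟨⟨rfl, h5⟩, rfl⟩ := h
        have hlt : y' < y := by
          by_contra! hc
          have := mono b.1 b.2 y y' hc
          omega
        have hlt' : y' < z := by
          by_contra! hc
          have := mono b.1 b.2 z y' hc
          omega
        have : y = z := by omega
        rw [this]
    refine h1.trans ?_
    rcases Finset.eq_empty_or_nonempty ((diffIdx₂ {1} Y).filter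
      fun u => diffPoly₂ u.1.1.1 u.1.1.2 u.1.2 u.2 = a) with he | ⟨t, ht⟩
    · rw [he]; simp
    · obtain ⟨ht1, rfl⟩ := Finset.mem_filter.1 ht
      exact card_diffPoly₂_eq_le (by simp) hD t ht1
  rcases ha.lt_or_gt with h | h
  · refine le_trans (le_of_eq ?_) (pos (-a) (by omega))
    refine Finset.card_bij (fun p _ => (p.2, p.1)) (fun p hp => ?_) (fun p _ p' _ hpp => ?_)
      fun p hp => ⟨(p.2, p.1), ?_, rfl⟩
    · simp only [Finset.mem_filter, Finset.mem_product] at hp ⊢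
      exact ⟨⟨hp.1.2, hp.1.1⟩, hp.2.1.symm, by omega⟩
    · simp only [Prod.mk.injEq] at hpp
      exact Prod.ext hpp.2 hpp.1
    · simp only [Finset.mem_filter, Finset.mem_product] at hp ⊢
      exact ⟨⟨hp.1.2, hp.1.1⟩, hp.2.1.symm, by omega⟩
  · exact pos a h

theorem card_diffPoly₂_sub_eq_le {Y D : ℕ}
    (hD : ∀ n : ℕ, n ≠ 0 → n ≤ 2 * Y ^ 4 → n.divisors.card ≤ D) {a : ℤ} (ha : a ≠ 0)
    [DecidableEq ((ℕ × ℕ) × ℕ)] :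
    ((diffIdx₂ {1} Y ×ˢ diffIdx₂ {1} Y).filter fun p => p.1.1 = p.2.1 ∧
      diffPoly₂ p.1.1.1.1 p.1.1.1.2 p.1.1.2 p.1.2 -
        diffPoly₂ p.2.1.1.1 p.2.1.1.2 p.2.1.2 p.2.2 = a).card ≤ D ^ 4 := by
  by_cases hY : a.natAbs ≤ 2 * Y ^ 4
  · have h1 := hD a.natAbs (by omega) hY
    have e4 : ((a.natAbs.divisors ×ˢ a.natAbs.divisors) ×ˢ
        (a.natAbs.divisors ×ˢ a.natAbs.divisors)).card ≤ D ^ 4 := by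
      simp only [Finset.card_product]
      calc _ = a.natAbs.divisors.card ^ 4 := by ring
        _ ≤ _ := Nat.pow_le_pow_left h1 4
    refine le_trans ?_ e4
    have fact : ∀ k l y y' : ℕ, diffPoly₂ 1 k l y - diffPoly₂ 1 k l y' =
        12 * k * l * (y - y') * (y + y' + k + l) := fun k l y y' => by
      rw [diffPoly₂_eq, diffPoly₂_eq]; push_cast; ring
    refine Finset.card_le_card_of_injOn (fun p => ((p.1.1.1.2, p.1.1.2),
      (((p.1.2 : ℤ) - p.2.2).natAbs, p.1.2 + p.2.2 + p.1.1.1.2 + p.1.1.2))) (fun p hp => ?_)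
        fun p hp p' hp' h => ?_
    · obtain ⟨⟨⟨⟨m, k⟩, l⟩, y⟩, ⟨b', y'⟩⟩ := p
      simp only [Finset.coe_filter, Finset.mem_product, Set.mem_ofPred_eq] at hp
      obtain ⟨⟨h1, h2⟩, rfl, h4⟩ := hp
      obtain rfl : m = 1 := by simpa using (mem_diffBase.1 (mem_diffIdx₂ h1).1).1
      rw [fact] at h4
      have hna : a.natAbs ≠ 0 := by omega
      simp only [Finset.coe_product, Set.mem_prod, Finset.mem_coe, Nat.mem_divisors, ne_eq, hna,
        not_false_eq_true, and_true]
      rw [← h4]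
      refine ⟨⟨?_, ?_⟩, ?_, ?_⟩ <;> rw [← Int.natCast_dvd]
      · exact ⟨12 * l * (y - y') * (y + y' + k + l), by ring⟩
      · exact ⟨12 * k * (y - y') * (y + y' + k + l), by ring⟩
      · rw [Int.natAbs_dvd]
        exact ⟨12 * k * l * (y + y' + k + l), by ring⟩
      · exact ⟨12 * k * l * (y - y'), by push_cast; ring⟩
    · obtain ⟨⟨⟨⟨m, k⟩, l⟩, y⟩, ⟨b', y'⟩⟩ := p
      obtain ⟨⟨⟨⟨m₁, k₁⟩, l₁⟩, z⟩, ⟨c', z'⟩⟩ := p'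
      simp only [Finset.coe_filter, Finset.mem_product, Set.mem_ofPred_eq] at hp hp'
      obtain ⟨⟨h1, h2⟩, rfl, h4⟩ := hp
      obtain ⟨⟨h1', h2'⟩, rfl, h4'⟩ := hp'
      obtain rfl : m = 1 := by simpa using (mem_diffBase.1 (mem_diffIdx₂ h1).1).1
      obtain rfl : m₁ = 1 := by simpa using (mem_diffBase.1 (mem_diffIdx₂ h1').1).1
      simp only [Prod.mk.injEq] at h
      obtain ⟨⟨rfl, rfl⟩, h5, h6⟩ := h
      have h3 := h4.trans h4'.symm
      rw [fact, fact] at h3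
      have hk : (1:ℤ) ≤ k := by exact_mod_cast (mem_diffBase.1 (mem_diffIdx₂ h1).1).2.1
      have hl : (1:ℤ) ≤ l := by exact_mod_cast (mem_diffIdx₂ h1).2.1
      have h7 : (y + y' + k + l : ℤ) = z + z' + k + l := by exact_mod_cast h6
      rw [h7] at h3
      have h8 : (y - y' : ℤ) = z - z' := by
        have hp : (0:ℤ) < 12 * k * l := by positivity
        have hp' : (0:ℤ) < z + z' + k + l := by positivity
        exact mul_left_cancel₀ hp.ne' (mul_right_cancel₀ hp'.ne' h3)
      have h9 : y = z := by omega
      have h10 : y' = z' := by omega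
      rw [h9, h10]
  · refine le_trans (le_of_eq ?_) (Nat.zero_le _)
    rw [Finset.card_eq_zero, Finset.filter_eq_empty_iff]
    rintro ⟨⟨⟨⟨m, k⟩, l⟩, y⟩, ⟨b', y'⟩⟩ hp hq
    simp only [Finset.mem_product] at hp hq
    obtain ⟨h1, h2⟩ := hp
    have bd : ∀ m k l y : ℕ, (⟨((m, k), l), y⟩ : Σ _ : (ℕ × ℕ) × ℕ, ℕ) ∈ diffIdx₂ {1} Y →
        0 ≤ diffPoly₂ m k l y ∧ diffPoly₂ m k l y ≤ (Y : ℤ) ^ 4 := by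
      intro m k l y hm
      obtain ⟨a1, a2, a3, a4⟩ := mem_diffIdx₂ hm
      obtain rfl : m = 1 := by simpa using (mem_diffBase.1 a1).1
      refine ⟨by rw [diffPoly₂_eq]; positivity, ?_⟩
      have b1 := diffPoly_le (m := 1) (k := k) (y := y + l) (Y := Y) one_pos a4
      have b2 : 0 ≤ diffPoly 1 k y := by unfold diffPoly; positivity
      unfold diffPoly₂; linarith
    have q1 := bd _ _ _ _ h1
    have q2 := bd _ _ _ _ (by exact h2 : (⟨((b'.1.1, b'.1.2), b'.2), y'⟩ : Σ _ : (ℕ × ℕ) × ℕ, ℕ) ∈ _)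
    apply hY
    zify
    rw [abs_le]
    constructor <;> linarith [hq.2]

/-- A weighted exponential sum. -/
def wsum {ι : Type} (Z : Finset ι) (n : ι → ℤ) (a : ι → ℂ) (α : ℝ) : ℂ :=
  ∑ i ∈ Z, a i * e (n i * α)

@[fun_prop]
theorem continuous_wsum {ι : Type} (Z : Finset ι) (n : ι → ℤ) (a : ι → ℂ) :
    Continuous (wsum Z n a) := by
  unfold wsum; fun_prop

theorem dom_wsum {ι : Type} {Z : Finset ι} (n : ι → ℤ) {a : ι → ℂ} (ha : ∀ i ∈ Z, ‖a i‖ ≤ 1) :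
    Dom (wsum Z n a) (trig Z n) :=
  Dom.sum Z fun i hi => Dom.char (n i) (ha i hi)

theorem card_filter_eq_of_injOn {ι : Type*} {Z : Finset ι} {n : ι → ℤ} (hn : Set.InjOn n Z) :
    ((Z ×ˢ Z).filter fun q => n q.1 = n q.2).card = Z.card := by
  classical
  rw [← Finset.diag_card Z]
  congr 1
  ext ⟨x, y⟩
  simp only [Finset.mem_filter, Finset.mem_product, Finset.mem_diag]
  constructor
  · rintro ⟨⟨h1, h2⟩, h3⟩; exact ⟨h1, hn h1 h2 h3⟩
  · rintro ⟨h1, rfl⟩; exact ⟨⟨h1, h1⟩, rfl⟩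

theorem integral_norm_trig_sq_of_injOn {ι : Type*} {Z : Finset ι} {n : ι → ℤ}
    (hn : Set.InjOn n Z) : ∫ α in (0:ℝ)..1, ‖trig Z n α‖ ^ 2 = Z.card := by
  rw [integral_norm_sq_trig_eq_card, card_filter_eq_of_injOn hn]

theorem integral_norm_wsum_sq_le {ι : Type} {Z : Finset ι} {n : ι → ℤ} {a : ι → ℂ}
    (ha : ∀ i ∈ Z, ‖a i‖ ≤ 1) (hn : Set.InjOn n Z) :
    ∫ α in (0:ℝ)..1, ‖wsum Z n a α‖ ^ 2 ≤ Z.card :=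
  (dom_wsum n ha).norm_sq.integral_le.trans (integral_norm_trig_sq_of_injOn hn).le

theorem diffPoly_injective {m k y z : ℕ} (hm : 0 < m) (hk : 0 < k) (h : diffPoly m k y = diffPoly m k z) :
    y = z := by
  by_contra hne
  rcases lt_or_gt_of_ne hne with h1 | h1
  · exact absurd h (ne_of_lt (by unfold diffPoly; gcongr))
  · exact absurd h (ne_of_gt (by unfold diffPoly; gcongr))

theorem diffPoly₂_injective {m k l y z : ℕ} (hk : 0 < k) (hl : 0 < l)
    (h : diffPoly₂ m k l y = diffPoly₂ m k l z) : y = z := by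
  rw [diffPoly₂_eq, diffPoly₂_eq] at h
  by_contra hne
  rcases lt_or_gt_of_ne hne with h1 | h1
  · exact absurd h (ne_of_lt (by gcongr))
  · exact absurd h (ne_of_gt (by gcongr))

theorem integral_fullSum_sq_mul_le {ι : Type*} {Z : Finset ι} {n : ι → ℤ} (hn : Set.InjOn n Z)
    {N D : ℕ} (hD : ∀ m : ℕ, m ≠ 0 → m ≤ 2 * N ^ 4 → m.divisors.card ≤ D) :
    ∫ α in (0:ℝ)..1, ‖fullSum N α‖ ^ 2 * ‖trig Z n α‖ ^ 2 ≤
      3 * (N * Z.card) + 2 * √(N * Z.card * (12 * D ^ 5 * Z.card ^ 2)) := by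
  have h1 := norm_integral_trig_mul_le (diffIdx {1} N) (diffBase {1} N) Z (fun t => t.1)
    (fun t => diffPoly t.1.1 t.1.2 t.2) n (fun u hu => (mem_diffIdx.1 hu).1)
    (fun u hu v hv huv h => by
      obtain ⟨u, y⟩ := u
      obtain ⟨v, z⟩ := v
      simp only at huv h
      subst huv
      obtain ⟨hm, hk, -⟩ := mem_diffBase.1 (mem_diffIdx.1 hu).1
      rw [diffPoly_injective (by simp at hm; omega) hk h]) hn (D := 12 * D ^ 5)
    (fun a ha _ => card_diffPoly_sub_eq_le hD ha)
  have h2 : ((diffBase {1} N).card : ℝ) ≤ N := by exact_mod_cast card_diffBase_one_le N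
  have h3 : ∫ α in (0:ℝ)..1, ‖fullSum N α‖ ^ 2 * ‖trig Z n α‖ ^ 2 = N * Z.card +
      2 * ∫ α in (0:ℝ)..1, (diffSum {1} N α).re * ‖trig Z n α‖ ^ 2 := by
    rw [← integral_norm_trig_sq_of_injOn hn, ← intervalIntegral.integral_const_mul,
      ← intervalIntegral.integral_const_mul, ← intervalIntegral.integral_add
        (Continuous.intervalIntegrable (by fun_prop) _ _)
        (Continuous.intervalIntegrable (by fun_prop) _ _)]
    refine intervalIntegral.integral_congr fun α _ => ?_
    simp only [norm_sq_fullSum]; ring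
  have h4 : ∫ α in (0:ℝ)..1, (diffSum {1} N α).re * ‖trig Z n α‖ ^ 2 ≤
      N * Z.card + √(N * Z.card * (12 * D ^ 5 * Z.card ^ 2)) := by
    refine h1.trans (add_le_add (by gcongr) (Real.sqrt_le_sqrt ?_))
    push_cast
    gcongr
  rw [h3]; linarith

theorem integral_fullSum_pow_four_mul_le {ι : Type*} {Z : Finset ι} {n : ι → ℤ}
    (hn : Set.InjOn n Z)
    {N D : ℕ} (hN : 1 ≤ N) (hD : ∀ m : ℕ, m ≠ 0 → m ≤ 2 * N ^ 4 → m.divisors.card ≤ D) :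
    ∫ α in (0:ℝ)..1, ‖fullSum N α‖ ^ 4 * ‖trig Z n α‖ ^ 2 ≤
      26 * (N ^ 3 * Z.card) + 16 * (N * √(N ^ 2 * Z.card * (D ^ 4 * Z.card ^ 2))) := by
  have h1 := norm_integral_trig_mul_le (diffIdx₂ {1} N) (diffBase {1} N ×ˢ Finset.Icc 1 N) Z
    (fun t => t.1) (fun t => diffPoly₂ t.1.1.1 t.1.1.2 t.1.2 t.2) n
    (fun u hu => (Finset.mem_sigma.1 hu).1)
    (fun u hu v hv huv h => by
      obtain ⟨u, y⟩ := u
      obtain ⟨v, z⟩ := v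
      simp only at huv h
      subst huv
      have h5 := mem_diffIdx₂ hu
      rw [diffPoly₂_injective (mem_diffBase.1 h5.1).2.1 h5.2.1 h]) hn (D := D ^ 4)
    (fun a ha _ => card_diffPoly₂_sub_eq_le hD ha)
  have h2 : ((diffBase {1} N).card : ℝ) ≤ N := by exact_mod_cast card_diffBase_one_le N
  have h2' : ((diffBase {1} N ×ˢ Finset.Icc 1 N).card : ℝ) ≤ N ^ 2 := by
    rw [Finset.card_product, Nat.card_Icc, sq]; push_cast; gcongr
  have hN1 : (1:ℝ) ≤ N := by exact_mod_cast hN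
  have h4 : ∫ α in (0:ℝ)..1, (diffSum₂ {1} N α).re * ‖trig Z n α‖ ^ 2 ≤
      N ^ 2 * Z.card + √(N ^ 2 * Z.card * (D ^ 4 * Z.card ^ 2)) := by
    refine h1.trans (add_le_add (by gcongr) (Real.sqrt_le_sqrt ?_))
    push_cast
    gcongr
  have h5 : ∀ α, ‖fullSum N α‖ ^ 4 ≤ 10 * N ^ 3 + 16 * (N * (diffSum₂ {1} N α).re) := by
    intro α
    have h6 := norm_diffSum_sq_le {1} N α
    have h7 : 0 ≤ (diffBase {1} N).card * (N:ℝ) + 2 * (diffSum₂ {1} N α).re := by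
      rcases (Nat.zero_le (diffBase {1} N).card).eq_or_lt with h0 | h0
      · have : diffIdx₂ {1} N = ∅ := by
          rw [eq_comm, Finset.card_eq_zero] at h0
          rw [diffIdx₂, h0]; simp
        rw [← h0, diffSum₂, this]; simp [trig]
      · have h0' : (0:ℝ) < (diffBase {1} N).card := by exact_mod_cast h0
        by_contra! hc
        nlinarith [mul_neg_of_pos_of_neg h0' hc, sq_nonneg ‖diffSum {1} N α‖]
    have h8 := norm_fullSum_pow_four_le N α
    have h9 : ‖diffSum {1} N α‖ ^ 2 ≤ N * (N * N + 2 * (diffSum₂ {1} N α).re) :=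
      h6.trans (mul_le_mul h2 (by gcongr) h7 (by positivity))
    nlinarith [pow_le_pow_right₀ hN1 (show 2 ≤ 3 by norm_num)]
  have h3 : ∫ α in (0:ℝ)..1, ‖fullSum N α‖ ^ 4 * ‖trig Z n α‖ ^ 2 ≤ 10 * N ^ 3 * Z.card +
      16 * (N * ∫ α in (0:ℝ)..1, (diffSum₂ {1} N α).re * ‖trig Z n α‖ ^ 2) := by
    rw [← integral_norm_trig_sq_of_injOn hn, ← intervalIntegral.integral_const_mul,
      ← intervalIntegral.integral_const_mul, ← intervalIntegral.integral_const_mul,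
      ← intervalIntegral.integral_add
        (Continuous.intervalIntegrable (by fun_prop) _ _)
        (Continuous.intervalIntegrable (by fun_prop) _ _)]
    refine intervalIntegral.integral_mono_on (by norm_num)
          (Continuous.intervalIntegrable (by fun_prop) _ _)
          (Continuous.intervalIntegrable (by fun_prop) _ _) fun α _ => ?_
    nlinarith [mul_le_mul_of_nonneg_right (h5 α) (sq_nonneg ‖trig Z n α‖)]
  refine h3.trans ?_
  have := mul_le_mul_of_nonneg_left h4 (by positivity : (0:ℝ) ≤ 16 * N)
  nlinarith

theorem integral_smoothSum_sq_mul_le {ι : Type} {Z : Finset ι} {n : ι → ℤ} {a : ι → ℂ}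
    (ha : ∀ i ∈ Z, ‖a i‖ ≤ 1) (hn : Set.InjOn n Z)
    {N D : ℕ} (R : ℕ) (hZ : N ≤ Z.card)
    (hD : ∀ m : ℕ, m ≠ 0 → m ≤ 2 * N ^ 4 → m.divisors.card ≤ D) :
    ∫ α in (0:ℝ)..1, ‖smoothSum N R α‖ ^ 2 * ‖wsum Z n a α‖ ^ 2 ≤
      11 * D ^ 3 * √(N * Z.card ^ 3) := by
  have h1 := ((dom_smoothSum_fullSum N R).norm_sq.mul_real (dom_wsum n ha).norm_sq).integral_le
  refine (h1.trans (integral_fullSum_sq_mul_le hn hD)).trans ?_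
  have hZ' : (N:ℝ) ≤ Z.card := by exact_mod_cast hZ
  have hD1 : (1:ℝ) ≤ D ∨ N = 0 := by
    rcases Nat.eq_zero_or_pos N with h | h
    · exact Or.inr h
    · have := hD 1 one_ne_zero (by have := Nat.pow_pos (n := 4) h; omega)
      left; simp at this; exact_mod_cast this
  rcases hD1 with hD1 | rfl
  swap
  · simp
  generalize (Z.card : ℝ) = z at hZ' ⊢
  have hN0 : (0:ℝ) ≤ N := by positivity
  have hz0 : 0 ≤ z := hN0.trans hZ'
  have h2 : N * z ≤ √(N * z ^ 3) := by
    apply Real.le_sqrt_of_sq_le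
    have : (N:ℝ) * (N * z ^ 2) ≤ N * (z * z ^ 2) := by gcongr
    nlinarith
  have h3 : √(N * z * (12 * D ^ 5 * z ^ 2)) ≤ 4 * D ^ 3 * √(N * z ^ 3) := by
    rw [← Real.sqrt_sq (by positivity : (0:ℝ) ≤ 4 * D ^ 3), ← Real.sqrt_mul (by positivity)]
    apply Real.sqrt_le_sqrt
    have : (D:ℝ) ^ 5 ≤ D ^ 6 := pow_le_pow_right₀ hD1 (by norm_num)
    have h5 : 0 ≤ N * z ^ 3 := by positivity
    nlinarith [mul_le_mul_of_nonneg_right this h5]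
  have h4 : (1:ℝ) ≤ D ^ 3 := one_le_pow₀ hD1
  nlinarith [mul_le_mul_of_nonneg_right h4 (Real.sqrt_nonneg (N * z ^ 3))]

theorem integral_smoothSum_pow_four_mul_le {ι : Type} {Z : Finset ι} {n : ι → ℤ} {a : ι → ℂ}
    (ha : ∀ i ∈ Z, ‖a i‖ ≤ 1) (hn : Set.InjOn n Z)
    {N D : ℕ} (R : ℕ) (hN : 1 ≤ N) (hZ : N ^ 2 ≤ Z.card)
    (hD : ∀ m : ℕ, m ≠ 0 → m ≤ 2 * N ^ 4 → m.divisors.card ≤ D) :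
    ∫ α in (0:ℝ)..1, ‖smoothSum N R α‖ ^ 4 * ‖wsum Z n a α‖ ^ 2 ≤
      42 * D ^ 2 * (N ^ 2 * √(Z.card ^ 3)) := by
  have h1 := (((dom_smoothSum_fullSum N R).norm_pow 2).mul_real (dom_wsum n ha).norm_sq).integral_le
  refine (h1.trans (integral_fullSum_pow_four_mul_le hn hN hD)).trans ?_
  have hZ' : (N:ℝ) ^ 2 ≤ Z.card := by exact_mod_cast hZ
  have hD1 : (1:ℝ) ≤ D := by
    have := hD 1 one_ne_zero (by have := Nat.pow_pos (n := 4) hN; omega)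
    simp at this; exact_mod_cast this
  generalize (Z.card : ℝ) = z at hZ' ⊢
  have hN0 : (0:ℝ) ≤ N := by positivity
  have hz0 : 0 ≤ z := (sq_nonneg _).trans hZ'
  have h2 : N * z ≤ √(z ^ 3) := by
    apply Real.le_sqrt_of_sq_le
    have : (N:ℝ) ^ 2 * z ^ 2 ≤ z * z ^ 2 := by gcongr
    nlinarith
  have h3 : √(N ^ 2 * z * (D ^ 4 * z ^ 2)) = N * D ^ 2 * √(z ^ 3) := by
    rw [← Real.sqrt_sq (by positivity : (0:ℝ) ≤ N * D ^ 2), ← Real.sqrt_mul (by positivity)]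
    congr 1; ring
  have h4 : (1:ℝ) ≤ D ^ 2 := one_le_pow₀ hD1
  rw [h3]
  have h5 : (N:ℝ) ^ 3 * z ≤ N ^ 2 * √(z ^ 3) := by
    have := mul_le_mul_of_nonneg_left h2 (sq_nonneg (N:ℝ))
    nlinarith
  have h6 : 0 ≤ (N:ℝ) ^ 2 * √(z ^ 3) := by positivity
  nlinarith [mul_le_mul_of_nonneg_right h4 h6]

theorem integral_smoothSum_pow_four_mul_le' {ι : Type} {Z : Finset ι} {n : ι → ℤ} {a : ι → ℂ}
    (ha : ∀ i ∈ Z, ‖a i‖ ≤ 1) (hn : Set.InjOn n Z)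
    {N D : ℕ} (R : ℕ) (hN : 1 ≤ N) (hZ : Z.card ≤ N ^ 2)
    (hD : ∀ m : ℕ, m ≠ 0 → m ≤ 2 * N ^ 4 → m.divisors.card ≤ D) :
    ∫ α in (0:ℝ)..1, ‖smoothSum N R α‖ ^ 4 * ‖wsum Z n a α‖ ^ 2 ≤
      42 * D ^ 2 * (N ^ 3 * Z.card) := by
  have h1 := (((dom_smoothSum_fullSum N R).norm_pow 2).mul_real (dom_wsum n ha).norm_sq).integral_le
  refine (h1.trans (integral_fullSum_pow_four_mul_le hn hN hD)).trans ?_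
  have hZ' : (Z.card : ℝ) ≤ (N:ℝ) ^ 2 := by exact_mod_cast hZ
  have hD1 : (1:ℝ) ≤ D := by
    have := hD 1 one_ne_zero (by have := Nat.pow_pos (n := 4) hN; omega)
    simp at this; exact_mod_cast this
  have hz0 : 0 ≤ (Z.card : ℝ) := by positivity
  generalize (Z.card : ℝ) = z at hZ' hz0 ⊢
  have h3 : √(N ^ 2 * z * (D ^ 4 * z ^ 2)) ≤ N ^ 2 * D ^ 2 * z := by
    apply Real.sqrt_le_iff.2 ⟨by positivity, ?_⟩
    have : (N:ℝ) ^ 2 * D ^ 4 * z ^ 2 * z ≤ N ^ 2 * D ^ 4 * z ^ 2 * N ^ 2 := by gcongr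
    nlinarith
  have h4 : (1:ℝ) ≤ D ^ 2 := one_le_pow₀ hD1
  have h6 : 0 ≤ (N:ℝ) ^ 3 * z := by positivity
  have h7 := mul_le_mul_of_nonneg_left h3 (by positivity : (0:ℝ) ≤ 16 * N)
  nlinarith [mul_le_mul_of_nonneg_right h4 h6]

/-- The major arc majorant for the complete sum of length `N`. -/
def majArc (N : ℕ) : ℝ → ℝ := Psi N ((N : ℝ) * (N : ℝ) ^ 3)

theorem majArc_nonneg (N : ℕ) (α : ℝ) : 0 ≤ majArc N α := Psi_nonneg N (by positivity) α

@[fun_prop]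
theorem continuous_majArc (N : ℕ) : Continuous (majArc N) := continuous_Psi N (by positivity)

theorem norm_fullSum_pow_eight_le {N D : ℕ} (hN : 1 ≤ N)
    (hD : ∀ m : ℕ, m ≠ 0 → m ≤ 24 * N ^ 4 → m.divisors.card ≤ D) (α : ℝ) :
    ‖fullSum N α‖ ^ 8 ≤ 3000000 * (D ^ 2 * (1 + Real.log (6 * (N * N ^ 3)))) *
      (N ^ 7 + N ^ 8 * majArc N α) := by
  have h1 := norm_diffSum_pow_four_le (𝓜 := {1}) (H := N) (Y := N) (D := D) hN hN
    (fun b hb => (mem_diffBase.1 hb).2.2.1)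
    (fun m hm hmN => hD m hm (hmN.trans (by
      have : N * N ^ 2 ≤ N ^ 4 := by
        rw [← pow_succ']; exact Nat.pow_le_pow_right hN (by norm_num)
      omega))) α
  rw [← majArc] at h1
  have hN1 : (1:ℝ) ≤ N := by exact_mod_cast hN
  have hD1 : (1:ℝ) ≤ D := by
    have := hD 1 one_ne_zero (by have := Nat.pow_pos (n := 4) hN; omega)
    simp at this; exact_mod_cast this
  have hl : 0 ≤ Real.log (6 * ((N:ℝ) * N ^ 3)) := Real.log_nonneg (by
    have : 1 ≤ (N:ℝ) * N ^ 3 := one_le_mul_of_one_le_of_one_le hN1 (one_le_pow₀ hN1)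
    linarith)
  have hT : 1 ≤ (D:ℝ) ^ 2 * (1 + Real.log (6 * ((N:ℝ) * N ^ 3))) :=
    one_le_mul_of_one_le_of_one_le (one_le_pow₀ hD1) (by linarith)
  set T := (D:ℝ) ^ 2 * (1 + Real.log (6 * ((N:ℝ) * N ^ 3)))
  have hm := majArc_nonneg N α
  have h2 : ‖fullSum N α‖ ^ 8 ≤ (N + 2 * ‖diffSum {1} N α‖) ^ 4 := by
    have := pow_le_pow_left₀ (sq_nonneg _) (norm_fullSum_sq_le N α) 4
    rwa [← pow_mul] at this
  have h3 : (N + 2 * ‖diffSum {1} N α‖) ^ 4 ≤ 8 * (N:ℝ) ^ 4 + 128 * ‖diffSum {1} N α‖ ^ 4 := by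
    have := add_pow_le (by positivity : (0:ℝ) ≤ N)
      (by positivity : 0 ≤ 2 * ‖diffSum {1} N α‖) 4
    norm_num [mul_pow] at this ⊢
    linarith
  have h4 : ((({1} : Finset ℕ).card : ℝ) * N) ^ 4 * N ^ 3 * (1 + N * majArc N α) =
      N ^ 7 + N ^ 8 * majArc N α := by
    rw [Finset.card_singleton]; push_cast; ring
  rw [h4] at h1
  have h5 : (N:ℝ) ^ 4 ≤ N ^ 7 + N ^ 8 * majArc N α := by
    have : (N:ℝ) ^ 4 ≤ N ^ 7 := pow_le_pow_right₀ hN1 (by norm_num)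
    have : 0 ≤ (N:ℝ) ^ 8 * majArc N α := by positivity
    linarith
  set W := (N:ℝ) ^ 7 + N ^ 8 * majArc N α
  have hW0 : 0 ≤ W := le_trans (by positivity) h5
  have := mul_le_mul_of_nonneg_right hT hW0
  linarith

theorem integral_majArc_mul_le {ι : Type} {Z : Finset ι} {n : ι → ℤ} {a : ι → ℂ}
    (ha : ∀ i ∈ Z, ‖a i‖ ≤ 1) (hn : Set.InjOn n Z)
    {N D : ℕ} (hN : 1 ≤ N) (hZ : N ≤ Z.card) (hb : ∀ i ∈ Z, |n i| ≤ 8 * N ^ 4)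
    (hD : ∀ m : ℕ, m ≠ 0 → m ≤ 24 * N ^ 4 → m.divisors.card ≤ D) :
    ∫ α in (0:ℝ)..1, majArc N α * ‖wsum Z n a α‖ ^ 2 ≤
      2 * (D ^ 2 * (1 + Real.log (6 * (N * N ^ 3)))) * (Z.card ^ 2 / N ^ 4) := by
  have hN1 : (1:ℝ) ≤ N := by exact_mod_cast hN
  have hD1 : (1:ℝ) ≤ D := by
    have := hD 1 one_ne_zero (by have := Nat.pow_pos (n := 4) hN; omega)
    simp at this; exact_mod_cast this
  have hM : (1:ℝ) ≤ (N:ℝ) * N ^ 3 := one_le_mul_of_one_le_of_one_le hN1 (one_le_pow₀ hN1)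
  have h1 := integral_Psi_mul_norm_sq_le Z n a ha N (N := (N:ℝ) * N ^ 3) (by positivity) (D := D)
    (fun i hi j hj hij => hD _ (by omega) (by
      have h1 := hb i hi
      have h2 := hb j hj
      rw [abs_le] at h1 h2
      zify
      rw [abs_le]
      constructor <;> nlinarith [h1.1, h1.2, h2.1, h2.2, pow_nonneg (Int.natCast_nonneg N) 4]))
  rw [card_filter_eq_of_injOn hn] at h1
  have hl : Real.log (1 + (N:ℝ) * N ^ 3) ≤ Real.log (6 * ((N:ℝ) * N ^ 3)) :=
    Real.log_le_log (by positivity) (by linarith)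
  have hl0 : 0 ≤ Real.log (1 + (N:ℝ) * N ^ 3) := Real.log_nonneg (by linarith)
  refine h1.trans ?_
  have hZ' : (N:ℝ) ≤ Z.card := by exact_mod_cast hZ
  generalize (Z.card : ℝ) = z at *
  set l := Real.log (1 + (N:ℝ) * N ^ 3)
  set l' := Real.log (6 * ((N:ℝ) * N ^ 3))
  have h2 : (N:ℝ) * z + D * z ^ 2 ≤ 2 * (D * z ^ 2) := by
    have : (N:ℝ) * z ≤ z * z := by gcongr; linarith
    nlinarith [sq_nonneg z]
  have h3 : (D:ℝ) ≤ D ^ 2 := le_self_pow₀ hD1 (by norm_num)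
  calc l / (N * N ^ 3) * (N * z + D * z ^ 2) ≤ (1 + l') / (N * N ^ 3) * (2 * (D ^ 2 * z ^ 2)) := by
        have : l ≤ 1 + l' := by linarith
        have h4 : (0:ℝ) ≤ N * z + D * z ^ 2 := by
          have : 0 ≤ z := by linarith
          positivity
        refine mul_le_mul (by gcongr) (h2.trans (by gcongr)) h4 ?_
        have : 0 ≤ 1 + l' := by linarith
        positivity
    _ = 2 * (D ^ 2 * (1 + l')) * (z ^ 2 / N ^ 4) := by
        rw [← pow_succ' (N:ℝ) 3]; ring

theorem smoothSum_eq_wsum (N R : ℕ) :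
    smoothSum N R = wsum (smoothUpTo N R) (fun x => (x : ℤ) ^ 4) (fun _ => 1) := by
  funext α; simp [smoothSum, trig, wsum]

theorem integral_majArc_mul_smoothSum_le {N D : ℕ} (R : ℕ) (hN : 1 ≤ N)
    (hD : ∀ m : ℕ, m ≠ 0 → m ≤ 24 * N ^ 4 → m.divisors.card ≤ D) :
    ∫ α in (0:ℝ)..1, majArc N α * ‖smoothSum N R α‖ ^ 2 ≤
      2 * (D ^ 2 * (1 + Real.log (6 * (N * N ^ 3)))) * (1 / N ^ 2) := by
  have hN1 : (1:ℝ) ≤ N := by exact_mod_cast hN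
  have hD1 : (1:ℝ) ≤ D := by
    have := hD 1 one_ne_zero (by have := Nat.pow_pos (n := 4) hN; omega)
    simp at this; exact_mod_cast this
  have hM : (1:ℝ) ≤ (N:ℝ) * N ^ 3 := one_le_mul_of_one_le_of_one_le hN1 (one_le_pow₀ hN1)
  have hinj : Set.InjOn (fun x : ℕ => (x : ℤ) ^ 4) (smoothUpTo N R) := by
    intro x _ y _ h
    simp only at h
    have h' : x ^ 4 = y ^ 4 := by exact_mod_cast h
    exact Nat.pow_left_injective (by norm_num) h'
  have h1 := integral_Psi_mul_norm_sq_le (smoothUpTo N R) (fun x => (x : ℤ) ^ 4) (fun _ => 1)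
    (by simp) N (N := (N:ℝ) * N ^ 3) (by positivity) (D := D)
    (fun i hi j hj hij => hD _ (by omega) (by
      have h1 := Nat.pow_le_pow_left (mem_smoothUpTo.1 hi).2.1 4
      have h2 := Nat.pow_le_pow_left (mem_smoothUpTo.1 hj).2.1 4
      zify at h1 h2 ⊢
      rw [abs_le]
      have h3 : (0:ℤ) ≤ (i:ℤ) ^ 4 := by positivity
      have h4 : (0:ℤ) ≤ (j:ℤ) ^ 4 := by positivity
      constructor <;> linarith))
  rw [card_filter_eq_of_injOn hinj] at h1
  have h0 : ∀ α, ∑ i ∈ smoothUpTo N R, (1:ℂ) * e (((i : ℤ) ^ 4 : ℤ) * α) = smoothSum N R α := by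
    intro α; rw [smoothSum_eq_wsum]; rfl
  simp only [h0] at h1
  refine h1.trans ?_
  have hz : ((smoothUpTo N R).card : ℝ) ≤ N := by
    have := Finset.card_le_card (smoothUpTo_subset_Icc N R)
    simp at this; exact_mod_cast this
  have hl : Real.log (1 + (N:ℝ) * N ^ 3) ≤ Real.log (6 * ((N:ℝ) * N ^ 3)) :=
    Real.log_le_log (by positivity) (by linarith)
  have hl0 : 0 ≤ Real.log (1 + (N:ℝ) * N ^ 3) := Real.log_nonneg (by linarith)
  have hz0 : (0:ℝ) ≤ ((smoothUpTo N R).card : ℝ) := by positivity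
  generalize ((smoothUpTo N R).card : ℝ) = z at *
  set l := Real.log (1 + (N:ℝ) * N ^ 3)
  set l' := Real.log (6 * ((N:ℝ) * N ^ 3))
  have h2 : (N:ℝ) * z + D * z ^ 2 ≤ 2 * (D * N ^ 2) := by
    have h3 : (N:ℝ) * z ≤ N * N := by gcongr
    have h4 : (D:ℝ) * z ^ 2 ≤ D * N ^ 2 := by gcongr
    nlinarith [sq_nonneg (N:ℝ)]
  have h3 : (D:ℝ) ≤ D ^ 2 := le_self_pow₀ hD1 (by norm_num)
  calc l / (N * N ^ 3) * (N * z + D * z ^ 2) ≤ (1 + l') / (N * N ^ 3) * (2 * (D ^ 2 * N ^ 2)) := by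
        have : l ≤ 1 + l' := by linarith
        have h4 : (0:ℝ) ≤ N * z + D * z ^ 2 := by positivity
        refine mul_le_mul (by gcongr) (h2.trans (by gcongr)) h4 ?_
        have : 0 ≤ 1 + l' := by linarith
        positivity
    _ = 2 * (D ^ 2 * (1 + l')) * (1 / N ^ 2) := by
        field_simp

/-- The mean value estimates feeding into the main argument, with all losses collected in `Q`. -/
structure MeanValues (N R : ℕ) (Q : ℝ) : Prop where
  one_le : 1 ≤ Q
  six : moment 6 N R ≤ Q * (N : ℝ) ^ (3.198 : ℝ)
  eight : moment 8 N R ≤ Q * (N : ℝ) ^ (4.6 : ℝ)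
  ten : moment 10 N R ≤ Q * (N : ℝ) ^ (6.23755 : ℝ)
  twelve : moment 12 N R ≤ Q * (N : ℝ) ^ (8 : ℝ)
  weyl : ∀ α, ‖fullSum N α‖ ^ 8 ≤ Q * (N ^ 7 + N ^ 8 * majArc N α)
  arc : ∫ α in (0:ℝ)..1, majArc N α * ‖smoothSum N R α‖ ^ 2 ≤ Q * (1 / N ^ 2)
  sq_mul : ∀ (Z : Finset ℤ) (n : ℤ → ℤ) (a : ℤ → ℂ), (∀ i ∈ Z, ‖a i‖ ≤ 1) → Set.InjOn n Z →
    N ≤ Z.card → ∫ α in (0:ℝ)..1, ‖smoothSum N R α‖ ^ 2 * ‖wsum Z n a α‖ ^ 2 ≤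
      Q * √(N * Z.card ^ 3)
  pow_four_mul : ∀ (Z : Finset ℤ) (n : ℤ → ℤ) (a : ℤ → ℂ), (∀ i ∈ Z, ‖a i‖ ≤ 1) →
    Set.InjOn n Z → N ^ 2 ≤ Z.card →
    ∫ α in (0:ℝ)..1, ‖smoothSum N R α‖ ^ 4 * ‖wsum Z n a α‖ ^ 2 ≤ Q * (N ^ 2 * √(Z.card ^ 3))
  pow_four_mul_of_le : ∀ (Z : Finset ℤ) (n : ℤ → ℤ) (a : ℤ → ℂ), (∀ i ∈ Z, ‖a i‖ ≤ 1) →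
    Set.InjOn n Z → Z.card ≤ N ^ 2 →
    ∫ α in (0:ℝ)..1, ‖smoothSum N R α‖ ^ 4 * ‖wsum Z n a α‖ ^ 2 ≤ Q * (N ^ 3 * Z.card)
  arc_mul : ∀ (Z : Finset ℤ) (n : ℤ → ℤ) (a : ℤ → ℂ), (∀ i ∈ Z, ‖a i‖ ≤ 1) → Set.InjOn n Z →
    (∀ i ∈ Z, |n i| ≤ 8 * N ^ 4) → N ≤ Z.card →
    ∫ α in (0:ℝ)..1, majArc N α * ‖wsum Z n a α‖ ^ 2 ≤ Q * (Z.card ^ 2 / N ^ 4)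

theorem PolyBd.div_rpow {f : ℕ → ℕ → ℝ} {x : ℝ} (hf : PolyBd f x) (y : ℝ) :
    PolyBd (fun N R => f N R / (N : ℝ) ^ y) (x - y) := by
  obtain ⟨C, K, hC, hK, h⟩ := hf
  refine ⟨C, K, hC, hK, fun N R hN hR => ?_⟩
  have hN' : (0:ℝ) < N := by exact_mod_cast hN
  rw [Real.rpow_sub hN', div_le_iff₀ (by positivity)]
  refine (h N R hN hR).trans (le_of_eq ?_)
  field_simp

theorem exists_polyBd_meanValues {ε : ℝ} (hε : 0 < ε) :
    ∃ Q : ℕ → ℕ → ℝ, PolyBd Q ε ∧ ∀ N R : ℕ, 1 ≤ N → 1 ≤ R → MeanValues N R (Q N R) := by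
  obtain ⟨h6, h8⟩ := polyBd_moment_six_eight
  have h6' := (h6.div_rpow 3.198).mono_exp (by linarith : (3.198:ℝ) - 3.198 ≤ ε)
  have h8' := (h8.div_rpow 4.6).mono_exp (by linarith : (4.6:ℝ) - 4.6 ≤ ε)
  have h10' := (polyBd_moment_ten.div_rpow 6.23755).mono_exp
    (by linarith : (6.23755:ℝ) - 6.23755 ≤ ε)
  have h12' := ((polyBd_moment_twelve hε).div_rpow 8).mono_exp
    (by linarith : (8 + ε) - 8 ≤ ε)
  have hD := polyBd_divMax 24 4 (by positivity : 0 < ε / 4)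
  have hN4 : PolyBd (fun N _ => 6 * ((N:ℝ) * (N:ℝ) ^ 3)) (1 + 1 * (3:ℕ)) :=
    (PolyBd.self_left.mul (PolyBd.self_left.pow (fun _ _ => by positivity) 3)
      (fun _ _ => by positivity)).const_mul (fun _ _ => by positivity) (by norm_num)
  have hlog := hN4.log (fun _ _ => by positivity) (by positivity : 0 < ε / 4)
  have hl0 : ∀ N : ℕ, 0 ≤ Real.log (6 * ((N:ℝ) * (N:ℝ) ^ 3)) := by
    intro N
    rcases Nat.eq_zero_or_pos N with rfl | hN
    · simp
    · have hN1 : (1:ℝ) ≤ N := by exact_mod_cast hN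
      have : (1:ℝ) ≤ (N:ℝ) * N ^ 3 := one_le_mul_of_one_le_of_one_le hN1 (one_le_pow₀ hN1)
      exact Real.log_nonneg (by linarith)
  have hT := (((hD.pow (fun _ _ => by positivity) 2).mul (((PolyBd.const 1).mono_exp
    (by positivity : 0 ≤ ε / 4)).add hlog) (fun N _ => by have := hl0 N; positivity)).const_mul
      (fun N _ => by have := hl0 N; positivity) (by norm_num : (0:ℝ) ≤ 3000000)).mono_exp
      (by push_cast; linarith : ε / 4 * (2:ℕ) + ε / 4 ≤ ε)
  have hD3 := ((hD.pow (fun _ _ => by positivity) 3).const_mul (fun _ _ => by positivity)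
    (by norm_num : (0:ℝ) ≤ 11)).mono_exp (by push_cast; linarith : ε / 4 * (3:ℕ) ≤ ε)
  have hD2 := ((hD.pow (fun _ _ => by positivity) 2).const_mul (fun _ _ => by positivity)
    (by norm_num : (0:ℝ) ≤ 42)).mono_exp (by push_cast; linarith : ε / 4 * (2:ℕ) ≤ ε)
  have h1' := (PolyBd.const 1).mono_exp hε.le
  refine ⟨_, ((((((h1'.add h6').add h8').add h10').add h12').add hD3).add hD2).add hT,
    fun N R hN hR => ?_⟩
  have hdiv : ∀ m : ℕ, m ≠ 0 → m ≤ 24 * N ^ 4 → m.divisors.card ≤ divMax (24 * (N * R) ^ 4) :=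
    fun m hm hmN => card_divisors_le_divMax hm (hmN.trans (by
      gcongr; exact Nat.le_mul_of_pos_right _ hR))
  have hdiv' : ∀ m : ℕ, m ≠ 0 → m ≤ 2 * N ^ 4 → m.divisors.card ≤ divMax (24 * (N * R) ^ 4) :=
    fun m hm hmN => hdiv m hm (by omega)
  have hN0 : (0:ℝ) < N := by exact_mod_cast hN
  have p6 : 0 ≤ moment 6 N R / (N:ℝ) ^ (3.198:ℝ) := div_nonneg (moment_nonneg _ _ _) (by positivity)
  have p8 : 0 ≤ moment 8 N R / (N:ℝ) ^ (4.6:ℝ) := div_nonneg (moment_nonneg _ _ _) (by positivity)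
  have p10 : 0 ≤ moment 10 N R / (N:ℝ) ^ (6.23755:ℝ) :=
    div_nonneg (moment_nonneg _ _ _) (by positivity)
  have p12 : 0 ≤ moment 12 N R / (N:ℝ) ^ (8:ℝ) := div_nonneg (moment_nonneg _ _ _) (by positivity)
  have e6 := norm_fullSum_pow_eight_le hN hdiv
  have eA := integral_majArc_mul_smoothSum_le R hN hdiv
  have eB := fun (Z : Finset ℤ) (n : ℤ → ℤ) (a : ℤ → ℂ) ha hn hZ =>
    integral_smoothSum_sq_mul_le (Z := Z) (n := n) (a := a) ha hn R hZ hdiv'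
  have eC := fun (Z : Finset ℤ) (n : ℤ → ℤ) (a : ℤ → ℂ) ha hn hZ =>
    integral_smoothSum_pow_four_mul_le (Z := Z) (n := n) (a := a) ha hn R hN hZ hdiv'
  have eC' := fun (Z : Finset ℤ) (n : ℤ → ℤ) (a : ℤ → ℂ) ha hn hZ =>
    integral_smoothSum_pow_four_mul_le' (Z := Z) (n := n) (a := a) ha hn R hN hZ hdiv'
  have eD := fun (Z : Finset ℤ) (n : ℤ → ℤ) (a : ℤ → ℂ) ha hn hb hZ =>
    integral_majArc_mul_le (Z := Z) (n := n) (a := a) ha hn hN hZ hb hdiv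
  have hl := hl0 N
  generalize (divMax (24 * (N * R) ^ 4)) = D at *
  have hT0 : 0 ≤ (D:ℝ) ^ 2 * (1 + Real.log (6 * ((N:ℝ) * (N:ℝ) ^ 3))) := by positivity
  have pD3 : 0 ≤ (D:ℝ) ^ 3 := by positivity
  have pD2 : 0 ≤ (D:ℝ) ^ 2 := by positivity
  generalize (D:ℝ) ^ 2 * (1 + Real.log (6 * ((N:ℝ) * (N:ℝ) ^ 3))) = T at *
  constructor
  · linarith
  · rw [← div_le_iff₀ (by positivity)]; linarith
  · rw [← div_le_iff₀ (by positivity)]; linarith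
  · rw [← div_le_iff₀ (by positivity)]; linarith
  · rw [← div_le_iff₀ (by positivity)]; linarith
  · intro α
    refine (e6 α).trans (mul_le_mul_of_nonneg_right (by linarith) ?_)
    have := majArc_nonneg N α
    positivity
  · exact eA.trans (mul_le_mul_of_nonneg_right (by linarith) (by positivity))
  · intro Z n a ha hn hZ
    exact (eB Z n a ha hn hZ).trans (mul_le_mul_of_nonneg_right (by linarith) (by positivity))
  · intro Z n a ha hn hZ
    exact (eC Z n a ha hn hZ).trans (mul_le_mul_of_nonneg_right (by linarith) (by positivity))
  · intro Z n a ha hn hZ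
    exact (eC' Z n a ha hn hZ).trans (mul_le_mul_of_nonneg_right (by linarith) (by positivity))
  · intro Z n a ha hn hb hZ
    exact (eD Z n a ha hn hb hZ).trans (mul_le_mul_of_nonneg_right (by linarith) (by positivity))

theorem integral_mul_le_of_sq_le {f g : ℝ → ℝ} (hf : Continuous f) (hg : Continuous g)
    (hf0 : ∀ x, 0 ≤ f x) (hg0 : ∀ x, 0 ≤ g x) {W N z x y x' y' : ℝ} (hW : 0 ≤ W) (hN : 0 < N)
    (hz : 0 < z)
    (h1 : ∫ α in (0:ℝ)..1, f α ^ 2 ≤ W * (N ^ x * z ^ y))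
    (h2 : ∫ α in (0:ℝ)..1, g α ^ 2 ≤ W * (N ^ x' * z ^ y')) :
    ∫ α in (0:ℝ)..1, f α * g α ≤ W * (N ^ ((x + x') / 2) * z ^ ((y + y') / 2)) := by
  have h3 := interval_holder₂ (hf.pow 2) (hg.pow 2) (fun x => sq_nonneg (f x))
    (fun x => sq_nonneg (g x)) (a := 1 / 2) (b := 1 / 2) (by norm_num) (by norm_num) (by norm_num)
  have h4 : ∀ α, (f α ^ 2) ^ (1 / 2 : ℝ) * (g α ^ 2) ^ (1 / 2 : ℝ) = f α * g α := by
    intro α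
    rw [rpow_natCast_mul (hf0 α), rpow_natCast_mul (hg0 α)]; norm_num
  simp only [Pi.pow_apply, h4] at h3
  refine h3.trans ?_
  have p1 : (0:ℝ) ≤ ∫ α in (0:ℝ)..1, f α ^ 2 :=
    intervalIntegral.integral_nonneg zero_le_one fun _ _ => sq_nonneg _
  have p2 : (0:ℝ) ≤ ∫ α in (0:ℝ)..1, g α ^ 2 :=
    intervalIntegral.integral_nonneg zero_le_one fun _ _ => sq_nonneg _
  refine (mul_le_mul (Real.rpow_le_rpow p1 h1 (by norm_num)) (Real.rpow_le_rpow p2 h2 (by norm_num))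
    (by positivity) (by positivity)).trans (le_of_eq ?_)
  have hW2 : W ^ (1 / 2 : ℝ) * W ^ (1 / 2 : ℝ) = W := by
    rw [← Real.sqrt_eq_rpow]; exact Real.mul_self_sqrt hW
  rw [Real.mul_rpow hW (by positivity), Real.mul_rpow hW (by positivity),
    Real.mul_rpow (by positivity) (by positivity), Real.mul_rpow (by positivity) (by positivity),
    ← Real.rpow_mul hN.le, ← Real.rpow_mul hN.le, ← Real.rpow_mul hz.le, ← Real.rpow_mul hz.le,
    add_div, add_div, Real.rpow_add hN, Real.rpow_add hz, ← hW2, div_eq_mul_one_div x,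
    div_eq_mul_one_div x', div_eq_mul_one_div y, div_eq_mul_one_div y']
  rw [show (W ^ (1 / 2 : ℝ) * W ^ (1 / 2 : ℝ)) = W from hW2]
  calc _ = (W ^ (1 / 2 : ℝ) * W ^ (1 / 2 : ℝ)) * (N ^ (x * (1 / 2)) * N ^ (x' * (1 / 2)) *
        (z ^ (y * (1 / 2)) * z ^ (y' * (1 / 2)))) := by ring
    _ = _ := by rw [hW2]

namespace MeanValues

variable {N R : ℕ} {Q : ℝ}

theorem le_four_mul_pow_three (hM : MeanValues N R Q) : Q ≤ 4 * Q ^ 3 := by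
  have := hM.one_le
  nlinarith [sq_nonneg Q, sq_nonneg (Q - 1), mul_nonneg (sub_nonneg.2 this) (sq_nonneg Q)]

theorem moment_le (hM : MeanValues N R Q) {k : ℕ} {x : ℝ} (hk : moment k N R ≤ Q * (N : ℝ) ^ x)
    (z : ℝ) (j : ℕ) (hjk : j * 2 = k) :
    ∫ α in (0:ℝ)..1, (‖smoothSum N R α‖ ^ j) ^ 2 ≤ 4 * Q ^ 3 * ((N : ℝ) ^ x * z ^ (0:ℝ)) := by
  simp only [← pow_mul, hjk, Real.rpow_zero, mul_one]
  have hQW := hM.le_four_mul_pow_three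
  exact hk.trans (by gcongr)

/-- The part of the pointwise bound for the complete sum that matters on the minor arcs. -/
def minorPart (N : ℕ) (Q : ℝ) (α : ℝ) : ℝ :=
  Q * ((N : ℝ) ^ (7 / 8 : ℝ) + (N : ℝ) ^ (79 / 80 : ℝ) * majArc N α ^ (1 / 10 : ℝ))

/-- The part of the pointwise bound for the complete sum that matters on the major arcs. -/
def majorPart (N : ℕ) (Q : ℝ) (α : ℝ) : ℝ :=
  2 * Q * ((N : ℝ) ^ (19 / 16 : ℝ) * majArc N α ^ (1 / 2 : ℝ))

@[fun_prop]
theorem continuous_minorPart : Continuous (minorPart N Q) := by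
  unfold minorPart
  exact continuous_const.mul (continuous_const.add (continuous_const.mul
    ((continuous_majArc N).rpow_const fun _ => Or.inr (by norm_num))))

@[fun_prop]
theorem continuous_majorPart : Continuous (majorPart N Q) := by
  unfold majorPart
  exact continuous_const.mul (continuous_const.mul
    ((continuous_majArc N).rpow_const fun _ => Or.inr (by norm_num)))

theorem minorPart_nonneg (hQ : 0 ≤ Q) (α : ℝ) : 0 ≤ minorPart N Q α := by
  have := majArc_nonneg N α
  unfold minorPart; positivity

theorem majorPart_nonneg (hQ : 0 ≤ Q) (α : ℝ) : 0 ≤ majorPart N Q α := by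
  have := majArc_nonneg N α
  unfold majorPart; positivity

theorem norm_fullSum_le (hM : MeanValues N R Q) (hN : 1 ≤ N) (α : ℝ) :
    ‖fullSum N α‖ ≤ minorPart N Q α + majorPart N Q α := by
  have hQ := hM.one_le
  have hN1 : (1:ℝ) ≤ N := by exact_mod_cast hN
  have hN0 : (0:ℝ) < N := by linarith
  have hψ := majArc_nonneg N α
  have h1 : ‖fullSum N α‖ ≤ Q * ((N:ℝ) ^ (7 / 8 : ℝ) + N * majArc N α ^ (1 / 8 : ℝ)) := by
    have h2 := Real.rpow_le_rpow (by positivity) (hM.weyl α) (by norm_num : (0:ℝ) ≤ 1 / 8)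
    rw [rpow_natCast_mul (norm_nonneg _)] at h2
    norm_num at h2
    refine h2.trans ?_
    rw [Real.mul_rpow (by linarith) (by positivity)]
    have h3 : Q ^ (1 / 8 : ℝ) ≤ Q := by
      conv_rhs => rw [← Real.rpow_one Q]
      exact Real.rpow_le_rpow_of_exponent_le hQ (by norm_num)
    have h4 := Real.rpow_add_le_add_rpow (by positivity : (0:ℝ) ≤ (N:ℝ) ^ 7)
      (by positivity : (0:ℝ) ≤ (N:ℝ) ^ 8 * majArc N α) (by norm_num : (0:ℝ) ≤ 1 / 8) (by norm_num)
    rw [Real.mul_rpow (by positivity) hψ, rpow_natCast_mul hN0.le, rpow_natCast_mul hN0.le] at h4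
    norm_num at h4
    exact mul_le_mul h3 h4 (by positivity) (by linarith)
  refine h1.trans ?_
  unfold minorPart majorPart
  set ψ := majArc N α
  rcases le_or_gt ψ ((N:ℝ) ^ (-(1 / 2) : ℝ)) with h | h
  · have h5 : (N:ℝ) * ψ ^ (1 / 8 : ℝ) ≤ (N:ℝ) ^ (79 / 80 : ℝ) * ψ ^ (1 / 10 : ℝ) := by
      have h6 : ψ ^ (1 / 8 : ℝ) = ψ ^ (1 / 40 : ℝ) * ψ ^ (1 / 10 : ℝ) := by
        rw [← Real.rpow_add_of_nonneg hψ (by norm_num) (by norm_num)]; norm_num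
      have h7 : ψ ^ (1 / 40 : ℝ) ≤ (N:ℝ) ^ (-(1 / 80) : ℝ) := by
        refine (Real.rpow_le_rpow hψ h (by norm_num)).trans (le_of_eq ?_)
        rw [← Real.rpow_mul hN0.le]; norm_num
      have h8 : (N:ℝ) ^ (79 / 80 : ℝ) = N * (N:ℝ) ^ (-(1 / 80) : ℝ) := by
        conv_rhs => rw [← Real.rpow_one_add' hN0.le (by norm_num)]
        norm_num
      rw [h6, h8, ← mul_assoc]
      gcongr
    have : 0 ≤ 2 * Q * ((N:ℝ) ^ (19 / 16 : ℝ) * ψ ^ (1 / 2 : ℝ)) := by positivity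
    have h9 : Q * ((N:ℝ) ^ (7 / 8 : ℝ) + N * ψ ^ (1 / 8 : ℝ)) ≤
      Q * ((N:ℝ) ^ (7 / 8 : ℝ) + (N:ℝ) ^ (79 / 80 : ℝ) * ψ ^ (1 / 10 : ℝ)) := by gcongr
    linarith
  · have hψ0 : 0 < ψ := lt_of_le_of_lt (by positivity) h
    have h5 : (N:ℝ) ^ (7 / 8 : ℝ) ≤ (N:ℝ) ^ (19 / 16 : ℝ) * ψ ^ (1 / 2 : ℝ) := by
      have h6 := Real.rpow_le_rpow (by positivity) h.le (by norm_num : (0:ℝ) ≤ 1 / 2)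
      rw [← Real.rpow_mul hN0.le] at h6
      refine le_trans ?_ (mul_le_mul_of_nonneg_left h6 (by positivity))
      rw [← Real.rpow_add hN0]
      exact Real.rpow_le_rpow_of_exponent_le hN1 (by norm_num)
    have h7 : (N:ℝ) * ψ ^ (1 / 8 : ℝ) ≤ (N:ℝ) ^ (19 / 16 : ℝ) * ψ ^ (1 / 2 : ℝ) := by
      have h6 := Real.rpow_le_rpow (by positivity) h.le (by norm_num : (0:ℝ) ≤ 3 / 8)
      rw [← Real.rpow_mul hN0.le] at h6
      have h8 : ψ ^ (1 / 2 : ℝ) = ψ ^ (3 / 8 : ℝ) * ψ ^ (1 / 8 : ℝ) := by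
        rw [← Real.rpow_add_of_nonneg hψ (by norm_num) (by norm_num)]; norm_num
      rw [h8, ← mul_assoc]
      refine mul_le_mul_of_nonneg_right ?_ (by positivity)
      refine le_trans (le_of_eq ?_) (mul_le_mul_of_nonneg_left h6 (by positivity))
      rw [← Real.rpow_add hN0]; norm_num
    have : 0 ≤ Q * ((N:ℝ) ^ (7 / 8 : ℝ) + (N:ℝ) ^ (79 / 80 : ℝ) * ψ ^ (1 / 10 : ℝ)) := by positivity
    have h9 := mul_le_mul_of_nonneg_left (add_le_add h5 h7) (by linarith : 0 ≤ Q)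
    linarith

theorem integral_minorPart_sq_le (hM : MeanValues N R Q) (hN : 1 ≤ N) (z : ℝ) :
    ∫ α in (0:ℝ)..1, (minorPart N Q α * ‖smoothSum N R α‖ ^ 5) ^ 2 ≤
      4 * Q ^ 3 * ((N : ℝ) ^ (7.98755 : ℝ) * z ^ (0:ℝ)) := by
  have hQ := hM.one_le
  have hN1 : (1:ℝ) ≤ N := by exact_mod_cast hN
  have hN0 : (0:ℝ) < N := by linarith
  have c1 : Continuous fun α => ‖smoothSum N R α‖ := by fun_prop
  have c2 : Continuous fun α => majArc N α ^ (1 / 5 : ℝ) :=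
    (continuous_majArc N).rpow_const fun _ => Or.inr (by norm_num)
  have h1 := interval_holder₂ (f := fun α => majArc N α * ‖smoothSum N R α‖ ^ 2)
    (g := fun α => ‖smoothSum N R α‖ ^ 12) (by fun_prop) (by fun_prop)
    (fun α => mul_nonneg (majArc_nonneg N α) (by positivity)) (fun α => by positivity)
    (a := 1 / 5) (b := 4 / 5) (by norm_num) (by norm_num) (by norm_num)
  have h2 : ∀ α, (majArc N α * ‖smoothSum N R α‖ ^ 2) ^ (1 / 5 : ℝ) *
      (‖smoothSum N R α‖ ^ 12) ^ (4 / 5 : ℝ) =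
      majArc N α ^ (1 / 5 : ℝ) * ‖smoothSum N R α‖ ^ 10 := by
    intro α
    rw [Real.mul_rpow (majArc_nonneg N α) (by positivity), rpow_natCast_mul (norm_nonneg _),
      rpow_natCast_mul (norm_nonneg _), mul_assoc,
      ← Real.rpow_add_of_nonneg (norm_nonneg _) (by norm_num) (by norm_num), ← Real.rpow_natCast]
    norm_num
  simp only [h2] at h1
  have h3 : ∫ α in (0:ℝ)..1, majArc N α ^ (1 / 5 : ℝ) * ‖smoothSum N R α‖ ^ 10 ≤
      Q * (N:ℝ) ^ (6 : ℝ) := by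
    refine h1.trans ?_
    have p1 : 0 ≤ ∫ α in (0:ℝ)..1, majArc N α * ‖smoothSum N R α‖ ^ 2 :=
      intervalIntegral.integral_nonneg zero_le_one fun α _ =>
        mul_nonneg (majArc_nonneg N α) (by positivity)
    refine (mul_le_mul (Real.rpow_le_rpow p1 hM.arc (by norm_num))
      (Real.rpow_le_rpow (moment_nonneg 12 N R) hM.twelve (by norm_num))
      (Real.rpow_nonneg (moment_nonneg 12 N R) _) (by positivity)).trans (le_of_eq ?_)
    rw [Real.mul_rpow (by linarith) (by positivity), Real.mul_rpow (by linarith) (by positivity),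
      ← Real.rpow_mul hN0.le, show (1 / (N:ℝ) ^ 2) = (N:ℝ) ^ (-2 : ℝ) by
        rw [Real.rpow_neg hN0.le, one_div]; norm_num,
      ← Real.rpow_mul hN0.le]
    calc _ = (Q ^ (1 / 5 : ℝ) * Q ^ (4 / 5 : ℝ)) * ((N:ℝ) ^ (-2 * (1 / 5) : ℝ) *
          (N:ℝ) ^ (8 * (4 / 5) : ℝ)) := by ring
      _ = _ := by
        rw [← Real.rpow_add (by linarith), ← Real.rpow_add hN0]; norm_num
  have h4 : ∀ α, (minorPart N Q α * ‖smoothSum N R α‖ ^ 5) ^ 2 ≤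
      2 * Q ^ 2 * ((N:ℝ) ^ (7 / 4 : ℝ)) * ‖smoothSum N R α‖ ^ 10 +
      2 * Q ^ 2 * ((N:ℝ) ^ (79 / 40 : ℝ)) *
        (majArc N α ^ (1 / 5 : ℝ) * ‖smoothSum N R α‖ ^ 10) := by
    intro α
    have hψ := majArc_nonneg N α
    have e1 : ((N:ℝ) ^ (7 / 8 : ℝ)) ^ 2 = (N:ℝ) ^ (7 / 4 : ℝ) := by
      rw [← Real.rpow_mul_natCast hN0.le]; norm_num
    have e2 : ((N:ℝ) ^ (79 / 80 : ℝ)) ^ 2 = (N:ℝ) ^ (79 / 40 : ℝ) := by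
      rw [← Real.rpow_mul_natCast hN0.le]; norm_num
    have e3 : (majArc N α ^ (1 / 10 : ℝ)) ^ 2 = majArc N α ^ (1 / 5 : ℝ) := by
      rw [← Real.rpow_mul_natCast hψ]; norm_num
    rw [← e1, ← e2, ← e3]
    unfold minorPart
    generalize (N:ℝ) ^ (7 / 8 : ℝ) = u
    generalize (N:ℝ) ^ (79 / 80 : ℝ) = v
    generalize majArc N α ^ (1 / 10 : ℝ) = w
    have := mul_nonneg (mul_nonneg (sq_nonneg Q) (sq_nonneg (u - v * w)))
      (sq_nonneg (‖smoothSum N R α‖ ^ 5))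
    nlinarith
  have h5 := intervalIntegral.integral_mono (a := 0) (b := 1) (μ := volume) zero_le_one
    (Continuous.intervalIntegrable (by fun_prop) _ _)
    (Continuous.intervalIntegrable (by fun_prop) _ _) h4
  refine h5.trans ?_
  rw [intervalIntegral.integral_add (Continuous.intervalIntegrable (by fun_prop) _ _)
    (Continuous.intervalIntegrable (by fun_prop) _ _), intervalIntegral.integral_const_mul,
    intervalIntegral.integral_const_mul]
  have h6 : ∫ α in (0:ℝ)..1, ‖smoothSum N R α‖ ^ 10 ≤ _ := hM.ten
  have h7 := mul_le_mul_of_nonneg_left h6 (by positivity : 0 ≤ 2 * Q ^ 2 * ((N:ℝ) ^ (7 / 4 : ℝ)))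
  have h8 := mul_le_mul_of_nonneg_left h3 (by positivity : 0 ≤ 2 * Q ^ 2 * ((N:ℝ) ^ (79 / 40 : ℝ)))
  refine (add_le_add h7 h8).trans ?_
  have e4 : (N:ℝ) ^ (7 / 4 : ℝ) * (N:ℝ) ^ (6.23755 : ℝ) = (N:ℝ) ^ (7.98755 : ℝ) := by
    rw [← Real.rpow_add hN0]; norm_num
  have e5 : (N:ℝ) ^ (79 / 40 : ℝ) * (N:ℝ) ^ (6 : ℝ) ≤ (N:ℝ) ^ (7.98755 : ℝ) := by
    rw [← Real.rpow_add hN0]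
    exact Real.rpow_le_rpow_of_exponent_le hN1 (by norm_num)
  have e6 := mul_le_mul_of_nonneg_left e5 (by positivity : 0 ≤ 2 * Q ^ 3)
  rw [Real.rpow_zero, mul_one, ← e4]
  rw [← e4] at e6
  nlinarith

end MeanValues

namespace MeanValues

variable {N R : ℕ} {Q : ℝ} {Z : Finset ℤ} {n : ℤ → ℤ} {a : ℤ → ℂ}

theorem integral_wsum_sq_le (hM : MeanValues N R Q) (ha : ∀ i ∈ Z, ‖a i‖ ≤ 1)
    (hn : Set.InjOn n Z) :
    ∫ α in (0:ℝ)..1, ‖wsum Z n a α‖ ^ 2 ≤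
      4 * Q ^ 3 * ((N : ℝ) ^ (0 : ℝ) * (Z.card : ℝ) ^ (1 : ℝ)) := by
  have := hM.le_four_mul_pow_three
  have hQ := hM.one_le
  rw [Real.rpow_zero, one_mul, Real.rpow_one]
  refine (integral_norm_wsum_sq_le ha hn).trans ?_
  exact le_mul_of_one_le_left (by positivity) (hQ.trans this)

theorem integral_smoothSum_mul_sq_le (hM : MeanValues N R Q) (ha : ∀ i ∈ Z, ‖a i‖ ≤ 1)
    (hn : Set.InjOn n Z) (hZ : N ≤ Z.card) :
    ∫ α in (0:ℝ)..1, (‖smoothSum N R α‖ * ‖wsum Z n a α‖) ^ 2 ≤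
      4 * Q ^ 3 * ((N : ℝ) ^ (1 / 2 : ℝ) * (Z.card : ℝ) ^ (3 / 2 : ℝ)) := by
  have h1 := hM.le_four_mul_pow_three
  simp only [mul_pow]
  refine (hM.sq_mul Z n a ha hn hZ).trans ?_
  rw [Real.sqrt_eq_rpow, Real.mul_rpow (by positivity) (by positivity),
    rpow_natCast_mul (by positivity), show ((3 : ℕ) : ℝ) * (1 / 2) = 3 / 2 by norm_num]
  gcongr

theorem integral_sq_mul_sq_le (hM : MeanValues N R Q) (ha : ∀ i ∈ Z, ‖a i‖ ≤ 1)
    (hn : Set.InjOn n Z) (hZ : N ^ 2 ≤ Z.card) :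
    ∫ α in (0:ℝ)..1, (‖smoothSum N R α‖ ^ 2 * ‖wsum Z n a α‖) ^ 2 ≤
      4 * Q ^ 3 * ((N : ℝ) ^ (2 : ℝ) * (Z.card : ℝ) ^ (3 / 2 : ℝ)) := by
  have h1 := hM.le_four_mul_pow_three
  simp only [mul_pow, ← pow_mul]
  refine (hM.pow_four_mul Z n a ha hn hZ).trans ?_
  rw [Real.sqrt_eq_rpow,
    rpow_natCast_mul (by positivity), show ((3 : ℕ) : ℝ) * (1 / 2) = 3 / 2 by norm_num,
    ← Real.rpow_natCast (N : ℝ) 2]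
  push_cast
  gcongr

theorem integral_sq_mul_sq_le_of_le (hM : MeanValues N R Q) (ha : ∀ i ∈ Z, ‖a i‖ ≤ 1)
    (hn : Set.InjOn n Z) (hZ : Z.card ≤ N ^ 2) :
    ∫ α in (0:ℝ)..1, (‖smoothSum N R α‖ ^ 2 * ‖wsum Z n a α‖) ^ 2 ≤
      4 * Q ^ 3 * ((N : ℝ) ^ (3 : ℝ) * (Z.card : ℝ) ^ (1 : ℝ)) := by
  have h1 := hM.le_four_mul_pow_three
  simp only [mul_pow, ← pow_mul]
  refine (hM.pow_four_mul_of_le Z n a ha hn hZ).trans ?_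
  rw [Real.rpow_one, ← Real.rpow_natCast (N : ℝ) 3]
  push_cast
  gcongr

theorem integral_majorPart_mul_sq_le (hM : MeanValues N R Q) (ha : ∀ i ∈ Z, ‖a i‖ ≤ 1)
    (hn : Set.InjOn n Z) (hN : 1 ≤ N) (hb : ∀ i ∈ Z, |n i| ≤ 8 * N ^ 4) (hZ : N ≤ Z.card) :
    ∫ α in (0:ℝ)..1, (majorPart N Q α * ‖wsum Z n a α‖) ^ 2 ≤
      4 * Q ^ 3 * ((N : ℝ) ^ (-1.625 : ℝ) * (Z.card : ℝ) ^ (2 : ℝ)) := by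
  have hQ := hM.one_le
  have hN0 : (0:ℝ) < N := by exact_mod_cast hN
  have h1 : ∀ α, (majorPart N Q α * ‖wsum Z n a α‖) ^ 2 =
      4 * Q ^ 2 * (N : ℝ) ^ (19 / 8 : ℝ) * (majArc N α * ‖wsum Z n a α‖ ^ 2) := by
    intro α
    have e1 : ((N:ℝ) ^ (19 / 16 : ℝ)) ^ 2 = (N:ℝ) ^ (19 / 8 : ℝ) := by
      rw [← Real.rpow_mul_natCast hN0.le]; norm_num
    have e2 : (majArc N α ^ (1 / 2 : ℝ)) ^ 2 = majArc N α := by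
      rw [← Real.rpow_mul_natCast (majArc_nonneg N α)]; norm_num
    unfold majorPart
    rw [← e1]
    conv_rhs => rw [← e2]
    ring
  simp only [h1]
  rw [intervalIntegral.integral_const_mul]
  refine (mul_le_mul_of_nonneg_left (hM.arc_mul Z n a ha hn hb hZ) (by positivity)).trans
    (le_of_eq ?_)
  have e3 : (N:ℝ) ^ (19 / 8 : ℝ) / (N:ℝ) ^ 4 = (N:ℝ) ^ (-1.625 : ℝ) := by
    rw [← Real.rpow_natCast, ← Real.rpow_sub hN0]; norm_num
  rw [← e3, ← Real.rpow_natCast (Z.card : ℝ) 2]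
  push_cast
  ring

theorem integral_six_mul_le (hM : MeanValues N R Q) (ha : ∀ i ∈ Z, ‖a i‖ ≤ 1)
    (hn : Set.InjOn n Z) (hN : 1 ≤ N) (hZ : 0 < Z.card) :
    ∫ α in (0:ℝ)..1, ‖smoothSum N R α‖ ^ 6 * ‖wsum Z n a α‖ ≤
      4 * Q ^ 3 * ((N : ℝ) ^ (4 : ℝ) * (Z.card : ℝ) ^ (1 / 2 : ℝ)) := by
  have hQ := hM.one_le
  refine (integral_mul_le_of_sq_le (by fun_prop) (by fun_prop) (fun _ => by positivity)
    (fun _ => by positivity) (by positivity) (by exact_mod_cast hN) (by exact_mod_cast hZ)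
    (hM.moment_le hM.twelve _ 6 rfl) (hM.integral_wsum_sq_le ha hn)).trans_eq (by norm_num)

theorem integral_six_mul_le_of_le (hM : MeanValues N R Q) (ha : ∀ i ∈ Z, ‖a i‖ ≤ 1)
    (hn : Set.InjOn n Z) (hN : 1 ≤ N) (hZ : N ≤ Z.card) :
    ∫ α in (0:ℝ)..1, ‖smoothSum N R α‖ ^ 6 * ‖wsum Z n a α‖ ≤
      4 * Q ^ 3 * ((N : ℝ) ^ (3.368775 : ℝ) * (Z.card : ℝ) ^ (3 / 4 : ℝ)) := by
  have hQ := hM.one_le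
  have h1 : ∀ α, ‖smoothSum N R α‖ ^ 6 * ‖wsum Z n a α‖ =
    ‖smoothSum N R α‖ ^ 5 * (‖smoothSum N R α‖ * ‖wsum Z n a α‖) := fun α => by ring
  simp only [h1]
  refine (integral_mul_le_of_sq_le (by fun_prop) (by fun_prop) (fun _ => by positivity)
    (fun _ => by positivity) (by positivity) (by exact_mod_cast hN) (by exact_mod_cast hN.trans hZ)
    (hM.moment_le hM.ten _ 5 rfl) (hM.integral_smoothSum_mul_sq_le ha hn hZ)).trans_eq
    (by norm_num)

theorem integral_seven_mul_le (hM : MeanValues N R Q) (ha : ∀ i ∈ Z, ‖a i‖ ≤ 1)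
    (hn : Set.InjOn n Z) (hN : 1 ≤ N) (hZ : N ^ 2 ≤ Z.card) :
    ∫ α in (0:ℝ)..1, ‖smoothSum N R α‖ ^ 7 * ‖wsum Z n a α‖ ≤
      4 * Q ^ 3 * ((N : ℝ) ^ (4.5 : ℝ) * (Z.card : ℝ) ^ (5 / 8 : ℝ)) := by
  have hQ := hM.one_le
  have hz : 0 < Z.card := lt_of_lt_of_le (by positivity) hZ
  have h1 : ∀ α, ‖smoothSum N R α‖ ^ 7 * ‖wsum Z n a α‖ =
    ‖smoothSum N R α‖ ^ 6 * (‖smoothSum N R α‖ * ‖wsum Z n a α‖) := fun α => by ring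
  have h2 : ∀ α, (‖smoothSum N R α‖ * ‖wsum Z n a α‖) ^ 2 =
    ‖smoothSum N R α‖ ^ 2 * ‖wsum Z n a α‖ * ‖wsum Z n a α‖ := fun α => by ring
  have h3 : ∫ α in (0:ℝ)..1, (‖smoothSum N R α‖ * ‖wsum Z n a α‖) ^ 2 ≤
      4 * Q ^ 3 * ((N : ℝ) ^ (1 : ℝ) * (Z.card : ℝ) ^ (5 / 4 : ℝ)) := by
    simp only [h2]
    refine (integral_mul_le_of_sq_le (by fun_prop) (by fun_prop) (fun _ => by positivity)
      (fun _ => by positivity) (by positivity) (by exact_mod_cast hN) (by exact_mod_cast hz)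
      (hM.integral_sq_mul_sq_le ha hn hZ) (hM.integral_wsum_sq_le ha hn)).trans_eq (by norm_num)
  simp only [h1]
  refine (integral_mul_le_of_sq_le (by fun_prop) (by fun_prop) (fun _ => by positivity)
    (fun _ => by positivity) (by positivity) (by exact_mod_cast hN) (by exact_mod_cast hz)
    (hM.moment_le hM.twelve _ 6 rfl) h3).trans_eq (by norm_num)

theorem integral_seven_mul_le' (hM : MeanValues N R Q) (ha : ∀ i ∈ Z, ‖a i‖ ≤ 1)
    (hn : Set.InjOn n Z) (hN : 1 ≤ N) (hZ : N ^ 2 ≤ Z.card) :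
    ∫ α in (0:ℝ)..1, ‖smoothSum N R α‖ ^ 7 * ‖wsum Z n a α‖ ≤
      4 * Q ^ 3 * ((N : ℝ) ^ (4.118775 : ℝ) * (Z.card : ℝ) ^ (3 / 4 : ℝ)) := by
  have hQ := hM.one_le
  have hz : 0 < Z.card := lt_of_lt_of_le (by positivity) hZ
  have h1 : ∀ α, ‖smoothSum N R α‖ ^ 7 * ‖wsum Z n a α‖ =
    ‖smoothSum N R α‖ ^ 5 * (‖smoothSum N R α‖ ^ 2 * ‖wsum Z n a α‖) := fun α => by ring
  simp only [h1]
  refine (integral_mul_le_of_sq_le (by fun_prop) (by fun_prop) (fun _ => by positivity)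
    (fun _ => by positivity) (by positivity) (by exact_mod_cast hN) (by exact_mod_cast hz)
    (hM.moment_le hM.ten _ 5 rfl) (hM.integral_sq_mul_sq_le ha hn hZ)).trans_eq (by norm_num)

theorem integral_seven_mul_le_of_le (hM : MeanValues N R Q) (ha : ∀ i ∈ Z, ‖a i‖ ≤ 1)
    (hn : Set.InjOn n Z) (hN : 1 ≤ N) (hz : 0 < Z.card) (hZ : Z.card ≤ N ^ 2) :
    ∫ α in (0:ℝ)..1, ‖smoothSum N R α‖ ^ 7 * ‖wsum Z n a α‖ ≤
      4 * Q ^ 3 * ((N : ℝ) ^ (4.618775 : ℝ) * (Z.card : ℝ) ^ (1 / 2 : ℝ)) := by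
  have hQ := hM.one_le
  have h1 : ∀ α, ‖smoothSum N R α‖ ^ 7 * ‖wsum Z n a α‖ =
    ‖smoothSum N R α‖ ^ 5 * (‖smoothSum N R α‖ ^ 2 * ‖wsum Z n a α‖) := fun α => by ring
  simp only [h1]
  refine (integral_mul_le_of_sq_le (by fun_prop) (by fun_prop) (fun _ => by positivity)
    (fun _ => by positivity) (by positivity) (by exact_mod_cast hN) (by exact_mod_cast hz)
    (hM.moment_le hM.ten _ 5 rfl) (hM.integral_sq_mul_sq_le_of_le ha hn hZ)).trans_eq
    (by norm_num)

theorem integral_eight_mul_le (hM : MeanValues N R Q) (ha : ∀ i ∈ Z, ‖a i‖ ≤ 1)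
    (hn : Set.InjOn n Z) (hN : 1 ≤ N) (hZ : N ^ 2 ≤ Z.card) :
    ∫ α in (0:ℝ)..1, ‖smoothSum N R α‖ ^ 8 * ‖wsum Z n a α‖ ≤
      4 * Q ^ 3 * ((N : ℝ) ^ (5 : ℝ) * (Z.card : ℝ) ^ (3 / 4 : ℝ)) := by
  have hQ := hM.one_le
  have hz : 0 < Z.card := lt_of_lt_of_le (by positivity) hZ
  have h1 : ∀ α, ‖smoothSum N R α‖ ^ 8 * ‖wsum Z n a α‖ =
    ‖smoothSum N R α‖ ^ 6 * (‖smoothSum N R α‖ ^ 2 * ‖wsum Z n a α‖) := fun α => by ring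
  simp only [h1]
  refine (integral_mul_le_of_sq_le (by fun_prop) (by fun_prop) (fun _ => by positivity)
    (fun _ => by positivity) (by positivity) (by exact_mod_cast hN) (by exact_mod_cast hz)
    (hM.moment_le hM.twelve _ 6 rfl) (hM.integral_sq_mul_sq_le ha hn hZ)).trans_eq (by norm_num)

theorem integral_fullSum_mul_le (hM : MeanValues N R Q) (hN : 1 ≤ N) {G : ℝ → ℝ}
    (hG : Continuous G) (hG0 : ∀ α, 0 ≤ G α) :
    ∫ α in (0:ℝ)..1, ‖fullSum N α‖ * G α ≤
      (∫ α in (0:ℝ)..1, minorPart N Q α * G α) + ∫ α in (0:ℝ)..1, majorPart N Q α * G α := by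
  have hc := continuous_fullSum N
  rw [← intervalIntegral.integral_add (Continuous.intervalIntegrable (by fun_prop) _ _)
    (Continuous.intervalIntegrable (by fun_prop) _ _)]
  refine intervalIntegral.integral_mono (a := 0) (b := 1) (μ := volume) zero_le_one
    (Continuous.intervalIntegrable (by fun_prop) _ _)
    (Continuous.intervalIntegrable (by fun_prop) _ _) fun α => ?_
  rw [← add_mul]
  exact mul_le_mul_of_nonneg_right (hM.norm_fullSum_le hN α) (hG0 α)

theorem integral_fullSum_mul_five_mul_le (hM : MeanValues N R Q) (ha : ∀ i ∈ Z, ‖a i‖ ≤ 1)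
    (hn : Set.InjOn n Z) (hN : 1 ≤ N) (hb : ∀ i ∈ Z, |n i| ≤ 8 * N ^ 4) (hZ : N ≤ Z.card) :
    ∫ α in (0:ℝ)..1, ‖fullSum N α‖ * (‖smoothSum N R α‖ ^ 5 * ‖wsum Z n a α‖) ≤
      4 * Q ^ 3 * ((N : ℝ) ^ (3.993775 : ℝ) * (Z.card : ℝ) ^ (1 / 2 : ℝ)) +
      4 * Q ^ 3 * ((N : ℝ) ^ (2.306275 : ℝ) * (Z.card : ℝ) ^ (1 : ℝ)) := by
  have hQ := hM.one_le
  refine (hM.integral_fullSum_mul_le hN (by fun_prop) (fun _ => by positivity)).trans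
    (add_le_add ?_ ?_)
  · have h1 : ∀ α, minorPart N Q α * (‖smoothSum N R α‖ ^ 5 * ‖wsum Z n a α‖) =
      minorPart N Q α * ‖smoothSum N R α‖ ^ 5 * ‖wsum Z n a α‖ := fun α => by ring
    simp only [h1]
    refine (integral_mul_le_of_sq_le (by fun_prop) (by fun_prop)
      (fun _ => mul_nonneg (minorPart_nonneg (by linarith) _) (by positivity))
      (fun _ => by positivity) (by positivity) (by exact_mod_cast hN)
      (by exact_mod_cast hN.trans hZ)
      (hM.integral_minorPart_sq_le hN _) (hM.integral_wsum_sq_le ha hn)).trans_eq (by norm_num)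
  · have h1 : ∀ α, majorPart N Q α * (‖smoothSum N R α‖ ^ 5 * ‖wsum Z n a α‖) =
      ‖smoothSum N R α‖ ^ 5 * (majorPart N Q α * ‖wsum Z n a α‖) := fun α => by ring
    simp only [h1]
    refine (integral_mul_le_of_sq_le (by fun_prop) (by fun_prop) (fun _ => by positivity)
      (fun _ => mul_nonneg (majorPart_nonneg (by linarith) _) (by positivity))
      (by positivity) (by exact_mod_cast hN) (by exact_mod_cast hN.trans hZ)
      (hM.moment_le hM.ten _ 5 rfl)
      (hM.integral_majorPart_mul_sq_le ha hn hN hb hZ)).trans_eq (by norm_num)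

theorem integral_fullSum_mul_seven_mul_le (hM : MeanValues N R Q) (ha : ∀ i ∈ Z, ‖a i‖ ≤ 1)
    (hn : Set.InjOn n Z) (hN : 1 ≤ N) (hb : ∀ i ∈ Z, |n i| ≤ 8 * N ^ 4)
    (hZ : N ^ 2 ≤ Z.card) :
    ∫ α in (0:ℝ)..1, ‖fullSum N α‖ * (‖smoothSum N R α‖ ^ 7 * ‖wsum Z n a α‖) ≤
      4 * Q ^ 3 * ((N : ℝ) ^ (4.993775 : ℝ) * (Z.card : ℝ) ^ (3 / 4 : ℝ)) +
      4 * Q ^ 3 * ((N : ℝ) ^ (4.1875 : ℝ) * (Z.card : ℝ) ^ (1 : ℝ)) := by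
  have hQ := hM.one_le
  have hNZ : N ≤ Z.card := (Nat.le_self_pow two_ne_zero N).trans hZ
  refine (hM.integral_fullSum_mul_le hN (by fun_prop) (fun _ => by positivity)).trans
    (add_le_add ?_ ?_)
  · have h1 : ∀ α, minorPart N Q α * (‖smoothSum N R α‖ ^ 7 * ‖wsum Z n a α‖) =
      minorPart N Q α * ‖smoothSum N R α‖ ^ 5 * (‖smoothSum N R α‖ ^ 2 * ‖wsum Z n a α‖) :=
      fun α => by ring
    simp only [h1]
    refine (integral_mul_le_of_sq_le (by fun_prop) (by fun_prop)
      (fun _ => mul_nonneg (minorPart_nonneg (by linarith) _) (by positivity))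
      (fun _ => by positivity) (by positivity) (by exact_mod_cast hN)
      (by exact_mod_cast hN.trans hNZ)
      (hM.integral_minorPart_sq_le hN _) (hM.integral_sq_mul_sq_le ha hn hZ)).trans_eq
      (by norm_num)
  · have h1 : ∀ α, majorPart N Q α * (‖smoothSum N R α‖ ^ 7 * ‖wsum Z n a α‖) =
      ‖smoothSum N R α‖ ^ 7 * (majorPart N Q α * ‖wsum Z n a α‖) := fun α => by ring
    simp only [h1]
    have h14 : moment 14 N R ≤ Q * (N:ℝ) ^ (10 : ℝ) := by
      refine (moment_add_le 12 2 N R).trans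
        ((mul_le_mul_of_nonneg_left hM.twelve (by positivity)).trans (le_of_eq ?_))
      rw [show (10:ℝ) = 2 + 8 by norm_num, Real.rpow_add (by exact_mod_cast hN),
        ← Real.rpow_natCast]
      push_cast; ring
    refine (integral_mul_le_of_sq_le (by fun_prop) (by fun_prop) (fun _ => by positivity)
      (fun _ => mul_nonneg (majorPart_nonneg (by linarith) _) (by positivity))
      (by positivity) (by exact_mod_cast hN) (by exact_mod_cast hN.trans hNZ)
      (hM.moment_le h14 _ 7 rfl)
      (hM.integral_majorPart_mul_sq_le ha hn hN hb hNZ)).trans_eq (by norm_num)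

end MeanValues

/-- The Fourier coefficients of `|h|^k`. -/
def momentCoeff (k N R : ℕ) (m : ℤ) : ℂ :=
  ∫ α in (0:ℝ)..1, ((‖smoothSum N R α‖ ^ k : ℝ) : ℂ) * e ((-m : ℤ) * α)

theorem continuous_e_int_mul (m : ℤ) : Continuous fun α : ℝ => e (m * α) :=
  continuous_e_comp (by fun_prop)

theorem sum_norm_integral_mul_e_le {Z : Finset ℤ} {n : ℤ → ℤ} {F : ℝ → ℂ} (hF : Continuous F) {B : ℝ}
    (hB : ∀ a : ℤ → ℂ, (∀ i ∈ Z, ‖a i‖ ≤ 1) →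
      ∫ α in (0:ℝ)..1, ‖F α‖ * ‖wsum Z n a α‖ ≤ B) :
    ∑ i ∈ Z, ‖∫ α in (0:ℝ)..1, F α * e (n i * α)‖ ≤ B := by
  set I : ℤ → ℂ := fun i => ∫ α in (0:ℝ)..1, F α * e (n i * α) with hI
  set a : ℤ → ℂ := fun i => (starRingEnd ℂ) (I i) / ‖I i‖ with ha
  have ha1 : ∀ i, ‖a i‖ ≤ 1 := fun i => by
    simp only [ha, norm_div, RCLike.norm_conj, Complex.norm_real, norm_norm]
    exact div_self_le_one _
  have ha2 : ∀ i, a i * I i = (‖I i‖ : ℂ) := fun i => by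
    by_cases h0 : I i = 0
    · simp [h0]
    · have : (‖I i‖ : ℂ) ≠ 0 := by simpa using h0
      simp only [ha]
      rw [div_mul_eq_mul_div, div_eq_iff this, mul_comm ((starRingEnd ℂ) _), Complex.mul_conj,
        Complex.normSq_eq_norm_sq]
      push_cast; ring
  have h1 : ((∑ i ∈ Z, ‖I i‖ : ℝ) : ℂ) = ∫ α in (0:ℝ)..1, F α * wsum Z n a α := by
    push_cast
    simp only [← ha2, wsum, Finset.mul_sum]
    rw [intervalIntegral.integral_finsetSum (fun i _ => Continuous.intervalIntegrable
      (show Continuous fun α => F α * (a i * e (n i * α)) from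
        hF.mul (continuous_const.mul (continuous_e_int_mul _))) _ _)]
    refine Finset.sum_congr rfl fun i _ => ?_
    rw [hI, ← intervalIntegral.integral_const_mul]
    congr 1; funext α; ring
  have h2 : ∑ i ∈ Z, ‖I i‖ = ‖∫ α in (0:ℝ)..1, F α * wsum Z n a α‖ := by
    rw [← h1, Complex.norm_real, Real.norm_of_nonneg (Finset.sum_nonneg fun _ _ => norm_nonneg _)]
  change ∑ i ∈ Z, ‖I i‖ ≤ B
  rw [h2]
  refine (intervalIntegral.norm_integral_le_integral_norm zero_le_one).trans
    (le_trans (le_of_eq ?_) (hB a fun i _ => ha1 i))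
  simp only [norm_mul]

theorem Dom.norm_integral_le_norm {F G : ℝ → ℂ} (hd : Dom F G) :
    ‖∫ α in (0:ℝ)..1, F α‖ ≤ ‖∫ α in (0:ℝ)..1, G α‖ := by
  obtain ⟨ι, s, n, a, b, hab, hF, hG⟩ := hd
  simp only [hF, hG]
  rw [integral_sum_e, integral_sum_e]
  have h1 : (∑ i ∈ s with n i = 0, (b i : ℂ)) = ((∑ i ∈ s with n i = 0, b i : ℝ) : ℂ) := by
    push_cast; rfl
  rw [h1, Complex.norm_real]
  refine (norm_sum_le _ _).trans ((Finset.sum_le_sum fun i hi =>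
    hab i (Finset.mem_filter.1 hi).1).trans (le_abs_self _))

theorem norm_momentCoeff_le (k N R : ℕ) (m : ℤ) : ‖momentCoeff k N R m‖ ≤ moment k N R := by
  refine (intervalIntegral.norm_integral_le_integral_norm zero_le_one).trans (le_of_eq ?_)
  simp only [norm_mul, norm_e, mul_one, Complex.norm_real, norm_pow, norm_norm]
  rfl

theorem norm_momentCoeff_le_fullSum (k N R : ℕ) (m : ℤ) :
    ‖momentCoeff (2 * k + 2) N R m‖ ≤ ‖∫ α in (0:ℝ)..1, fullSum N α *
      (starRingEnd ℂ) (smoothSum N R α) * ((‖smoothSum N R α‖ ^ (2 * k) : ℝ) : ℂ) *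
      e ((-m : ℤ) * α)‖ := by
  have hd := ((((dom_smoothSum_fullSum N R).mul (Dom.refl_trig (smoothUpTo N R) fun x => (x : ℤ) ^ 4).conj).mul
    (dom_smoothSum_pow N R k)).mul (Dom.char (-m) (a := 1) (by simp)))
  refine le_trans (le_of_eq ?_) ((hd.norm_integral_le_norm).trans (le_of_eq ?_))
  rotate_left
  · congr 1
  · unfold momentCoeff
    congr 1
    refine congrArg (fun f : ℝ → ℂ => ∫ α in (0:ℝ)..1, f α) (funext fun α => ?_)
    have : smoothSum N R α * (starRingEnd ℂ) (smoothSum N R α) = ((‖smoothSum N R α‖ ^ 2 : ℝ) : ℂ) := by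
      rw [Complex.mul_conj, Complex.normSq_eq_norm_sq]
    change _ = smoothSum N R α * (starRingEnd ℂ) (smoothSum N R α) * _ * _
    rw [this]
    push_cast; ring

section

variable {N R : ℕ} {Z : Finset ℤ} {n : ℤ → ℤ}

theorem card_mul_le_of_le_momentCoeff {k : ℕ} {A B : ℝ}
    (hA : ∀ i ∈ Z, A ≤ ‖momentCoeff k N R (n i)‖)
    (hB : ∀ a : ℤ → ℂ, (∀ i ∈ Z, ‖a i‖ ≤ 1) →
      ∫ α in (0:ℝ)..1, ‖smoothSum N R α‖ ^ k * ‖wsum Z (fun i => -n i) a α‖ ≤ B) :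
    Z.card * A ≤ B := by
  have h1 := sum_norm_integral_mul_e_le (Z := Z) (n := fun i => -n i)
    (F := fun α => ((‖smoothSum N R α‖ ^ k : ℝ) : ℂ)) (by fun_prop) (B := B) (by
      intro a ha
      simpa using hB a ha)
  have h2 := Finset.card_nsmul_le_sum Z _ A hA
  rw [nsmul_eq_mul] at h2
  exact h2.trans h1

theorem card_mul_le_of_le_momentCoeff_fullSum {k : ℕ} {A B : ℝ}
    (hA : ∀ i ∈ Z, A ≤ ‖momentCoeff (2 * k + 2) N R (n i)‖)
    (hB : ∀ a : ℤ → ℂ, (∀ i ∈ Z, ‖a i‖ ≤ 1) →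
      ∫ α in (0:ℝ)..1, ‖fullSum N α‖ *
        (‖smoothSum N R α‖ ^ (2 * k + 1) * ‖wsum Z (fun i => -n i) a α‖) ≤ B) :
    Z.card * A ≤ B := by
  have hc := continuous_fullSum N
  have hc' : Continuous fun α => (starRingEnd ℂ) (smoothSum N R α) :=
    Complex.continuous_conj.comp (continuous_smoothSum N R)
  have h1 := sum_norm_integral_mul_e_le (Z := Z) (n := fun i => -n i)
    (F := fun α => fullSum N α * (starRingEnd ℂ) (smoothSum N R α) *
      ((‖smoothSum N R α‖ ^ (2 * k) : ℝ) : ℂ)) (by fun_prop) (B := B) (by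
      intro a ha
      refine le_trans (le_of_eq ?_) (hB a ha)
      refine congrArg (fun f : ℝ → ℝ => ∫ α in (0:ℝ)..1, f α) (funext fun α => ?_)
      simp only [norm_mul, RCLike.norm_conj, Complex.norm_real, norm_pow, norm_norm]
      ring)
  have h2 := Finset.card_nsmul_le_sum Z _ A
    (fun i hi => (hA i hi).trans (norm_momentCoeff_le_fullSum k N R (n i)))
  rw [nsmul_eq_mul] at h2
  exact h2.trans h1

end

theorem log_le_of_mul_le {z A W N x y : ℝ} (hz : 0 < z) (hA : 0 < A) (hW : 0 < W) (hN : 0 < N)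
    (h : z * A ≤ W * (N ^ x * z ^ y)) :
    Real.log z + Real.log A ≤ Real.log W + x * Real.log N + y * Real.log z := by
  have h1 := Real.log_le_log (by positivity) h
  rw [Real.log_mul hz.ne' hA.ne', Real.log_mul hW.ne' (by positivity),
    Real.log_mul (by positivity) (by positivity), Real.log_rpow hN, Real.log_rpow hz] at h1
  linarith

theorem log_le_or_of_mul_le {z A W N x y x' y' : ℝ} (hz : 0 < z) (hA : 0 < A) (hW : 0 < W)
    (hN : 0 < N) (h : z * A ≤ W * (N ^ x * z ^ y) + W * (N ^ x' * z ^ y')) :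
    Real.log z + Real.log A ≤ Real.log (2 * W) + x * Real.log N + y * Real.log z ∨
    Real.log z + Real.log A ≤ Real.log (2 * W) + x' * Real.log N + y' * Real.log z := by
  rcases le_total (N ^ x * z ^ y) (N ^ x' * z ^ y') with h1 | h1
  · right
    refine log_le_of_mul_le hz hA (by positivity) hN ?_
    have := mul_le_mul_of_nonneg_left h1 hW.le
    linarith
  · left
    refine log_le_of_mul_le hz hA (by positivity) hN ?_
    have := mul_le_mul_of_nonneg_left h1 hW.le
    linarith

theorem MeanValues.log_le {N R : ℕ} {Q : ℝ} (hM : MeanValues N R Q) (hN : 1 ≤ N) {k : ℕ} {x A : ℝ}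
    {W : ℝ} (hQW : Q ≤ W)
    (hA : 0 < A) {m : ℤ} (hAm : A ≤ ‖momentCoeff k N R m‖) (hk : moment k N R ≤ Q * (N : ℝ) ^ x) :
    Real.log A ≤ Real.log W + x * Real.log N := by
  have hN0 : (0:ℝ) < N := by exact_mod_cast hN
  have hQ := hM.one_le
  have h1 := (hAm.trans (norm_momentCoeff_le k N R m)).trans hk
  have := log_le_of_mul_le (z := 1) (y := 0) one_pos hA (by linarith : 0 < W) hN0 (x := x) (by
    rw [one_mul, Real.rpow_zero, mul_one]; exact h1.trans (by gcongr))
  simpa using this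

theorem MeanValues.seven {N R : ℕ} {Q : ℝ} (hM : MeanValues N R Q) (hN : 1 ≤ N) :
    moment 7 N R ≤ 4 * Q ^ 3 * (N : ℝ) ^ (3.899 : ℝ) := by
  have hQ := hM.one_le
  have h := integral_mul_le_of_sq_le (z := 1) (f := fun α => ‖smoothSum N R α‖ ^ 3)
    (g := fun α => ‖smoothSum N R α‖ ^ 4) (by fun_prop) (by fun_prop) (fun _ => by positivity)
    (fun _ => by positivity) (by positivity) (by exact_mod_cast hN) one_pos
    (hM.moment_le hM.six _ 3 rfl) (hM.moment_le hM.eight _ 4 rfl)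
  simp only [← pow_add] at h
  exact h.trans_eq (by norm_num)

set_option maxHeartbeats 1000000 in
theorem MeanValues.card_mul_mul_mul_le {N R : ℕ} {Q : ℝ} (hM : MeanValues N R Q) (hN : 1 ≤ N)
    {Z : Finset ℤ} (hZ : Z.Nonempty) {n₆ n₇ n₈ : ℤ → ℤ} (h₆ : Set.InjOn n₆ Z)
    (h₇ : Set.InjOn n₇ Z) (h₈ : Set.InjOn n₈ Z) (hb₆ : ∀ i ∈ Z, |n₆ i| ≤ 8 * N ^ 4)
    (hb₈ : ∀ i ∈ Z, |n₈ i| ≤ 8 * N ^ 4) {A B C : ℝ} (hA0 : 0 < A) (hB0 : 0 < B) (hC0 : 0 < C)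
    (hA : ∀ i ∈ Z, A ≤ ‖momentCoeff 6 N R (n₆ i)‖) (hB : ∀ i ∈ Z, B ≤ ‖momentCoeff 7 N R (n₇ i)‖)
    (hC : ∀ i ∈ Z, C ≤ ‖momentCoeff 8 N R (n₈ i)‖) :
    Z.card * (A * B * C) ≤ (8 * Q ^ 3) ^ 3 * (N : ℝ) ^ (13.106325 : ℝ) := by
  have hQ := hM.one_le
  have hN0 : (0:ℝ) < N := by exact_mod_cast hN
  have hz : 0 < Z.card := hZ.card_pos
  have hz0 : (0:ℝ) < Z.card := by exact_mod_cast hz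
  have g₆ : Set.InjOn (fun i => -n₆ i) Z := fun i hi j hj h => h₆ hi hj (neg_injective h)
  have g₇ : Set.InjOn (fun i => -n₇ i) Z := fun i hi j hj h => h₇ hi hj (neg_injective h)
  have g₈ : Set.InjOn (fun i => -n₈ i) Z := fun i hi j hj h => h₈ hi hj (neg_injective h)
  have k₆ : ∀ i ∈ Z, |(fun i => -n₆ i) i| ≤ 8 * (N:ℤ) ^ 4 := fun i hi => by
    simpa only [abs_neg] using hb₆ i hi
  have k₈ : ∀ i ∈ Z, |(fun i => -n₈ i) i| ≤ 8 * (N:ℤ) ^ 4 := fun i hi => by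
    simpa only [abs_neg] using hb₈ i hi
  have hW : (0:ℝ) < 4 * Q ^ 3 := by positivity
  have hlN : 0 ≤ Real.log N := Real.log_nonneg (by exact_mod_cast hN)
  have hlW : Real.log (4 * Q ^ 3) ≤ Real.log (8 * Q ^ 3) :=
    Real.log_le_log hW (by linarith)
  have hlz : 0 ≤ Real.log Z.card := Real.log_nonneg (by exact_mod_cast hz)
  have e8 : 2 * (4 * Q ^ 3) = 8 * Q ^ 3 := by ring
  suffices hlog : Real.log Z.card + Real.log A + Real.log B + Real.log C ≤
      3 * Real.log (8 * Q ^ 3) + 13.106325 * Real.log N by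
    have h1 : Real.log (Z.card * (A * B * C)) ≤
        Real.log ((8 * Q ^ 3) ^ 3 * (N : ℝ) ^ (13.106325 : ℝ)) := by
      rw [Real.log_mul hz0.ne' (by positivity), Real.log_mul (by positivity) hC0.ne',
        Real.log_mul hA0.ne' hB0.ne', Real.log_mul (by positivity) (by positivity),
        Real.log_rpow hN0, Real.log_pow]
      push_cast
      linarith
    exact (Real.log_le_log_iff (by positivity) (by positivity)).1 h1
  have hlN2 : Real.log ((N:ℝ) ^ 2) = 2 * Real.log N := by rw [Real.log_pow]; norm_num
  rcases le_total (N ^ 2) Z.card with hZ2 | hZ2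
  · have hNZ : N ≤ Z.card := (Nat.le_self_pow two_ne_zero N).trans hZ2
    have l6 := log_le_of_mul_le hz0 hA0 hW hN0 (card_mul_le_of_le_momentCoeff hA
      fun a ha => hM.integral_six_mul_le ha g₆ hN hz)
    have l7 := log_le_of_mul_le hz0 hB0 hW hN0 (card_mul_le_of_le_momentCoeff hB
      fun a ha => hM.integral_seven_mul_le ha g₇ hN hZ2)
    have l7' := log_le_of_mul_le hz0 hB0 hW hN0 (card_mul_le_of_le_momentCoeff hB
      fun a ha => hM.integral_seven_mul_le' ha g₇ hN hZ2)
    have l8 := log_le_of_mul_le hz0 hC0 hW hN0 (card_mul_le_of_le_momentCoeff hC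
      fun a ha => hM.integral_eight_mul_le ha g₈ hN hZ2)
    have l6f := log_le_or_of_mul_le hz0 hA0 hW hN0 (card_mul_le_of_le_momentCoeff_fullSum (k := 2) hA
      fun a ha => hM.integral_fullSum_mul_five_mul_le ha g₆ hN k₆ hNZ)
    have l8f := log_le_or_of_mul_le hz0 hC0 hW hN0 (card_mul_le_of_le_momentCoeff_fullSum (k := 3) hC
      fun a ha => hM.integral_fullSum_mul_seven_mul_le ha g₈ hN k₈ hZ2)
    rw [e8] at l6f l8f
    rcases l6f with h6 | h6
    · rcases l8f with h8 | h8
      · linarith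
      · linarith
    · linarith
  · have hlz2 : Real.log Z.card ≤ 2 * Real.log N := by
      rw [← hlN2]; exact Real.log_le_log hz0 (by exact_mod_cast hZ2)
    obtain ⟨i, hi⟩ := hZ
    have hQW := hM.le_four_mul_pow_three
    have lC := hM.log_le hN hQW hC0 (hC i hi) hM.eight
    rcases le_total N Z.card with hNZ | hNZ
    · have l6 := log_le_of_mul_le hz0 hA0 hW hN0 (card_mul_le_of_le_momentCoeff hA
        fun a ha => hM.integral_six_mul_le_of_le ha g₆ hN hNZ)
      have l7 := log_le_of_mul_le hz0 hB0 hW hN0 (card_mul_le_of_le_momentCoeff hB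
        fun a ha => hM.integral_seven_mul_le_of_le ha g₇ hN hz hZ2)
      linarith
    · have hlz1 : Real.log Z.card ≤ Real.log N := Real.log_le_log hz0 (by exact_mod_cast hNZ)
      have lA := hM.log_le hN hQW hA0 (hA i hi) hM.six
      have lB : Real.log B ≤ Real.log (4 * Q ^ 3) + 3.899 * Real.log N := by
        have h1 := (hB i hi).trans ((norm_momentCoeff_le 7 N R _).trans (hM.seven hN))
        have := log_le_of_mul_le (z := 1) (y := 0) one_pos hB0 hW hN0 (x := 3.899) (by
          rw [one_mul, Real.rpow_zero, mul_one]; exact h1)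
        simpa using this
      linarith

/-- A dyadic decomposition: bounds for the sub-level sets of three functions bound the sum of
their product. -/
theorem sum_mul_mul_le_of_dyadic {T : Finset ℤ} {a b c : ℤ → ℝ} {X S : ℝ} {L : ℕ} (hS : 0 < S)
    (ha : ∀ i ∈ T, 1 ≤ S * a i ∧ S * a i < 2 ^ L) (hb : ∀ i ∈ T, 1 ≤ S * b i ∧ S * b i < 2 ^ L)
    (hc : ∀ i ∈ T, 1 ≤ S * c i ∧ S * c i < 2 ^ L)
    (hX : ∀ Z ⊆ T, Z.Nonempty → ∀ A B C : ℝ, 0 < A → 0 < B → 0 < C → (∀ i ∈ Z, A ≤ a i) →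
      (∀ i ∈ Z, B ≤ b i) → (∀ i ∈ Z, C ≤ c i) → Z.card * (A * B * C) ≤ X) (hX0 : 0 ≤ X) :
    ∑ i ∈ T, a i * b i * c i ≤ 8 * (L : ℝ) ^ 3 * X := by
  classical
  have key : ∀ x : ℝ, 1 ≤ S * x → S * x < 2 ^ L → Nat.log 2 ⌊S * x⌋₊ < L ∧
      2 ^ Nat.log 2 ⌊S * x⌋₊ / S ≤ x ∧ x ≤ 2 * (2 ^ Nat.log 2 ⌊S * x⌋₊ / S) := by
    intro x h1 h2
    have hf : 1 ≤ ⌊S * x⌋₊ := Nat.one_le_floor_iff _ |>.2 h1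
    have h3 : ⌊S * x⌋₊ < 2 ^ L := by
      rw [Nat.floor_lt (by linarith)]; exact_mod_cast h2
    refine ⟨Nat.log_lt_of_lt_pow (by omega) h3, ?_, ?_⟩
    · rw [div_le_iff₀ hS, mul_comm x S]
      have h4 := Nat.pow_log_le_self 2 (by omega : ⌊S * x⌋₊ ≠ 0)
      have h5 : ((2 ^ Nat.log 2 ⌊S * x⌋₊ : ℕ) : ℝ) ≤ S * x :=
        (Nat.cast_le.2 h4).trans (Nat.floor_le (by linarith))
      exact_mod_cast h5
    · rw [← mul_div_assoc, le_div_iff₀ hS, mul_comm x S]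
      have h4 := Nat.lt_pow_succ_log_self (b := 2) (by norm_num) ⌊S * x⌋₊
      have h5 := Nat.lt_of_floor_lt (a := S * x) h4
      rw [pow_succ] at h5
      push_cast at h5
      linarith
  set g : ℤ → ℕ × ℕ × ℕ := fun i =>
    (Nat.log 2 ⌊S * a i⌋₊, Nat.log 2 ⌊S * b i⌋₊, Nat.log 2 ⌊S * c i⌋₊) with hg
  set D : Finset (ℕ × ℕ × ℕ) := Finset.range L ×ˢ Finset.range L ×ˢ Finset.range L with hD
  have hgD : ∀ i ∈ T, g i ∈ D := fun i hi => by
    simp only [hD, hg, Finset.mem_product, Finset.mem_range]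
    exact ⟨(key _ (ha i hi).1 (ha i hi).2).1, (key _ (hb i hi).1 (hb i hi).2).1,
      (key _ (hc i hi).1 (hc i hi).2).1⟩
  rw [← Finset.sum_fiberwise_of_maps_to hgD]
  have hfib : ∀ t ∈ D, ∑ i ∈ T with g i = t, a i * b i * c i ≤ 8 * X := by
    rintro ⟨k, l, m⟩ -
    rcases (T.filter fun i => g i = (k, l, m)).eq_empty_or_nonempty with h0 | h0
    · rw [h0]; simp; positivity
    have hp : ∀ i ∈ T.filter (fun i => g i = (k, l, m)),
        (2 ^ k / S ≤ a i ∧ a i ≤ 2 * (2 ^ k / S)) ∧ (2 ^ l / S ≤ b i ∧ b i ≤ 2 * (2 ^ l / S)) ∧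
        (2 ^ m / S ≤ c i ∧ c i ≤ 2 * (2 ^ m / S)) := by
      intro i hi
      obtain ⟨hi, hgi⟩ := Finset.mem_filter.1 hi
      simp only [hg, Prod.mk.injEq] at hgi
      obtain ⟨e1, e2, e3⟩ := hgi
      have k1 := (key _ (ha i hi).1 (ha i hi).2).2
      have k2 := (key _ (hb i hi).1 (hb i hi).2).2
      have k3 := (key _ (hc i hi).1 (hc i hi).2).2
      rw [e1] at k1; rw [e2] at k2; rw [e3] at k3
      exact ⟨k1, k2, k3⟩
    have h1 := hX _ (Finset.filter_subset _ _) h0 (2 ^ k / S) (2 ^ l / S) (2 ^ m / S)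
      (by positivity) (by positivity) (by positivity) (fun i hi => (hp i hi).1.1)
      (fun i hi => (hp i hi).2.1.1) (fun i hi => (hp i hi).2.2.1)
    refine (Finset.sum_le_card_nsmul _ _ (2 * (2 ^ k / S) * (2 * (2 ^ l / S)) * (2 * (2 ^ m / S)))
      fun i hi => ?_).trans ?_
    · obtain ⟨p1, p2, p3⟩ := hp i hi
      have q2 : 0 ≤ b i := le_trans (by positivity) p2.1
      have q3 : 0 ≤ c i := le_trans (by positivity) p3.1
      exact mul_le_mul (mul_le_mul p1.2 p2.2 q2 (by positivity)) p3.2 q3 (by positivity)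
    · rw [nsmul_eq_mul]
      nlinarith
  refine (Finset.sum_le_card_nsmul _ _ _ hfib).trans (le_of_eq ?_)
  rw [hD, Finset.card_product, Finset.card_product, Finset.card_range, nsmul_eq_mul]
  push_cast; ring

theorem norm_momentCoeff_le_pow {k N : ℕ} (hN : 1 ≤ N) (hk : k ≤ 8) (R : ℕ) (m : ℤ) :
    ‖momentCoeff k N R m‖ ≤ (N : ℝ) ^ 8 := by
  refine (norm_momentCoeff_le k N R m).trans ?_
  have h := moment_add_le 0 k N R
  simp only [zero_add, moment, pow_zero] at h
  simp at h
  exact h.trans (pow_le_pow_right₀ (by exact_mod_cast hN) hk)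

theorem MeanValues.sum_momentCoeff_le {N R : ℕ} {Q : ℝ} (hM : MeanValues N R Q) (hN : 1 ≤ N)
    {T : Finset ℤ} {n₆ n₇ n₈ : ℤ → ℤ} (h₆ : Set.InjOn n₆ T)
    (h₇ : Set.InjOn n₇ T) (h₈ : Set.InjOn n₈ T) (hb₆ : ∀ i ∈ T, |n₆ i| ≤ 8 * N ^ 4)
    (hb₈ : ∀ i ∈ T, |n₈ i| ≤ 8 * N ^ 4) :
    ∑ i ∈ T, ‖momentCoeff 6 N R (n₆ i)‖ * ‖momentCoeff 7 N R (n₇ i)‖ *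
      ‖momentCoeff 8 N R (n₈ i)‖ ≤
      17 + 8 * ((28 * (Nat.log 2 N + 1) : ℕ) : ℝ) ^ 3 *
        ((8 * Q ^ 3) ^ 3 * (N : ℝ) ^ (13.106325 : ℝ)) := by
  classical
  have hQ := hM.one_le
  have hN1 : (1:ℝ) ≤ N := by exact_mod_cast hN
  have hN0 : (0:ℝ) < N := by linarith
  set a : ℤ → ℝ := fun i => ‖momentCoeff 6 N R (n₆ i)‖ with ha
  set b : ℤ → ℝ := fun i => ‖momentCoeff 7 N R (n₇ i)‖ with hb
  set c : ℤ → ℝ := fun i => ‖momentCoeff 8 N R (n₈ i)‖ with hc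
  have ha0 : ∀ i, 0 ≤ a i := fun i => norm_nonneg _
  have hb0 : ∀ i, 0 ≤ b i := fun i => norm_nonneg _
  have hc0 : ∀ i, 0 ≤ c i := fun i => norm_nonneg _
  have ha8 : ∀ i, a i ≤ (N:ℝ) ^ 8 := fun i => norm_momentCoeff_le_pow hN (by norm_num) R _
  have hb8 : ∀ i, b i ≤ (N:ℝ) ^ 8 := fun i => norm_momentCoeff_le_pow hN (by norm_num) R _
  have hc8 : ∀ i, c i ≤ (N:ℝ) ^ 8 := fun i => norm_momentCoeff_le_pow hN (by norm_num) R _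
  have hlt : (N:ℝ) ^ 28 < 2 ^ (28 * (Nat.log 2 N + 1)) := by
    have h1 : N < 2 ^ (Nat.log 2 N + 1) := Nat.lt_pow_succ_log_self (by norm_num) N
    have h2 : N ^ 28 < (2 ^ (Nat.log 2 N + 1)) ^ 28 := Nat.pow_lt_pow_left h1 (by norm_num)
    rw [← pow_mul, mul_comm _ 28] at h2
    exact_mod_cast h2
  have hup : ∀ x : ℝ, x ≤ (N:ℝ) ^ 8 → (N:ℝ) ^ 20 * x < 2 ^ (28 * (Nat.log 2 N + 1)) := by
    intro x hx
    refine lt_of_le_of_lt ?_ hlt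
    calc (N:ℝ) ^ 20 * x ≤ (N:ℝ) ^ 20 * (N:ℝ) ^ 8 := by gcongr
      _ = (N:ℝ) ^ 28 := by ring
  set big : ℤ → Prop := fun i =>
    1 ≤ (N:ℝ) ^ 20 * a i ∧ 1 ≤ (N:ℝ) ^ 20 * b i ∧ 1 ≤ (N:ℝ) ^ 20 * c i with hbig
  rw [← Finset.sum_filter_add_sum_filter_not T big, add_comm]
  refine add_le_add ?_ ?_
  · have hcard : ((T.filter fun i => ¬ big i).card : ℝ) ≤ 17 * (N:ℝ) ^ 4 := by
      have h1 : T.card ≤ (Finset.Icc (-(8 * (N:ℤ) ^ 4)) (8 * (N:ℤ) ^ 4)).card :=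
        Finset.card_le_card_of_injOn n₆ (fun i hi => by
          simpa [abs_le] using hb₆ i hi) h₆
      rw [Int.card_Icc] at h1
      have h2 : T.card ≤ 17 * N ^ 4 := by
        refine h1.trans ?_
        have : 1 ≤ N ^ 4 := Nat.one_le_pow _ _ hN
        zify at this
        rw [Int.toNat_le]
        push_cast
        linarith
      exact_mod_cast (Finset.card_filter_le _ _).trans h2
    have hterm : ∀ i ∈ T.filter (fun i => ¬ big i), a i * b i * c i ≤ 1 / (N:ℝ) ^ 4 := by
      intro i hi
      have hi := (Finset.mem_filter.1 hi).2
      have e1 : (N:ℝ) ^ 8 * (N:ℝ) ^ 8 * (N:ℝ) ^ 4 = N ^ 20 := by ring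
      rw [le_div_iff₀ (by positivity)]
      have aux : ∀ x y z : ℝ, 0 ≤ x → 0 ≤ y → 0 ≤ z → y ≤ (N:ℝ) ^ 8 → z ≤ (N:ℝ) ^ 8 →
          (N:ℝ) ^ 20 * x < 1 → x * (y * z) * (N:ℝ) ^ 4 ≤ 1 := by
        intro x y z hx hy hz hy8 hz8 hlt
        calc x * (y * z) * (N:ℝ) ^ 4 ≤ x * ((N:ℝ) ^ 8 * (N:ℝ) ^ 8) * (N:ℝ) ^ 4 := by gcongr
          _ = (N:ℝ) ^ 20 * x := by ring
          _ ≤ 1 := hlt.le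
      simp only [hbig, not_and_or, not_le] at hi
      rcases hi with hi | hi | hi
      · have := aux _ _ _ (ha0 i) (hb0 i) (hc0 i) (hb8 i) (hc8 i) hi; linarith
      · have := aux _ _ _ (hb0 i) (ha0 i) (hc0 i) (ha8 i) (hc8 i) hi; linarith
      · have := aux _ _ _ (hc0 i) (ha0 i) (hb0 i) (ha8 i) (hb8 i) hi; linarith
    refine (Finset.sum_le_card_nsmul _ _ _ hterm).trans ?_
    rw [nsmul_eq_mul, mul_one_div, div_le_iff₀ (by positivity)]
    exact hcard
  · refine sum_mul_mul_le_of_dyadic (S := (N:ℝ) ^ 20) (by positivity) ?_ ?_ ?_ ?_ (by positivity)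
    · exact fun i hi => ⟨(Finset.mem_filter.1 hi).2.1, hup _ (ha8 i)⟩
    · exact fun i hi => ⟨(Finset.mem_filter.1 hi).2.2.1, hup _ (hb8 i)⟩
    · exact fun i hi => ⟨(Finset.mem_filter.1 hi).2.2.2, hup _ (hc8 i)⟩
    · intro Z hZ hZ0 A B C hA0 hB0 hC0 hA hB hC
      have hZT : Z ⊆ T := hZ.trans (Finset.filter_subset _ _)
      exact hM.card_mul_mul_mul_le hN hZ0 (h₆.mono (by exact_mod_cast hZT))
        (h₇.mono (by exact_mod_cast hZT)) (h₈.mono (by exact_mod_cast hZT))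
        (fun i hi => hb₆ i (hZT hi)) (fun i hi => hb₈ i (hZT hi)) hA0 hB0 hC0 hA hB hC

/-- `F` is a trigonometric polynomial with all frequencies at most `M` in absolute value. -/
def TrigDegLE (M : ℤ) (F : ℝ → ℂ) : Prop :=
  ∃ (ι : Type) (s : Finset ι) (n : ι → ℤ), (∀ i ∈ s, |n i| ≤ M) ∧ ∀ α, F α = trig s n α

namespace TrigDegLE

variable {M M' : ℤ} {F F' : ℝ → ℂ}

theorem mul (hF : TrigDegLE M F) (hF' : TrigDegLE M' F') :
    TrigDegLE (M + M') fun α => F α * F' α := by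
  obtain ⟨ι, s, n, hn, hs⟩ := hF
  obtain ⟨ι', s', n', hn', hs'⟩ := hF'
  refine ⟨ι × ι', s ×ˢ s', fun q => n q.1 + n' q.2, fun q hq => ?_, fun α => ?_⟩
  · obtain ⟨h1, h2⟩ := Finset.mem_product.1 hq
    exact (abs_add_le _ _).trans (add_le_add (hn _ h1) (hn' _ h2))
  · change F α * F' α = _
    rw [hs, hs', trig_mul]

theorem conj (hF : TrigDegLE M F) : TrigDegLE M fun α => (starRingEnd ℂ) (F α) := by
  obtain ⟨ι, s, n, hn, hs⟩ := hF
  refine ⟨ι, s, fun i => -n i, fun i hi => by simpa using hn i hi, fun α => ?_⟩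
  change (starRingEnd ℂ) (F α) = _
  rw [hs, trig_conj]

theorem one : TrigDegLE 0 fun _ => 1 :=
  ⟨Unit, {()}, fun _ => 0, by simp, fun α => by simp [trig, e_zero]⟩

theorem pow (hF : TrigDegLE M F) (k : ℕ) : TrigDegLE (k * M) fun α => F α ^ k := by
  induction k with
  | zero => simpa using one
  | succ k ih =>
    have := ih.mul hF
    simp only [pow_succ]
    convert this using 1
    push_cast; ring

theorem norm_pow (hF : TrigDegLE M F) (k : ℕ) :
    TrigDegLE (2 * k * M) fun α => ((‖F α‖ ^ (2 * k) : ℝ) : ℂ) := by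
  have h := (hF.mul hF.conj).pow k
  have h1 : ∀ α, F α * (starRingEnd ℂ) (F α) = ((‖F α‖ ^ 2 : ℝ) : ℂ) := fun α => by
    rw [Complex.mul_conj, Complex.normSq_eq_norm_sq]
  simp only [h1] at h
  convert h using 1
  · ring
  · funext α; rw [pow_mul]; push_cast; rfl

theorem eq_sum (hF : TrigDegLE M F) (α : ℝ) :
    F α = ∑ m ∈ Finset.Icc (-M) M, (∫ x in (0:ℝ)..1, F x * e ((-m : ℤ) * x)) * e (m * α) := by
  obtain ⟨ι, s, n, hn, hs⟩ := hF
  have h1 : ∀ m : ℤ, ∫ x in (0:ℝ)..1, F x * e ((-m : ℤ) * x) =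
      ((s.filter fun i => n i = m).card : ℂ) := by
    intro m
    have h2 : ∀ x : ℝ, F x * e ((-m : ℤ) * x) = trig s (fun i => n i - m) x := by
      intro x
      rw [hs, trig, trig, Finset.sum_mul]
      refine Finset.sum_congr rfl fun i _ => ?_
      rw [← e_add]; push_cast; ring_nf
    simp only [h2, integral_trig, sub_eq_zero]
  simp only [h1]
  rw [hs, trig]
  rw [← Finset.sum_fiberwise_of_maps_to (g := n) (t := Finset.Icc (-M) M)
    (fun i hi => by simpa [abs_le] using hn i hi)]
  refine Finset.sum_congr rfl fun m _ => ?_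
  rw [Finset.sum_congr rfl (g := fun _ => e (m * α)) fun i hi => by
    rw [(Finset.mem_filter.1 hi).2], Finset.sum_const, nsmul_eq_mul]

end TrigDegLE

theorem trigDegLE_smoothSum (N R : ℕ) : TrigDegLE ((N : ℤ) ^ 4) (smoothSum N R) := by
  refine ⟨ℕ, smoothUpTo N R, fun x => (x : ℤ) ^ 4, fun x hx => ?_, fun α => rfl⟩
  rw [abs_of_nonneg (by positivity)]
  exact pow_le_pow_left₀ (by positivity) (by exact_mod_cast (mem_smoothUpTo.1 hx).2.1) 4

theorem norm_smoothSum_pow_eq_sum {k N R : ℕ} (hk : 2 * k ≤ 8) (α : ℝ) :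
    ((‖smoothSum N R α‖ ^ (2 * k) : ℝ) : ℂ) =
      ∑ m ∈ Finset.Icc (-(8 * (N : ℤ) ^ 4)) (8 * (N : ℤ) ^ 4),
        momentCoeff (2 * k) N R m * e (m * α) := by
  obtain ⟨ι, s, n, hn, hs⟩ := (trigDegLE_smoothSum N R).norm_pow k
  have h : TrigDegLE (8 * (N : ℤ) ^ 4) fun α => ((‖smoothSum N R α‖ ^ (2 * k) : ℝ) : ℂ) := by
    refine ⟨ι, s, n, fun i hi => (hn i hi).trans ?_, hs⟩
    have : (2 * (k : ℤ)) ≤ 8 := by exact_mod_cast hk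
    exact mul_le_mul_of_nonneg_right this (by positivity)
  exact h.eq_sum α

theorem integral_comp_add_periodic {G : ℝ → ℂ} (hG : ∀ x, G (x + 1) = G x) (c : ℝ) :
    ∫ x in (0:ℝ)..1, G (c + x) = ∫ x in (0:ℝ)..1, G x := by
  rw [intervalIntegral.integral_comp_add_left]
  have := Function.Periodic.intervalIntegral_add_eq (f := G) (T := 1) hG c 0
  simpa using this

theorem integral_e_comp_linear {G : ℝ → ℂ} (hG : ∀ x, G (x + 1) = G x) (hc : Continuous G)
    {c d u v : ℤ} (hcd : c ≠ 0 ∨ d ≠ 0)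
    (h0 : ∫ α in (0:ℝ)..1, ∫ β in (0:ℝ)..1, e (u * α + v * β) * G (c * α + d * β) ≠ 0) :
    ∃ r : ℤ, u = r * c ∧ v = r * d ∧
      ∫ α in (0:ℝ)..1, ∫ β in (0:ℝ)..1, e (u * α + v * β) * G (c * α + d * β) =
        ∫ x in (0:ℝ)..1, e (r * x) * G x := by
  have hper : ∀ r : ℤ, ∀ x, e (r * (x + 1)) * G (x + 1) = e (r * x) * G x := fun r x => by
    rw [e_int_mul_add_one, hG]
  have hcont : ∀ r : ℤ, Continuous fun x : ℝ => e (r * x) * G x := fun r =>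
    (continuous_e_int_mul r).mul hc
  have h1 : ∀ α, ∫ β in (0:ℝ)..1, e (u * α + v * β) * G (c * α + d * β) =
      e (u * α) * ∫ β in (0:ℝ)..1, e (v * β) * G (c * α + d * β) := by
    intro α
    rw [← intervalIntegral.integral_const_mul]
    congr 1; funext β; rw [e_add]; ring
  simp only [h1] at h0 ⊢
  by_cases hd : d = 0
  · subst hd
    have hc0 : c ≠ 0 := by simpa using hcd
    have h2 : ∀ α : ℝ, ∫ β in (0:ℝ)..1, e (v * β) * G (c * α + (0:ℤ) * β) =
        (if v = 0 then 1 else 0) * G (c * α) := by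
      intro α
      simp only [Int.cast_zero, zero_mul, add_zero]
      rw [intervalIntegral.integral_mul_const, integral_e]
    simp only [h2] at h0 ⊢
    by_cases hv : v = 0
    · simp only [hv, if_true, one_mul] at h0 ⊢
      obtain ⟨r, hr⟩ : c ∣ u := by
        by_contra hcu
        exact h0 (integral_e_mul_comp_eq_zero hG hc0 hcu)
      refine ⟨r, by rw [hr, mul_comm], by simp, ?_⟩
      rw [← integral_comp_int_mul (hper r) (hcont r) hc0]
      congr 1; funext α; rw [hr]; push_cast; ring_nf
    · simp [hv] at h0
  · by_cases hdv : d ∣ v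
    · obtain ⟨r, hr⟩ := hdv
      have h2 : ∀ α : ℝ, ∫ β in (0:ℝ)..1, e (v * β) * G (c * α + d * β) =
          e ((-(r * c) : ℤ) * α) * ∫ x in (0:ℝ)..1, e (r * x) * G x := by
        intro α
        have h3 := integral_comp_int_mul (G := fun x => e (r * x) * G (c * α + x))
          (fun x => by rw [e_int_mul_add_one, ← add_assoc, hG])
          ((continuous_e_int_mul r).mul (hc.comp (by fun_prop))) hd
        have h4 : ∀ β : ℝ, e (r * (d * β)) = e (v * β) := fun β => by
          rw [hr]; push_cast; ring_nf
        simp only [h4] at h3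
        rw [h3, ← integral_comp_add_periodic (G := fun x => e (r * x) * G x) (hper r) (c * α),
          ← intervalIntegral.integral_const_mul]
        congr 1; funext x
        rw [← mul_assoc, ← e_add]
        congr 2; push_cast; ring
      simp only [h2] at h0 ⊢
      have h5 : ∫ α in (0:ℝ)..1, e (u * α) * (e ((-(r * c) : ℤ) * α) *
          ∫ x in (0:ℝ)..1, e (r * x) * G x) =
          (if u - r * c = 0 then 1 else 0) * ∫ x in (0:ℝ)..1, e (r * x) * G x := by
        rw [← integral_e, ← intervalIntegral.integral_mul_const]
        congr 1; funext α
        rw [← mul_assoc, ← e_add]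
        congr 2; push_cast; ring
      rw [h5] at h0 ⊢
      by_cases hu : u - r * c = 0
      · exact ⟨r, by linarith, by rw [hr, mul_comm], by simp [hu]⟩
      · simp [hu] at h0
    · exfalso
      apply h0
      have h2 : ∀ α : ℝ, ∫ β in (0:ℝ)..1, e (v * β) * G (c * α + d * β) = 0 := fun α =>
        integral_e_mul_comp_eq_zero (G := fun x => G (c * α + x))
          (fun x => by rw [← add_assoc, hG]) hd hdv
      simp [h2]

theorem continuous_integral_linear {G : ℝ → ℝ → ℂ} (hG : Continuous (Function.uncurry G)) :
    Continuous fun α => ∫ β in (0:ℝ)..1, G α β :=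
  intervalIntegral.continuous_parametric_intervalIntegral_of_continuous' hG 0 1

theorem integral_integral_finset_sum {ι : Type*} (s : Finset ι) (G : ι → ℝ → ℝ → ℂ)
    (hG : ∀ i ∈ s, Continuous (Function.uncurry (G i))) :
    ∫ α in (0:ℝ)..1, ∫ β in (0:ℝ)..1, ∑ i ∈ s, G i α β =
      ∑ i ∈ s, ∫ α in (0:ℝ)..1, ∫ β in (0:ℝ)..1, G i α β := by
  rw [← intervalIntegral.integral_finsetSum fun i hi =>
    (continuous_integral_linear (hG i hi)).intervalIntegrable _ _]
  refine congrArg (fun f : ℝ → ℂ => ∫ α in (0:ℝ)..1, f α) (funext fun α => ?_)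
  refine intervalIntegral.integral_finsetSum fun i hi => ?_
  have : Continuous fun β => G i α β := (hG i hi).comp (Continuous.prodMk_right α)
  exact this.intervalIntegrable _ _

theorem continuous_e_linear (u v : ℤ) :
    Continuous (Function.uncurry fun α β : ℝ => e (u * α + v * β)) := by
  unfold Function.uncurry
  exact continuous_e.comp (by fun_prop)

/-- The correlation of `e(uα + vβ)` with the seventh power of the smooth Weyl sum at `c₂α + d₂β`. -/
def resonance (N R : ℕ) (c₂ d₂ u v : ℤ) : ℂ :=
  ∫ α in (0:ℝ)..1, ∫ β in (0:ℝ)..1,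
    e (u * α + v * β) * ((‖smoothSum N R (c₂ * α + d₂ * β)‖ ^ 7 : ℝ) : ℂ)

theorem exists_of_resonance_ne_zero {N R : ℕ} {c₂ d₂ u v : ℤ} (h2 : c₂ ≠ 0 ∨ d₂ ≠ 0)
    (h0 : resonance N R c₂ d₂ u v ≠ 0) :
    ∃ r : ℤ, u = r * c₂ ∧ v = r * d₂ ∧ resonance N R c₂ d₂ u v = momentCoeff 7 N R (-r) := by
  obtain ⟨r, hu, hv, hr⟩ := integral_e_comp_linear
    (G := fun x => ((‖smoothSum N R x‖ ^ 7 : ℝ) : ℂ)) (fun x => by rw [smoothSum_add_one])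
    (by fun_prop) h2 h0
  refine ⟨r, hu, hv, hr.trans ?_⟩
  rw [momentCoeff]
  refine congrArg (fun f : ℝ → ℂ => ∫ α in (0:ℝ)..1, f α) (funext fun α => ?_)
  rw [neg_neg, mul_comm]

theorem integral_integral_le_sum_resonance (N R : ℕ) (c₁ d₁ c₂ d₂ c₃ d₃ : ℤ) :
    ∫ α in (0:ℝ)..1, ∫ β in (0:ℝ)..1, ‖smoothSum N R (c₁ * α + d₁ * β)‖ ^ 6 *
      ‖smoothSum N R (c₂ * α + d₂ * β)‖ ^ 7 * ‖smoothSum N R (c₃ * α + d₃ * β)‖ ^ 8 ≤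
    ∑ p ∈ Finset.Icc (-(8 * (N : ℤ) ^ 4)) (8 * (N : ℤ) ^ 4) ×ˢ
        Finset.Icc (-(8 * (N : ℤ) ^ 4)) (8 * (N : ℤ) ^ 4),
      ‖momentCoeff 6 N R p.1‖ * ‖resonance N R c₂ d₂ (p.1 * c₁ + p.2 * c₃) (p.1 * d₁ + p.2 * d₃)‖ *
        ‖momentCoeff 8 N R p.2‖ := by
  set S := Finset.Icc (-(8 * (N : ℤ) ^ 4)) (8 * (N : ℤ) ^ 4) with hS
  have h6 := fun α => norm_smoothSum_pow_eq_sum (k := 3) (N := N) (R := R) (by norm_num) α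
  have h8 := fun α => norm_smoothSum_pow_eq_sum (k := 4) (N := N) (R := R) (by norm_num) α
  simp only [Nat.reduceMul] at h6 h8
  have hF : ∀ α β : ℝ, ((‖smoothSum N R (c₁ * α + d₁ * β)‖ ^ 6 *
      ‖smoothSum N R (c₂ * α + d₂ * β)‖ ^ 7 * ‖smoothSum N R (c₃ * α + d₃ * β)‖ ^ 8 : ℝ) : ℂ) =
      ∑ p ∈ S ×ˢ S, momentCoeff 6 N R p.1 * momentCoeff 8 N R p.2 *
        (e ((p.1 * c₁ + p.2 * c₃ : ℤ) * α + (p.1 * d₁ + p.2 * d₃ : ℤ) * β) *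
          ((‖smoothSum N R (c₂ * α + d₂ * β)‖ ^ 7 : ℝ) : ℂ)) := by
    intro α β
    rw [Complex.ofReal_mul, Complex.ofReal_mul, h6, h8, mul_right_comm, Finset.sum_mul_sum,
      ← Finset.sum_product', Finset.sum_mul]
    refine Finset.sum_congr rfl fun p _ => ?_
    have : e (p.1 * (c₁ * α + d₁ * β)) * e (p.2 * (c₃ * α + d₃ * β)) =
        e ((p.1 * c₁ + p.2 * c₃ : ℤ) * α + (p.1 * d₁ + p.2 * d₃ : ℤ) * β) := by
      rw [← e_add]; congr 1; push_cast; ring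
    rw [← this]; ring
  have hI : ((∫ α in (0:ℝ)..1, ∫ β in (0:ℝ)..1, ‖smoothSum N R (c₁ * α + d₁ * β)‖ ^ 6 *
      ‖smoothSum N R (c₂ * α + d₂ * β)‖ ^ 7 * ‖smoothSum N R (c₃ * α + d₃ * β)‖ ^ 8 : ℝ) : ℂ) =
      ∑ p ∈ S ×ˢ S, momentCoeff 6 N R p.1 * momentCoeff 8 N R p.2 *
        resonance N R c₂ d₂ (p.1 * c₁ + p.2 * c₃) (p.1 * d₁ + p.2 * d₃) := by
    simp only [← intervalIntegral.integral_ofReal, hF]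
    rw [integral_integral_finset_sum]
    · refine Finset.sum_congr rfl fun p _ => ?_
      simp only [intervalIntegral.integral_const_mul, resonance]
    · intro p _
      have hc := continuous_e_linear (p.1 * c₁ + p.2 * c₃) (p.1 * d₁ + p.2 * d₃)
      unfold Function.uncurry at hc ⊢
      exact continuous_const.mul (hc.mul (by fun_prop))
  refine (le_abs_self _).trans ?_
  rw [← Real.norm_eq_abs, ← Complex.norm_real, hI]
  refine (norm_sum_le _ _).trans (le_of_eq (Finset.sum_congr rfl fun p _ => ?_))
  rw [norm_mul, norm_mul]; ring

theorem MeanValues.integral_integral_le {N R : ℕ} {Q : ℝ} (hM : MeanValues N R Q) (hN : 1 ≤ N)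
    {c₁ d₁ c₂ d₂ c₃ d₃ : ℤ} (h12 : c₁ * d₂ - c₂ * d₁ ≠ 0) (h13 : c₁ * d₃ - c₃ * d₁ ≠ 0)
    (h23 : c₂ * d₃ - c₃ * d₂ ≠ 0) :
    ∫ α in (0:ℝ)..1, ∫ β in (0:ℝ)..1, ‖smoothSum N R (c₁ * α + d₁ * β)‖ ^ 6 *
      ‖smoothSum N R (c₂ * α + d₂ * β)‖ ^ 7 * ‖smoothSum N R (c₃ * α + d₃ * β)‖ ^ 8 ≤
    17 + 8 * ((28 * (Nat.log 2 N + 1) : ℕ) : ℝ) ^ 3 *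
      ((8 * Q ^ 3) ^ 3 * (N : ℝ) ^ (13.106325 : ℝ)) := by
  classical
  refine (integral_integral_le_sum_resonance N R c₁ d₁ c₂ d₂ c₃ d₃).trans ?_
  set S := Finset.Icc (-(8 * (N : ℤ) ^ 4)) (8 * (N : ℤ) ^ 4) with hS
  set J : ℤ × ℤ → ℂ := fun p =>
    resonance N R c₂ d₂ (p.1 * c₁ + p.2 * c₃) (p.1 * d₁ + p.2 * d₃) with hJ
  have h2 : c₂ ≠ 0 ∨ d₂ ≠ 0 := by
    by_contra! h; apply h12; rw [h.1, h.2]; ring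
  have hr : ∀ p : ℤ × ℤ, ∃ r : ℤ, J p ≠ 0 → p.1 * c₁ + p.2 * c₃ = r * c₂ ∧
      p.1 * d₁ + p.2 * d₃ = r * d₂ ∧ J p = momentCoeff 7 N R (-r) := by
    intro p
    by_cases h : J p = 0
    · exact ⟨0, fun h' => (h' h).elim⟩
    · obtain ⟨r, h⟩ := exists_of_resonance_ne_zero h2 h
      exact ⟨r, fun _ => h⟩
  choose r hr using hr
  set U := (S ×ˢ S).filter fun p => J p ≠ 0 with hU
  have hUr : ∀ p ∈ U, (p.1 ∈ S ∧ p.2 ∈ S) ∧ p.1 * c₁ + p.2 * c₃ = r p * c₂ ∧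
      p.1 * d₁ + p.2 * d₃ = r p * d₂ ∧ J p = momentCoeff 7 N R (-r p) := fun p hp => by
    obtain ⟨h1, h3⟩ := Finset.mem_filter.1 hp
    exact ⟨Finset.mem_product.1 h1, hr p h3⟩
  have hcr : ∀ p ∈ U, p.1 * (c₁ * d₂ - c₂ * d₁) = p.2 * (c₂ * d₃ - c₃ * d₂) ∧
      p.1 * (c₁ * d₃ - c₃ * d₁) = r p * (c₂ * d₃ - c₃ * d₂) := fun p hp => by
    obtain ⟨-, h1, h3, -⟩ := hUr p hp
    exact ⟨by linear_combination d₂ * h1 - c₂ * h3, by linear_combination d₃ * h1 - c₃ * h3⟩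
  have hfst : Set.InjOn Prod.fst (U : Set (ℤ × ℤ)) := fun p hp q hq hpq => by
    have h1 := (hcr p hp).1
    rw [hpq, (hcr q hq).1] at h1
    exact Prod.ext hpq (mul_right_cancel₀ h23 h1).symm
  set T := U.image Prod.fst with hT
  have hex : ∀ i : ℤ, ∃ p : ℤ × ℤ, i ∈ T → p ∈ U ∧ p.1 = i := fun i => by
    by_cases h : i ∈ T
    · obtain ⟨p, hp⟩ := Finset.mem_image.1 h
      exact ⟨p, fun _ => hp⟩
    · exact ⟨0, fun h' => (h h').elim⟩
  choose g hg using hex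
  have hgf : ∀ p ∈ U, g p.1 = p := fun p hp => by
    have h := hg p.1 (Finset.mem_image_of_mem _ hp)
    exact hfst h.1 hp h.2
  have hmem : ∀ i, i ∈ S → |i| ≤ 8 * (N : ℤ) ^ 4 := fun i hi => abs_le.2 (Finset.mem_Icc.1 hi)
  refine le_trans (le_of_eq ?_) (hM.sum_momentCoeff_le hN (T := T) (n₆ := fun i => i)
    (n₇ := fun i => -r (g i)) (n₈ := fun i => (g i).2) ?_ ?_ ?_ ?_ ?_)
  · rw [hT, Finset.sum_image hfst, ← Finset.sum_filter_of_ne (p := fun p => J p ≠ 0)]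
    · refine Finset.sum_congr rfl fun p hp => ?_
      rw [hgf p hp, ← (hUr p hp).2.2.2]
    · intro p _ h0 hJ0
      apply h0
      change _ * ‖J p‖ * _ = 0
      rw [hJ0]; simp
  · exact fun i _ j _ hij => hij
  · intro i hi j hj hij
    have hi' := hg i hi
    have hj' := hg j hj
    have h1 := (hcr _ hi'.1).2
    have h3 := (hcr _ hj'.1).2
    have hij : r (g i) = r (g j) := neg_injective hij
    rw [hij, ← h3, hi'.2, hj'.2] at h1
    exact mul_right_cancel₀ h13 h1
  · intro i hi j hj hij
    have hi' := hg i hi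
    have hj' := hg j hj
    have h1 := (hcr _ hi'.1).1
    have h3 := (hcr _ hj'.1).1
    have hij : (g i).2 = (g j).2 := hij
    rw [hij, ← h3, hi'.2, hj'.2] at h1
    exact mul_right_cancel₀ h12 h1
  · intro i hi
    have hi' := hg i hi
    have := hmem _ (hUr _ hi'.1).1.1
    rwa [hi'.2] at this
  · intro i hi
    exact hmem _ (hUr _ (hg i hi).1).1.2

theorem h_eq_smoothSum {P R : ℝ} (hR : 0 ≤ R) (α : ℝ) : h P R α = smoothSum ⌊P⌋₊ ⌊R⌋₊ α := by
  have h1 : smoothA P R = smoothUpTo ⌊P⌋₊ ⌊R⌋₊ := by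
    unfold smoothA smoothUpTo
    refine Finset.filter_congr fun n _ => ?_
    simp only [Nat.le_floor_iff hR]
  rw [h, h1, smoothSum, trig]
  refine Finset.sum_congr rfl fun x _ => ?_
  push_cast; rw [mul_comm]

theorem pow_seven_le {a b c : ℝ} (hb : 0 ≤ b) :
    (a * b * c) ^ 7 ≤ 1 / 2 * (a ^ 6 * b ^ 7 * c ^ 8) + 1 / 2 * (c ^ 6 * b ^ 7 * a ^ 8) := by
  have h : 0 ≤ 1 / 2 * (a ^ 6 * c ^ 6 * b ^ 7) * (a - c) ^ 2 := by positivity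
  nlinarith [h]

theorem integral_integral_mono {f g : ℝ → ℝ → ℝ} (hf : Continuous (Function.uncurry f))
    (hg : Continuous (Function.uncurry g)) (hfg : ∀ α β, f α β ≤ g α β) :
    ∫ α in (0:ℝ)..1, ∫ β in (0:ℝ)..1, f α β ≤ ∫ α in (0:ℝ)..1, ∫ β in (0:ℝ)..1, g α β := by
  refine intervalIntegral.integral_mono zero_le_one
    ((intervalIntegral.continuous_parametric_intervalIntegral_of_continuous' hf 0 1).intervalIntegrable
      _ _)
    ((intervalIntegral.continuous_parametric_intervalIntegral_of_continuous' hg 0 1).intervalIntegrable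
      _ _) fun α => ?_
  exact intervalIntegral.integral_mono zero_le_one
    ((hf.comp (Continuous.prodMk_right α)).intervalIntegrable _ _)
    ((hg.comp (Continuous.prodMk_right α)).intervalIntegrable _ _) fun β => hfg α β

theorem MeanValues.integral_integral_seven_le {N R : ℕ} {Q : ℝ} (hM : MeanValues N R Q)
    (hN : 1 ≤ N) {c₁ d₁ c₂ d₂ c₃ d₃ : ℤ} (h12 : c₁ * d₂ - c₂ * d₁ ≠ 0)
    (h13 : c₁ * d₃ - c₃ * d₁ ≠ 0) (h23 : c₂ * d₃ - c₃ * d₂ ≠ 0) :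
    ∫ α in (0:ℝ)..1, ∫ β in (0:ℝ)..1, ‖smoothSum N R (c₁ * α + d₁ * β) *
      smoothSum N R (c₂ * α + d₂ * β) * smoothSum N R (c₃ * α + d₃ * β)‖ ^ 7 ≤
    17 + 8 * ((28 * (Nat.log 2 N + 1) : ℕ) : ℝ) ^ 3 *
      ((8 * Q ^ 3) ^ 3 * (N : ℝ) ^ (13.106325 : ℝ)) := by
  have hA := hM.integral_integral_le hN h12 h13 h23
  have hB := hM.integral_integral_le hN (c₁ := c₃) (d₁ := d₃) (c₂ := c₂) (d₂ := d₂) (c₃ := c₁)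
    (d₃ := d₁) (fun h => h23 (by linear_combination -h)) (fun h => h13 (by linear_combination -h))
    (fun h => h12 (by linear_combination -h))
  set F : ℝ → ℝ → ℝ := fun α β => ‖smoothSum N R (c₁ * α + d₁ * β)‖ ^ 6 *
      ‖smoothSum N R (c₂ * α + d₂ * β)‖ ^ 7 * ‖smoothSum N R (c₃ * α + d₃ * β)‖ ^ 8 with hF
  set G : ℝ → ℝ → ℝ := fun α β => ‖smoothSum N R (c₃ * α + d₃ * β)‖ ^ 6 *
      ‖smoothSum N R (c₂ * α + d₂ * β)‖ ^ 7 * ‖smoothSum N R (c₁ * α + d₁ * β)‖ ^ 8 with hG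
  have hFc : Continuous (Function.uncurry F) := by
    simp only [hF]; unfold Function.uncurry; fun_prop
  have hGc : Continuous (Function.uncurry G) := by
    simp only [hG]; unfold Function.uncurry; fun_prop
  have h1 := integral_integral_mono (f := fun α β : ℝ => ‖smoothSum N R (c₁ * α + d₁ * β) *
      smoothSum N R (c₂ * α + d₂ * β) * smoothSum N R (c₃ * α + d₃ * β)‖ ^ 7)
    (g := fun α β => 1 / 2 * F α β + 1 / 2 * G α β)
    (by unfold Function.uncurry; fun_prop)
    ((hFc.const_mul (1 / 2)).add (hGc.const_mul (1 / 2))) (fun α β => by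
      rw [norm_mul, norm_mul]
      exact pow_seven_le (norm_nonneg _))
  have hF1 : ∀ α, IntervalIntegrable (fun β => F α β) volume 0 1 := fun α =>
    (hFc.comp (Continuous.prodMk_right α)).intervalIntegrable _ _
  have hG1 : ∀ α, IntervalIntegrable (fun β => G α β) volume 0 1 := fun α =>
    (hGc.comp (Continuous.prodMk_right α)).intervalIntegrable _ _
  have h2 : ∀ α, ∫ β in (0:ℝ)..1, (1 / 2 * F α β + 1 / 2 * G α β) =
      1 / 2 * (∫ β in (0:ℝ)..1, F α β) + 1 / 2 * ∫ β in (0:ℝ)..1, G α β := fun α => by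
    rw [intervalIntegral.integral_add ((hF1 α).const_mul _) ((hG1 α).const_mul _),
      intervalIntegral.integral_const_mul, intervalIntegral.integral_const_mul]
  have hF2 : IntervalIntegrable (fun α => ∫ β in (0:ℝ)..1, F α β) volume 0 1 :=
    (intervalIntegral.continuous_parametric_intervalIntegral_of_continuous' hFc 0
      1).intervalIntegrable _ _
  have hG2 : IntervalIntegrable (fun α => ∫ β in (0:ℝ)..1, G α β) volume 0 1 :=
    (intervalIntegral.continuous_parametric_intervalIntegral_of_continuous' hGc 0
      1).intervalIntegrable _ _
  simp only [h2] at h1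
  rw [intervalIntegral.integral_add (hF2.const_mul _) (hG2.const_mul _),
      intervalIntegral.integral_const_mul, intervalIntegral.integral_const_mul] at h1
  linarith

theorem natLog_add_one_le {ε : ℝ} (hε : 0 < ε) :
    ∃ C : ℝ, 0 ≤ C ∧ ∀ N : ℕ, 1 ≤ N → ((Nat.log 2 N + 1 : ℕ) : ℝ) ≤ C * (N : ℝ) ^ ε := by
  refine ⟨1 / (ε * Real.log 2) + 1, by positivity, fun N hN => ?_⟩
  have hN0 : (1:ℝ) ≤ N := by exact_mod_cast hN
  have h1 : ((2 ^ Nat.log 2 N : ℕ) : ℝ) ≤ N := Nat.cast_le.2 (Nat.pow_log_le_self 2 (by omega))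
  have h2 : (Nat.log 2 N : ℝ) * Real.log 2 ≤ Real.log N := by
    have := Real.log_le_log (by positivity) h1
    push_cast at this
    rwa [Real.log_pow] at this
  have h3 := Real.log_le_rpow_div (x := (N:ℝ)) (by linarith) hε
  have h4 : (1:ℝ) ≤ (N:ℝ) ^ ε := Real.one_le_rpow hN0 hε.le
  have hl : 0 < Real.log 2 := Real.log_pos (by norm_num)
  have h5 : (Nat.log 2 N : ℝ) ≤ 1 / (ε * Real.log 2) * (N:ℝ) ^ ε := by
    rw [one_div_mul_eq_div, le_div_iff₀ (by positivity)]
    rw [le_div_iff₀ hε] at h3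
    nlinarith
  push_cast; nlinarith

theorem exists_polyBd_integral_integral :
    ∃ B : ℕ → ℕ → ℝ, PolyBd B 13.1064 ∧ ∀ N R : ℕ, 1 ≤ N → 1 ≤ R → ∀ c₁ d₁ c₂ d₂ c₃ d₃ : ℤ,
      c₁ * d₂ - c₂ * d₁ ≠ 0 → c₁ * d₃ - c₃ * d₁ ≠ 0 → c₂ * d₃ - c₃ * d₂ ≠ 0 →
      ∫ α in (0:ℝ)..1, ∫ β in (0:ℝ)..1, ‖smoothSum N R (c₁ * α + d₁ * β) *
        smoothSum N R (c₂ * α + d₂ * β) * smoothSum N R (c₃ * α + d₃ * β)‖ ^ 7 ≤ B N R := by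
  obtain ⟨Q, ⟨C, K, hC, hK, hQ⟩, hM⟩ := exists_polyBd_meanValues (ε := 0.000001) (by norm_num)
  obtain ⟨D, hD, hL⟩ := natLog_add_one_le (ε := 0.000001) (by norm_num)
  set W : ℕ → ℕ → ℝ := fun N R => C * (N : ℝ) ^ (0.000001 : ℝ) * (R : ℝ) ^ K with hW
  set V : ℕ → ℕ → ℝ := fun N _ => D * (N : ℝ) ^ (0.000001 : ℝ) with hV
  have hW0 : ∀ N R, 0 ≤ W N R := fun N R => by simp only [hW]; positivity
  have hV0 : ∀ N R, 0 ≤ V N R := fun N R => by simp only [hV]; positivity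
  have hWP : PolyBd W 0.000001 := ⟨C, K, hC, hK, fun N R _ _ => le_rfl⟩
  have hVP : PolyBd V 0.000001 := ⟨D, 0, hD, le_rfl, fun N R _ _ => by simp [hV]⟩
  refine ⟨fun N R => 17 + 8 * (28 ^ 3 * V N R ^ 3) * (8 ^ 3 * W N R ^ 9 * (N : ℝ) ^ (13.106325 : ℝ)),
    ?_, fun N R hN hR c₁ d₁ c₂ d₂ c₃ d₃ h12 h13 h23 => ?_⟩
  · refine ((PolyBd.const 17).mono_exp (by norm_num)).add ?_
    have h1 := ((hVP.pow hV0 3).const_mul (fun N R => pow_nonneg (hV0 N R) 3)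
      (c := 28 ^ 3) (by norm_num)).const_mul (fun N R => by have := hV0 N R; positivity)
      (c := 8) (by norm_num)
    have h2 := ((hWP.pow hW0 9).const_mul (fun N R => pow_nonneg (hW0 N R) 9)
      (c := 8 ^ 3) (by norm_num)).mul (PolyBd.rpow_left 13.106325) (fun N R => by positivity)
    refine (h1.mul h2 (fun N R => by have := hW0 N R; positivity)).mono_exp ?_
    norm_num
  · refine ((hM N R hN hR).integral_integral_seven_le hN h12 h13 h23).trans ?_
    have hQ0 : 0 ≤ Q N R := zero_le_one.trans (hM N R hN hR).one_le
    have h1 : ((28 * (Nat.log 2 N + 1) : ℕ) : ℝ) ^ 3 ≤ 28 ^ 3 * V N R ^ 3 := by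
      rw [Nat.cast_mul, mul_pow]
      exact mul_le_mul_of_nonneg_left (pow_le_pow_left₀ (by positivity) (hL N hN) 3) (by norm_num)
    have h2 : (8 * Q N R ^ 3) ^ 3 ≤ 8 ^ 3 * W N R ^ 9 := by
      rw [mul_pow, ← pow_mul]
      exact mul_le_mul_of_nonneg_left (pow_le_pow_left₀ hQ0 (hQ N R hN hR) 9) (by norm_num)
    have h3 : 0 ≤ (N : ℝ) ^ (13.106325 : ℝ) := by positivity
    have h4 := hV0 N R
    refine add_le_add le_rfl (mul_le_mul (mul_le_mul_of_nonneg_left h1 (by norm_num))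
      (mul_le_mul_of_nonneg_right h2 h3) (by positivity) (by positivity))

/-- for some `η > 0`, whenever `c_i, d_i` (`i = 1,2,3`) are integers with
`(c₁d₂ − c₂d₁)(c₁d₃ − c₃d₁)(c₂d₃ − c₃d₂) ≠ 0` and `Λ_j = c_jα + d_jβ`, one has
`∫₀¹∫₀¹ |h(Λ₁)h(Λ₂)h(Λ₃)|⁷ dα dβ ≪ P^{13 + Δ₁₀/2 + ε}` for `2 ≤ R ≤ P^η`. -/
theorem entangled_moment_three_forms :
    ∃ η : ℝ, 0 < η ∧
      ∀ c d : Fin 3 → ℤ,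
        (c 0 * d 1 - c 1 * d 0) * (c 0 * d 2 - c 2 * d 0) * (c 1 * d 2 - c 2 * d 1) ≠ 0 →
        ∀ ε : ℝ, 0 < ε →
          ∃ C : ℝ, ∀ P R : ℝ, 2 ≤ P → 2 ≤ R → R ≤ P ^ η →
            (∫ α in (0:ℝ)..1, ∫ β in (0:ℝ)..1,
                ‖h P R ((c 0 : ℝ) * α + (d 0 : ℝ) * β) *
                  h P R ((c 1 : ℝ) * α + (d 1 : ℝ) * β) *
                  h P R ((c 2 : ℝ) * α + (d 2 : ℝ) * β)‖ ^ 7)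
              ≤ C * P ^ (13 + Δ₁₀ / 2 + ε) := by
  obtain ⟨B, ⟨C, K, hC, hK, hB⟩, hI⟩ := exists_polyBd_integral_integral
  refine ⟨0.0003 / (K + 1), by positivity, fun c d hcd ε hε => ⟨C, fun P R hP hR hRP => ?_⟩⟩
  obtain ⟨h01, h12⟩ := mul_ne_zero_iff.1 hcd
  obtain ⟨h01, h02⟩ := mul_ne_zero_iff.1 h01
  have hN : 1 ≤ ⌊P⌋₊ := (Nat.one_le_floor_iff P).2 (by linarith)
  have hR1 : 1 ≤ ⌊R⌋₊ := (Nat.one_le_floor_iff R).2 (by linarith)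
  simp only [h_eq_smoothSum (P := P) (by linarith : 0 ≤ R)]
  refine (hI _ _ hN hR1 _ _ _ _ _ _ h01 h02 h12).trans ((hB _ _ hN hR1).trans ?_)
  have hNP : ((⌊P⌋₊ : ℕ) : ℝ) ≤ P := Nat.floor_le (by linarith)
  have hRR : ((⌊R⌋₊ : ℕ) : ℝ) ≤ P ^ (0.0003 / (K + 1)) := (Nat.floor_le (by linarith)).trans hRP
  have h1 : ((⌊P⌋₊ : ℕ) : ℝ) ^ (13.1064 : ℝ) ≤ P ^ (13.1064 : ℝ) :=
    Real.rpow_le_rpow (by positivity) hNP (by norm_num)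
  have h2 : ((⌊R⌋₊ : ℕ) : ℝ) ^ K ≤ P ^ (0.0003 : ℝ) := by
    refine (Real.rpow_le_rpow (by positivity) hRR hK).trans ?_
    rw [← Real.rpow_mul (by linarith)]
    refine Real.rpow_le_rpow_of_exponent_le (by linarith) ?_
    rw [div_mul_eq_mul_div, div_le_iff₀ (by linarith)]
    nlinarith
  have h3 : P ^ (13.1064 : ℝ) * P ^ (0.0003 : ℝ) ≤ P ^ (13 + Δ₁₀ / 2 + ε) := by
    rw [← Real.rpow_add (by linarith)]
    refine Real.rpow_le_rpow_of_exponent_le (by linarith) ?_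
    unfold Δ₁₀; linarith
  rw [mul_assoc]
  exact mul_le_mul_of_nonneg_left ((mul_le_mul h1 h2 (by positivity) (by positivity)).trans h3) hC
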